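/- The class of countable graphs with no K_{3,3} minor has a minor-universal element: there exists a countable graph U such that U has no K_{3,3} minor and every countable graph with no K_{3,3} minor is a minor of U. -/

import Mathlib

/-- `H` is a minor of `G`: pairwise disjoint nonempty connected branch sets, one for each
vertex of `H`, with a `G`-edge between the branch sets of any two `H`-adjacent vertices. -/
def IsMinor {V : Type*} {W : Type*} (H : SimpleGraph V) (G : SimpleGraph W) : Prop :=
  ∃ B : V → Set W,
    (∀ v : V, (G.induce (B v)).Connected) ∧
    (∀ u v : V, u ≠ v → Disjoint (B u) (B v)) ∧
    (∀ u v : V, H.Adj u v → ∃ x ∈ B u, ∃ y ∈ B v, G.Adj x y)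

set_option autoImplicit false

namespace K33U

open Relation

/-! ### Connectivity inside a vertex set -/

/-- `a` and `b` are joined by a walk of `G` all of whose edges have both ends in `S`. -/
def Joined {V : Type*} (G : SimpleGraph V) (S : Set V) : V → V → Prop :=
  ReflTransGen fun u w => G.Adj u w ∧ u ∈ S ∧ w ∈ S

/-- Any two vertices of `S` are joined inside `S`. -/
def ConnOn {V : Type*} (G : SimpleGraph V) (S : Set V) : Prop :=
  ∀ a ∈ S, ∀ b ∈ S, Joined G S a b

section Basics

variable {V A B : Type*} {G G' : SimpleGraph V} {S T : Set V} {a b c : V}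

theorem Joined.refl (a : V) : Joined G S a a := ReflTransGen.refl

theorem Joined.trans (h : Joined G S a b) (h' : Joined G S b c) : Joined G S a c :=
  ReflTransGen.trans h h'

theorem Joined.symm (h : Joined G S a b) : Joined G S b a := by
  induction h with
  | refl => exact .refl _
  | tail _ h ih => exact (ReflTransGen.single ⟨h.1.symm, h.2.2, h.2.1⟩).trans ih

theorem Joined.edge (h : G.Adj a b) (ha : a ∈ S) (hb : b ∈ S) : Joined G S a b :=
  ReflTransGen.single ⟨h, ha, hb⟩

theorem Joined.mono' (hG : ∀ u ∈ S, ∀ w ∈ S, G.Adj u w → G'.Adj u w) (hS : S ⊆ T)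
    (h : Joined G S a b) : Joined G' T a b :=
  ReflTransGen.mono (r := fun u w => G.Adj u w ∧ u ∈ S ∧ w ∈ S)
    (fun u w h => ⟨hG u h.2.1 w h.2.2 h.1, hS h.2.1, hS h.2.2⟩) _ _ h

theorem Joined.mono (hG : G ≤ G') (hS : S ⊆ T) (h : Joined G S a b) : Joined G' T a b :=
  h.mono' (fun _ _ _ _ h => hG h) hS

theorem Joined.mem (h : Joined G S a b) (ha : a ∈ S) : b ∈ S := by
  cases h with
  | refl => exact ha
  | tail _ h => exact h.2.2

theorem Joined.exists_exit (h : Joined G S a b) {P : Set V} (ha : a ∈ P) (hb : b ∉ P) :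
    ∃ u w, G.Adj u w ∧ u ∈ S ∧ w ∈ S ∧ u ∈ P ∧ w ∉ P ∧ Joined G (S ∩ P) a u := by
  have key : (b ∈ P ∧ Joined G (S ∩ P) a b) ∨
      ∃ u w, G.Adj u w ∧ u ∈ S ∧ w ∈ S ∧ u ∈ P ∧ w ∉ P ∧ Joined G (S ∩ P) a u := by
    clear hb
    induction h with
    | refl => exact .inl ⟨ha, .refl _⟩
    | @tail x y _ h ih =>
      rcases ih with ⟨hx, ih⟩ | ih
      · by_cases hy : y ∈ P
        · exact .inl ⟨hy, ih.trans (.edge h.1 ⟨h.2.1, hx⟩ ⟨h.2.2, hy⟩)⟩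
        · exact .inr ⟨x, y, h.1, h.2.1, h.2.2, hx, hy, ih⟩
      · exact .inr ih
  exact key.resolve_left fun h => hb h.1

theorem Joined.of_closed (h : Joined G S a b) {P : Set V} (ha : a ∈ P)
    (hP : ∀ u ∈ S ∩ P, ∀ w ∈ S, G.Adj u w → w ∈ P) : b ∈ P ∧ Joined G (S ∩ P) a b := by
  induction h with
  | refl => exact ⟨ha, .refl _⟩
  | @tail x y _ h ih =>
    have := hP x ⟨h.2.1, ih.1⟩ y h.2.2 h.1
    exact ⟨this, ih.2.trans (.edge h.1 ⟨h.2.1, ih.1⟩ ⟨h.2.2, this⟩)⟩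

theorem ConnOn.mono (h : ConnOn G S) (hG : G ≤ G') : ConnOn G' S :=
  fun a ha b hb => (h a ha b hb).mono hG subset_rfl

theorem ConnOn.of_root (r : V) (h : ∀ a ∈ S, Joined G S r a) : ConnOn G S :=
  fun a ha b hb => (h a ha).symm.trans (h b hb)

theorem ConnOn.singleton (a : V) : ConnOn G {a} := by
  rintro x rfl y rfl; exact .refl _

theorem ConnOn.union (hS : ConnOn G S) (hT : ConnOn G T) (ha : a ∈ S) (hb : b ∈ T)
    (h : a = b ∨ G.Adj a b) : ConnOn G (S ∪ T) := by
  refine .of_root a ?_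
  have h1 : Joined G (S ∪ T) a b := by
    rcases h with rfl | h
    · exact .refl _
    · exact .edge h (.inl ha) (.inr hb)
  rintro x (hx | hx)
  · exact (hS a ha x hx).mono le_rfl Set.subset_union_left
  · exact h1.trans ((hT b hb x hx).mono le_rfl Set.subset_union_right)

/-- The vertices joined to `a` inside `S`. -/
def comp (G : SimpleGraph V) (S : Set V) (a : V) : Set V := {x | x ∈ S ∧ Joined G S a x}

theorem comp_subset : comp G S a ⊆ S := fun _ h => h.1

theorem mem_comp_self (ha : a ∈ S) : a ∈ comp G S a := ⟨ha, .refl _⟩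

theorem connOn_comp : ConnOn G (comp G S a) := by
  by_cases ha : a ∈ S
  · refine .of_root a fun x hx => ?_
    have := hx.2.of_closed (P := comp G S a) (mem_comp_self ha)
      (fun u hu w hw h => ⟨hw, hu.2.2.trans (.edge h hu.1 hw)⟩)
    exact this.2.mono le_rfl Set.inter_subset_right
  · intro x hx
    exact absurd hx.1 (by
      have := hx.2
      rcases ReflTransGen.cases_head this with rfl | ⟨y, h, _⟩
      · exact ha
      · exact absurd h.2.1 ha)

theorem comp_closed {u w : V} (hu : u ∈ comp G S a) (hw : w ∈ S) (h : G.Adj u w) :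
    w ∈ comp G S a := ⟨hw, hu.2.trans (.edge h hu.1 hw)⟩

theorem connected_induce_iff : (G.induce S).Connected ↔ S.Nonempty ∧ ConnOn G S := by
  constructor
  · intro h
    obtain ⟨x⟩ := h.nonempty
    refine ⟨⟨x.1, x.2⟩, fun a ha b hb => ?_⟩
    obtain ⟨p⟩ := h.preconnected ⟨a, ha⟩ ⟨b, hb⟩
    have : ∀ x y : S, (G.induce S).Walk x y → Joined G S x y := by
      intro x y p
      induction p with
      | nil => exact .refl _
      | @cons x y z h _ ih => exact Joined.trans (Joined.edge (G := G) h x.2 y.2) ih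
    exact this _ _ p
  · rintro ⟨⟨x, hx⟩, h⟩
    have : Nonempty S := ⟨⟨x, hx⟩⟩
    refine ⟨fun ⟨a, ha⟩ ⟨b, hb⟩ => ?_⟩
    have key : ∀ y, Joined G S a y → ∀ hy : y ∈ S, (G.induce S).Reachable ⟨a, ha⟩ ⟨y, hy⟩ := by
      intro y hy
      induction hy with
      | refl => intro _; exact .refl _
      | @tail u w _ h ih =>
        intro hw
        refine (ih h.2.1).trans (SimpleGraph.Adj.reachable ?_)
        exact h.1
    exact key b (h a ha b hb) hb

end Basics

/-! ### Models of minors -/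

/-- A model of `H` in `G`, given as a partial labelling of the vertices of `G`. -/
structure IsModel {V A : Type*} (H : SimpleGraph A) (G : SimpleGraph V) (c : V → Option A) :
    Prop where
  surj : ∀ a, ∃ v, c v = some a
  conn : ∀ a, ConnOn G {v | c v = some a}
  adj : ∀ a b, H.Adj a b → ∃ u v, G.Adj u v ∧ c u = some a ∧ c v = some b

section Models

variable {V A B : Type*} {G G' : SimpleGraph V} {H : SimpleGraph A} {K : SimpleGraph B}
  {S T : Set V} {a b c : V}

open Classical in
theorem isMinor_iff : IsMinor H G ↔ ∃ c, IsModel H G c := by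
  constructor
  · rintro ⟨B, h1, h2, h3⟩
    have hc : ∀ v a, (if h : ∃ a, v ∈ B a then some h.choose else none) = some a ↔ v ∈ B a := by
      intro v a
      split_ifs with h
      · constructor
        · intro h'
          rw [← Option.some.inj h']; exact h.choose_spec
        · intro h'
          by_contra hne
          exact Set.disjoint_left.1 (h2 _ a (fun e => hne (by rw [e]))) h.choose_spec h'
      · exact ⟨fun h' => by simp at h', fun h' => (h ⟨a, h'⟩).elim⟩
    refine ⟨fun v => if h : ∃ a, v ∈ B a then some h.choose else none, ?_, ?_, ?_⟩
    · intro a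
      obtain ⟨⟨x, hx⟩, _⟩ := connected_induce_iff.1 (h1 a)
      exact ⟨x, (hc x a).2 hx⟩
    · intro a
      simpa only [hc, Set.ofPred_mem_eq] using (connected_induce_iff.1 (h1 a)).2
    · intro a b hab
      obtain ⟨x, hx, y, hy, h⟩ := h3 a b hab
      exact ⟨x, y, h, (hc _ _).2 hx, (hc _ _).2 hy⟩
  · rintro ⟨c, h⟩
    refine ⟨fun a => {v | c v = some a}, fun a => connected_induce_iff.2 ⟨h.surj a, h.conn a⟩,
      ?_, ?_⟩
    · intro a b hab
      refine Set.disjoint_left.2 fun v hv hv' => hab ?_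
      exact Option.some.inj (hv.symm.trans hv')
    · intro a b hab
      obtain ⟨x, y, h1, h2, h3⟩ := h.adj a b hab
      exact ⟨x, h2, y, h3, h1⟩

theorem ConnOn.bind {c : V → Option A} {d : A → Option B} {b : B}
    (h : ∀ a, ConnOn G {v | c v = some a})
    (hadj : ∀ x y, H.Adj x y → ∃ u v, G.Adj u v ∧ c u = some x ∧ c v = some y)
    (h' : ConnOn H {x | d x = some b}) : ConnOn G {v | (c v).bind d = some b} := by
  have hsub : ∀ a, d a = some b →
      {v | c v = some a} ⊆ {v | (c v).bind d = some b} := by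
    intro a ha v hv
    have : c v = some a := hv
    simp [this, ha]
  have key : ∀ a a', Joined H {x | d x = some b} a a' → d a = some b → ∀ u v, c u = some a →
      c v = some a' → Joined G {v | (c v).bind d = some b} u v := by
    intro a a' haa ha
    induction haa with
    | refl =>
      intro u v hu hv
      exact (h a u hu v hv).mono le_rfl (hsub a ha)
    | @tail x y _ hxy ih =>
      intro u v hu hv
      obtain ⟨p, q, hpq, hp, hq⟩ := hadj x y hxy.1
      refine ((ih u p hu hp).trans (.edge hpq (hsub x hxy.2.1 hp) (hsub y hxy.2.2 hq))).trans ?_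
      exact (h y q hq v hv).mono le_rfl (hsub y hxy.2.2)
  intro u hu v hv
  obtain ⟨a, ha, ha'⟩ := Option.bind_eq_some_iff.1 (show (c u).bind d = some b from hu)
  obtain ⟨a', hb, hb'⟩ := Option.bind_eq_some_iff.1 (show (c v).bind d = some b from hv)
  exact key a a' (h' a ha' a' hb') ha' u v ha hb

theorem IsModel.trans {c : V → Option A} {d : A → Option B} (h : IsModel H G c)
    (h' : IsModel K H d) : IsModel K G fun v => (c v).bind d := by
  refine ⟨fun b => ?_, fun b => .bind h.conn h.adj (h'.conn b), fun a b hab => ?_⟩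
  · obtain ⟨a, ha⟩ := h'.surj b
    obtain ⟨v, hv⟩ := h.surj a
    exact ⟨v, by simp [hv, ha]⟩
  · obtain ⟨x, y, hxy, hx, hy⟩ := h'.adj a b hab
    obtain ⟨u, v, huv, hu, hv⟩ := h.adj x y hxy
    exact ⟨u, v, huv, by simp [hu, hx], by simp [hv, hy]⟩

theorem IsModel.mono {c : V → Option A} (h : IsModel H G c) (hG : G ≤ G') : IsModel H G' c :=
  ⟨h.surj, fun a => (h.conn a).mono hG, fun a b hab => by
    obtain ⟨u, v, h1, h2⟩ := h.adj a b hab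
    exact ⟨u, v, hG h1, h2⟩⟩

theorem IsModel.of_injective {f : A → V} (hf : Function.Injective f)
    (h : ∀ a b, H.Adj a b → G.Adj (f a) (f b)) : ∃ c, IsModel H G c := by
  classical
  have key : ∀ v a, Function.partialInv f v = some a ↔ f a = v := by
    intro v a
    exact hf.isPartialInv a v
  refine ⟨Function.partialInv f, fun a => ⟨f a, (key _ _).2 rfl⟩, fun a => ?_, fun a b hab =>
    ⟨f a, f b, h a b hab, (key _ _).2 rfl, (key _ _).2 rfl⟩⟩
  intro x hx y hy
  rw [← (key _ _).1 hx, ← (key _ _).1 hy]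
  exact .refl _

theorem isMinor_trans (h : IsMinor H G) (h' : IsMinor K H) : IsMinor K G := by
  rw [isMinor_iff] at *
  obtain ⟨c, hc⟩ := h
  obtain ⟨d, hd⟩ := h'
  exact ⟨_, hc.trans hd⟩

/-- Rooted fibres need only be joined to the ends of the edges that are used. -/
theorem IsModel.of_roots (c : V → Option A) (r : A → V) (hr : ∀ a, c (r a) = some a)
    (h : ∀ a b, H.Adj a b → ∃ u v, G.Adj u v ∧ c u = some a ∧ c v = some b ∧
      Joined G {x | c x = some a} (r a) u ∧ Joined G {x | c x = some b} (r b) v) :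
    ∃ c', IsModel H G c' ∧ ∀ v a, c' v = some a → c v = some a := by
  classical
  let c' : V → Option A := fun v => (c v).bind fun a =>
    if Joined G {x | c x = some a} (r a) v then some a else none
  have hc' : ∀ v a, c' v = some a ↔ v ∈ comp G {x | c x = some a} (r a) := by
    intro v a
    simp only [c', Option.bind_eq_some_iff, comp, Set.mem_ofPred_eq]
    constructor
    · rintro ⟨b, hb, h⟩
      split_ifs at h with h1
      cases h
      exact ⟨hb, h1⟩
    · rintro ⟨h1, h2⟩
      exact ⟨a, h1, if_pos h2⟩
  refine ⟨c', ⟨fun a => ⟨r a, (hc' _ _).2 (mem_comp_self (hr a))⟩, fun a => ?_, fun a b hab => ?_⟩,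
    fun v a h => ((hc' v a).1 h).1⟩
  · simp only [hc', Set.ofPred_mem_eq]
    exact connOn_comp
  · obtain ⟨u, v, h0, h1, h2, h3, h4⟩ := h a b hab
    exact ⟨u, v, h0, (hc' _ _).2 ⟨h1, h3⟩, (hc' _ _).2 ⟨h2, h4⟩⟩

theorem Joined.finite (h : Joined G S a b) :
    ∃ E : Set (Sym2 V), E.Finite ∧ E ⊆ G.edgeSet ∧ Joined (SimpleGraph.fromEdgeSet E) S a b := by
  induction h with
  | refl => exact ⟨∅, Set.finite_empty, by simp, .refl _⟩
  | @tail x y _ hxy ih =>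
    obtain ⟨E, h1, h2, h3⟩ := ih
    refine ⟨insert s(x, y) E, h1.insert _, ?_, ?_⟩
    · rw [Set.insert_subset_iff]
      exact ⟨hxy.1, h2⟩
    · refine (h3.mono (SimpleGraph.fromEdgeSet_mono (Set.subset_insert _ _)) subset_rfl).trans
        (.edge ?_ hxy.2.1 hxy.2.2)
      simp [SimpleGraph.fromEdgeSet_adj, hxy.1.ne]

theorem IsModel.finite [Finite A] {c : V → Option A} (h : IsModel H G c) :
    ∃ E : Set (Sym2 V), E.Finite ∧ E ⊆ G.edgeSet ∧
      ∃ c', IsModel H (SimpleGraph.fromEdgeSet E) c' ∧ ∀ v a, c' v = some a → c v = some a := by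
  classical
  choose r hr using h.surj
  have key : ∀ p : A × A, ∃ E : Set (Sym2 V), E.Finite ∧ E ⊆ G.edgeSet ∧ (H.Adj p.1 p.2 →
      ∃ u v, (SimpleGraph.fromEdgeSet E).Adj u v ∧ c u = some p.1 ∧ c v = some p.2 ∧
      Joined (SimpleGraph.fromEdgeSet E) {x | c x = some p.1} (r p.1) u ∧
      Joined (SimpleGraph.fromEdgeSet E) {x | c x = some p.2} (r p.2) v) := by
    rintro ⟨p, q⟩
    by_cases hpq : H.Adj p q
    · obtain ⟨u, v, h0, h1, h2⟩ := h.adj p q hpq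
      obtain ⟨E, a1, a2, a3⟩ := (h.conn p (r p) (hr p) u h1).finite
      obtain ⟨F, b1, b2, b3⟩ := (h.conn q (r q) (hr q) v h2).finite
      refine ⟨insert s(u, v) (E ∪ F), (a1.union b1).insert _, ?_, fun _ => ⟨u, v, ?_, h1, h2,
        a3.mono (SimpleGraph.fromEdgeSet_mono fun e he => .inr (.inl he)) subset_rfl,
        b3.mono (SimpleGraph.fromEdgeSet_mono fun e he => .inr (.inr he)) subset_rfl⟩⟩
      · rw [Set.insert_subset_iff]
        exact ⟨h0, Set.union_subset a2 b2⟩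
      · simp [SimpleGraph.fromEdgeSet_adj, h0.ne]
    · exact ⟨∅, Set.finite_empty, by simp, fun h => (hpq h).elim⟩
  choose E hE1 hE2 hE3 using key
  refine ⟨⋃ p, E p, Set.finite_iUnion hE1, Set.iUnion_subset hE2, ?_⟩
  refine IsModel.of_roots c r hr fun a b hab => ?_
  obtain ⟨u, v, h0, h1, h2, h3, h4⟩ := hE3 (a, b) hab
  have hle := SimpleGraph.fromEdgeSet_mono (Set.subset_iUnion E (a, b))
  exact ⟨u, v, hle h0, h1, h2, h3.mono hle subset_rfl, h4.mono hle subset_rfl⟩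

end Models

/-- `K_{3,3}`. -/
abbrev K33 : SimpleGraph (Fin 3 ⊕ Fin 3) := completeBipartiteGraph (Fin 3) (Fin 3)

/-- The subgraph of `G` induced on `S` has no `K_{3,3}` minor. -/
def Free {V : Type*} (G : SimpleGraph V) (S : Set V) : Prop :=
  ¬ ∃ c, IsModel K33 G c ∧ ∀ v a, c v = some a → v ∈ S

section FreeSec

variable {V : Type*} {G G' : SimpleGraph V} {S T : Set V}

theorem Free.anti (h : Free G S) (hG : ∀ u ∈ T, ∀ v ∈ T, G'.Adj u v → G.Adj u v) (hT : T ⊆ S) :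
    Free G' T := by
  rintro ⟨c, h1, h2⟩
  refine h ⟨c, ⟨h1.surj, fun a x hx y hy => ?_, fun a b hab => ?_⟩, fun v a hv => hT (h2 v a hv)⟩
  · exact (h1.conn a x hx y hy).mono' (fun u hu w hw => hG u (h2 u a hu) w (h2 w a hw)) subset_rfl
  · obtain ⟨u, v, h3, h4, h5⟩ := h1.adj a b hab
    exact ⟨u, v, hG u (h2 u a h4) v (h2 v b h5) h3, h4, h5⟩

theorem free_univ_iff : Free G Set.univ ↔ ¬ IsMinor K33 G := by
  simp [Free, isMinor_iff]

theorem Free.of_support (h : Free G S) (hS : ∀ u v, G.Adj u v → u ∈ S) : Free G T := by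
  rintro ⟨c, hc, -⟩
  refine h ⟨c, hc, fun v p hv => ?_⟩
  have : ∃ q, K33.Adj p q := by
    rcases p with p | p
    · exact ⟨.inr 0, by simp⟩
    · exact ⟨.inl 0, by simp⟩
  obtain ⟨q, hpq⟩ := this
  obtain ⟨u, w, huw, hu, -⟩ := hc.adj p q hpq
  rcases (ReflTransGen.cases_tail (hc.conn p u hu v hv)) with rfl | ⟨x, -, hx⟩
  · exact hS _ _ huw
  · exact hS _ _ hx.1.symm

theorem Free.of_card (S : Finset V) (hS : S.card ≤ 5) : Free G S := by
  rintro ⟨c, h1, h2⟩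
  choose f hf using h1.surj
  have hinj : Function.Injective f := fun a b hab => by
    have := hf a
    rw [hab, hf b] at this
    exact (Option.some.inj this).symm
  have := Finset.card_le_card_of_injOn (s := Finset.univ) (t := S) f
    (fun a _ => h2 _ a (hf a)) hinj.injOn
  simp at this
  omega

theorem free_sUnion_of_directed {D : Set (SimpleGraph V)} (hne : D.Nonempty)
    (hdir : DirectedOn (· ≤ ·) D) (h : ∀ G ∈ D, Free G Set.univ) : Free (sSup D) Set.univ := by
  rintro ⟨c, hc, -⟩
  obtain ⟨E, hE, hsub, c', hc', -⟩ := hc.finite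
  have key : ∀ E : Set (Sym2 V), E.Finite → E ⊆ (sSup D).edgeSet → ∃ G ∈ D, E ⊆ G.edgeSet := by
    intro E hE
    induction E, hE using Set.Finite.induction_on with
    | empty => intro _; obtain ⟨G, hG⟩ := hne; exact ⟨G, hG, by simp⟩
    | @insert e E _ _ ih =>
      intro hs
      rw [Set.insert_subset_iff] at hs
      obtain ⟨G1, hG1, h1⟩ := ih hs.2
      have : ∃ G ∈ D, e ∈ G.edgeSet := by
        have := hs.1
        induction e with
        | h x y => simpa using this
      obtain ⟨G2, hG2, h2⟩ := this
      obtain ⟨G3, hG3, h31, h32⟩ := hdir G1 hG1 G2 hG2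
      refine ⟨G3, hG3, Set.insert_subset (SimpleGraph.edgeSet_mono h32 h2)
        (h1.trans (SimpleGraph.edgeSet_mono h31))⟩
  obtain ⟨G, hG, hEG⟩ := key E hE hsub
  refine h G hG ⟨c', hc'.mono ?_, fun _ _ _ => trivial⟩
  rw [← SimpleGraph.fromEdgeSet_edgeSet G]
  exact SimpleGraph.fromEdgeSet_mono hEG

theorem K33_side {P : Fin 3 ⊕ Fin 3 → Prop} (x y : Option (Fin 3 ⊕ Fin 3))
    (h : ∀ p q, x ≠ some p → y ≠ some p → x ≠ some q → y ≠ some q → K33.Adj p q → P p → P q) :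
    (∀ p, x ≠ some p → y ≠ some p → P p) ∨ ∀ p, x ≠ some p → y ≠ some p → ¬ P p := by
  have e1 : ∀ x y : Option (Fin 3 ⊕ Fin 3),
      (∃ i : Fin 3, x ≠ some (Sum.inl i) ∧ y ≠ some (Sum.inl i)) ∧
      ∃ i : Fin 3, x ≠ some (Sum.inr i) ∧ y ≠ some (Sum.inr i) := by decide
  obtain ⟨⟨i, hi1, hi2⟩, j, hj1, hj2⟩ := e1 x y
  have hij := h (.inl i) (.inr j) hi1 hi2 hj1 hj2 (by simp)
  have hji := h (.inr j) (.inl i) hj1 hj2 hi1 hi2 (by simp)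
  by_cases hP : P (.inl i)
  · left
    rintro (k | k) hk1 hk2
    · exact h (.inr j) (.inl k) hj1 hj2 hk1 hk2 (by simp) (hij hP)
    · exact h (.inl i) (.inr k) hi1 hi2 hk1 hk2 (by simp) hP
  · right
    rintro (k | k) hk1 hk2 hk
    · exact hP (hji (h (.inl k) (.inr j) hk1 hk2 hj1 hj2 (by simp) hk))
    · exact hP (h (.inr k) (.inl i) hk1 hk2 hi1 hi2 (by simp) hk)

theorem Free.glue_aux {A B : Set V} {s t : V} (hA : Free G A)
    (hno : ∀ u ∈ A, u ∉ B → ∀ v ∈ B, v ∉ A → ¬ G.Adj u v)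
    (hAB : A ∩ B ⊆ {s, t}) (hsA : s ∈ A) (htA : t ∈ A) (hsB : s ∈ B) (htB : t ∈ B)
    (hst : s = t ∨ G.Adj s t)
    {c : V → Option (Fin 3 ⊕ Fin 3)} (hc : IsModel K33 G c) (hcS : ∀ v a, c v = some a → v ∈ A ∪ B)
    (hside : ∀ p, c s ≠ some p → c t ≠ some p → ∃ v ∈ A, c v = some p) : False := by
  classical
  have hfull : ∀ p, c s ≠ some p → c t ≠ some p → ∀ v, c v = some p → v ∈ A ∧ v ∉ B := by
    intro p hp1 hp2 v hv
    obtain ⟨w, hwA, hw⟩ := hside p hp1 hp2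
    have hmem : ∀ x, c x = some p → x ∈ A → x ∉ B := by
      intro x hx hxA hxB
      rcases hAB ⟨hxA, hxB⟩ with rfl | h
      · exact hp1 hx
      · have : x = t := h
        exact hp2 (this ▸ hx)
    have := ((hc.conn p) w hw v hv).of_closed (P := A) hwA (by
      rintro u ⟨hu, huA⟩ x hx hux
      by_contra hxA
      exact hno u huA (hmem u hu huA) x ((hcS x p hx).resolve_left hxA) hxA hux)
    exact ⟨this.1, hmem v hv this.1⟩
  let c' : V → Option (Fin 3 ⊕ Fin 3) := fun v => if v ∈ A then c v else none
  have hc' : ∀ v p, c' v = some p ↔ v ∈ A ∧ c v = some p := by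
    intro v p
    simp only [c']
    split_ifs with h <;> simp [h]
  refine hA ⟨c', ⟨fun p => ?_, fun p => ?_, fun p q hpq => ?_⟩, fun v p hv => ((hc' v p).1 hv).1⟩
  · by_cases h1 : c s = some p
    · exact ⟨s, (hc' _ _).2 ⟨hsA, h1⟩⟩
    by_cases h2 : c t = some p
    · exact ⟨t, (hc' _ _).2 ⟨htA, h2⟩⟩
    obtain ⟨v, hv, hv'⟩ := hside p h1 h2
    exact ⟨v, (hc' _ _).2 ⟨hv, hv'⟩⟩
  · simp only [hc']
    by_cases h : c s = some p ∨ c t = some p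
    · have key : ∀ x, x ∈ A → c x = some p → ∃ r, (r = s ∨ r = t) ∧ c r = some p ∧
          Joined G {v | v ∈ A ∧ c v = some p} x r := by
        intro x hxA hx
        by_cases hxst : x = s ∨ x = t
        · exact ⟨x, hxst, hx, .refl _⟩
        obtain ⟨r, hr, hr'⟩ : ∃ r, (r = s ∨ r = t) ∧ c r = some p := by
          rcases h with h | h
          exacts [⟨s, .inl rfl, h⟩, ⟨t, .inr rfl, h⟩]
        obtain ⟨u, w, huw, hu, hw, huP, hwP, hj⟩ :=
          (hc.conn p x hx r hr').exists_exit (P := {v | v ∈ A ∧ ¬ (v = s ∨ v = t)})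
            ⟨hxA, hxst⟩ (fun h => h.2 hr)
        have hst' : w = s ∨ w = t := by
          by_contra hn
          have hwA : w ∉ A := fun h => hwP ⟨h, hn⟩
          exact hno u huP.1 (fun h => huP.2 (hAB ⟨huP.1, h⟩)) w ((hcS w p hw).resolve_left hwA)
            hwA huw
        have hwA : w ∈ A := by rcases hst' with rfl | rfl <;> assumption
        exact ⟨w, hst', hw, (hj.mono (T := {v | v ∈ A ∧ c v = some p}) le_rfl
          fun v hv => ⟨hv.2.1, hv.1⟩).trans
          (.edge huw ⟨huP.1, hu⟩ ⟨hwA, hw⟩)⟩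
      have hst2 : ∀ r r', (r = s ∨ r = t) → (r' = s ∨ r' = t) → c r = some p → c r' = some p →
          Joined G {v | v ∈ A ∧ c v = some p} r r' := by
        rintro r r' (rfl | rfl) (rfl | rfl) h1 h2
        · exact .refl _
        · rcases hst with rfl | h
          · exact .refl _
          · exact .edge h ⟨hsA, h1⟩ ⟨htA, h2⟩
        · rcases hst with rfl | h
          · exact .refl _
          · exact .edge h.symm ⟨htA, h1⟩ ⟨hsA, h2⟩
        · exact .refl _
      intro x hx y hy
      obtain ⟨r, h1, h2, h3⟩ := key x hx.1 hx.2
      obtain ⟨r', h1', h2', h3'⟩ := key y hy.1 hy.2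
      exact (h3.trans (hst2 r r' h1 h1' h2 h2')).trans h3'.symm
    · push Not at h
      have : {v | v ∈ A ∧ c v = some p} = {v | c v = some p} := by
        ext v
        exact ⟨fun h => h.2, fun hv => ⟨(hfull p h.1 h.2 v hv).1, hv⟩⟩
      rw [this]
      exact hc.conn p
  · obtain ⟨u, v, huv, hu, hv⟩ := hc.adj p q hpq
    by_cases huA : u ∈ A ∧ v ∈ A
    · exact ⟨u, v, huv, (hc' _ _).2 ⟨huA.1, hu⟩, (hc' _ _).2 ⟨huA.2, hv⟩⟩
    have huB : u ∈ B ∧ v ∈ B := by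
      rcases hcS u p hu with h1 | h1 <;> rcases hcS v q hv with h2 | h2
      · exact (huA ⟨h1, h2⟩).elim
      · refine ⟨?_, h2⟩
        by_contra h3
        exact hno u h1 h3 v h2 (fun h => huA ⟨h1, h⟩) huv
      · refine ⟨h1, ?_⟩
        by_contra h3
        exact hno v h2 h3 u h1 (fun h => huA ⟨h, h2⟩) huv.symm
      · exact ⟨h1, h2⟩
    have hp : c s = some p ∨ c t = some p := by
      by_contra h; push Not at h
      exact (hfull p h.1 h.2 u hu).2 huB.1
    have hq : c s = some q ∨ c t = some q := by
      by_contra h; push Not at h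
      exact (hfull q h.1 h.2 v hv).2 huB.2
    have hne : p ≠ q := hpq.ne
    rcases hp with hp | hp <;> rcases hq with hq | hq
    · exact (hne (Option.some.inj (hp.symm.trans hq))).elim
    · refine ⟨s, t, hst.resolve_left ?_, (hc' _ _).2 ⟨hsA, hp⟩, (hc' _ _).2 ⟨htA, hq⟩⟩
      rintro rfl
      exact hne (Option.some.inj (hp.symm.trans hq))
    · refine ⟨t, s, (hst.resolve_left ?_).symm, (hc' _ _).2 ⟨htA, hp⟩, (hc' _ _).2 ⟨hsA, hq⟩⟩
      rintro rfl
      exact hne (Option.some.inj (hp.symm.trans hq))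
    · exact (hne (Option.some.inj (hp.symm.trans hq))).elim

/-- Gluing two `K_{3,3}`-minor-free graphs along a vertex or an edge. -/
theorem Free.glue {A B : Set V} {s t : V} (hA : Free G A) (hB : Free G B)
    (hno : ∀ u ∈ A, u ∉ B → ∀ v ∈ B, v ∉ A → ¬ G.Adj u v)
    (hAB : A ∩ B ⊆ {s, t}) (hsA : s ∈ A) (htA : t ∈ A) (hsB : s ∈ B) (htB : t ∈ B)
    (hst : s = t ∨ G.Adj s t) : Free G (A ∪ B) := by
  rintro ⟨c, hc, hcS⟩
  have hin : ∀ p, c s ≠ some p → c t ≠ some p → ∀ v, c v = some p → v ∈ A → v ∉ B := by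
    intro p hp1 hp2 v hv hvA hvB
    rcases hAB ⟨hvA, hvB⟩ with rfl | h
    · exact hp1 hv
    · have : v = t := h
      exact hp2 (this ▸ hv)
  have hall : ∀ p, c s ≠ some p → c t ≠ some p → (∃ v ∈ A, c v = some p) →
      ∀ v, c v = some p → v ∈ A := by
    rintro p hp1 hp2 ⟨w, hwA, hw⟩ v hv
    refine (((hc.conn p) w hw v hv).of_closed (P := A) hwA ?_).1
    rintro u ⟨hu, huA⟩ z hz huz
    by_contra hzA
    exact hno u huA (hin p hp1 hp2 u hu huA) z ((hcS z p hz).resolve_left hzA) hzA huz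
  rcases K33_side (P := fun p => ∃ v ∈ A, c v = some p) (c s) (c t) (by
    intro p q hp1 hp2 hq1 hq2 hpq hp
    obtain ⟨u, v, huv, hu, hv⟩ := hc.adj p q hpq
    refine ⟨v, ?_, hv⟩
    have huA := hall p hp1 hp2 hp u hu
    by_contra hvA
    exact hno u huA (hin p hp1 hp2 u hu huA) v ((hcS v q hv).resolve_left hvA) hvA huv)
    with h | h
  · exact hA.glue_aux hno hAB hsA htA hsB htB hst hc hcS h
  · refine hB.glue_aux (fun u hu hu' v hv hv' h => hno v hv hv' u hu hu' h.symm)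
      (by rwa [Set.inter_comm]) hsB htB hsA htA hst hc (by rwa [Set.union_comm]) fun p h1 h2 => ?_
    obtain ⟨v, hv⟩ := hc.surj p
    exact ⟨v, (hcS v p hv).resolve_left fun hA => h p h1 h2 ⟨v, hA, hv⟩, hv⟩

end FreeSec

/-! ### The edge space over `ZMod 2` -/

/-- The graph on `ℕ` with edge set `E`. -/
abbrev gr (E : Finset (Sym2 ℕ)) : SimpleGraph ℕ := SimpleGraph.fromEdgeSet (E : Set (Sym2 ℕ))

/-- Vectors of the edge space. -/
abbrev EV := Sym2 ℕ →₀ ZMod 2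

/-- The boundary of an edge. -/
noncomputable def bdE : Sym2 ℕ → (ℕ →₀ ZMod 2) :=
  Sym2.lift ⟨fun a b => Finsupp.single a 1 + Finsupp.single b 1, fun _ _ => add_comm _ _⟩

theorem bdE_mk (a b : ℕ) : bdE s(a, b) = Finsupp.single a 1 + Finsupp.single b 1 := rfl

/-- The boundary map of the edge space. -/
noncomputable def bd : EV →ₗ[ZMod 2] (ℕ →₀ ZMod 2) := Finsupp.linearCombination (ZMod 2) bdE

theorem bd_single (e : Sym2 ℕ) : bd (Finsupp.single e 1) = bdE e := by
  simp [bd]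

/-- The cycle space of the edge set `E`. -/
noncomputable def Zs (E : Finset (Sym2 ℕ)) : Submodule (ZMod 2) EV :=
  LinearMap.ker bd ⊓ Finsupp.supported (ZMod 2) (ZMod 2) (E : Set (Sym2 ℕ))

theorem mem_Zs {E : Finset (Sym2 ℕ)} {z : EV} : z ∈ Zs E ↔ bd z = 0 ∧ ∀ e, z e ≠ 0 → e ∈ E := by
  simp [Zs, Finsupp.mem_supported, Set.subset_def]

theorem Zs_mono {E E' : Finset (Sym2 ℕ)} (h : E ⊆ E') : Zs E ≤ Zs E' := fun z hz => by
  rw [mem_Zs] at *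
  exact ⟨hz.1, fun e he => h (hz.2 e he)⟩

theorem ZMod2_add_self {M : Type*} [AddCommGroup M] [Module (ZMod 2) M] (x : M) : x + x = 0 := by
  rw [← two_smul (ZMod 2) x]
  have : (2 : ZMod 2) = 0 := by decide
  rw [this, zero_smul]

theorem ZMod2_cases (x : ZMod 2) : x = 0 ∨ x = 1 := by revert x; decide

theorem ZMod2_eq_one {x : ZMod 2} (h : x ≠ 0) : x = 1 := (ZMod2_cases x).resolve_left h

theorem bd_apply_eq_zero {z : EV} {x : ℕ} (h : ∀ e, z e ≠ 0 → x ∉ e) : bd z x = 0 := by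
  rw [bd, Finsupp.linearCombination_apply, Finsupp.sum, Finsupp.finsetSum_apply]
  refine Finset.sum_eq_zero fun e he => ?_
  have := h e (Finsupp.mem_support_iff.1 he)
  induction e with
  | h a b =>
    simp only [Sym2.mem_iff, not_or] at this
    simp [bdE_mk, Ne.symm this.1, Ne.symm this.2]

/-! ### Edges of walks and closed walks given as lists -/

/-- The edges between consecutive entries of a list. -/
def pe : List ℕ → List (Sym2 ℕ)
  | a :: b :: l => s(a, b) :: pe (b :: l)
  | _ => []

/-- The edges of a closed walk, given as a cyclic list. -/
def cyc (f : List ℕ) : List (Sym2 ℕ) := pe (f ++ f.take 1)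

/-- The sum of a list of edges. -/
noncomputable def vec (l : List (Sym2 ℕ)) : EV := (l.map fun e => Finsupp.single e 1).sum

/-- The vector of a closed walk. -/
noncomputable def sg (f : List ℕ) : EV := vec (cyc f)

@[simp] theorem pe_nil : pe [] = [] := rfl
@[simp] theorem pe_singleton (a : ℕ) : pe [a] = [] := rfl
@[simp] theorem pe_cons_cons (a b : ℕ) (l : List ℕ) : pe (a :: b :: l) = s(a, b) :: pe (b :: l) :=
  rfl

theorem pe_append (l m : List ℕ) (a : ℕ) : pe (l ++ a :: m) = pe (l ++ [a]) ++ pe (a :: m) := by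
  induction l with
  | nil => simp
  | cons x l ih =>
    cases l with
    | nil => simp
    | cons y l => simpa using ih

theorem pe_reverse (l : List ℕ) : pe l.reverse = (pe l).reverse := by
  induction l with
  | nil => rfl
  | cons a l ih =>
    cases l with
    | nil => rfl
    | cons b l =>
      have := pe_append l.reverse [a] b
      rw [pe_cons_cons, List.reverse_cons (a := s(a, b)), ← ih, List.reverse_cons,
        List.reverse_cons, List.append_assoc, List.singleton_append, this]
      simp [Sym2.eq_swap]

theorem mem_of_mem_pe {l : List ℕ} {e : Sym2 ℕ} (he : e ∈ pe l) {x : ℕ} (hx : x ∈ e) : x ∈ l := by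
  induction l with
  | nil => simp at he
  | cons a l ih =>
    cases l with
    | nil => simp at he
    | cons b l =>
      rw [pe_cons_cons, List.mem_cons] at he
      rcases he with rfl | he
      · rcases Sym2.mem_iff.1 hx with rfl | rfl <;> simp
      · exact List.mem_cons_of_mem _ (ih he)

theorem cyc_cons (a : ℕ) (l : List ℕ) : cyc (a :: l) = pe (a :: l ++ [a]) := by
  simp [cyc]

theorem cyc_rotate (l m : List ℕ) : (cyc (l ++ m)).Perm (cyc (m ++ l)) := by
  cases l with
  | nil => simp
  | cons a l =>
    cases m with
    | nil => simp
    | cons b m =>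
      have h1 : cyc (a :: l ++ b :: m) = pe (a :: l ++ [b]) ++ pe (b :: m ++ [a]) := by
        have := pe_append (a :: l) (m ++ [a]) b
        simpa [cyc] using this
      have h2 : cyc (b :: m ++ a :: l) = pe (b :: m ++ [a]) ++ pe (a :: l ++ [b]) := by
        have := pe_append (b :: m) (l ++ [b]) a
        simpa [cyc] using this
      rw [h1, h2]
      exact List.perm_append_comm

theorem cyc_split (L0 L1 L2 : List ℕ) (a b : ℕ) : (cyc (L0 ++ a :: L1 ++ b :: L2)).Perm
    (pe (a :: L1 ++ [b]) ++ pe (b :: (L2 ++ L0) ++ [a])) := by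
  rw [List.append_assoc]
  refine (cyc_rotate _ _).trans ?_
  have := pe_append (a :: L1) (L2 ++ L0 ++ [a]) b
  refine List.Perm.of_eq ?_
  simpa [cyc] using this

theorem cyc_pendant (L0 L2 : List ℕ) (a x : ℕ) : (cyc (L0 ++ a :: x :: a :: L2)).Perm
    (s(a, x) :: s(a, x) :: cyc (L0 ++ a :: L2)) := by
  refine (cyc_rotate _ _).trans ?_
  refine List.Perm.trans ?_ (((cyc_rotate (a :: L2) L0).cons _).cons _)
  simp [cyc, Sym2.eq_swap]

theorem vec_perm {l m : List (Sym2 ℕ)} (h : l.Perm m) : vec l = vec m := (h.map _).sum_eq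

@[simp] theorem vec_nil : vec [] = 0 := rfl
@[simp] theorem vec_cons (e : Sym2 ℕ) (l : List (Sym2 ℕ)) :
    vec (e :: l) = Finsupp.single e 1 + vec l := by simp [vec]
@[simp] theorem vec_append (l m : List (Sym2 ℕ)) : vec (l ++ m) = vec l + vec m := by simp [vec]

theorem vec_apply (l : List (Sym2 ℕ)) (e : Sym2 ℕ) : vec l e = (l.count e : ZMod 2) := by
  induction l with
  | nil => simp
  | cons a l ih =>
    rw [vec_cons, Finsupp.add_apply, ih, List.count_cons, Finsupp.single_apply]
    by_cases h : a = e <;> simp [h, add_comm]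

theorem mem_of_vec_ne {l : List (Sym2 ℕ)} {e : Sym2 ℕ} (h : vec l e ≠ 0) : e ∈ l := by
  by_contra hn
  rw [vec_apply, List.count_eq_zero_of_not_mem hn] at h
  simp at h

theorem bd_vec_pe (a b : ℕ) (l : List ℕ) : bd (vec (pe (a :: l ++ [b]))) =
    Finsupp.single a 1 + Finsupp.single b 1 := by
  induction l generalizing a with
  | nil => simp [bd_single, bdE_mk]
  | cons c l ih =>
    rw [List.cons_append, List.cons_append, pe_cons_cons, vec_cons, map_add, bd_single, bdE_mk,
      ← List.cons_append, ih, add_assoc, ← add_assoc (Finsupp.single c 1), ZMod2_add_self, zero_add]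

theorem bd_sg (f : List ℕ) : bd (sg f) = 0 := by
  cases f with
  | nil => simp [sg, cyc]
  | cons a l => rw [sg, cyc_cons, bd_vec_pe, ZMod2_add_self]

/-! ### Two-bases -/

/-- A family of cycle vectors spanning the cycle space of `E` and covering every edge at most
twice. -/
structure TwoBasis (E : Finset (Sym2 ℕ)) (B : Multiset EV) : Prop where
  mem : ∀ b ∈ B, b ∈ Zs E
  span : Zs E ≤ Submodule.span (ZMod 2) {b | b ∈ B}
  two : ∀ e, (B.filter fun b => b e ≠ 0).card ≤ 2
  sum : B.sum = 0

theorem TwoBasis.apply_even {E : Finset (Sym2 ℕ)} {B : Multiset EV} (h : TwoBasis E B)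
    (e : Sym2 ℕ) : (B.filter fun b => b e ≠ 0) = 0 ∨
      ∃ b1 b2, (B.filter fun b => b e ≠ 0) = {b1, b2} := by
  have h1 : ∀ C : Multiset EV, (C.sum e : ZMod 2) =
      ((C.filter fun b => b e ≠ 0).card : ZMod 2) := by
    intro C
    induction C using Multiset.induction_on with
    | empty => simp
    | cons b C ih =>
      rw [Multiset.sum_cons, Finsupp.add_apply, ih, Multiset.filter_cons]
      by_cases hb : b e = 0
      · simp [hb]
      · simp [ZMod2_eq_one hb, add_comm]
  have h2 := h1 B
  have h3 := h.two e
  rw [h.sum] at h2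
  have h4 : (B.filter fun b => b e ≠ 0).card = 0 ∨ (B.filter fun b => b e ≠ 0).card = 1 ∨
    (B.filter fun b => b e ≠ 0).card = 2 := by omega
  rcases h4 with h4 | h4 | h4
  · exact .inl (Multiset.card_eq_zero.1 h4)
  · rw [h4] at h2; simp at h2
  · exact .inr (Multiset.card_eq_two.1 h4)

theorem TwoBasis.merge {E E' : Finset (Sym2 ℕ)} {b1 b2 : EV} {R : Multiset EV} {e0 : Sym2 ℕ}
    (h : TwoBasis E (b1 ::ₘ b2 ::ₘ R)) (hE : E' ⊆ E) (he0 : e0 ∉ E')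
    (hE' : ∀ z ∈ Zs E, z e0 = 0 → z ∈ Zs E')
    (h1 : b1 e0 ≠ 0) (h2 : b2 e0 ≠ 0) (hR : ∀ r ∈ R, r e0 = 0) :
    TwoBasis E' ((b1 + b2) ::ₘ R) := by
  refine ⟨?_, ?_, ?_, ?_⟩
  · intro b hb
    rw [Multiset.mem_cons] at hb
    rcases hb with rfl | hb
    · refine hE' _ (Submodule.add_mem _ (h.mem _ (by simp)) (h.mem _ (by simp))) ?_
      rw [Finsupp.add_apply, ZMod2_eq_one h1, ZMod2_eq_one h2]; decide
    · exact hE' _ (h.mem _ (by simp [hb])) (hR b hb)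
  · intro z hz
    have hz' := h.span (Zs_mono hE hz)
    have hset : {b | b ∈ b1 ::ₘ b2 ::ₘ R} = insert b1 (insert b2 {b | b ∈ R}) := by
      ext b; simp
    have hset' : {b | b ∈ (b1 + b2) ::ₘ R} = insert (b1 + b2) {b | b ∈ R} := by
      ext b; simp
    rw [hset, Submodule.mem_span_insert] at hz'
    obtain ⟨α, y, hy, rfl⟩ := hz'
    rw [Submodule.mem_span_insert] at hy
    obtain ⟨β, r, hr, rfl⟩ := hy
    have hr0 : r e0 = 0 := by
      have : Submodule.span (ZMod 2) {b | b ∈ R} ≤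
          LinearMap.ker (Finsupp.lapply (R := ZMod 2) (M := ZMod 2) e0) := by
        rw [Submodule.span_le]
        intro b hb
        simpa using hR b hb
      simpa using this hr
    have h0 : (α • b1 + (β • b2 + r)) e0 = 0 := by
      by_contra hne
      exact he0 ((mem_Zs.1 hz).2 _ hne)
    have hαβ : α = β := by
      simp only [Finsupp.add_apply, Finsupp.smul_apply, hr0, ZMod2_eq_one h1, ZMod2_eq_one h2] at h0
      have : ∀ α β : ZMod 2, α • (1 : ZMod 2) + (β • (1 : ZMod 2) + 0) = 0 → α = β := by decide
      exact this _ _ h0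
    rw [hset', Submodule.mem_span_insert]
    exact ⟨α, r, hr, by rw [hαβ, smul_add, add_assoc]⟩
  · intro e
    have := h.two e
    rw [Multiset.filter_cons, Multiset.filter_cons] at this
    rw [Multiset.filter_cons]
    simp only [Multiset.card_add] at *
    have e1 : ∀ (b : EV), (if b e ≠ 0 then ({b} : Multiset EV) else 0).card =
      if b e ≠ 0 then 1 else 0 := by intro b; split_ifs <;> simp
    rw [e1] at *
    rw [e1] at this
    rw [Finsupp.add_apply]
    by_cases h3 : b1 e = 0 <;> by_cases h4 : b2 e = 0 <;> simp [h3, h4] at this ⊢ <;>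
      first | omega | (split_ifs <;> omega)
  · rw [← h.sum]; simp [add_assoc]

theorem TwoBasis.erase {E : Finset (Sym2 ℕ)} {B : Multiset EV} (h : TwoBasis E B)
    (e0 : Sym2 ℕ) : ∃ B', TwoBasis (E.erase e0) B' := by
  have hE' : ∀ z ∈ Zs E, z e0 = 0 → z ∈ Zs (E.erase e0) := by
    intro z hz h0
    rw [mem_Zs] at *
    refine ⟨hz.1, fun e he => Finset.mem_erase.2 ⟨?_, hz.2 e he⟩⟩
    rintro rfl; exact he h0
  rcases h.apply_even e0 with h0 | ⟨b1, b2, h0⟩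
  · rw [Multiset.filter_eq_nil] at h0
    push Not at h0
    exact ⟨B, fun b hb => hE' b (h.mem b hb) (h0 b hb),
      (Zs_mono (Finset.erase_subset _ _)).trans h.span, h.two, h.sum⟩
  · have hB : B = b1 ::ₘ b2 ::ₘ (B.filter fun b => ¬ b e0 ≠ 0) := by
      conv_lhs => rw [← Multiset.filter_add_not (fun b : EV => b e0 ≠ 0) B, h0]
      simp
    have hm : ∀ b ∈ ({b1, b2} : Multiset EV), b e0 ≠ 0 := by
      intro b hb
      rw [← h0] at hb
      exact (Multiset.mem_filter.1 hb).2
    rw [hB] at h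
    exact ⟨_, h.merge (Finset.erase_subset _ _) (by simp) hE' (hm _ (by simp)) (hm _ (by simp))
      (fun r hr => by simpa using (Multiset.mem_filter.1 hr).2)⟩

theorem TwoBasis.anti {E E' : Finset (Sym2 ℕ)} {B : Multiset EV} (h : TwoBasis E B)
    (hE : E' ⊆ E) : ∃ B', TwoBasis E' B' := by
  have key : ∀ D : Finset (Sym2 ℕ), ∃ B', TwoBasis (E \ D) B' := by
    intro D
    induction D using Finset.induction_on with
    | empty => exact ⟨B, by simpa using h⟩
    | insert e D _ ih =>
      obtain ⟨B', hB'⟩ := ih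
      rw [Finset.sdiff_insert]
      exact hB'.erase e
  have := key (E \ E')
  rwa [Finset.sdiff_sdiff_eq_self hE] at this

/-! ### Plane certificates -/

/-- `F` is a family of closed walks that covers every edge of `E` exactly twice and generates the
cycle space of `E`. -/
structure PlaneCert (E : Finset (Sym2 ℕ)) (F : Multiset (List ℕ)) : Prop where
  count : ∀ e, (F.map fun f => (cyc f).count e).sum = if e ∈ E then 2 else 0
  span : Zs E ≤ Submodule.span (ZMod 2) {z | ∃ f ∈ F, sg f = z}

section PlaneCertSec

variable {E : Finset (Sym2 ℕ)} {F : Multiset (List ℕ)}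

theorem PlaneCert.mem_of_cyc (h : PlaneCert E F) {f : List ℕ} (hf : f ∈ F) {e : Sym2 ℕ}
    (he : e ∈ cyc f) : e ∈ E := by
  have h1 := h.count e
  by_contra hn
  rw [if_neg hn] at h1
  have := Multiset.sum_eq_zero_iff.1 h1 _ (Multiset.mem_map_of_mem _ hf)
  exact (List.count_pos_iff.2 he).ne' this

theorem PlaneCert.sg_mem (h : PlaneCert E F) {f : List ℕ} (hf : f ∈ F) : sg f ∈ Zs E :=
  mem_Zs.2 ⟨bd_sg f, fun _ he => h.mem_of_cyc hf (mem_of_vec_ne he)⟩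

theorem PlaneCert.twoBasis (h : PlaneCert E F) : TwoBasis E (F.map sg) := by
  refine ⟨?_, ?_, ?_, ?_⟩
  · intro b hb
    obtain ⟨f, hf, rfl⟩ := Multiset.mem_map.1 hb
    exact h.sg_mem hf
  · refine h.span.trans (Submodule.span_mono ?_)
    rintro z ⟨f, hf, rfl⟩
    exact Multiset.mem_map_of_mem _ hf
  · intro e
    have h1 : ∀ C : Multiset (List ℕ), ((C.map sg).filter fun b => b e ≠ 0).card ≤
        (C.map fun f => (cyc f).count e).sum := by
      intro C
      induction C using Multiset.induction_on with
      | empty => simp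
      | cons f C ih =>
        rw [Multiset.map_cons, Multiset.filter_cons, Multiset.map_cons, Multiset.sum_cons,
          Multiset.card_add]
        refine add_le_add ?_ ih
        split_ifs with hf
        · rw [Multiset.card_singleton]
          exact List.count_pos_iff.2 (mem_of_vec_ne hf)
        · simp
    refine (h1 F).trans ?_
    rw [h.count e]
    split_ifs <;> omega
  · ext e
    have h1 : ∀ C : Multiset (List ℕ), (C.map sg).sum e =
        ((C.map fun f => (cyc f).count e).sum : ZMod 2) := by
      intro C
      induction C using Multiset.induction_on with
      | empty => simp
      | cons f C ih =>
        rw [Multiset.map_cons, Multiset.sum_cons, Multiset.map_cons, Multiset.sum_cons,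
          Finsupp.add_apply, ih, sg, vec_apply, Nat.cast_add]
    rw [h1, h.count e]
    split_ifs
    · simpa using (by decide : (2 : ZMod 2) = 0)
    · simp

theorem PlaneCert.edge {u v : ℕ} (h : u ≠ v) : PlaneCert {s(u, v)} {[u, v]} := by
  refine ⟨fun e => ?_, fun z hz => ?_⟩
  · by_cases he : e = s(u, v)
    · subst he; simp [cyc, Sym2.eq_swap]
    · simp [cyc, Sym2.eq_swap (a := v), he, Ne.symm he]
  · rw [mem_Zs] at hz
    have hz1 : z s(u, v) = 0 := by
      have h1 : z = Finsupp.single s(u, v) (z s(u, v)) := by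
        ext e
        by_cases he : e = s(u, v)
        · simp [he]
        · have : z e = 0 := by
            by_contra hne
            exact he (by simpa using hz.2 e hne)
          rw [this, Finsupp.single_apply, if_neg (Ne.symm he)]
      rcases ZMod2_cases (z s(u, v)) with h0 | h0
      · exact h0
      · rw [h0] at h1
        have h2 := hz.1
        rw [h1, bd_single, bdE_mk] at h2
        have := DFunLike.congr_fun h2 u
        simp [h.symm] at this
    have : z = 0 := by
      ext e
      by_contra hne
      have : e = s(u, v) := by simpa using hz.2 e hne
      subst this
      exact hne hz1
    rw [this]
    exact Submodule.zero_mem _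

theorem PlaneCert.perm (h : PlaneCert E F) {f f' : List ℕ} {F' : Multiset (List ℕ)}
    (hF : F = f ::ₘ F') (hf : (cyc f').Perm (cyc f)) : PlaneCert E (f' ::ₘ F') := by
  subst hF
  refine ⟨fun e => ?_, h.span.trans (Submodule.span_mono ?_)⟩
  · rw [← h.count e]
    simp [hf.count_eq]
  · rintro z ⟨g, hg, rfl⟩
    rw [Multiset.mem_cons] at hg
    rcases hg with rfl | hg
    · exact ⟨f', by simp, vec_perm hf⟩
    · exact ⟨g, by simp [hg], rfl⟩

theorem PlaneCert.pendant {L0 L2 : List ℕ} {a x : ℕ} (h : PlaneCert E ((L0 ++ a :: L2) ::ₘ F))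
    (hx : ∀ e ∈ E, x ∉ e) (hxa : x ≠ a) :
    PlaneCert (insert s(a, x) E) ((L0 ++ a :: x :: a :: L2) ::ₘ F) := by
  have hnot : s(a, x) ∉ E := fun he => hx _ he (by simp)
  refine ⟨fun e => ?_, fun z hz => ?_⟩
  · have h1 := h.count e
    rw [Multiset.map_cons, Multiset.sum_cons] at *
    rw [(cyc_pendant L0 L2 a x).count_eq]
    simp only [List.count_cons]
    by_cases he : e = s(a, x)
    · subst he
      simp [hnot] at *
      omega
    · simp [he, Ne.symm he] at *
      omega
  · have hz' := mem_Zs.1 hz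
    have hzE : z ∈ Zs E := by
      refine mem_Zs.2 ⟨hz'.1, fun e he => (Finset.mem_insert.1 (hz'.2 e he)).resolve_left ?_⟩
      rintro rfl
      have h1 : bd (z + Finsupp.single s(a, x) 1) x = 0 := by
        refine bd_apply_eq_zero fun e he' => ?_
        rw [Finsupp.add_apply] at he'
        have hne : e ≠ s(a, x) := by
          rintro rfl
          rw [ZMod2_eq_one he] at he'
          exact he' (by simp; decide)
        rw [Finsupp.single_apply, if_neg (Ne.symm hne), add_zero] at he'
        exact hx e ((Finset.mem_insert.1 (hz'.2 e he')).resolve_left hne)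
      rw [map_add, hz'.1, bd_single, bdE_mk] at h1
      simp [hxa.symm] at h1
    refine Submodule.span_mono ?_ (h.span hzE)
    rintro y ⟨f, hf, rfl⟩
    rw [Multiset.mem_cons] at hf
    rcases hf with rfl | hf
    · refine ⟨_, Multiset.mem_cons_self _ _, ?_⟩
      rw [sg, vec_perm (cyc_pendant L0 L2 a x), vec_cons, vec_cons, ← add_assoc, ZMod2_add_self,
        zero_add, sg]
    · exact ⟨f, by simp [hf], rfl⟩

theorem cyc_chord_left (L1 : List ℕ) (a b : ℕ) :
    (cyc (a :: L1 ++ [b])).Perm (s(a, b) :: pe (a :: L1 ++ [b])) := by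
  have := pe_append (a :: L1) [a] b
  refine List.Perm.trans (List.Perm.of_eq (l₂ := pe (a :: L1 ++ [b]) ++ [s(a, b)]) ?_)
    (List.perm_append_singleton _ _)
  simpa [cyc, Sym2.eq_swap] using this

theorem cyc_chord_right (L0 L2 : List ℕ) (a b : ℕ) :
    (cyc (L0 ++ a :: b :: L2)).Perm (s(a, b) :: pe (b :: (L2 ++ L0) ++ [a])) := by
  refine (cyc_rotate _ _).trans (List.Perm.of_eq ?_)
  simp [cyc]

theorem sg_chord (L0 L1 L2 : List ℕ) (a b : ℕ) :
    sg (L0 ++ a :: L1 ++ b :: L2) = sg (a :: L1 ++ [b]) + sg (L0 ++ a :: b :: L2) := by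
  rw [sg, sg, sg, vec_perm (cyc_split _ _ _ _ _), vec_perm (cyc_chord_left _ _ _),
    vec_perm (cyc_chord_right _ _ _ _), vec_append, vec_cons, vec_cons]
  rw [add_add_add_comm, ZMod2_add_self, zero_add]

theorem PlaneCert.chord {L0 L1 L2 : List ℕ} {a b : ℕ}
    (h : PlaneCert E ((L0 ++ a :: L1 ++ b :: L2) ::ₘ F)) (hab : s(a, b) ∉ E) :
    PlaneCert (insert s(a, b) E) ((a :: L1 ++ [b]) ::ₘ (L0 ++ a :: b :: L2) ::ₘ F) := by
  refine ⟨fun e => ?_, fun z hz => ?_⟩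
  · have h1 := h.count e
    rw [Multiset.map_cons, Multiset.sum_cons, (cyc_split _ _ _ _ _).count_eq,
      List.count_append] at h1
    rw [Multiset.map_cons, Multiset.sum_cons, Multiset.map_cons, Multiset.sum_cons,
      (cyc_chord_left _ _ _).count_eq, (cyc_chord_right _ _ _ _).count_eq, List.count_cons,
      List.count_cons]
    by_cases he : e = s(a, b)
    · subst he
      simp only [hab, if_false, beq_self_eq_true, if_true, Finset.mem_insert_self] at *
      omega
    · simp only [beq_iff_eq, Ne.symm he, if_false, Finset.mem_insert, he, false_or] at *
      omega
  · have hz' := mem_Zs.1 hz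
    have hsub : Zs E ≤ Submodule.span (ZMod 2)
        {z | ∃ f ∈ ((a :: L1 ++ [b]) ::ₘ (L0 ++ a :: b :: L2) ::ₘ F), sg f = z} := by
      refine h.span.trans (Submodule.span_le.2 ?_)
      rintro y ⟨f, hf, rfl⟩
      rw [Multiset.mem_cons] at hf
      rcases hf with rfl | hf
      · rw [sg_chord]
        exact Submodule.add_mem _ (Submodule.subset_span ⟨_, by simp, rfl⟩)
          (Submodule.subset_span ⟨_, by simp, rfl⟩)
      · exact Submodule.subset_span ⟨f, by simp [hf], rfl⟩
    by_cases h0 : z s(a, b) = 0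
    · refine hsub (mem_Zs.2 ⟨hz'.1, fun e he =>
        (Finset.mem_insert.1 (hz'.2 e he)).resolve_left ?_⟩)
      rintro rfl
      exact he h0
    · have hmem : ∀ e ∈ pe (a :: L1 ++ [b]), e ∈ E := fun e he =>
        h.mem_of_cyc (Multiset.mem_cons_self _ _)
          ((cyc_split L0 L1 L2 a b).mem_iff.2 (List.mem_append_left _ he))
      have hz2 : z + sg (a :: L1 ++ [b]) ∈ Zs E := by
        rw [mem_Zs, map_add, hz'.1, bd_sg, add_zero]
        refine ⟨rfl, fun e he => ?_⟩
        rw [Finsupp.add_apply, sg, vec_apply, (cyc_chord_left _ _ _).count_eq,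
          List.count_cons] at he
        by_cases hab' : e = s(a, b)
        · subst hab'
          rw [List.count_eq_zero_of_not_mem fun h => hab (hmem _ h), ZMod2_eq_one h0] at he
          exact (he (by simp; decide)).elim
        · by_contra hn
          rw [List.count_eq_zero_of_not_mem fun h => hn (hmem _ h)] at he
          have : z e = 0 := by
            by_contra hne
            exact hn ((Finset.mem_insert.1 (hz'.2 e hne)).resolve_left hab')
          simp [this, Ne.symm hab'] at he
      have : z = (z + sg (a :: L1 ++ [b])) + sg (a :: L1 ++ [b]) := by
        rw [add_assoc, ZMod2_add_self, add_zero]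
      rw [this]
      exact Submodule.add_mem _ (hsub hz2) (Submodule.subset_span ⟨_, by simp, rfl⟩)

end PlaneCertSec

/-! ### A graph with a two-basis has no `K_{3,3}` minor -/

theorem four_le_weight (m : Fin 3 → Fin 3 → ZMod 2) (h1 : ∀ i, ∑ j, m i j = 0)
    (h2 : ∀ j, ∑ i, m i j = 0) (h : m ≠ 0) :
    4 ≤ ∑ i, ∑ j, if m i j ≠ 0 then 1 else 0 := by
  have key : ∀ a b c d : ZMod 2, ¬ (a = 0 ∧ b = 0 ∧ c = 0 ∧ d = 0) →
      4 ≤ (if a + b ≠ 0 then 1 else 0) + (if c + d ≠ 0 then 1 else 0) +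
        (if a + c ≠ 0 then 1 else 0) + (if b + d ≠ 0 then 1 else 0) +
        (if a + b + (c + d) ≠ 0 then 1 else 0) + (if a ≠ 0 then 1 else 0) +
        (if b ≠ 0 then 1 else 0) + (if c ≠ 0 then 1 else 0) + (if d ≠ 0 then 1 else 0) := by
    decide
  have e : ∀ x y z : ZMod 2, x + y + z = 0 → x = y + z := by decide
  have r1 := e _ _ _ (by simpa [Fin.sum_univ_three] using h1 1)
  have r2 := e _ _ _ (by simpa [Fin.sum_univ_three] using h1 2)
  have c0 := e _ _ _ (by simpa [Fin.sum_univ_three] using h2 0)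
  have c1 := e _ _ _ (by simpa [Fin.sum_univ_three] using h2 1)
  have c2 := e _ _ _ (by simpa [Fin.sum_univ_three] using h2 2)
  have hne : ¬ (m 1 1 = 0 ∧ m 1 2 = 0 ∧ m 2 1 = 0 ∧ m 2 2 = 0) := by
    rintro ⟨k1, k2, k3, k4⟩
    apply h
    rw [k1, k2] at r1
    rw [k3, k4] at r2
    rw [k1, k3] at c1
    rw [k2, k4] at c2
    rw [r1, r2] at c0
    simp only [add_zero] at r1 r2 c0 c1 c2
    funext i j
    fin_cases i <;> fin_cases j
    exacts [c0, c1, c2, r1, k1, k2, r2, k3, k4]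
  have := key _ _ _ _ hne
  simp only [Fin.sum_univ_three]
  rw [c0, c1, c2, r1, r2]
  omega

theorem exists_fiber_path {I : Finset (Sym2 ℕ)} {G : SimpleGraph ℕ} {S : Set ℕ}
    (hI : ∀ u w, G.Adj u w → u ∈ S → w ∈ S → s(u, w) ∈ I) {a b : ℕ} (h : Joined G S a b) :
    ∃ w : EV, (∀ e, w e ≠ 0 → e ∈ I) ∧ bd w = Finsupp.single a 1 + Finsupp.single b 1 := by
  induction h with
  | refl => exact ⟨0, by simp, by rw [map_zero, ZMod2_add_self]⟩
  | @tail x y _ hxy ih =>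
    obtain ⟨w, h1, h2⟩ := ih
    refine ⟨w + Finsupp.single s(x, y) 1, fun e he => ?_, ?_⟩
    · by_cases hw : w e = 0
      · rw [Finsupp.add_apply, hw, zero_add, Finsupp.single_apply] at he
        split_ifs at he with h
        · rw [← h]; exact hI _ _ hxy.1 hxy.2.1 hxy.2.2
        · exact (he rfl).elim
      · exact h1 e hw
    · rw [map_add, h2, bd_single, bdE_mk, add_assoc, ← add_assoc (Finsupp.single x 1),
        ZMod2_add_self, zero_add]

theorem TwoBasis.not_isModel {E : Finset (Sym2 ℕ)} {B : Multiset EV} (hB : TwoBasis E B)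
    (c : ℕ → Option (Fin 3 ⊕ Fin 3)) : ¬ IsModel K33 (gr E) c := by
  classical
  intro hc
  have hch : ∀ i j : Fin 3, ∃ p : ℕ × ℕ, s(p.1, p.2) ∈ E ∧ c p.1 = some (.inl i) ∧
      c p.2 = some (.inr j) := by
    intro i j
    obtain ⟨u, v, h1, h2, h3⟩ := hc.adj (.inl i) (.inr j) (by simp)
    exact ⟨(u, v), by simpa using ((SimpleGraph.fromEdgeSet_adj _).1 h1).1, h2, h3⟩
  choose p hpE hp1 hp2 using hch
  let ed : Fin 3 × Fin 3 → Sym2 ℕ := fun q => s((p q.1 q.2).1, (p q.1 q.2).2)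
  let I : Finset (Sym2 ℕ) := E.filter fun e => ∃ q, ∀ x ∈ e, c x = some q
  have hedI : ∀ q, ed q ∉ I := by
    intro q hq
    obtain ⟨-, r, hr⟩ := Finset.mem_filter.1 hq
    have h1 := hr _ (Sym2.mem_mk_left _ _)
    have h2 := hr _ (Sym2.mem_mk_right _ _)
    rw [hp1] at h1
    rw [hp2] at h2
    simp [← h2] at h1
  have hinj : Function.Injective ed := by
    intro q r hqr
    rcases Sym2.eq_iff.1 hqr with ⟨h1, h2⟩ | ⟨h1, h2⟩
    · have e1 := hp1 q.1 q.2
      rw [h1, hp1] at e1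
      have e2 := hp2 q.1 q.2
      rw [h2, hp2] at e2
      simp at e1 e2
      exact Prod.ext e1.symm e2.symm
    · have e1 := hp1 q.1 q.2
      rw [h1, hp2] at e1
      simp at e1
  obtain ⟨C, hC⟩ := hB.anti (E' := I ∪ Finset.univ.image ed) (by
    refine Finset.union_subset (Finset.filter_subset _ _) ?_
    intro e he
    obtain ⟨q, -, rfl⟩ := Finset.mem_image.1 he
    exact hpE _ _)
  -- the functional summing a vertex vector over a fibre
  let ψ : Fin 3 ⊕ Fin 3 → (ℕ →₀ ZMod 2) →ₗ[ZMod 2] ZMod 2 := fun r =>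
    Finsupp.linearCombination (ZMod 2) fun v => if c v = some r then 1 else 0
  have hψs : ∀ r v, ψ r (Finsupp.single v 1) = if c v = some r then 1 else 0 := by
    intro r v; simp [ψ]
  have hψ : ∀ r z, z ∈ Zs (I ∪ Finset.univ.image ed) →
      ∑ q, z (ed q) * ψ r (bdE (ed q)) = 0 := by
    intro r z hz
    rw [mem_Zs] at hz
    have h1 : ψ r (bd z) = ∑ e ∈ I ∪ Finset.univ.image ed, z e * ψ r (bdE e) := by
      have h2 : bd z = ∑ e ∈ z.support, z e • bdE e := by
        rw [bd, Finsupp.linearCombination_apply, Finsupp.sum]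
      rw [h2, map_sum]
      simp only [map_smul, smul_eq_mul]
      refine Finset.sum_subset (fun e he => hz.2 e (Finsupp.mem_support_iff.1 he)) ?_
      intro e _ he
      rw [Finsupp.notMem_support_iff.1 he, zero_mul]
    rw [hz.1, map_zero, Finset.sum_union (by
      rw [Finset.disjoint_right]
      intro e he
      obtain ⟨q, -, rfl⟩ := Finset.mem_image.1 he
      exact hedI q), Finset.sum_image hinj.injOn] at h1
    rw [Finset.sum_eq_zero (s := I), zero_add] at h1
    · exact h1.symm
    · intro e he
      obtain ⟨-, q, hq⟩ := Finset.mem_filter.1 he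
      induction e with
      | h a b =>
        rw [bdE_mk, map_add, hψs, hψs, hq a (by simp), hq b (by simp), ZMod2_add_self, mul_zero]
  have hψl : ∀ i q, ψ (.inl i) (bdE (ed q)) = if q.1 = i then 1 else 0 := by
    intro i q
    rw [bdE_mk, map_add, hψs, hψs, hp1, hp2]
    simp
  have hψr : ∀ j q, ψ (.inr j) (bdE (ed q)) = if q.2 = j then 1 else 0 := by
    intro j q
    rw [bdE_mk, map_add, hψs, hψs, hp1, hp2]
    simp
  let m : EV → Fin 3 → Fin 3 → ZMod 2 := fun z i j => z (ed (i, j))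
  have hrow : ∀ z ∈ Zs (I ∪ Finset.univ.image ed), ∀ i, ∑ j, m z i j = 0 := by
    intro z hz i
    have := hψ (.inl i) z hz
    simp only [hψl, Fintype.sum_prod_type, mul_ite, mul_one, mul_zero] at this
    rw [Finset.sum_comm] at this
    simpa using this
  have hcol : ∀ z ∈ Zs (I ∪ Finset.univ.image ed), ∀ j, ∑ i, m z i j = 0 := by
    intro z hz j
    have := hψ (.inr j) z hz
    simp only [hψr, Fintype.sum_prod_type, mul_ite, mul_one, mul_zero] at this
    simpa using this
  -- at most four members of the two-basis are visible
  have hcard : (C.filter fun b => m b ≠ 0).card ≤ 4 := by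
    have h1 : ∀ D : Multiset EV, (∀ b ∈ D, b ∈ Zs (I ∪ Finset.univ.image ed)) →
        4 * (D.filter fun b => m b ≠ 0).card ≤
        ∑ i, ∑ j, (D.filter fun b => m b i j ≠ 0).card := by
      intro D
      induction D using Multiset.induction_on with
      | empty => simp
      | cons b D ih =>
        intro hD
        have ih := ih fun b' hb' => hD b' (by simp [hb'])
        simp only [Multiset.filter_cons, Multiset.card_add, Finset.sum_add_distrib]
        by_cases hb : m b = 0
        · simpa [hb] using ih
        · have h4 := four_le_weight (m b) (hrow b (hD b (by simp))) (hcol b (hD b (by simp))) hb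
          have e1 : ∀ (P : Prop) [Decidable P], (if P then ({b} : Multiset EV) else 0).card =
            if P then 1 else 0 := by intro P _; split_ifs <;> simp
          simp only [e1]
          rw [if_pos hb]
          omega
    have h2 := h1 C hC.mem
    have h3 : ∑ i : Fin 3, ∑ j : Fin 3, (C.filter fun b => m b i j ≠ 0).card ≤
        ∑ i : Fin 3, ∑ j : Fin 3, 2 :=
      Finset.sum_le_sum fun i _ => Finset.sum_le_sum fun j _ => hC.two _
    simp only [Finset.sum_const, Finset.card_univ, Fintype.card_fin, smul_eq_mul] at h3
    omega
  -- the projection to four independent entries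
  let ρ : EV →ₗ[ZMod 2] (Fin 2 × Fin 2 → ZMod 2) :=
    LinearMap.pi fun q => Finsupp.lapply (ed (q.1.succ, q.2.succ))
  have hρ : ∀ z q, ρ z q = z (ed (q.1.succ, q.2.succ)) := fun z q => rfl
  have hsurj : ∀ q, ∃ z ∈ Zs (I ∪ Finset.univ.image ed), ρ z = Pi.single q 1 := by
    rintro ⟨i, j⟩
    have hIadj : ∀ r u w, (gr E).Adj u w → c u = some r → c w = some r → s(u, w) ∈ I := by
      intro r u w huw hu hw
      refine Finset.mem_filter.2 ⟨by simpa using ((SimpleGraph.fromEdgeSet_adj _).1 huw).1, r, ?_⟩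
      intro x hx
      rcases Sym2.mem_iff.1 hx with rfl | rfl <;> assumption
    have hl : ∀ i j j', ∃ w : EV, (∀ e, w e ≠ 0 → e ∈ I) ∧
        bd w = Finsupp.single (p i j).1 1 + Finsupp.single (p i j').1 1 := fun i j j' =>
      exists_fiber_path (S := {v | c v = some (.inl i)}) (fun u w h => hIadj _ u w h)
        (hc.conn (.inl i) _ (hp1 i j) _ (hp1 i j'))
    have hr : ∀ i i' j, ∃ w : EV, (∀ e, w e ≠ 0 → e ∈ I) ∧
        bd w = Finsupp.single (p i j).2 1 + Finsupp.single (p i' j).2 1 := fun i i' j =>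
      exists_fiber_path (S := {v | c v = some (.inr j)}) (fun u w h => hIadj _ u w h)
        (hc.conn (.inr j) _ (hp2 i j) _ (hp2 i' j))
    obtain ⟨w1, a1, b1⟩ := hl 0 0 j.succ
    obtain ⟨w2, a2, b2⟩ := hl i.succ 0 j.succ
    obtain ⟨w3, a3, b3⟩ := hr 0 i.succ 0
    obtain ⟨w4, a4, b4⟩ := hr 0 i.succ j.succ
    have hw : ∀ w : EV, (∀ e, w e ≠ 0 → e ∈ I) → ∀ q, w (ed q) = 0 := fun w hw q => by
      by_contra h
      exact hedI q (hw _ h)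
    let z : EV := w1 + w2 + w3 + w4 + (Finsupp.single (ed (0, 0)) 1 +
      Finsupp.single (ed (0, j.succ)) 1 + Finsupp.single (ed (i.succ, 0)) 1 +
      Finsupp.single (ed (i.succ, j.succ)) 1)
    refine ⟨z, mem_Zs.2 ⟨?_, fun e he => ?_⟩, ?_⟩
    · simp only [z, map_add, b1, b2, b3, b4, bd_single, ed, bdE_mk]
      generalize Finsupp.single (p 0 0).1 1 = x1
      generalize Finsupp.single (p 0 0).2 1 = x2
      generalize Finsupp.single (p 0 j.succ).1 1 = x3
      generalize Finsupp.single (p 0 j.succ).2 1 = x4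
      generalize Finsupp.single (p i.succ 0).1 1 = x5
      generalize Finsupp.single (p i.succ 0).2 1 = x6
      generalize Finsupp.single (p i.succ j.succ).1 1 = x7
      generalize Finsupp.single (p i.succ j.succ).2 1 = x8
      have : ∀ x1 x2 x3 x4 x5 x6 x7 x8 : ℕ →₀ ZMod 2, x1 + x3 + (x5 + x7) + (x2 + x6) +
          (x4 + x8) + (x1 + x2 + (x3 + x4) + (x5 + x6) + (x7 + x8)) =
          (x1 + x1) + (x2 + x2) + (x3 + x3) + (x4 + x4) + (x5 + x5) + (x6 + x6) + (x7 + x7) +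
          (x8 + x8) := by
        intros; abel
      rw [this]
      simp only [ZMod2_add_self]
    · by_contra hn
      rw [Finset.mem_union, not_or] at hn
      have hw' : ∀ w : EV, (∀ e, w e ≠ 0 → e ∈ I) → w e = 0 := fun w hw => by
        by_contra h
        exact hn.1 (hw _ h)
      have he' : ∀ q, ed q ≠ e := fun q h => hn.2 (Finset.mem_image.2 ⟨q, Finset.mem_univ _, h⟩)
      simp [z, hw' w1 a1, hw' w2 a2, hw' w3 a3, hw' w4 a4, he'] at he
    · funext q
      rw [hρ]
      simp only [z, Finsupp.add_apply, hw w1 a1, hw w2 a2, hw w3 a3, hw w4 a4,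
        Finsupp.single_apply, hinj.eq_iff, Prod.mk.injEq, zero_add]
      rw [Pi.single_apply]
      have h0 : ∀ k : Fin 2, (0 : Fin 3) ≠ k.succ := by decide
      simp [h0, Prod.ext_iff, eq_comm]
  have hspan : Submodule.span (ZMod 2) {x | x ∈ (C.filter fun b => m b ≠ 0).map ρ} = ⊤ := by
    rw [eq_top_iff]
    have h1 : ∀ z ∈ Zs (I ∪ Finset.univ.image ed),
        ρ z ∈ Submodule.span (ZMod 2) {x | x ∈ (C.filter fun b => m b ≠ 0).map ρ} := by
      intro z hz
      have h2 : Submodule.span (ZMod 2) {b | b ∈ C} ≤ Submodule.comap ρ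
          (Submodule.span (ZMod 2) {x | x ∈ (C.filter fun b => m b ≠ 0).map ρ}) := by
        rw [Submodule.span_le]
        intro b hb
        by_cases hm : m b = 0
        · have : ρ b = 0 := by
            funext q
            exact congrFun (congrFun hm q.1.succ) q.2.succ
          rw [SetLike.mem_coe, Submodule.mem_comap, this]
          exact Submodule.zero_mem _
        · exact Submodule.subset_span (Multiset.mem_map_of_mem _ (Multiset.mem_filter.2 ⟨hb, hm⟩))
      exact h2 (hC.span hz)
    intro x _
    rw [pi_eq_sum_univ' x]
    refine Submodule.sum_mem _ fun q _ => ?_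
    obtain ⟨z, hz, hz'⟩ := hsurj q
    have := Submodule.smul_mem _ (x q) (h1 z hz)
    rw [hz'] at this
    convert this using 2
  have hsum : ((C.filter fun b => m b ≠ 0).map ρ).sum = 0 := by
    have h1 : ((C.filter fun b => ¬ m b ≠ 0).map ρ).sum = 0 := by
      refine Multiset.sum_eq_zero fun x hx => ?_
      obtain ⟨b, hb, rfl⟩ := Multiset.mem_map.1 hx
      have hm : m b = 0 := by simpa using (Multiset.mem_filter.1 hb).2
      funext q
      exact congrFun (congrFun hm q.1.succ) q.2.succ
    have h2 : (C.map ρ).sum = 0 := by rw [Multiset.sum_hom, hC.sum, map_zero]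
    rw [← Multiset.filter_add_not (fun b => m b ≠ 0) C, Multiset.map_add, Multiset.sum_add, h1,
      add_zero] at h2
    exact h2
  have hcard' : ((C.filter fun b => m b ≠ 0).map ρ).card ≤ 4 := by rwa [Multiset.card_map]
  generalize (C.filter fun b => m b ≠ 0).map ρ = N at hspan hsum hcard'
  have hfin : Module.finrank (ZMod 2) (Fin 2 × Fin 2 → ZMod 2) = 4 := by simp
  have hle : ∀ M : Multiset (Fin 2 × Fin 2 → ZMod 2), M.card ≤ 3 →
      Submodule.span (ZMod 2) {x | x ∈ M} ≠ ⊤ := by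
    intro M hM h
    have h1 := finrank_span_finset_le_card (R := ZMod 2) M.toFinset
    have h2 : (M.toFinset : Set (Fin 2 × Fin 2 → ZMod 2)) = {x | x ∈ M} := by ext; simp
    rw [Set.finrank, h2, h, finrank_top, hfin] at h1
    have := Multiset.toFinset_card_le M
    omega
  rcases Multiset.empty_or_exists_mem N with rfl | ⟨x, hx⟩
  · exact hle 0 (by simp) hspan
  · obtain ⟨N', rfl⟩ := Multiset.exists_cons_of_mem hx
    refine hle N' (by rw [Multiset.card_cons] at hcard'; omega) ?_
    rw [eq_top_iff, ← hspan, Submodule.span_le]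
    intro y hy
    rcases Multiset.mem_cons.1 hy with rfl | hy
    · have : y = -N'.sum := by
        rw [Multiset.sum_cons] at hsum
        exact eq_neg_of_add_eq_zero_left hsum
      rw [this]
      exact Submodule.neg_mem _ (multiset_sum_mem _ fun z hz => Submodule.subset_span hz)
    · exact Submodule.subset_span hy

theorem TwoBasis.free {E : Finset (Sym2 ℕ)} {B : Multiset EV} (hB : TwoBasis E B) (S : Set ℕ) :
    Free (gr E) S := fun ⟨c, hc, _⟩ => hB.not_isModel c hc

/-! ### States and certificates -/

/-- The vertices covered by an edge set. -/
def vs (E : Finset (Sym2 ℕ)) : Set ℕ := {x | ∃ e ∈ E, x ∈ e}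

theorem vs_mono {E E' : Finset (Sym2 ℕ)} (h : E ⊆ E') : vs E ⊆ vs E' :=
  fun _ ⟨e, he, hx⟩ => ⟨e, h he, hx⟩

theorem vs_union (E E' : Finset (Sym2 ℕ)) : vs (E ∪ E') = vs E ∪ vs E' := by
  ext x
  simp only [vs, Finset.mem_union, Set.mem_ofPred_eq, Set.mem_union]
  constructor
  · rintro ⟨e, he | he, hx⟩
    exacts [.inl ⟨e, he, hx⟩, .inr ⟨e, he, hx⟩]
  · rintro (⟨e, he, hx⟩ | ⟨e, he, hx⟩)
    exacts [⟨e, .inl he, hx⟩, ⟨e, .inr he, hx⟩]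

theorem mem_vs_left {E : Finset (Sym2 ℕ)} {a b : ℕ} (h : s(a, b) ∈ E) : a ∈ vs E :=
  ⟨_, h, by simp⟩

theorem mem_vs_right {E : Finset (Sym2 ℕ)} {a b : ℕ} (h : s(a, b) ∈ E) : b ∈ vs E :=
  ⟨_, h, by simp⟩

theorem mem_vs_insert {E : Finset (Sym2 ℕ)} {a b x : ℕ} :
    x ∈ vs (insert s(a, b) E) ↔ x = a ∨ x = b ∨ x ∈ vs E := by
  simp [vs, or_assoc]

theorem vs_finite (E : Finset (Sym2 ℕ)) : (vs E).Finite := by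
  have : vs E = ⋃ e ∈ E, {x | x ∈ e} := by
    ext x; simp [vs]
  rw [this]
  refine Set.Finite.biUnion E.finite_toSet fun e _ => ?_
  induction e with
  | h a b => exact (Set.toFinite {a, b}).subset fun x hx => by simpa using hx

theorem exists_fresh (E : Finset (Sym2 ℕ)) : ∃ x, x ∉ vs E := (vs_finite E).exists_notMem

theorem gr_adj {E : Finset (Sym2 ℕ)} {a b : ℕ} : (gr E).Adj a b ↔ s(a, b) ∈ E ∧ a ≠ b := by
  simp [SimpleGraph.fromEdgeSet_adj]

theorem gr_mono {E E' : Finset (Sym2 ℕ)} (h : E ⊆ E') : gr E ≤ gr E' :=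
  SimpleGraph.fromEdgeSet_mono (by exact_mod_cast h)

theorem mem_pe_of_mem {l : List ℕ} {a b x : ℕ} (h : x ∈ a :: b :: l) :
    ∃ e ∈ pe (a :: b :: l), x ∈ e := by
  induction l generalizing a b with
  | nil => exact ⟨s(a, b), by simp, by simpa using h⟩
  | cons c l ih =>
    rcases List.mem_cons.1 h with rfl | h
    · exact ⟨s(x, b), by simp, by simp⟩
    · obtain ⟨e, he, hx⟩ := ih h
      exact ⟨e, by rw [pe_cons_cons]; exact List.mem_cons_of_mem _ he, hx⟩

theorem mem_cyc_of_mem {f : List ℕ} {x : ℕ} (h : x ∈ f) : ∃ e ∈ cyc f, x ∈ e := by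
  cases f with
  | nil => simp at h
  | cons a l =>
    rw [cyc_cons]
    have h' : x ∈ a :: l ++ [a] := List.mem_append_left _ h
    cases l with
    | nil => exact mem_pe_of_mem h'
    | cons b l => exact mem_pe_of_mem h'

/-- Pairs `(E, F)` of an edge set and a family of faces at which the graph may still grow:
plane graphs and small graphs, glued along edges. -/
inductive Cert : Finset (Sym2 ℕ) → Multiset (List ℕ) → Prop
  | plane {E F} : PlaneCert E F → Cert E F
  | small {E} (l : Finset ℕ) : l.card ≤ 5 → vs E ⊆ l → Cert E 0
  | sum {E₁ E₂ F₁ F₂ u v} : Cert E₁ F₁ → Cert E₂ F₂ → vs E₁ ∩ vs E₂ ⊆ {u, v} →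
      s(u, v) ∈ E₁ → s(u, v) ∈ E₂ → Cert (E₁ ∪ E₂) (F₁ + F₂)

theorem Cert.free {E : Finset (Sym2 ℕ)} {F : Multiset (List ℕ)} (h : Cert E F) :
    Free (gr E) Set.univ := by
  induction h with
  | plane h => exact h.twoBasis.free _
  | small l hl hE =>
    exact (Free.of_card l hl).of_support fun u v h => hE (mem_vs_left (gr_adj.1 h).1)
  | @sum E₁ E₂ F₁ F₂ u v _ _ hV h1 h2 ih1 ih2 =>
    have key : ∀ E E' : Finset (Sym2 ℕ), Free (gr E) Set.univ → vs E ∩ vs E' ⊆ {u, v} →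
        s(u, v) ∈ E → Free (gr (E ∪ E')) (vs E) := by
      intro E E' hE hV h1
      refine hE.anti (fun a ha b hb h => ?_) (Set.subset_univ _)
      rw [gr_adj] at *
      refine ⟨?_, h.2⟩
      rcases Finset.mem_union.1 h.1 with h' | h'
      · exact h'
      · have e1 := hV ⟨ha, mem_vs_left h'⟩
        have e2 := hV ⟨hb, mem_vs_right h'⟩
        simp only [Set.mem_insert_iff, Set.mem_singleton_iff] at e1 e2
        rcases e1 with rfl | rfl <;> rcases e2 with rfl | rfl
        · exact (h.2 rfl).elim
        · exact h1
        · rwa [Sym2.eq_swap]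
        · exact (h.2 rfl).elim
    refine Free.of_support (S := vs E₁ ∪ vs E₂) (Free.glue (s := u) (t := v) (key _ _ ih1 hV h1)
      ?_ ?_ hV (mem_vs_left h1) (mem_vs_right h1) (mem_vs_left h2) (mem_vs_right h2) ?_) ?_
    · rw [Finset.union_comm]
      exact key _ _ ih2 (by rwa [Set.inter_comm]) h2
    · intro x hx hx' y hy hy' h
      rcases Finset.mem_union.1 (gr_adj.1 h).1 with h | h
      · exact hy' (mem_vs_right h)
      · exact hx' (mem_vs_left h)
    · by_cases huv : u = v
      · exact .inl huv
      · exact .inr (gr_adj.2 ⟨Finset.mem_union_left _ h1, huv⟩)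
    · intro x y h
      rw [← vs_union]
      exact mem_vs_left (gr_adj.1 h).1

theorem Cert.face_edge {E : Finset (Sym2 ℕ)} {F : Multiset (List ℕ)} (h : Cert E F) {f : List ℕ}
    (hf : f ∈ F) {e : Sym2 ℕ} (he : e ∈ cyc f) : e ∈ E := by
  induction h with
  | plane h => exact h.mem_of_cyc hf he
  | small => simp at hf
  | sum _ _ _ _ _ ih1 ih2 =>
    rcases Multiset.mem_add.1 hf with hf | hf
    · exact Finset.mem_union_left _ (ih1 hf)
    · exact Finset.mem_union_right _ (ih2 hf)

theorem Cert.face_vs {E : Finset (Sym2 ℕ)} {F : Multiset (List ℕ)} (h : Cert E F) {f : List ℕ}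
    (hf : f ∈ F) {x : ℕ} (hx : x ∈ f) : x ∈ vs E := by
  obtain ⟨e, he, hx⟩ := mem_cyc_of_mem hx
  exact ⟨e, h.face_edge hf he, hx⟩

/-- A modification inside one face that is sound for plane certificates is sound for all. -/
theorem Cert.modify {f : List ℕ} {N : Multiset (List ℕ)} {D : Finset (Sym2 ℕ)}
    {side : Finset (Sym2 ℕ) → Prop} (hside : ∀ E E', E ⊆ E' → side E' → side E)
    (hplane : ∀ E F, PlaneCert E (f ::ₘ F) → side E → PlaneCert (E ∪ D) (N + F))
    {E : Finset (Sym2 ℕ)} {F : Multiset (List ℕ)} (h : Cert E (f ::ₘ F)) (hE : side E)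
    (hD : ∀ x ∈ vs D, x ∉ f → x ∉ vs E) : Cert (E ∪ D) (N + F) := by
  generalize hG : f ::ₘ F = G at h
  induction h generalizing F with
  | plane h => subst hG; exact .plane (hplane _ _ h hE)
  | small => simp at hG
  | @sum E₁ E₂ F₁ F₂ u v h1 h2 hV hu1 hu2 ih1 ih2 =>
    have key : ∀ E₁ E₂ F₁, Cert E₁ F₁ → vs E₁ ∩ vs E₂ ⊆ {u, v} → f ∈ F₁ →
        (∀ x ∈ vs D, x ∉ f → x ∉ vs (E₁ ∪ E₂)) → vs (E₁ ∪ D) ∩ vs E₂ ⊆ {u, v} := by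
      rintro E₁ E₂ F₁ h1 hV hf hD x ⟨hx, hx2⟩
      rw [vs_union] at hx
      rcases hx with hx | hx
      · exact hV ⟨hx, hx2⟩
      · by_cases hxf : x ∈ f
        · exact hV ⟨h1.face_vs hf hxf, hx2⟩
        · exact (hD x hx hxf (by rw [vs_union]; exact .inr hx2)).elim
    have hf : f ∈ F₁ + F₂ := by rw [← hG]; simp
    rcases Multiset.mem_add.1 hf with hf | hf
    · obtain ⟨F₁', rfl⟩ := Multiset.exists_cons_of_mem hf
      have hF : F = F₁' + F₂ := by
        rw [Multiset.cons_add] at hG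
        exact (Multiset.cons_inj_right _).1 hG
      have := Cert.sum (ih1 (hside _ _ Finset.subset_union_left hE)
        (fun x hx hxf hx' => hD x hx hxf (vs_mono Finset.subset_union_left hx')) rfl) h2
        (key _ _ _ h1 hV hf hD) (Finset.mem_union_left _ hu1) hu2
      rw [hF, ← add_assoc, Finset.union_right_comm]
      exact this
    · obtain ⟨F₂', rfl⟩ := Multiset.exists_cons_of_mem hf
      have hF : F = F₂' + F₁ := by
        rw [add_comm, Multiset.cons_add] at hG
        exact (Multiset.cons_inj_right _).1 hG
      have := Cert.sum (ih2 (hside _ _ Finset.subset_union_right hE)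
        (fun x hx hxf hx' => hD x hx hxf (vs_mono Finset.subset_union_right hx')) rfl) h1
        (u := u) (v := v) ?_ (Finset.mem_union_left _ hu2) hu1
      · rw [hF, ← add_assoc, Finset.union_comm E₁, Finset.union_right_comm]
        exact this
      · rintro x ⟨hx, hx2⟩
        rw [vs_union] at hx
        rcases hx with hx | hx
        · exact hV ⟨hx2, hx⟩
        · by_cases hxf : x ∈ f
          · exact hV ⟨hx2, h2.face_vs hf hxf⟩
          · exact (hD x hx hxf (by rw [vs_union]; exact .inl hx2)).elim

/-! ### Moves and morphisms of states -/

theorem Cert.pendant {E : Finset (Sym2 ℕ)} {F : Multiset (List ℕ)} {L0 L2 : List ℕ} {a x : ℕ}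
    (h : Cert E ((L0 ++ a :: L2) ::ₘ F)) (hx : x ∉ vs E) :
    Cert (insert s(a, x) E) ((L0 ++ a :: x :: a :: L2) ::ₘ F) := by
  have ha : a ∈ vs E := h.face_vs (Multiset.mem_cons_self _ _) (by simp)
  have := Cert.modify (D := {s(a, x)}) (N := {L0 ++ a :: x :: a :: L2})
    (side := fun E => x ∉ vs E ∧ True)
    (fun E E' hE h => ⟨fun h' => h.1 (vs_mono hE h'), trivial⟩) (fun E F hP hE => ?_) h
        ⟨hx, trivial⟩ ?_
  · rwa [Finset.union_comm, ← Finset.insert_eq, Multiset.singleton_add] at this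
  · have ha' : a ∈ vs E := (Cert.plane hP).face_vs (Multiset.mem_cons_self _ _) (by simp)
    rw [Finset.union_comm, Multiset.singleton_add]
    exact hP.pendant (fun e he hxe => hE.1 ⟨e, he, hxe⟩) fun h => hE.1 (h ▸ ha')
  · rintro y ⟨e, he, hy⟩ hyf
    obtain rfl := Finset.mem_singleton.1 he
    rcases Sym2.mem_iff.1 hy with rfl | rfl
    · simp at hyf
    · exact hx

theorem Cert.chord {E : Finset (Sym2 ℕ)} {F : Multiset (List ℕ)} {L0 L1 L2 : List ℕ} {a b : ℕ}
    (h : Cert E ((L0 ++ a :: L1 ++ b :: L2) ::ₘ F)) (hab : s(a, b) ∉ E) :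
    Cert (insert s(a, b) E) ((a :: L1 ++ [b]) ::ₘ (L0 ++ a :: b :: L2) ::ₘ F) := by
  have := Cert.modify (D := {s(a, b)}) (N := (a :: L1 ++ [b]) ::ₘ {L0 ++ a :: b :: L2})
    (side := fun E => s(a, b) ∉ E) (fun E E' hE h h' => h (hE h')) (fun E F hP hE => ?_) h hab ?_
  · rwa [Finset.union_comm, ← Finset.insert_eq, Multiset.cons_add, Multiset.singleton_add] at this
  · rw [Finset.union_comm, ← Finset.insert_eq, Multiset.cons_add, Multiset.singleton_add]
    exact hP.chord hE
  · rintro y ⟨e, he, hy⟩ hyf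
    obtain rfl := Finset.mem_singleton.1 he
    rcases Sym2.mem_iff.1 hy with rfl | rfl <;> simp at hyf

theorem Cert.page {E : Finset (Sym2 ℕ)} {F : Multiset (List ℕ)} {u v : ℕ}
    (h : Cert E F) (huv : s(u, v) ∈ E) (hne : u ≠ v) : Cert E ([u, v] ::ₘ F) := by
  have := h.sum (.plane (.edge hne)) (u := u) (v := v) ?_ huv (by simp)
  · rwa [Finset.union_eq_left.2 (by simpa), add_comm, Multiset.singleton_add] at this
  · rintro x ⟨-, e, he, hx⟩
    obtain rfl := Finset.mem_singleton.1 he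
    simpa using hx

/-- A state: an edge set together with a family of faces. -/
abbrev St := Finset (Sym2 ℕ) × Multiset (List ℕ)

/-- Elementary growth moves of states. -/
inductive Move : St → St → Prop
  | pendant {E F L0 L2 a x} : x ∉ vs E →
      Move (E, (L0 ++ a :: L2) ::ₘ F) (insert s(a, x) E, (L0 ++ a :: x :: a :: L2) ::ₘ F)
  | chord {E F L0 L1 L2 a b} : a ≠ b →
      Move (E, (L0 ++ a :: L1 ++ b :: L2) ::ₘ F)
        (insert s(a, b) E, (a :: L1 ++ [b]) ::ₘ (L0 ++ a :: b :: L2) ::ₘ F)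
  | page {E F u v} : s(u, v) ∈ E → u ≠ v → Move (E, F) (E, [u, v] ::ₘ F)
  | small {E F u v} (D : Finset (Sym2 ℕ)) (l : Finset ℕ) : s(u, v) ∈ E → u ≠ v → s(u, v) ∈ D →
      l.card ≤ 5 → vs D ⊆ l → vs D ∩ vs E ⊆ {u, v} → Move (E, F) (E ∪ D, F)

/-- A minor model of the graph on `A` in the graph on `X`. -/
structure Core (A X : Finset (Sym2 ℕ)) (c : ℕ → Option ℕ) : Prop where
  dom : ∀ v a, c v = some a → v ∈ vs X ∧ a ∈ vs A
  surj : ∀ a ∈ vs A, ∃ v, c v = some a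
  conn : ∀ a, ConnOn (gr X) {v | c v = some a}
  adj : ∀ a b, s(a, b) ∈ A → a ≠ b → ∃ v w, c v = some a ∧ c w = some b ∧ s(v, w) ∈ X

/-- Every face of `F` embeds, up to the colouring `c`, into its own face of `G`. -/
def FaceRel (F G : Multiset (List ℕ)) (c : ℕ → Option ℕ) : Prop :=
  ∃ G' ≤ G, Multiset.Rel (fun f g => (f.map some).Sublist (g.map c)) F G'

theorem Core.bind {A X Y : Finset (Sym2 ℕ)} {c κ : ℕ → Option ℕ} (h : Core A X c)
    (h' : Core X Y κ) : Core A Y fun v => (κ v).bind c where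
  dom v a hv := by
    obtain ⟨u, hu, hu'⟩ := Option.bind_eq_some_iff.1 hv
    exact ⟨(h'.dom v u hu).1, (h.dom u a hu').2⟩
  surj a ha := by
    obtain ⟨u, hu⟩ := h.surj a ha
    obtain ⟨v, hv⟩ := h'.surj u (h.dom u a hu).1
    exact ⟨v, by simp [hv, hu]⟩
  conn a := by
    refine ConnOn.bind (G := gr Y) (H := gr X) (c := κ) (d := c) h'.conn ?_ (h.conn a)
    intro u w huw
    obtain ⟨v, w', hv, hw, he⟩ := h'.adj u w (gr_adj.1 huw).1 (gr_adj.1 huw).2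
    refine ⟨v, w', gr_adj.2 ⟨he, ?_⟩, hv, hw⟩
    rintro rfl
    exact (gr_adj.1 huw).2 (Option.some_injective _ (hv.symm.trans hw))
  adj a b hab hne := by
    obtain ⟨u, w, hu, hw, he⟩ := h.adj a b hab hne
    obtain ⟨u', w', hu', hw', he'⟩ := h'.adj u w he (by
      rintro rfl; exact hne (Option.some_injective _ (hu.symm.trans hw)))
    exact ⟨u', w', by simp [hu', hu], by simp [hw', hw], he'⟩

theorem FaceRel.trans {F G H : Multiset (List ℕ)} {c κ : ℕ → Option ℕ} (h : FaceRel F G c)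
    (h' : FaceRel G H κ) : FaceRel F H fun v => (κ v).bind c := by
  obtain ⟨G', hG, h⟩ := h
  obtain ⟨H', hH, h'⟩ := h'
  obtain ⟨R, rfl⟩ := Multiset.le_iff_exists_add.1 hG
  obtain ⟨H1, H2, h1, h2, rfl⟩ := Multiset.rel_add_left.1 h'
  refine ⟨H1, (Multiset.le_add_right _ _).trans hH, ?_⟩
  clear h' hG hH h2
  induction h generalizing H1 with
  | zero => rw [Multiset.rel_zero_left.1 h1]; exact .zero
  | @cons f g F G hfg _ ih =>
    obtain ⟨g', G', hg, hG, rfl⟩ := Multiset.rel_cons_left.1 h1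
    refine .cons ?_ (ih _ hG)
    have := hg.map (·.bind c)
    simp only [List.map_map] at this
    exact hfg.trans this

theorem FaceRel.mono {F G H : Multiset (List ℕ)} {c c' : ℕ → Option ℕ} (h : FaceRel F G c)
    (hc : ∀ g ∈ G, ∀ v ∈ g, c' v = c v) (hG : G ≤ H) : FaceRel F H c' := by
  obtain ⟨G', hG', h⟩ := h
  refine ⟨G', hG'.trans hG, h.mono fun _ _ g hg h => ?_⟩
  rwa [List.map_congr_left (hc g (Multiset.mem_of_le hG' hg))]

theorem FaceRel.refl (F : Multiset (List ℕ)) : FaceRel F F some :=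
  ⟨F, le_rfl, Multiset.rel_refl_of_refl_on fun _ _ => .refl _⟩

theorem FaceRel.cons {F G : Multiset (List ℕ)} {f g : List ℕ} {c : ℕ → Option ℕ}
    (h : FaceRel F G c) (hf : (f.map some).Sublist (g.map c)) : FaceRel (f ::ₘ F) (g ::ₘ G) c := by
  obtain ⟨G', hG, h⟩ := h
  exact ⟨g ::ₘ G', Multiset.cons_le_cons _ hG, .cons hf h⟩

theorem FaceRel.of_cons {F G : Multiset (List ℕ)} {f : List ℕ} {c : ℕ → Option ℕ}
    (h : FaceRel (f ::ₘ F) G c) :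
    ∃ g G0, G = g ::ₘ G0 ∧ (f.map some).Sublist (g.map c) ∧ FaceRel F G0 c := by
  obtain ⟨G', hG, h⟩ := h
  obtain ⟨R, rfl⟩ := Multiset.le_iff_exists_add.1 hG
  obtain ⟨g, G0, hfg, h', rfl⟩ := Multiset.rel_cons_left.1 h
  exact ⟨g, G0 + R, by simp, hfg, G0, Multiset.le_add_right _ _, h'⟩

/-- `E'` retracts onto its subgraph `E` by contracting the fibres of `κ`. -/
structure Retr (E E' : Finset (Sym2 ℕ)) (κ : ℕ → Option ℕ) : Prop where
  sub : E ⊆ E'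
  core : Core E E' κ
  fix : ∀ v ∈ vs E, κ v = some v

theorem Core.mono {A X X' : Finset (Sym2 ℕ)} {c : ℕ → Option ℕ} (h : Core A X c) (hX : X ⊆ X') :
    Core A X' c where
  dom v a hv := ⟨vs_mono hX (h.dom v a hv).1, (h.dom v a hv).2⟩
  surj := h.surj
  conn a := (h.conn a).mono (gr_mono hX)
  adj a b hab hne := by
    obtain ⟨v, w, hv, hw, he⟩ := h.adj a b hab hne
    exact ⟨v, w, hv, hw, hX he⟩

theorem Core.extend {A X : Finset (Sym2 ℕ)} {c : ℕ → Option ℕ} (h : Core A X c) {b x : ℕ}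
    (hx : c x = none) (hb : s(b, x) ∈ X) (hne : b ≠ x) : Core A X (Function.update c x (c b)) where
  dom v a hv := by
    by_cases hvx : v = x
    · subst hvx
      rw [Function.update_self] at hv
      exact ⟨mem_vs_right hb, (h.dom b a hv).2⟩
    · rw [Function.update_of_ne hvx] at hv
      exact h.dom v a hv
  surj a ha := by
    obtain ⟨v, hv⟩ := h.surj a ha
    exact ⟨v, by rw [Function.update_of_ne (by rintro rfl; simp [hx] at hv)]; exact hv⟩
  conn a := by
    by_cases hba : c b = some a
    · have : {v | Function.update c x (c b) v = some a} = {v | c v = some a} ∪ {x} := by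
        ext v
        by_cases hvx : v = x
        · subst hvx; simp [hba]
        · simp [hvx]
      rw [this]
      exact (h.conn a).union (.singleton x) hba rfl (.inr (gr_adj.2 ⟨hb, hne⟩))
    · have : {v | Function.update c x (c b) v = some a} = {v | c v = some a} := by
        ext v
        by_cases hvx : v = x
        · subst hvx; simp [hba, hx]
        · simp [Function.update_of_ne hvx]
      rw [this]
      exact h.conn a
  adj p q hpq hne := by
    obtain ⟨v, w, hv, hw, he⟩ := h.adj p q hpq hne
    refine ⟨v, w, ?_, ?_, he⟩
    · rwa [Function.update_of_ne (by rintro rfl; simp [hx] at hv)]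
    · rwa [Function.update_of_ne (by rintro rfl; simp [hx] at hw)]

theorem Core.eq_none {A X : Finset (Sym2 ℕ)} {c : ℕ → Option ℕ} (h : Core A X c) {x : ℕ}
    (hx : x ∉ vs X) : c x = none := by
  cases hc : c x with
  | none => rfl
  | some a => exact (hx (h.dom x a hc).1).elim

open Classical in
theorem Retr.refl (E : Finset (Sym2 ℕ)) : Retr E E fun v => if v ∈ vs E then some v else none where
  sub := subset_rfl
  fix v hv := if_pos hv
  core :=
    { dom := fun v a hv => by
        split_ifs at hv with h
        obtain rfl := Option.some_injective _ hv
        exact ⟨h, h⟩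
      surj := fun a ha => ⟨a, if_pos ha⟩
      conn := fun a => by
        refine .of_root a fun b hb => ?_
        simp only [Set.mem_ofPred_eq] at hb
        split_ifs at hb
        obtain rfl := Option.some_injective _ hb
        exact .refl _
      adj := fun a b hab hne => ⟨a, b, if_pos (mem_vs_left hab), if_pos (mem_vs_right hab), hab⟩ }

theorem Retr.mono {E E1 E2 : Finset (Sym2 ℕ)} {κ : ℕ → Option ℕ} (h : Retr E E1 κ) (h' : E1 ⊆ E2) :
    Retr E E2 κ := ⟨h.sub.trans h', h.core.mono h', h.fix⟩

/-- The order on states: `Y` extends `X` so that every face of `X` stays available. -/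
def Ext (X Y : St) : Prop := ∃ κ, Retr X.1 Y.1 κ ∧ FaceRel X.2 Y.2 κ

theorem Ext.trans {X Y Z : St} (h : Ext X Y) (h' : Ext Y Z) : Ext X Z := by
  obtain ⟨κ, h, hf⟩ := h
  obtain ⟨κ', h', hf'⟩ := h'
  refine ⟨_, ⟨h.sub.trans h'.sub, h.core.bind h'.core, fun v hv => ?_⟩, hf.trans hf'⟩
  simp [h'.fix v (vs_mono h.sub hv), h.fix v hv]

theorem mem_vs_of_agree {E : Finset (Sym2 ℕ)} {F : Multiset (List ℕ)} {f g : List ℕ}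
    {κ κ' : ℕ → Option ℕ} (h : Cert E (f ::ₘ F)) (hκ : ∀ v ∈ vs E, κ' v = κ v)
    (hg : ∀ v ∈ g, v ∈ f) : g.map κ' = g.map κ :=
  List.map_congr_left fun v hv => hκ v (h.face_vs (Multiset.mem_cons_self _ _) (hg v hv))

theorem Retr.of_core {E E1 E2 : Finset (Sym2 ℕ)} {κ κ' : ℕ → Option ℕ} (h : Retr E E1 κ)
    (hE : E1 ⊆ E2) (h' : Core E E2 κ') (hκ : ∀ v ∈ vs E1, κ' v = κ v) : Retr E E2 κ' :=
  ⟨h.sub.trans hE, h', fun v hv => (hκ v (vs_mono h.sub hv)).trans (h.fix v hv)⟩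

/-- Adding a path of length three through a face. -/
theorem Cert.ear {E : Finset (Sym2 ℕ)} {F : Multiset (List ℕ)} {L0 L1 L2 : List ℕ} {a b : ℕ}
    (h : Cert E ((L0 ++ a :: L1 ++ b :: L2) ::ₘ F)) :
    ∃ E' x x', E ⊆ E' ∧ x ∉ vs E ∧ x' ∉ vs E ∧ s(x', b) ∈ E' ∧
      Cert E' ((x' :: x :: a :: L1 ++ [b]) ::ₘ (L0 ++ a :: x :: x' :: b :: L2) ::ₘ F) ∧
      (∀ A c, Core A E c → ∃ c', Core A E' c' ∧ (∀ v ∈ vs E, c' v = c v) ∧ c' x = c a ∧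
        c' x' = c a) ∧
      ∀ A c, Core A E c → ∃ c', Core A E' c' ∧ (∀ v ∈ vs E, c' v = c v) ∧ c' x = c b := by
  have ha : a ∈ vs E := h.face_vs (Multiset.mem_cons_self _ _) (by simp)
  have hb : b ∈ vs E := h.face_vs (Multiset.mem_cons_self _ _) (by simp)
  obtain ⟨x, hx⟩ := exists_fresh E
  rw [List.append_assoc, List.cons_append] at h
  have h1 := h.pendant hx
  obtain ⟨x', hx'⟩ := exists_fresh (insert s(a, x) E)
  have h2 : Cert (insert s(a, x) E) (((L0 ++ [a]) ++ x :: (a :: (L1 ++ b :: L2))) ::ₘ F) := by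
    simpa using h1
  have h2 := h2.pendant hx'
  have hx'1 : x' ≠ a := by rintro rfl; exact hx' (mem_vs_insert.2 (.inl rfl))
  have hx'2 : x' ≠ x := by rintro rfl; exact hx' (mem_vs_insert.2 (.inr (.inl rfl)))
  have hx'3 : x' ∉ vs E := fun h => hx' (mem_vs_insert.2 (.inr (.inr h)))
  have hxb : x ≠ b := by rintro rfl; exact hx hb
  have hx'b : x' ≠ b := by rintro rfl; exact hx'3 hb
  have hxa : x ≠ a := by rintro rfl; exact hx ha
  have h3 : Cert (insert s(x, x') (insert s(a, x) E))
      (((L0 ++ [a, x]) ++ x' :: (x :: a :: L1) ++ b :: L2) ::ₘ F) := by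
    simpa using h2
  have h3 := h3.chord (by
    rw [Finset.mem_insert, Finset.mem_insert]
    rintro (h | h | h)
    · rcases Sym2.eq_iff.1 h with h | h
      · exact hx'2 h.1
      · exact hxb h.2.symm
    · rcases Sym2.eq_iff.1 h with h | h
      · exact hx'1 h.1
      · exact hx'2 h.1
    · exact hx'3 (mem_vs_left h))
  refine ⟨_, x, x', ?_, hx, hx'3, Finset.mem_insert_self _ _, by simpa using h3, ?_, ?_⟩
  · exact ((Finset.subset_insert _ _).trans (Finset.subset_insert _ _)).trans
      (Finset.subset_insert _ _)
  · intro A c hc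
    have hc1 : Core A (insert s(x', b) (insert s(x, x') (insert s(a, x) E))) c := hc.mono
      (((Finset.subset_insert _ _).trans (Finset.subset_insert _ _)).trans
      (Finset.subset_insert _ _))
    have hc2 := hc1.extend (b := a) (x := x) (hc.eq_none hx) (by simp) hxa.symm
    have hc3 := hc2.extend (b := x) (x := x')
      (by rw [Function.update_of_ne hx'2]; exact hc.eq_none hx'3) (by simp) hx'2.symm
    refine ⟨_, hc3, fun v hv => ?_, ?_, ?_⟩
    · rw [Function.update_of_ne (by rintro rfl; exact hx'3 hv),
        Function.update_of_ne (by rintro rfl; exact hx hv)]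
    · rw [Function.update_of_ne hx'2.symm, Function.update_self]
    · rw [Function.update_self, Function.update_self]
  · intro A c hc
    have hc1 : Core A (insert s(x', b) (insert s(x, x') (insert s(a, x) E))) c := hc.mono
      (((Finset.subset_insert _ _).trans (Finset.subset_insert _ _)).trans
      (Finset.subset_insert _ _))
    have hc2 := hc1.extend (b := b) (x := x') (hc.eq_none hx'3) (by simp [Sym2.eq_swap]) hx'b.symm
    have hc3 := hc2.extend (b := x') (x := x)
      (by rw [Function.update_of_ne hx'2.symm]; exact hc.eq_none hx) (by simp [Sym2.eq_swap]) hx'2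
    refine ⟨_, hc3, fun v hv => ?_, ?_⟩
    · rw [Function.update_of_ne (by rintro rfl; exact hx hv),
        Function.update_of_ne (by rintro rfl; exact hx'3 hv)]
    · rw [Function.update_self, Function.update_self]

theorem Cert.row (bs : List ℕ) : ∀ {E : Finset (Sym2 ℕ)} {F : Multiset (List ℕ)}
    {P J R : List ℕ} {y b0 : ℕ}, Cert E ((P ++ bs ++ J ++ y :: R) ::ₘ F) → bs.head? = some b0 →
    ∃ E' N x0 xs, E ⊆ E' ∧ Cert E' ((P ++ b0 :: x0 :: xs ++ R) ::ₘ (N + F)) ∧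
      (∀ A c, Core A E c → ∃ c', Core A E' c' ∧ (∀ v ∈ vs E, c' v = c v) ∧ c' x0 = c y) ∧
      ∀ A c, Core A E c → ∃ c', Core A E' c' ∧ (∀ v ∈ vs E, c' v = c v) ∧
        (bs.map c ++ [c y]).Sublist ((x0 :: xs).map c') := by
  induction bs using List.reverseRecOn with
  | nil => simp
  | append_singleton bs b ih =>
    intro E F P J R y b0 h hb0
    have hy : y ∈ vs E := h.face_vs (Multiset.mem_cons_self _ _) (by simp)
    have h1 : Cert E (((P ++ bs) ++ b :: J ++ y :: R) ::ₘ F) := by simpa using h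
    obtain ⟨E1, x, x', hE, -, -, -, h2, hc1, hc2⟩ := h1.ear
    rw [Multiset.cons_swap] at h2
    cases bs with
    | nil =>
      obtain rfl : b = b0 := by simpa using hb0
      refine ⟨E1, {x' :: x :: b :: J ++ [y]}, x, [x', y], hE, by simpa using h2, hc2, ?_⟩
      intro A c hc
      obtain ⟨c', hc', h3, h4, h5⟩ := hc1 A c hc
      refine ⟨c', hc', h3, ?_⟩
      simp [h4, h5, h3 y hy]
    | cons b' bs =>
      have hb' : (b' :: bs).head? = some b0 := by simpa using hb0
      have h3 : Cert E1 ((P ++ (b' :: bs) ++ [b] ++ x :: (x' :: y :: R)) ::ₘ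
        (x' :: x :: b :: J ++ [y]) ::ₘ F) := by simpa using h2
      obtain ⟨E2, N, x0, xs, hE2, h4, hd1, hd2⟩ := ih h3 hb'
      refine ⟨E2, N + {x' :: x :: b :: J ++ [y]}, x0, xs ++ [x', y], hE.trans hE2, ?_, ?_, ?_⟩
      · rw [add_assoc, Multiset.singleton_add]
        simpa using h4
      · intro A c hc
        obtain ⟨c', hc', e1, e2⟩ := hc2 A c hc
        obtain ⟨c'', hc'', e3, e4⟩ := hd1 A c' hc'
        exact ⟨c'', hc'', fun v hv => (e3 v (vs_mono hE hv)).trans (e1 v hv), e4.trans e2⟩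
      · intro A c hc
        obtain ⟨c', hc', e1, e2, e2'⟩ := hc1 A c hc
        obtain ⟨c'', hc'', e3, e4⟩ := hd2 A c' hc'
        refine ⟨c'', hc'', fun v hv => (e3 v (vs_mono hE hv)).trans (e1 v hv), ?_⟩
        rw [mem_vs_of_agree h e1 (by intro v hv; simp at hv ⊢; tauto), e2] at e4
        rw [← List.cons_append, List.map_append, List.map_append]
        refine List.Sublist.append (by simpa using e4) ?_
        simp [e3 y (vs_mono hE hy), e1 y hy]

theorem Cert.cross (rest : List ℕ) : ∀ {E E1 : Finset (Sym2 ℕ)} {F : Multiset (List ℕ)}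
    {L A B : List ℕ} {c : ℕ} {κ0 κ1 : ℕ → Option ℕ}, Cert E1 ((A ++ c :: B ++ rest) ::ₘ F) →
    Retr E E1 κ0 → Retr E E1 κ1 → (L.map some).Sublist ((A ++ [c]).map κ0) →
    (L.map some).Sublist ((c :: B).map κ1) → (∀ r ∈ rest, r ∈ vs E) →
    ∃ E2 N A' c' B' κ0' κ1', Cert E2 ((A' ++ c' :: B') ::ₘ (N + F)) ∧ Retr E E2 κ0' ∧
      Retr E E2 κ1' ∧ ((L ++ rest).map some).Sublist ((A' ++ [c']).map κ0') ∧
      ((L ++ rest).map some).Sublist ((c' :: B').map κ1') := by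
  induction rest with
  | nil =>
    intro E E1 F L A B c κ0 κ1 h h0 h1 hL0 hL1 _
    exact ⟨E1, 0, A, c, B, κ0, κ1, by simpa using h, h0, h1, by simpa using hL0, by simpa using hL1⟩
  | cons y R ih =>
    intro E E1 F L A B c κ0 κ1 h h0 h1 hL0 hL1 hr
    have hy := hr y (by simp)
    have h' : Cert E1 ((A ++ (c :: B) ++ [] ++ y :: R) ::ₘ F) := by simpa using h
    obtain ⟨E2, N, x0, xs, hE, h2, hd0, hd1⟩ := h'.row (b0 := c) _ rfl
    obtain ⟨κ0', c0, e0, i0⟩ := hd0 _ _ h0.core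
    obtain ⟨κ1', c1, e1, i1⟩ := hd1 _ _ h1.core
    have s0 : ((L ++ [y]).map some).Sublist ((A ++ [c] ++ [x0]).map κ0') := by
      rw [List.map_append, List.map_append (l₁ := A ++ [c])]
      refine List.Sublist.append ?_ (by simp [i0, h0.fix y hy])
      rwa [mem_vs_of_agree h e0]
      intro v hv; simp at hv ⊢; tauto
    have s1 : ((L ++ [y]).map some).Sublist ((x0 :: xs).map κ1') := by
      refine List.Sublist.trans ?_ i1
      rw [List.map_append]
      exact hL1.append (by simp [h1.fix y hy])
    obtain ⟨E3, N', A', c', B', κ0'', κ1'', q1, q2, q3, q4, q5⟩ := ih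
      (by simpa using h2) (h0.of_core hE c0 e0) (h1.of_core hE c1 e1) s0 s1
      fun r hr' => hr r (by simp [hr'])
    exact ⟨E3, N' + N, A', c', B', κ0'', κ1'', by rwa [add_assoc], q2, q3, by simpa using q4,
      by simpa using q5⟩

/-- A face can be doubled, each copy being available after a suitable contraction. -/
theorem Cert.two_copies {E : Finset (Sym2 ℕ)} {F : Multiset (List ℕ)} {f : List ℕ}
    (h : Cert E (f ::ₘ F)) (hf : 2 ≤ f.length) :
    ∃ E' N g0 g1 κ0 κ1, Cert E' (g0 ::ₘ g1 ::ₘ (N + F)) ∧ Retr E E' κ0 ∧ Retr E E' κ1 ∧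
      (f.map some).Sublist (g0.map κ0) ∧ (f.map some).Sublist (g1.map κ1) := by
  cases f with
  | nil => simp at hf
  | cons y R =>
    have hv : ∀ v ∈ y :: R, v ∈ vs E := fun v hv => h.face_vs (Multiset.mem_cons_self _ _) hv
    have hr := Retr.refl E
    have hy := hr.fix y (hv y (by simp))
    obtain ⟨E1, N, A, c, B, κ0, κ1, h1, r0, r1, s0, s1⟩ := Cert.cross R (L := [y]) (A := [])
      (B := []) (c := y) (by simpa using h) hr hr (by simp [hy]) (by simp [hy])
      (fun r hr => hv r (by simp [hr]))
    cases A with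
    | nil =>
      have := s0.length_le
      simp only [List.length_map, List.length_append, List.length_cons, List.length_nil] at this hf
      omega
    | cons a A =>
      have h2 : Cert E1 (([] ++ a :: A ++ c :: B) ::ₘ (N + F)) := by simpa using h1
      obtain ⟨E2, x, x', hE, -, -, -, h3, hc, -⟩ := h2.ear
      obtain ⟨κ0', k0, e0, -⟩ := hc _ _ r0.core
      obtain ⟨κ1', k1, e1, -⟩ := hc _ _ r1.core
      refine ⟨E2, N, _, _, κ0', κ1', h3, r0.of_core hE k0 e0, r1.of_core hE k1 e1, ?_, ?_⟩
      · rw [← mem_vs_of_agree h1 e0 (by intro v hv; simp at hv ⊢; tauto)] at s0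
        refine s0.trans (List.Sublist.map _ ?_)
        exact (List.sublist_cons_self _ _).trans (List.sublist_cons_self _ _)
      · rw [← mem_vs_of_agree h1 e1 (by intro v hv; simp at hv ⊢; tauto)] at s1
        refine s1.trans (List.Sublist.map _ ?_)
        simp only [List.nil_append]
        exact ((List.sublist_cons_self _ _).trans (List.sublist_cons_self _ _)).trans
          (List.sublist_cons_self _ _)

/-- A morphism of states: a minor model together with a matching of faces. -/
structure Morph (A X : St) (c : ℕ → Option ℕ) : Prop where
  core : Core A.1 X.1 c
  face : FaceRel A.2 X.2 c

theorem Core.chord {A X : Finset (Sym2 ℕ)} {c : ℕ → Option ℕ} (h : Core A X c) {a b p q : ℕ}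
    (hp : c p = some a) (hq : c q = some b) (he : s(p, q) ∈ X) : Core (insert s(a, b) A) X c where
  dom v d hv := ⟨(h.dom v d hv).1, vs_mono (Finset.subset_insert _ _) (h.dom v d hv).2⟩
  surj d hd := by
    rcases mem_vs_insert.1 hd with rfl | rfl | hd
    exacts [⟨p, hp⟩, ⟨q, hq⟩, h.surj d hd]
  conn := h.conn
  adj d e hde hne := by
    rcases Finset.mem_insert.1 hde with h' | h'
    · rcases Sym2.eq_iff.1 h' with ⟨rfl, rfl⟩ | ⟨rfl, rfl⟩
      · exact ⟨p, q, hp, hq, he⟩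
      · exact ⟨q, p, hq, hp, by rwa [Sym2.eq_swap]⟩
    · exact h.adj d e h' hne

theorem Core.pendant {A X X' : Finset (Sym2 ℕ)} {c : ℕ → Option ℕ} (h : Core A X c) (hX : X ⊆ X')
    {a x p y : ℕ} (hp : c p = some a) (hx : x ∉ vs A) (hy : y ∉ vs X) (he : s(p, y) ∈ X') :
    Core (insert s(a, x) A) X' (Function.update c y (some x)) := by
  have hcy := h.eq_none hy
  have hpy : p ≠ y := by rintro rfl; simp [hcy] at hp
  have up : ∀ v d, c v = some d → Function.update c y (some x) v = some d := fun v d hv => by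
    rwa [Function.update_of_ne (by rintro rfl; simp [hcy] at hv)]
  refine ⟨fun v d hv => ?_, fun d hd => ?_, fun d => ?_, fun d e hde hne => ?_⟩
  · by_cases hvy : v = y
    · subst hvy
      rw [Function.update_self] at hv
      obtain rfl := Option.some_injective _ hv
      exact ⟨mem_vs_right he, mem_vs_right (Finset.mem_insert_self _ _)⟩
    · rw [Function.update_of_ne hvy] at hv
      exact ⟨vs_mono hX (h.dom v d hv).1, vs_mono (Finset.subset_insert _ _) (h.dom v d hv).2⟩
  · rcases mem_vs_insert.1 hd with rfl | rfl | hd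
    · exact ⟨p, up _ _ hp⟩
    · exact ⟨y, Function.update_self ..⟩
    · obtain ⟨v, hv⟩ := h.surj d hd
      exact ⟨v, up _ _ hv⟩
  · by_cases hdx : d = x
    · subst hdx
      convert ConnOn.singleton (G := gr X') y using 1
      ext v
      by_cases hvy : v = y
      · subst hvy; simp
      · simp only [Set.mem_ofPred_eq, Function.update_of_ne hvy, Set.mem_singleton_iff, hvy,
          iff_false]
        exact fun hv => hx (h.dom v d hv).2
    · convert (h.conn d).mono (gr_mono hX) using 1
      ext v
      by_cases hvy : v = y
      · subst hvy; simp [hcy, Ne.symm hdx]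
      · simp [Function.update_of_ne hvy]
  · rcases Finset.mem_insert.1 hde with h' | h'
    · rcases Sym2.eq_iff.1 h' with ⟨rfl, rfl⟩ | ⟨rfl, rfl⟩
      · exact ⟨p, y, up _ _ hp, Function.update_self .., he⟩
      · exact ⟨y, p, Function.update_self .., up _ _ hp, by rwa [Sym2.eq_swap]⟩
    · obtain ⟨v, w, hv, hw, hvw⟩ := h.adj d e h' hne
      exact ⟨v, w, up _ _ hv, up _ _ hw, hX hvw⟩

theorem Core.attach {A X D : Finset (Sym2 ℕ)} {c : ℕ → Option ℕ} (h : Core A X c) {u v u' v' : ℕ}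
    (hu : c u' = some u) (hv : c v' = some v) (hD : vs D ∩ vs A ⊆ {u, v})
    {φ : ℕ → ℕ} (hφ : Function.Injective φ) (hφu : φ u = u') (hφv : φ v = v')
    (hφw : ∀ w, w ≠ u → w ≠ v → φ w ∉ vs X) :
    ∃ c', Core (A ∪ D) (X ∪ D.image (Sym2.map φ)) c' ∧ ∀ w ∈ vs X, c' w = c w := by
  classical
  have himg : ∀ a b, s(a, b) ∈ D → s(φ a, φ b) ∈ X ∪ D.image (Sym2.map φ) := fun a b hab =>
    Finset.mem_union_right _ (Finset.mem_image.2 ⟨_, hab, rfl⟩)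
  have hvimg : ∀ a ∈ vs D, φ a ∈ vs (X ∪ D.image (Sym2.map φ)) := by
    rintro a ⟨e, he, ha⟩
    exact ⟨Sym2.map φ e, Finset.mem_union_right _ (Finset.mem_image_of_mem _ he),
      Sym2.mem_map.2 ⟨a, ha, rfl⟩⟩
  let c' : ℕ → Option ℕ := fun y => if y ∈ vs X then c y else
    if ∃ w ∈ vs D, φ w = y then some (Function.invFun φ y) else none
  have hφi : ∀ w, Function.invFun φ (φ w) = w := Function.leftInverse_invFun hφ
  have c1 : ∀ y ∈ vs X, c' y = c y := fun y hy => if_pos hy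
  have c2 : ∀ y d, c y = some d → c' y = some d := fun y d hd => (c1 y (h.dom y d hd).1).trans hd
  have c3 : ∀ w ∈ vs D, c' (φ w) = some w := by
    intro w hw
    by_cases hwu : w = u
    · subst hwu; rw [hφu]; exact c2 _ _ hu
    by_cases hwv : w = v
    · subst hwv; rw [hφv]; exact c2 _ _ hv
    show ite _ _ _ = _
    rw [if_neg (hφw w hwu hwv), if_pos ⟨w, hw, rfl⟩, hφi]
  have c4 : ∀ y d, c' y = some d → c y = some d ∨ y ∉ vs X ∧ d ∈ vs D ∧ y = φ d := by
    intro y d hy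
    by_cases hyX : y ∈ vs X
    · exact .inl ((c1 y hyX).symm.trans hy)
    · change ite _ _ _ = _ at hy
      rw [if_neg hyX] at hy
      split_ifs at hy with hex
      obtain ⟨w, hw, rfl⟩ := hex
      rw [hφi] at hy
      obtain rfl := Option.some_injective _ hy
      exact .inr ⟨hyX, hw, rfl⟩
  refine ⟨c', ⟨fun y d hy => ?_, fun d hd => ?_, fun d => ?_, fun a b hab hne => ?_⟩, c1⟩
  · rcases c4 y d hy with hy | ⟨-, hd, rfl⟩
    · exact ⟨vs_mono Finset.subset_union_left (h.dom y d hy).1,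
        vs_mono Finset.subset_union_left (h.dom y d hy).2⟩
    · exact ⟨hvimg d hd, vs_mono Finset.subset_union_right hd⟩
  · rw [vs_union] at hd
    rcases hd with hd | hd
    · obtain ⟨y, hy⟩ := h.surj d hd
      exact ⟨y, c2 y d hy⟩
    · exact ⟨φ d, c3 d hd⟩
  · by_cases hd : d ∈ vs A
    · convert (h.conn d).mono (gr_mono Finset.subset_union_left) using 1
      ext y
      refine ⟨fun hy => (c4 y d hy).resolve_right ?_, c2 y d⟩
      rintro ⟨hyX, hdD, rfl⟩
      rcases hD ⟨hdD, hd⟩ with rfl | hdv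
      · exact hyX (hφu ▸ (h.dom _ _ hu).1)
      · obtain rfl : d = v := hdv
        exact hyX (hφv ▸ (h.dom _ _ hv).1)
    · intro y hy y' hy'
      rcases c4 y d hy with hy | ⟨-, -, rfl⟩
      · exact (hd (h.dom y d hy).2).elim
      rcases c4 y' d hy' with hy' | ⟨-, -, rfl⟩
      · exact (hd (h.dom y' d hy').2).elim
      exact .refl _
  · rcases Finset.mem_union.1 hab with hab | hab
    · obtain ⟨p, q, hp, hq, hpq⟩ := h.adj a b hab hne
      exact ⟨p, q, c2 _ _ hp, c2 _ _ hq, Finset.mem_union_left _ hpq⟩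
    · exact ⟨φ a, φ b, c3 a (mem_vs_left hab), c3 b (mem_vs_right hab), himg a b hab⟩

theorem exists_relabel (X : Finset (Sym2 ℕ)) {u v u' v' : ℕ} (huv : u ≠ v) (hu'v' : u' ≠ v') :
    ∃ φ : ℕ → ℕ, Function.Injective φ ∧ φ u = u' ∧ φ v = v' ∧
      ∀ w, w ≠ u → w ≠ v → φ w ∉ vs X := by
  obtain ⟨M, hM⟩ := ((vs_finite X).union (Set.toFinite {u', v'})).bddAbove
  have hu' : u' ≤ M := hM (by simp)
  have hv' : v' ≤ M := hM (by simp)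
  refine ⟨fun w => if w = u then u' else if w = v then v' else M + 1 + w, ?_, by simp,
    by simp [huv.symm], fun w h1 h2 h => ?_⟩
  · intro a b hab
    dsimp only at hab
    split_ifs at hab <;> grind
  · simp only [if_neg h1, if_neg h2] at h
    have := hM (Or.inl h)
    omega

theorem sublist_split {L0 L2 : List ℕ} {a : ℕ} {g : List ℕ} {c : ℕ → Option ℕ}
    (h : ((L0 ++ a :: L2).map some).Sublist (g.map c)) :
    ∃ M0 p M2, g = M0 ++ p :: M2 ∧ c p = some a ∧ (L0.map some).Sublist (M0.map c) ∧
      (L2.map some).Sublist (M2.map c) := by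
  rw [List.map_append, List.map_cons, List.append_sublist_iff] at h
  obtain ⟨r1, r2, hg, h1, h2⟩ := h
  obtain ⟨g1, g2, rfl, rfl, rfl⟩ := List.map_eq_append_iff.1 hg
  rw [List.cons_sublist_iff] at h2
  obtain ⟨s1, s2, hg2, ha, h2⟩ := h2
  obtain ⟨k1, k2, rfl, rfl, rfl⟩ := List.map_eq_append_iff.1 hg2
  obtain ⟨p, hp, hpa⟩ := List.mem_map.1 ha
  obtain ⟨m1, m2, rfl⟩ := List.append_of_mem hp
  refine ⟨g1 ++ m1, p, m2 ++ k2, by simp, hpa, ?_, ?_⟩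
  · rw [List.map_append]
    exact h1.trans (List.sublist_append_left _ _)
  · rw [List.map_append]
    exact h2.trans (List.sublist_append_right _ _)

open Classical in
theorem FaceRel.refl_ite {X : St} (h : Cert X.1 X.2) {F : Multiset (List ℕ)} (hF : F ≤ X.2) :
    FaceRel F F fun v => if v ∈ vs X.1 then some v else none :=
  (FaceRel.refl F).mono
    (fun _ hg _ hv => if_pos (h.face_vs (Multiset.mem_of_le hF hg) hv)) le_rfl

/-- Every move of a state can be mirrored in any certified state modelling it. -/
theorem Move.lift {A A' Y : St} {c : ℕ → Option ℕ} (hm : Move A A') (hY : Cert Y.1 Y.2)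
    (h : Morph A Y c) :
    ∃ Y' c', Cert Y'.1 Y'.2 ∧ Ext Y Y' ∧ Morph A' Y' c' ∧ ∀ v ∈ vs Y.1, c' v = c v := by
  classical
  obtain ⟨X, G⟩ := Y
  obtain ⟨hc, hf⟩ := h
  cases hm with
  | @pendant E F L0 L2 a x hx =>
    obtain ⟨g, G0, hG, hg, hF⟩ := hf.of_cons
    simp only at hG hY hc hx
    subst hG
    obtain ⟨M0, p, M2, rfl, hp, h0, h2⟩ := sublist_split hg
    obtain ⟨y, hy⟩ := exists_fresh X
    have hc' := hc.pendant (Finset.subset_insert s(p, y) X) hp hx hy (Finset.mem_insert_self _ _)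
    have agree : ∀ v ∈ vs X, Function.update c y (some x) v = c v := fun v hv => by
      rw [Function.update_of_ne (by rintro rfl; exact hy hv)]
    have agree' : ∀ g : List ℕ, (∀ v ∈ g, v ∈ M0 ++ p :: M2) →
      g.map (Function.update c y (some x)) = g.map c := fun g => mem_vs_of_agree hY agree
    refine ⟨(insert s(p, y) X, (M0 ++ p :: y :: p :: M2) ::ₘ G0), _, hY.pendant hy,
      ⟨_, (Retr.refl X).mono (Finset.subset_insert _ _), ?_⟩, ⟨hc', ?_⟩, agree⟩
    · refine (FaceRel.refl_ite (X := (X, (M0 ++ p :: M2) ::ₘ G0)) hY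
        (Multiset.le_cons_self _ _)).cons ?_
      have h3 : (M0 ++ p :: M2).map some =
          (M0 ++ p :: M2).map (fun v => if v ∈ vs X then some v else none) :=
        List.map_congr_left fun v hv => (if_pos (hY.face_vs (Multiset.mem_cons_self _ _) hv)).symm
      rw [h3]
      refine List.Sublist.map _ ((List.Sublist.refl _).append ?_)
      exact ((List.sublist_cons_self _ _).trans (List.sublist_cons_self _ _)).cons_cons _ |>.trans
        (by exact .refl _)
    · refine (hF.mono (fun g hg v hv => agree v (hY.face_vs (Multiset.mem_cons_of_mem hg) hv))
        le_rfl).cons ?_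
      simp only [List.map_append, List.map_cons]
      rw [agree' M0 (by simp +contextual), agree' M2 (by simp +contextual),
        agree p (hc.dom _ _ hp).1, hp, Function.update_self]
      exact h0.append (((h2.cons_cons _).cons_cons _).cons_cons _)
  | @chord E F L0 L1 L2 a b hab =>
    obtain ⟨g, G0, hG, hg, hF⟩ := hf.of_cons
    simp only at hG hY hc
    subst hG
    have hlen : 2 ≤ g.length := by
      have := hg.length_le
      simp at this; omega
    obtain ⟨E1, N, g0, g1, κ0, κ1, h1, r0, r1, s0, s1⟩ := hY.two_copies hlen
    have hc1 := hc.bind r1.core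
    have s1' := hg.trans (by
      have := s1.map (·.bind c)
      simpa [List.map_map, Function.comp_def] using this : (g.map c).Sublist
        (g1.map fun v => (κ1 v).bind c))
    rw [List.append_assoc, List.cons_append] at s1'
    obtain ⟨M0, p, M', rfl, hp, t0, t'⟩ := sublist_split s1'
    obtain ⟨M1, q, M2, rfl, hq, t1, t2⟩ := sublist_split t'
    rw [Multiset.cons_swap] at h1
    have h1' : Cert E1 ((M0 ++ p :: M1 ++ q :: M2) ::ₘ g0 ::ₘ (N + G0)) := by simpa using h1
    obtain ⟨E2, x, x', hE, hx, hx', hx'q, h2, hd, -⟩ := h1'.ear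
    obtain ⟨c', hc', ag, e1, e2⟩ := hd _ _ hc1
    obtain ⟨κ0', hκ, agκ, -⟩ := hd _ _ r0.core
    have agree' : ∀ g : List ℕ, (∀ v ∈ g, v ∈ M0 ++ p :: M1 ++ q :: M2) →
      g.map c' = g.map fun v => (κ1 v).bind c := fun g => mem_vs_of_agree h1' ag
    have hp' := (ag p (hc1.dom _ _ hp).1).trans hp
    have hq' := (ag q (hc1.dom _ _ hq).1).trans hq
    have agc : ∀ v ∈ vs X, c' v = c v := fun v hv => by
      rw [ag v (vs_mono r1.sub hv), r1.fix v hv]; rfl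
    refine ⟨(E2, _), c', h2, ⟨κ0', r0.of_core hE hκ agκ, ?_⟩,
      ⟨hc'.chord (e2.trans hp) hq' hx'q, ?_⟩, agc⟩
    · have : FaceRel (g ::ₘ G0) (g0 ::ₘ (N + G0)) κ0' := by
        refine FaceRel.cons ((FaceRel.refl G0).mono (fun g hg v hv => ?_)
          (Multiset.le_add_left _ _)) ?_
        · have hv := hY.face_vs (Multiset.mem_cons_of_mem hg) hv
          rw [agκ v (vs_mono r0.sub hv), r0.fix v hv]
        · rw [List.map_congr_left fun v hv => agκ v (h1'.face_vs (by simp) hv)]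
          exact s0
      refine this.mono (fun _ _ _ _ => rfl) ?_
      exact (Multiset.le_cons_self _ _).trans (Multiset.le_cons_self _ _)
    · have hF' : FaceRel F (g0 ::ₘ (N + G0)) c' := hF.mono
        (fun g hg v hv => agc v (hY.face_vs (Multiset.mem_cons_of_mem hg) hv))
        ((Multiset.le_add_left _ _).trans (Multiset.le_cons_self _ _))
      refine (hF'.cons ?_).cons ?_
      · simp only [List.map_append, List.map_cons]
        rw [agree' M0 (by simp +contextual), agree' M2 (by simp +contextual), hp', hq']
        refine t0.append (.cons_cons _ ?_)
        exact ((t2.cons_cons _).cons _).cons _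
      · simp only [List.map_append, List.map_cons, List.cons_append, List.map_nil]
        rw [agree' M1 (by simp +contextual), hp', hq', e2, hp]
        refine .cons_cons _ (.cons _ (.cons _ ?_))
        exact t1.append (.refl _)
  | @page E F u v huv hne =>
    obtain ⟨p, q, hp, hq, hpq⟩ := hc.adj u v huv hne
    have hne' : p ≠ q := by rintro rfl; exact hne (Option.some_injective _ (hp.symm.trans hq))
    refine ⟨(X, [p, q] ::ₘ G), c, hY.page hpq hne', ⟨_, Retr.refl X, ?_⟩, ⟨hc, ?_⟩,
      fun _ _ => rfl⟩
    · exact (FaceRel.refl_ite hY le_rfl).mono (fun _ _ _ _ => rfl) (Multiset.le_cons_self _ _)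
    · exact FaceRel.cons hf (by simp [hp, hq])
  | @small E F u v D l huv hne huvD hl hDl hDE =>
    obtain ⟨p, q, hp, hq, hpq⟩ := hc.adj u v huv hne
    have hne' : p ≠ q := by rintro rfl; exact hne (Option.some_injective _ (hp.symm.trans hq))
    obtain ⟨φ, hφ, hφu, hφv, hφw⟩ := exists_relabel X hne hne'
    obtain ⟨c', hc', ag⟩ := hc.attach hp hq hDE hφ hφu hφv hφw
    have hcert : Cert (X ∪ D.image (Sym2.map φ)) (G + 0) := by
      refine hY.sum (.small (l.image φ) (Finset.card_image_le.trans hl) ?_) (u := p) (v := q) ?_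
        hpq (Finset.mem_image.2 ⟨_, huvD, by simp [hφu, hφv]⟩)
      · rintro y ⟨e, he, hy⟩
        obtain ⟨e', he', rfl⟩ := Finset.mem_image.1 he
        obtain ⟨w, hw, rfl⟩ := Sym2.mem_map.1 hy
        exact_mod_cast Finset.mem_image_of_mem _ (hDl ⟨e', he', hw⟩)
      · rintro y ⟨hyX, e, he, hy⟩
        obtain ⟨e', he', rfl⟩ := Finset.mem_image.1 he
        obtain ⟨w, hw, rfl⟩ := Sym2.mem_map.1 hy
        by_cases hwu : w = u
        · subst hwu; simp [hφu]
        by_cases hwv : w = v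
        · subst hwv; simp [hφv]
        exact (hφw w hwu hwv hyX).elim
    rw [add_zero] at hcert
    refine ⟨(_, G), c', hcert, ⟨_, (Retr.refl X).mono Finset.subset_union_left,
      FaceRel.refl_ite hY le_rfl⟩, ⟨hc', ?_⟩, ag⟩
    exact hf.mono (fun g hg v hv => ag v (hY.face_vs hg hv)) le_rfl

/-! ### The generic certified graph -/

/-- Certified states. -/
def CS := {X : St // Cert X.1 X.2}

theorem Ext.refl {X : St} (h : Cert X.1 X.2) : Ext X X :=
  ⟨_, Retr.refl _, FaceRel.refl_ite h le_rfl⟩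

instance : Preorder CS where
  le X Y := Ext X.1 Y.1
  le_refl X := Ext.refl X.2
  le_trans _ _ _ h h' := h.trans h'

/-- Decode a finitely supported function as a finite partial function. -/
def decode (f : ℕ →₀ ℕ) (v : ℕ) : Option ℕ := if f v = 0 then none else some (f v - 1)

theorem exists_decode {A X : Finset (Sym2 ℕ)} {c : ℕ → Option ℕ} (h : Core A X c) :
    ∃ f, decode f = c := by
  refine ⟨Finsupp.onFinset (vs_finite X).toFinset (fun v => (c v).elim 0 (· + 1)) ?_, ?_⟩
  · intro v hv
    cases hc : c v with
    | none => simp [hc] at hv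
    | some a => exact (vs_finite X).mem_toFinset.2 (h.dom v a hc).1
  · funext v
    cases hc : c v <;> simp [decode, hc]

instance : Countable St := by
  have : Countable (Sym2 ℕ) := inferInstanceAs (Countable (Quot _))
  have : Countable (Multiset (List ℕ)) := inferInstanceAs (Countable (Quot _))
  infer_instance

noncomputable instance : Encodable (St × St × St × (ℕ →₀ ℕ)) := Encodable.ofCountable _

/-- The dense set of certified states realizing a given request. -/
def requestSet (r : ℕ × St × St × St × (ℕ →₀ ℕ)) : Order.Cofinal CS where
  carrier := {Y | Ext r.2.2.2.1 Y.1 → Move r.2.1 r.2.2.1 →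
    Morph r.2.1 r.2.2.2.1 (decode r.2.2.2.2) →
    ∃ c', Morph r.2.2.1 Y.1 c' ∧ ∀ v ∈ vs r.2.2.2.1.1, c' v = decode r.2.2.2.2 v}
  isCofinal Y := by
    obtain ⟨-, A, A', X, f⟩ := r
    by_cases h : Ext X Y.1 ∧ Move A A' ∧ Morph A X (decode f)
    · obtain ⟨⟨κ, hκ, hF⟩, hm, hc⟩ := h
      obtain ⟨Y', c', hY', hext, hc', ag⟩ := hm.lift Y.2 ⟨hc.core.bind hκ.core, hc.face.trans hF⟩
      refine ⟨⟨Y', hY'⟩, fun _ _ _ => ⟨c', hc', fun v hv => ?_⟩, hext⟩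
      rw [ag v (vs_mono hκ.sub hv), hκ.fix v hv]
      rfl
    · exact ⟨Y, fun h1 h2 h3 => (h ⟨h1, h2, h3⟩).elim, le_refl Y⟩

/-- The initial certified state. -/
def startCS : CS := ⟨({s(0, 1)}, {[0, 1]}), .plane (.edge zero_ne_one)⟩

/-- A generic increasing sequence of certified states. -/
noncomputable def gen (n : ℕ) : CS := Order.sequenceOfCofinals startCS requestSet n

theorem gen_mono : Monotone gen := Order.sequenceOfCofinals.monotone _ _

theorem gen_vs {m n : ℕ} (h : m ≤ n) : (gen m).1.1 ⊆ (gen n).1.1 := by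
  obtain ⟨κ, hκ, -⟩ : Ext (gen m).1 (gen n).1 := gen_mono h
  exact hκ.sub

theorem gen_move {A A' : St} {n : ℕ} {c : ℕ → Option ℕ} (hm : Move A A')
    (hc : Morph A (gen n).1 c) :
    ∃ m c', n ≤ m ∧ Morph A' (gen m).1 c' ∧ ∀ v ∈ vs (gen n).1.1, c' v = c v := by
  obtain ⟨f, rfl⟩ := exists_decode hc.core
  have h := Order.sequenceOfCofinals.encode_mem startCS requestSet (n, A, A', (gen n).1, f)
  have hle : n ≤ Encodable.encode (n, A, A', (gen n).1, f) + 1 := by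
    rw [Encodable.encode_prod_val]
    exact (Nat.left_le_pair _ _).trans (Nat.le_succ _)
  obtain ⟨c', h1, h2⟩ := h (gen_mono hle) hm hc
  exact ⟨_, c', hle, h1, h2⟩

theorem gen_moves {A A' : St} {n : ℕ} {c : ℕ → Option ℕ} (hm : ReflTransGen Move A A')
    (hc : Morph A (gen n).1 c) :
    ∃ m c', n ≤ m ∧ Morph A' (gen m).1 c' ∧ ∀ v ∈ vs (gen n).1.1, c' v = c v := by
  induction hm with
  | refl => exact ⟨n, c, le_rfl, hc, fun _ _ => rfl⟩
  | tail _ h ih =>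
    obtain ⟨m, c', hnm, hc', ag⟩ := ih
    obtain ⟨k, c'', hmk, hc'', ag'⟩ := gen_move h hc'
    exact ⟨k, c'', hnm.trans hmk, hc'',
      fun v hv => (ag' v (vs_mono (gen_vs hnm) hv)).trans (ag v hv)⟩

theorem exists_start_morph {a b : ℕ} (hab : a ≠ b) :
    ∃ c, Morph ({s(a, b)}, {[a, b]}) (gen 0).1 c := by
  refine ⟨fun v => if v = 0 then some a else if v = 1 then some b else none,
    ⟨?_, fun d hd => ?_, fun d => ?_, fun d e hde hne => ?_⟩, ?_⟩
  · intro v d hv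
    split_ifs at hv with h0 h1
    · obtain rfl := Option.some_injective _ hv
      subst h0
      exact ⟨mem_vs_left (b := 1) (by simp [gen, Order.sequenceOfCofinals, startCS]),
        mem_vs_left (b := b) (by simp)⟩
    · obtain rfl := Option.some_injective _ hv
      subst h1
      exact ⟨mem_vs_right (a := 0) (by simp [gen, Order.sequenceOfCofinals, startCS]),
        mem_vs_right (a := a) (by simp)⟩
  · obtain ⟨e, he, hd⟩ := hd
    obtain rfl := Finset.mem_singleton.1 he
    rcases Sym2.mem_iff.1 hd with rfl | rfl
    exacts [⟨0, by simp⟩, ⟨1, by simp⟩]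
  · have : Set.Subsingleton {v : ℕ | (if v = 0 then some a else if v = 1 then some b else none) =
        some d} := by
      intro v hv w hw
      simp only [Set.mem_ofPred_eq] at hv hw
      grind
    intro v hv w hw
    rw [this hv hw]
    exact .refl _
  · have hE : s(0, 1) ∈ (gen 0).1.1 := by simp [gen, Order.sequenceOfCofinals, startCS]
    rcases Sym2.eq_iff.1 (Finset.mem_singleton.1 hde) with ⟨rfl, rfl⟩ | ⟨rfl, rfl⟩
    · exact ⟨0, 1, by simp, by simp, hE⟩
    · exact ⟨1, 0, by simp, by simp, by rwa [Sym2.eq_swap]⟩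
  · have hE : (gen 0).1.2 = {[0, 1]} := rfl
    rw [hE]
    exact ⟨{[0, 1]}, le_rfl, .cons (by simp) .zero⟩

/-- The universal graph. -/
noncomputable def univGraph : SimpleGraph ℕ := sSup (Set.range fun n => gr (gen n).1.1)

theorem free_univGraph : Free univGraph Set.univ := by
  refine free_sUnion_of_directed ⟨_, 0, rfl⟩ ?_ ?_
  · rintro _ ⟨m, rfl⟩ _ ⟨n, rfl⟩
    exact ⟨_, ⟨max m n, rfl⟩, gr_mono (gen_vs (le_max_left _ _)),
      gr_mono (gen_vs (le_max_right _ _))⟩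
  · rintro _ ⟨n, rfl⟩
    exact (gen n).2.free

theorem gr_le_univGraph (n : ℕ) : gr (gen n).1.1 ≤ univGraph :=
  le_sSup (Set.mem_range_self n)

/-- A graph exhausted by a sequence of moves is a minor of the universal graph. -/
theorem isMinor_univGraph_of_moves {G : SimpleGraph ℕ} {A : ℕ → St} {a b : ℕ} (hab : a ≠ b)
    (h0 : A 0 = ({s(a, b)}, {[a, b]})) (hA : ∀ i, ReflTransGen Move (A i) (A (i + 1)))
    (hv : ∀ v, ∃ i, v ∈ vs (A i).1) (hE : ∀ u v, G.Adj u v → ∃ i, s(u, v) ∈ (A i).1) :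
    IsMinor G univGraph := by
  obtain ⟨c0, hc0⟩ := exists_start_morph hab
  rw [← h0] at hc0
  let P : ℕ → ℕ × (ℕ → Option ℕ) → Prop := fun i p => Morph (A i) (gen p.1).1 p.2
  have step : ∀ i (p : {p // P i p}), ∃ q : {q // P (i + 1) q}, p.1.1 ≤ q.1.1 ∧
      ∀ v ∈ vs (gen p.1.1).1.1, q.1.2 v = p.1.2 v := by
    rintro i ⟨⟨n, c⟩, hp⟩
    obtain ⟨m, c', h1, h2, h3⟩ := gen_moves (hA i) hp
    exact ⟨⟨(m, c'), h2⟩, h1, h3⟩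
  choose nxt hn1 hn2 using step
  let seq : ∀ i, {p // P i p} := fun i => Nat.rec ⟨(0, c0), hc0⟩ (fun i p => nxt i p) i
  have hmono : Monotone fun i => (seq i).1.1 := monotone_nat_of_le_succ fun i => hn1 i (seq i)
  have hag : ∀ i j, i ≤ j → ∀ v a, (seq i).1.2 v = some a → (seq j).1.2 v = some a := by
    intro i j hij
    induction j, hij using Nat.le_induction with
    | base => exact fun _ _ => id
    | succ j hij ih =>
      intro v a hv
      have := ih v a hv
      rw [← this]
      exact hn2 j (seq j) v ((seq j).2.core.dom v a this).1
  classical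
  let c : ℕ → Option ℕ := fun v =>
    if h : ∃ i a, (seq i).1.2 v = some a then some h.choose_spec.choose else none
  have hc : ∀ v a, c v = some a ↔ ∃ i, (seq i).1.2 v = some a := by
    intro v a
    have key : ∀ i, (seq i).1.2 v = some a → c v = some a := by
      intro i hi
      have h : ∃ i a, (seq i).1.2 v = some a := ⟨i, a, hi⟩
      have h2 := h.choose_spec.choose_spec
      simp only [c, dif_pos h]
      rcases le_total i h.choose with hle | hle
      · exact h2.symm.trans (hag _ _ hle _ _ hi)
      · exact (hag _ _ hle _ _ h2).symm.trans hi
    refine ⟨fun h => ?_, fun ⟨i, hi⟩ => key i hi⟩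
    by_cases h' : ∃ i a, (seq i).1.2 v = some a
    · obtain ⟨i, a', hi⟩ := h'
      simp only [c, dif_pos (⟨i, a', hi⟩ : ∃ i a, (seq i).1.2 v = some a)] at h
      have := (⟨i, a', hi⟩ : ∃ i a, (seq i).1.2 v = some a).choose_spec.choose_spec
      exact ⟨_, this.trans h⟩
    · simp [c, dif_neg h'] at h
  refine isMinor_iff.2 ⟨c, ⟨fun d => ?_, fun d => ?_, fun d e hde => ?_⟩⟩
  · obtain ⟨i, hi⟩ := hv d
    obtain ⟨v, hv⟩ := (seq i).2.core.surj d hi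
    exact ⟨v, (hc v d).2 ⟨i, hv⟩⟩
  · intro v hv w hw
    obtain ⟨i, hi⟩ := (hc v d).1 hv
    obtain ⟨j, hj⟩ := (hc w d).1 hw
    have hi' := hag i (max i j) (le_max_left _ _) _ _ hi
    have hj' := hag j (max i j) (le_max_right _ _) _ _ hj
    exact ((seq (max i j)).2.core.conn d v hi' w hj').mono (gr_le_univGraph _)
      fun x hx => (hc x d).2 ⟨_, hx⟩
  · obtain ⟨i, hi⟩ := hE d e hde
    obtain ⟨v, w, hv, hw, hvw⟩ := (seq i).2.core.adj d e hi hde.ne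
    refine ⟨v, w, gr_le_univGraph _ (gr_adj.2 ⟨hvw, ?_⟩), (hc v d).2 ⟨i, hv⟩, (hc w e).2 ⟨i, hw⟩⟩
    rintro rfl
    exact hde.ne (Option.some_injective _ (hv.symm.trans hw))

/-! ### Edge-maximal graphs -/

/-- `G` has no `K_{3,3}` minor, but any additional edge creates one. -/
structure EdgeMax {V : Type*} (G : SimpleGraph V) : Prop where
  free : Free G Set.univ
  max : ∀ u v, u ≠ v → ¬ G.Adj u v → ¬ Free (G ⊔ SimpleGraph.edge u v) Set.univ

section EdgeMaxSec

variable {V : Type*} {G : SimpleGraph V} {s t : V} {A C D : Set V}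

theorem exists_edgeMax (h : Free G Set.univ) : ∃ G', G ≤ G' ∧ EdgeMax G' := by
  obtain ⟨m, hm, hmax⟩ := zorn_le_nonempty₀ {H : SimpleGraph V | Free H Set.univ}
    (fun c hc hchain y hy => ⟨sSup c, free_sUnion_of_directed ⟨y, hy⟩ hchain.directedOn
      (fun H hH => hc hH), fun z hz => le_sSup hz⟩) G h
  refine ⟨m, hm, hmax.1, fun u v huv hadj hfree => hadj ?_⟩
  have := hmax.2 hfree le_sup_left
  exact this (Or.inr ((SimpleGraph.edge_adj ..).2 ⟨.inl ⟨rfl, rfl⟩, huv⟩))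

theorem free_map {W : Type*} {G : SimpleGraph W} (f : W ↪ V) (h : Free G Set.univ) :
    Free (G.map f) Set.univ := by
  refine Free.of_support (S := Set.range f) ?_ ?_
  · rintro ⟨c, hc, hS⟩
    refine h ⟨fun w => c (f w), ⟨fun a => ?_, fun a x hx y hy => ?_, fun a b hab => ?_⟩,
      fun _ _ _ => trivial⟩
    · obtain ⟨v, hv⟩ := hc.surj a
      obtain ⟨w, rfl⟩ := hS v a hv
      exact ⟨w, hv⟩
    · have key : ∀ z, Joined (G.map f) {v | c v = some a} (f x) z → ∀ w, f w = z →
          Joined G {w | c (f w) = some a} x w := by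
        intro z hz
        induction hz with
        | refl => intro w hw; rw [f.injective hw]; exact .refl _
        | @tail p q _ hpq ih =>
          rintro w rfl
          obtain ⟨hadj, hp, hq⟩ := hpq
          obtain ⟨u, w', huw, rfl, hw'⟩ := (SimpleGraph.map_adj ..).1 hadj
          rw [f.injective hw'] at huw
          exact (ih u rfl).trans (.edge huw hp hq)
      exact key _ (hc.conn a _ hx _ hy) y rfl
    · obtain ⟨u, v, huv, hu, hv⟩ := hc.adj a b hab
      obtain ⟨u', v', h', rfl, rfl⟩ := (SimpleGraph.map_adj ..).1 huv
      exact ⟨u', v', h', hu, hv⟩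
  · intro u v huv
    obtain ⟨u', v', h', rfl, rfl⟩ := (SimpleGraph.map_adj ..).1 huv
    exact ⟨u', rfl⟩

/-- A connected set attached to `s` and `t` can play the part of an edge `st`. -/
theorem Free.add_of_conn (h : Free G Set.univ) (hC : ConnOn G C) (hsC : s ∉ C) (htC : t ∉ C)
    {x y : V} (hx : x ∈ C) (hsx : G.Adj s x) (hy : y ∈ C) (hyt : G.Adj y t) (hA : Disjoint A C) :
    Free (G ⊔ SimpleGraph.edge s t) A := by
  classical
  rintro ⟨c, hc, hcA⟩
  have hcC : ∀ v a, c v = some a → v ∉ C := fun v a hv hvC =>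
    Set.disjoint_left.1 hA (hcA v a hv) hvC
  let H : SimpleGraph V := SimpleGraph.mk
    (fun u v => (G ⊔ SimpleGraph.edge s t).Adj u v ∧ u ∉ C ∧ v ∉ C)
    ⟨fun u v h => ⟨h.1.symm, h.2.2, h.2.1⟩⟩ ⟨fun v h => h.1.ne rfl⟩
  let r : V → Option V := fun v => if v ∈ C then some s else some v
  have hr1 : ∀ v, v ∉ C → r v = some v := fun v hv => if_neg hv
  have hr2 : ∀ v, v ∈ C → r v = some s := fun v hv => if_pos hv
  have hH : IsModel K33 H c := by
    refine ⟨hc.surj, fun a p hp q hq => ?_, fun a b hab => ?_⟩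
    · exact (hc.conn a p hp q hq).mono' (fun u hu w hw h => ⟨h, hcC u a hu, hcC w a hw⟩) subset_rfl
    · obtain ⟨u, v, h1, h2, h3⟩ := hc.adj a b hab
      exact ⟨u, v, ⟨h1, hcC u a h2, hcC v b h3⟩, h2, h3⟩
  have hconn : ∀ a, ConnOn G {v | r v = some a} := by
    intro a
    by_cases has : a = s
    · subst has
      have : {v | r v = some a} = {a} ∪ C := by
        ext v
        by_cases hv : v ∈ C
        · simp [hr2 v hv, hv]
        · simp [hr1 v hv, hv]
      rw [this]
      exact (ConnOn.singleton a).union hC rfl hx (.inr hsx)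
    · have : {v | r v = some a} ⊆ {a} := by
        intro v hv
        by_cases hvC : v ∈ C
        · have : r v = some a := hv
          rw [hr2 v hvC] at this
          exact absurd (Option.some.inj this).symm has
        · have : r v = some a := hv
          rw [hr1 v hvC] at this
          exact Option.some.inj this
      intro p hp q hq
      rw [this hp, this hq]
      exact .refl _
  have hadj : ∀ p q, H.Adj p q → ∃ u v, G.Adj u v ∧ r u = some p ∧ r v = some q := by
    rintro p q ⟨hpq, hp, hq⟩
    rcases hpq with hpq | hpq
    · exact ⟨p, q, hpq, hr1 p hp, hr1 q hq⟩
    · obtain ⟨⟨rfl, rfl⟩ | ⟨rfl, rfl⟩, -⟩ := (SimpleGraph.edge_adj ..).1 hpq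
      · exact ⟨y, q, hyt, hr2 y hy, hr1 q hq⟩
      · exact ⟨p, y, hyt.symm, hr1 p hp, hr2 y hy⟩
  refine h ⟨fun v => (r v).bind c, ⟨fun a => ?_, fun a => .bind hconn hadj (hH.conn a),
    fun a b hab => ?_⟩, fun _ _ _ => trivial⟩
  · obtain ⟨v, hv⟩ := hc.surj a
    exact ⟨v, by simp [hr1 v (hcC v a hv), hv]⟩
  · obtain ⟨p, q, hpq, hp, hq⟩ := hH.adj a b hab
    obtain ⟨u, v, huv, hu, hv⟩ := hadj p q hpq
    exact ⟨u, v, huv, by simp [hu, hp], by simp [hv, hq]⟩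

/-- Gluing along a new edge between vertices near a cut of order at most one. -/
theorem EdgeMax.false_of_cut (hG : EdgeMax G) {d o : V} (hdo : d ≠ o) (hn : ¬ G.Adj d o)
    {A B : Set V} (hAB : A ∪ B = Set.univ) (hno : ∀ u ∈ A, u ∉ B → ∀ v ∈ B, v ∉ A → ¬ G.Adj u v)
    (hd : d ∈ A) (hdB : d ∉ B) (ho : o ∈ B) (hoA : o ∉ A)
    (hs : (A ∩ B = ∅) ∨ ∃ s, A ∩ B = {s} ∧ G.Adj s d ∧ G.Adj s o) : False := by
  classical
  set G' := G ⊔ SimpleGraph.edge d o with hG'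
  have hle : G ≤ G' := le_sup_left
  have hdo' : G'.Adj d o := Or.inr ((SimpleGraph.edge_adj ..).2 ⟨.inl ⟨rfl, rfl⟩, hdo⟩)
  have hadj : ∀ u v, G'.Adj u v → G.Adj u v ∨ (u = d ∧ v = o) ∨ u = o ∧ v = d := by
    intro u v h
    rcases h with h | h
    · exact .inl h
    · exact .inr ((SimpleGraph.edge_adj ..).1 h).1
  have hA : Free G' A := hG.free.anti (fun u hu v hv h => by
    rcases hadj u v h with h | ⟨rfl, rfl⟩ | ⟨rfl, rfl⟩
    · exact h
    · exact absurd hv hoA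
    · exact absurd hu hoA) (Set.subset_univ _)
  have hB : Free G' B := hG.free.anti (fun u hu v hv h => by
    rcases hadj u v h with h | ⟨rfl, rfl⟩ | ⟨rfl, rfl⟩
    · exact h
    · exact absurd hu hdB
    · exact absurd hv hdB) (Set.subset_univ _)
  apply hG.max d o hdo hn
  rw [← hAB]
  rcases hs with hs | ⟨s, hs, hsd, hso⟩
  · have hM : Free G' (({d, o} : Finset V) : Set V) :=
      Free.of_card _ ((Finset.card_le_two).trans (by norm_num))
    have h1 : Free G' (A ∪ (({d, o} : Finset V) : Set V)) := by
      refine hA.glue (s := d) (t := d) hM ?_ ?_ hd hd (by simp) (by simp) (.inl rfl)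
      · intro u hu hu' v hv hv' h
        simp only [Finset.coe_insert, Finset.coe_singleton, Set.mem_insert_iff,
          Set.mem_singleton_iff, not_or] at hu' hv
        have hvo : v = o := hv.resolve_left fun e => hv' (e ▸ hd)
        subst hvo
        rcases hadj u v h with h | ⟨rfl, -⟩ | ⟨rfl, rfl⟩
        · refine hno u hu (fun hB => ?_) v ho hoA h
          exact (hs ▸ (⟨hu, hB⟩ : u ∈ A ∩ B) : u ∈ (∅ : Set V))
        · exact hu'.1 rfl
        · exact hu'.2 rfl
      · rintro x ⟨hx, hx'⟩
        simp only [Finset.coe_insert, Finset.coe_singleton, Set.mem_insert_iff,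
          Set.mem_singleton_iff] at hx' ⊢
        rcases hx' with rfl | rfl
        · exact .inl rfl
        · exact absurd hx hoA
    have h2 := h1.glue (s := o) (t := o) hB ?_ ?_ (by simp) (by simp) ho ho (.inl rfl)
    · refine h2.anti (fun _ _ _ _ h => h) ?_
      rintro x (hx | hx)
      · exact .inl (.inl hx)
      · exact .inr hx
    · intro u hu hu' v hv hv' h
      simp only [Finset.coe_insert, Finset.coe_singleton, Set.mem_union, Set.mem_insert_iff,
        Set.mem_singleton_iff, not_or] at hu hv'
      rcases hadj u v h with h | ⟨rfl, rfl⟩ | ⟨rfl, rfl⟩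
      · have : u ∈ A := by
          rcases hu with hu | rfl | rfl
          · exact hu
          · exact hd
          · exact absurd ho hu'
        exact hno u this hu' v hv hv'.1 h
      · exact hv'.2.2 rfl
      · exact hu' ho
    · rintro x ⟨hx, hx'⟩
      simp only [Finset.coe_insert, Finset.coe_singleton, Set.mem_union, Set.mem_insert_iff,
        Set.mem_singleton_iff] at hx ⊢
      rcases hx with hx | rfl | rfl
      · exact ((hs ▸ (⟨hx, hx'⟩ : x ∈ A ∩ B) : x ∈ (∅ : Set V))).elim
      · exact absurd hx' hdB
      · exact .inl rfl
  · have hsA : s ∈ A := ((hs ▸ rfl : s ∈ A ∩ B)).1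
    have hsB : s ∈ B := ((hs ▸ rfl : s ∈ A ∩ B)).2
    have hM : Free G' (({s, d, o} : Finset V) : Set V) :=
      Free.of_card _ ((Finset.card_le_three).trans (by norm_num))
    have h1 : Free G' (A ∪ (({s, d, o} : Finset V) : Set V)) := by
      refine hA.glue (s := s) (t := d) hM ?_ ?_ hsA hd (by simp) (by simp) (.inr (hle hsd))
      · intro u hu hu' v hv hv' h
        simp only [Finset.coe_insert, Finset.coe_singleton, Set.mem_insert_iff,
          Set.mem_singleton_iff, not_or] at hu' hv
        have hvo : v = o := by
          rcases hv with rfl | rfl | rfl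
          · exact absurd hsA hv'
          · exact absurd hd hv'
          · rfl
        subst hvo
        rcases hadj u v h with h | ⟨rfl, -⟩ | ⟨rfl, rfl⟩
        · refine hno u hu (fun hB => ?_) v ho hoA h
          exact hu'.1 (hs ▸ (⟨hu, hB⟩ : u ∈ A ∩ B) : u ∈ ({s} : Set V))
        · exact hu'.2.1 rfl
        · exact hu'.2.2 rfl
      · rintro x ⟨hx, hx'⟩
        simp only [Finset.coe_insert, Finset.coe_singleton, Set.mem_insert_iff,
          Set.mem_singleton_iff] at hx' ⊢
        rcases hx' with rfl | rfl | rfl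
        · exact .inl rfl
        · exact .inr rfl
        · exact absurd hx hoA
    have h2 := h1.glue (s := s) (t := o) hB ?_ ?_ (by simp) (by simp) hsB ho (.inr (hle hso))
    · refine h2.anti (fun _ _ _ _ h => h) ?_
      rintro x (hx | hx)
      · exact .inl (.inl hx)
      · exact .inr hx
    · intro u hu hu' v hv hv' h
      simp only [Finset.coe_insert, Finset.coe_singleton, Set.mem_union, Set.mem_insert_iff,
        Set.mem_singleton_iff, not_or] at hu hv'
      rcases hadj u v h with h | ⟨rfl, rfl⟩ | ⟨rfl, rfl⟩
      · have : u ∈ A := by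
          rcases hu with hu | rfl | rfl | rfl
          · exact hu
          · exact hsA
          · exact hd
          · exact absurd ho hu'
        exact hno u this hu' v hv hv'.1 h
      · exact hv'.2.2.2 rfl
      · exact hu' ho
    · rintro x ⟨hx, hx'⟩
      simp only [Finset.coe_insert, Finset.coe_singleton, Set.mem_union, Set.mem_insert_iff,
        Set.mem_singleton_iff] at hx ⊢
      rcases hx with hx | rfl | rfl | rfl
      · exact .inl (hs ▸ (⟨hx, hx'⟩ : x ∈ A ∩ B) : x ∈ ({s} : Set V))
      · exact .inl rfl
      · exact absurd hx' hdB
      · exact .inr rfl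

theorem EdgeMax.exists_adj (hG : EdgeMax G) {A : Set V} (hA : A.Nonempty) (hA' : Aᶜ.Nonempty) :
    ∃ u ∈ A, ∃ v, v ∉ A ∧ G.Adj u v := by
  by_contra! hno
  obtain ⟨d, hd⟩ := hA
  obtain ⟨o, ho⟩ := hA'
  exact hG.false_of_cut (d := d) (o := o) (fun e => ho (e ▸ hd)) (hno d hd o ho) (A := A) (B := Aᶜ)
    (Set.union_compl_self A) (fun u hu _ v hv _ => hno u hu v hv) hd (fun h => h hd) ho ho
    (.inl (Set.inter_compl_self A))

theorem EdgeMax.exists_adj_of_ne (hG : EdgeMax G) (hD : D.Nonempty) (hs : s ∉ D)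
    (hD' : ∃ o, o ∉ D ∧ o ≠ s) :
    ∃ u ∈ D, ∃ v, v ∉ D ∧ v ≠ s ∧ G.Adj u v := by
  by_contra! hno
  obtain ⟨o0, ho0, ho0s⟩ := hD'
  have h1 : ∃ d ∈ D, G.Adj s d := by
    obtain ⟨u, hu, v, hv, h⟩ := hG.exists_adj hD ⟨s, hs⟩
    have : v = s := by
      by_contra hvs
      exact hno u hu v hv hvs h
    exact ⟨u, hu, this ▸ h.symm⟩
  have h2 : ∃ o, o ∉ D ∧ o ≠ s ∧ G.Adj s o := by
    obtain ⟨u, hu, v, hv, h⟩ := hG.exists_adj (A := insert s D) ⟨s, .inl rfl⟩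
      ⟨o0, fun h => h.elim ho0s ho0⟩
    rcases hu with rfl | hu
    · exact ⟨v, fun h => hv (.inr h), fun h => hv (.inl h), h⟩
    · exact absurd h (hno u hu v (fun h => hv (.inr h)) (fun h => hv (.inl h)))
  obtain ⟨d, hd, hsd⟩ := h1
  obtain ⟨o, ho, hos, hso⟩ := h2
  refine hG.false_of_cut (d := d) (o := o) (fun e => ho (e ▸ hd)) (hno d hd o ho hos)
    (A := insert s D) (B := Dᶜ) ?_ ?_ (.inr hd) (fun h => h hd) ho (fun h => h.elim hos ho)
    (.inr ⟨s, ?_, hsd, hso⟩)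
  · ext x; simp only [Set.mem_union, Set.mem_insert_iff, Set.mem_compl_iff, Set.mem_univ, iff_true]
    tauto
  · intro u hu hu' v hv hv'
    have : u ∈ D := by simpa using hu'
    exact hno u this v hv (fun h => hv' (.inl h))
  · ext x
    simp only [Set.mem_inter_iff, Set.mem_insert_iff, Set.mem_compl_iff, Set.mem_singleton_iff]
    constructor
    · rintro ⟨h | h, h'⟩
      · exact h
      · exact absurd h h'
    · rintro rfl; exact ⟨.inl rfl, hs⟩

/-- Separators of order at most two of an edge-maximal graph are edges. -/
theorem EdgeMax.adj_of_sep (hG : EdgeMax G) (hD : D.Nonempty) (hs : s ∉ D) (ht : t ∉ D)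
    (hno : ∀ u ∈ D, ∀ v, v ∉ D → v ≠ s → v ≠ t → ¬ G.Adj u v)
    (hO : ∃ o, o ∉ D ∧ o ≠ s ∧ o ≠ t) : G.Adj s t := by
  classical
  obtain ⟨o, ho, hos, hot⟩ := hO
  by_contra hst
  have hne : s ≠ t := by
    rintro rfl
    obtain ⟨u, hu, v, hv, hvs, h⟩ := hG.exists_adj_of_ne hD hs ⟨o, ho, hos⟩
    exact hno u hu v hv hvs hvs h
  -- every component of the complement of `s, t` is attached to both
  have key : ∀ X : Set V, X ⊆ {s, t}ᶜ → ∀ d ∈ X, (∀ u ∈ X, ∀ v, v ∉ X → v ≠ s → v ≠ t →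
      ¬ G.Adj u v) →
      ∃ C ⊆ X, ConnOn G C ∧ (∃ x ∈ C, G.Adj s x) ∧ ∃ y ∈ C, G.Adj y t := by
    intro X hX d hd hX'
    have hC : ∀ u ∈ comp G X d, ∀ v, v ∉ comp G X d → v ≠ s → v ≠ t → ¬ G.Adj u v := by
      intro u hu v hv hvs hvt h
      by_cases hvX : v ∈ X
      · exact hv (comp_closed hu hvX h)
      · exact hX' u (comp_subset hu) v hvX hvs hvt h
    have hsC : s ∉ comp G X d := fun h => by simpa using hX (comp_subset h)
    have htC : t ∉ comp G X d := fun h => by simpa using hX (comp_subset h)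
    refine ⟨comp G X d, comp_subset, connOn_comp, ?_, ?_⟩
    · obtain ⟨u, hu, v, hv, hvt, h⟩ := hG.exists_adj_of_ne (s := t) ⟨d, mem_comp_self hd⟩ htC
        ⟨s, hsC, hne⟩
      by_cases hvs : v = s
      · subst hvs; exact ⟨u, hu, h.symm⟩
      · exact absurd h (hC u hu v hv hvs hvt)
    · obtain ⟨u, hu, v, hv, hvs, h⟩ := hG.exists_adj_of_ne (s := s) ⟨d, mem_comp_self hd⟩ hsC
        ⟨t, htC, hne.symm⟩
      by_cases hvt : v = t
      · subst hvt; exact ⟨u, hu, h⟩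
      · exact absurd h (hC u hu v hv hvs hvt)
  obtain ⟨d, hd⟩ := hD
  have hDst : D ⊆ {s, t}ᶜ := by
    rintro x hx (rfl | h)
    · exact hs hx
    · exact ht (h ▸ hx)
  have hOst : (D ∪ {s, t})ᶜ ⊆ ({s, t}ᶜ : Set V) := fun x hx h => hx (.inr h)
  obtain ⟨C1, hC1, hc1, ⟨x1, hx1, hsx1⟩, y1, hy1, hyt1⟩ := key D hDst d hd hno
  obtain ⟨C2, hC2, hc2, ⟨x2, hx2, hsx2⟩, y2, hy2, hyt2⟩ := key (D ∪ {s, t})ᶜ hOst o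
    (by simp [ho, hos, hot]) (by
      intro u hu v hv hvs hvt h
      have hvD : v ∈ D := by
        by_contra hvD
        exact hv (by simp [hvD, hvs, hvt])
      simp only [Set.mem_compl_iff, Set.mem_union, Set.mem_insert_iff, Set.mem_singleton_iff,
        not_or] at hu
      exact hno v hvD u hu.1 hu.2.1 hu.2.2 h.symm)
  have hs1 : s ∉ C1 := fun h => hs (hC1 h)
  have ht1 : t ∉ C1 := fun h => ht (hC1 h)
  have hs2 : s ∉ C2 := fun h => hC2 h (by simp)
  have ht2 : t ∉ C2 := fun h => hC2 h (by simp)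
  have hfA : Free (G ⊔ SimpleGraph.edge s t) (D ∪ {s, t}) := by
    refine hG.free.add_of_conn hc2 hs2 ht2 hx2 hsx2 hy2 hyt2 ?_
    exact Set.disjoint_left.2 fun x hx hx' => hC2 hx' hx
  have hfB : Free (G ⊔ SimpleGraph.edge s t) Dᶜ := by
    refine hG.free.add_of_conn hc1 hs1 ht1 hx1 hsx1 hy1 hyt1 ?_
    exact Set.disjoint_left.2 fun x hx hx' => hx (hC1 hx')
  apply hG.max s t hne hst
  have := hfA.glue (s := s) (t := t) hfB ?_ ?_ (by simp) (by simp) hs ht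
    (.inr (Or.inr ((SimpleGraph.edge_adj ..).2 ⟨.inl ⟨rfl, rfl⟩, hne⟩)))
  · refine this.anti (fun _ _ _ _ h => h) fun x _ => ?_
    by_cases hx : x ∈ D
    · exact .inl (.inl hx)
    · exact .inr hx
  · intro u hu hu' v hv hv' h
    have huD : u ∈ D := by simpa using hu'
    simp only [Set.mem_union, Set.mem_insert_iff, Set.mem_singleton_iff, not_or] at hv'
    rcases h with h | h
    · exact hno u huD v hv'.1 hv'.2.1 hv'.2.2 h
    · obtain ⟨⟨rfl, rfl⟩ | ⟨rfl, rfl⟩, -⟩ := (SimpleGraph.edge_adj ..).1 h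
      · exact hs huD
      · exact ht huD
  · rintro x ⟨hx | hx, hx'⟩
    · exact absurd hx hx'
    · exact hx

theorem EdgeMax.connOn (hG : EdgeMax G) : ConnOn G Set.univ := by
  intro a _ b _
  by_contra h
  obtain ⟨u, hu, v, hv, huv⟩ := hG.exists_adj (A := comp G Set.univ a) ⟨a, mem_comp_self trivial⟩
    ⟨b, fun hb => h hb.2⟩
  exact hv (comp_closed hu trivial huv)

end EdgeMaxSec

/-! ### Ears -/

/-- A path with end vertices `a`, `b` and interior vertices `p`. -/
structure Ear where
  a : ℕ
  p : List ℕ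
  b : ℕ

/-- The edges of a path. -/
def Ear.edges (e : Ear) : List (Sym2 ℕ) := pe (e.a :: e.p ++ [e.b])

/-- `e` is a path with distinct ends in `E` and otherwise disjoint from `E`. -/
structure IsEar (E : Finset (Sym2 ℕ)) (e : Ear) : Prop where
  left : e.a ∈ vs E
  right : e.b ∈ vs E
  nodup : (e.a :: e.p ++ [e.b]).Nodup
  fresh : ∀ x ∈ e.p, x ∉ vs E
  new : e.p = [] → s(e.a, e.b) ∉ E

/-- The result of adding the edges of a path. -/
def addEar (E : Finset (Sym2 ℕ)) (e : Ear) : Finset (Sym2 ℕ) := E ∪ e.edges.toFinset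

/-- Adding an ear inside a face. -/
inductive EarStep (e : Ear) : St → St → Prop
  | fwd {E F L0 L1 L2} : EarStep e (E, (L0 ++ e.a :: L1 ++ e.b :: L2) ::ₘ F)
      (addEar E e, (e.p.reverse ++ e.a :: L1 ++ [e.b]) ::ₘ (L0 ++ e.a :: e.p ++ e.b :: L2) ::ₘ F)
  | bwd {E F L0 L1 L2} : EarStep e (E, (L0 ++ e.b :: L1 ++ e.a :: L2) ::ₘ F)
      (addEar E e, (e.p ++ e.b :: L1 ++ [e.a]) ::ₘ (L0 ++ e.b :: e.p.reverse ++ e.a :: L2) ::ₘ F)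

section Ears

variable {E : Finset (Sym2 ℕ)}

theorem subset_addEar (e : Ear) : E ⊆ addEar E e := Finset.subset_union_left

theorem Ear.edges_reverse (a b : ℕ) (p : List ℕ) :
    (Ear.mk b p.reverse a).edges = (Ear.mk a p b).edges.reverse := by
  simp [Ear.edges, ← pe_reverse]

theorem addEar_reverse (a b : ℕ) (p : List ℕ) :
    addEar E ⟨b, p.reverse, a⟩ = addEar E ⟨a, p, b⟩ := by
  simp [addEar, Ear.edges_reverse]

theorem IsEar.reverse {a b : ℕ} {p : List ℕ} (h : IsEar E ⟨a, p, b⟩) :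
    IsEar E ⟨b, p.reverse, a⟩ where
  left := h.right
  right := h.left
  nodup := by
    have := List.nodup_reverse.2 h.nodup
    simpa using this
  fresh x hx := h.fresh x (by simpa using hx)
  new hp := by
    have := h.new (by simpa using hp)
    rwa [Sym2.eq_swap]

theorem mem_vs_of_path {a b x : ℕ} {p : List ℕ} (h : x ∈ a :: p ++ [b]) :
    x ∈ vs (pe (a :: p ++ [b])).toFinset := by
  obtain ⟨e, he, hx⟩ : ∃ e ∈ pe (a :: p ++ [b]), x ∈ e := by
    cases p with
    | nil => exact mem_pe_of_mem h
    | cons c p => exact mem_pe_of_mem h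
  exact ⟨e, by simpa using he, hx⟩

theorem vs_addEar (e : Ear) : vs (addEar E e) = vs E ∪ {x | x ∈ e.a :: e.p ++ [e.b]} := by
  rw [addEar, vs_union]
  congr 1
  ext x
  refine ⟨?_, fun h => mem_vs_of_path h⟩
  rintro ⟨d, hd, hx⟩
  exact mem_of_mem_pe (List.mem_toFinset.1 hd) hx

theorem IsEar.vs_add {e : Ear} (h : IsEar E e) : vs (addEar E e) = vs E ∪ {x | x ∈ e.p} := by
  rw [vs_addEar]
  ext x
  have h1 := h.left
  have h2 := h.right
  simp only [List.cons_append, List.mem_cons, List.mem_append, List.not_mem_nil, or_false,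
    Set.mem_union, Set.mem_ofPred_eq]
  constructor
  · rintro (h | rfl | h | rfl) <;> tauto
  · tauto

theorem IsEar.new' {e : Ear} (h : IsEar E e) {d : Sym2 ℕ} (hd : d ∈ e.edges) : d ∉ E := by
  intro hdE
  obtain ⟨a, p, b⟩ := e
  have h1 := h.nodup
  cases p with
  | nil =>
    have : d = s(a, b) := by simpa [Ear.edges] using hd
    exact h.new rfl (this ▸ hdE)
  | cons x p =>
    -- one end of `d` is a new vertex
    have key : ∀ (p : List ℕ) (a : ℕ), (∀ x ∈ p, x ∉ vs E) → p ≠ [] → d ∈ pe (a :: p ++ [b]) →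
        False := by
      intro p
      induction p with
      | nil => intro a _ h _; exact h rfl
      | cons x p ih =>
        intro a hf _ hd
        have hx := hf x (by simp)
        simp only [List.cons_append, pe_cons_cons, List.mem_cons] at hd
        rcases hd with rfl | hd
        · exact hx (mem_vs_right hdE)
        · cases p with
          | nil =>
            have : d = s(x, b) := by simpa using hd
            exact hx (mem_vs_left (this ▸ hdE))
          | cons y p => exact ih x (fun z hz => hf z (List.mem_cons_of_mem _ hz)) (by simp) hd
    exact key (x :: p) a h.fresh (by simp) hd

theorem ear_moves (F : Multiset (List ℕ)) (b : ℕ) (L2 p : List ℕ) :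
    ∀ (E : Finset (Sym2 ℕ)) (a : ℕ) (L0 L1 : List ℕ), (a :: p ++ [b]).Nodup →
    (∀ x ∈ p, x ∉ vs E) → (p = [] → s(a, b) ∉ E) →
    let A : St := (E, (L0 ++ a :: L1 ++ b :: L2) ::ₘ F)
    let B : St := (addEar E ⟨a, p, b⟩,
      (p.reverse ++ a :: L1 ++ [b]) ::ₘ (L0 ++ a :: p ++ b :: L2) ::ₘ F)
    ReflTransGen Move A B ∧ (PlaneCert A.1 A.2 → PlaneCert B.1 B.2) := by
  induction p with
  | nil =>
    intro E a L0 L1 hn _ hnew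
    have hab : a ≠ b := by
      rintro rfl; simp at hn
    have hE : addEar E ⟨a, [], b⟩ = insert s(a, b) E := by
      simp [addEar, Ear.edges]
    simp only [hE]
    refine ⟨.single ?_, fun h => ?_⟩
    · simpa using Move.chord (E := E) (F := F) (L0 := L0) (L1 := L1) (L2 := L2) hab
    · simpa using h.chord (hnew rfl)
  | cons x p ih =>
    intro E a L0 L1 hn hf _
    have hxa : x ≠ a := by
      rintro rfl; simp at hn
    have hxb : x ≠ b := by
      rintro rfl; simp at hn
    have hab : a ≠ b := by
      rintro rfl; simp at hn
    have hap : a ∉ p := by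
      intro h; simp [h] at hn
    have hxp : x ∉ p := by
      intro h; simp [h] at hn
    have hx := hf x (by simp)
    have h1 := ih (insert s(a, x) E) x (L0 ++ [a]) (a :: L1) (List.Nodup.of_cons (a := a) hn)
      (fun y hy => by
        rw [mem_vs_insert]
        rintro (rfl | rfl | h)
        · exact hap hy
        · exact hxp hy
        · exact hf y (by simp [hy]) h)
      (fun _ => by
        intro h
        rcases Finset.mem_insert.1 h with h | h
        · have : a ∈ s(x, b) := by rw [h]; simp
          rcases Sym2.mem_iff.1 this with h | h
          · exact hxa h.symm
          · exact hab h
        · exact hx (mem_vs_left h))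
    have hE : addEar (insert s(a, x) E) ⟨x, p, b⟩ = addEar E ⟨a, x :: p, b⟩ := by
      ext d; simp [addEar, Ear.edges]
    rw [hE] at h1
    have e1 : L0 ++ [a] ++ x :: (a :: L1) ++ b :: L2 = L0 ++ a :: x :: a :: (L1 ++ b :: L2) := by
      simp
    have e2 : p.reverse ++ x :: (a :: L1) ++ [b] = (x :: p).reverse ++ a :: L1 ++ [b] := by simp
    have e3 : L0 ++ [a] ++ x :: p ++ b :: L2 = L0 ++ a :: (x :: p) ++ b :: L2 := by simp
    rw [e1, e2, e3] at h1
    refine ⟨ReflTransGen.head ?_ h1.1, fun h => h1.2 ?_⟩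
    · have := Move.pendant (E := E) (F := F) (L0 := L0) (L2 := L1 ++ b :: L2) (a := a) hx
      simpa using this
    · refine PlaneCert.pendant (L2 := L1 ++ b :: L2) (by simpa using h)
        (fun e he h => hx ⟨e, he, h⟩) hxa

theorem EarStep.moves_and {e : Ear} {A B : St} (h : EarStep e A B) (he : IsEar A.1 e) :
    ReflTransGen Move A B ∧ (PlaneCert A.1 A.2 → PlaneCert B.1 B.2) := by
  obtain ⟨a, p, b⟩ := e
  cases h with
  | fwd => exact ear_moves _ b _ p _ a _ _ he.nodup he.fresh he.new
  | @bwd E F L0 L1 L2 =>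
    have he' := he.reverse
    have := ear_moves F a L2 p.reverse E b L0 L1 he'.nodup he'.fresh he'.new
    simpa only [addEar_reverse, List.reverse_reverse] using this

theorem EarStep.fst {e : Ear} {A B : St} (h : EarStep e A B) : B.1 = addEar A.1 e := by
  cases h <;> rfl

/-- Faces are cycles of the graph. -/
def GoodFaces (A : St) : Prop := ∀ f ∈ A.2, f.Nodup ∧ ∀ x ∈ f, x ∈ vs A.1

theorem EarStep.goodFaces {e : Ear} {A B : St} (h : EarStep e A B) (he : IsEar A.1 e)
    (hA : GoodFaces A) : GoodFaces B := by
  have hBA := h.fst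
  have key : ∀ (a b : ℕ) (p L0 L1 L2 : List ℕ), IsEar A.1 ⟨a, p, b⟩ →
      (L0 ++ a :: L1 ++ b :: L2).Nodup → (∀ x ∈ (L0 ++ a :: L1 ++ b :: L2), x ∈ vs A.1) →
      (p.reverse ++ a :: L1 ++ [b]).Nodup ∧ (L0 ++ a :: p ++ b :: L2).Nodup := by
    intro a b p L0 L1 L2 he h1 h2
    have hp : p.Nodup := by
      have := he.nodup
      simp only [List.cons_append, List.nodup_cons, List.nodup_append] at this
      exact this.2.1
    have hd : ∀ x ∈ p, x ∉ (L0 ++ a :: L1 ++ b :: L2) := fun x hx h => he.fresh x hx (h2 x h)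
    simp only [List.append_assoc, List.cons_append, List.nodup_append, List.nodup_cons,
      List.mem_append, List.mem_cons, List.nodup_reverse, List.mem_reverse, not_or] at h1 hd ⊢
    grind
  have hv : ∀ x ∈ e.p, x ∈ vs B.1 := by
    intro x hx
    rw [hBA, he.vs_add]; exact .inr hx
  have hm : vs A.1 ⊆ vs B.1 := by rw [hBA]; exact vs_mono (subset_addEar e)
  obtain ⟨a, p, b⟩ := e
  cases h with
  | @fwd E F L0 L1 L2 =>
    have h0 := hA _ (Multiset.mem_cons_self _ _)
    have h1 := key a b p L0 L1 L2 he h0.1 h0.2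
    have h2 := fun x hx => hm (h0.2 x hx)
    simp only [] at h2 hv
    intro f hf
    simp only [Multiset.mem_cons] at hf
    rcases hf with rfl | rfl | hf
    · refine ⟨h1.1, fun x hx => ?_⟩
      simp only [List.mem_append, List.mem_cons, List.mem_reverse, List.not_mem_nil,
        or_false] at hx h2
      rcases hx with (hx | hx | hx) | hx
      · exact hv x hx
      all_goals exact h2 x (by tauto)
    · refine ⟨h1.2, fun x hx => ?_⟩
      simp only [List.mem_append, List.mem_cons] at hx h2
      rcases hx with (hx | hx | hx) | hx | hx
      · exact h2 x (by tauto)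
      · exact h2 x (by tauto)
      · exact hv x hx
      all_goals exact h2 x (by tauto)
    · have := hA f (Multiset.mem_cons_of_mem hf)
      exact ⟨this.1, fun x hx => hm (this.2 x hx)⟩
  | @bwd E F L0 L1 L2 =>
    have h0 := hA _ (Multiset.mem_cons_self _ _)
    have h1 := key b a p.reverse L0 L1 L2 he.reverse h0.1 h0.2
    rw [List.reverse_reverse] at h1
    have h2 := fun x hx => hm (h0.2 x hx)
    simp only [] at h2 hv
    intro f hf
    simp only [Multiset.mem_cons] at hf
    rcases hf with rfl | rfl | hf
    · refine ⟨h1.1, fun x hx => ?_⟩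
      simp only [List.mem_append, List.mem_cons, List.not_mem_nil, or_false] at hx h2
      rcases hx with (hx | hx | hx) | hx
      · exact hv x hx
      all_goals exact h2 x (by tauto)
    · refine ⟨h1.2, fun x hx => ?_⟩
      simp only [List.mem_append, List.mem_cons, List.mem_reverse] at hx h2
      rcases hx with (hx | hx | hx) | hx | hx
      · exact h2 x (by tauto)
      · exact h2 x (by tauto)
      · exact hv x hx
      all_goals exact h2 x (by tauto)
    · have := hA f (Multiset.mem_cons_of_mem hf)
      exact ⟨this.1, fun x hx => hm (this.2 x hx)⟩

/-! ### Ears and cycle spaces -/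

theorem bd_single' (e : Sym2 ℕ) (c : ZMod 2) : bd (Finsupp.single e c) = c • bdE e := by
  simp [bd, Finsupp.linearCombination_single]

/-- A cycle is constant along a path with interior vertices of degree two. -/
theorem const_on_path {z : EV} {b : ℕ} (p : List ℕ) : ∀ (E : Finset (Sym2 ℕ)) (a : ℕ),
    (∀ x ∈ p, bd z x = 0) → (∀ e, z e ≠ 0 → e ∈ E ∨ e ∈ pe (a :: p ++ [b])) →
    (∀ x ∈ p, x ∉ vs E) → p.Nodup → a ∉ p → b ∉ p →
    ∃ c, ∀ e ∈ pe (a :: p ++ [b]), z e = c := by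
  induction p with
  | nil => intro E a _ _ _ _ _ _; exact ⟨z s(a, b), by simp⟩
  | cons x p ih =>
    intro E a hz hsupp hf hn ha hb
    have hxa : x ≠ a := by rintro rfl; simp at ha
    have hxb : b ≠ x := by rintro rfl; simp at hb
    have hxp : x ∉ p := (List.nodup_cons.1 hn).1
    obtain ⟨c, hc⟩ := ih (insert s(a, x) E) x (fun y hy => hz y (by simp [hy]))
      (fun e he => by
        rcases hsupp e he with h | h
        · exact .inl (Finset.mem_insert_of_mem h)
        · simp only [List.cons_append, pe_cons_cons, List.mem_cons] at h
          rcases h with rfl | h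
          · exact .inl (Finset.mem_insert_self _ _)
          · exact .inr h)
      (fun y hy => by
        rw [mem_vs_insert]
        rintro (rfl | rfl | h)
        · exact ha (by simp [hy])
        · exact hxp hy
        · exact hf y (by simp [hy]) h)
      (List.nodup_cons.1 hn).2 hxp (fun h => hb (by simp [h]))
    obtain ⟨y, l, hyl⟩ : ∃ y l, p ++ [b] = y :: l := by
      cases p with
      | nil => exact ⟨b, [], rfl⟩
      | cons y p => exact ⟨y, p ++ [b], rfl⟩
    have hxl : x ∉ y :: l := by
      rw [← hyl]; simp [hxp, hxb.symm]
    have hyx : y ≠ x := by rintro rfl; simp at hxl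
    refine ⟨c, ?_⟩
    have hpe : pe (x :: p ++ [b]) = s(x, y) :: pe (y :: l) := by
      rw [List.cons_append, hyl, pe_cons_cons]
    have hc2 : z s(x, y) = c := hc _ (by rw [hpe]; simp)
    have hc1 : z s(a, x) = c := by
      by_cases he : s(a, x) = s(x, y)
      · rw [he, hc2]
      · have h0 : bd (z + (Finsupp.single s(a, x) (z s(a, x)) +
            Finsupp.single s(x, y) (z s(x, y)))) x = 0 := by
          refine bd_apply_eq_zero fun e hne hxe => hne ?_
          by_cases h1 : e = s(a, x)
          · subst h1
            simp [Ne.symm he, ZMod2_add_self]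
          by_cases h2 : e = s(x, y)
          · subst h2
            simp [he, ZMod2_add_self]
          simp only [Finsupp.add_apply, Finsupp.single_apply, Ne.symm h1, Ne.symm h2, if_false,
            add_zero]
          by_contra hze
          rcases hsupp e hze with h | h
          · exact hf x (by simp) ⟨e, h, hxe⟩
          · simp only [List.cons_append, pe_cons_cons, List.mem_cons] at h
            rcases h with h | h
            · exact h1 h
            · rw [← List.cons_append, hpe] at h
              rcases List.mem_cons.1 h with h | h
              · exact h2 h
              · exact hxl (mem_of_mem_pe h hxe)
        simp only [map_add, Finsupp.add_apply, bd_single', hz x (by simp), bdE_mk,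
          Finsupp.smul_apply, Finsupp.single_apply, hxa.symm, hyx, if_false, if_true] at h0
        simp only [zero_add, add_zero, smul_eq_mul, mul_one, hc2] at h0
        have : ∀ s t : ZMod 2, s + t = 0 → s = t := by decide
        exact this _ _ h0
    intro e he
    simp only [List.cons_append, pe_cons_cons, List.mem_cons] at he
    rcases he with rfl | he
    · exact hc1
    · exact hc e he

theorem pe_nodup {l : List ℕ} (h : l.Nodup) : (pe l).Nodup := by
  induction l with
  | nil => simp
  | cons a l ih =>
    cases l with
    | nil => simp
    | cons b l =>
      rw [pe_cons_cons, List.nodup_cons]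
      refine ⟨fun h' => ?_, ih (List.nodup_cons.1 h).2⟩
      exact (List.nodup_cons.1 h).1 (mem_of_mem_pe h' (by simp))

theorem vec_apply_of_mem {l : List (Sym2 ℕ)} (h : l.Nodup) {e : Sym2 ℕ} (he : e ∈ l) :
    vec l e = 1 := by
  rw [vec_apply, List.count_eq_one_of_mem h he]; rfl

theorem vec_apply_of_not_mem {l : List (Sym2 ℕ)} {e : Sym2 ℕ} (he : e ∉ l) : vec l e = 0 := by
  rw [vec_apply, List.count_eq_zero_of_not_mem he]; rfl

theorem Ear.edges_ne_nil (e : Ear) : ∃ d, d ∈ e.edges := by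
  obtain ⟨a, p, b⟩ := e
  cases p <;> simp [Ear.edges]

/-- A cycle of a graph with an ear either contains the ear or avoids it. -/
theorem IsEar.const {e : Ear} (h : IsEar E e) {z : EV} (hz : z ∈ Zs (addEar E e)) :
    ∃ c, ∀ d ∈ e.edges, z d = c := by
  rw [mem_Zs] at hz
  have hn := h.nodup
  refine const_on_path e.p E e.a (fun x _ => by rw [hz.1]; rfl) (fun d hd => ?_) h.fresh ?_ ?_ ?_
  · have := hz.2 d hd
    simpa [addEar, Ear.edges] using this
  all_goals
    simp only [List.cons_append, List.nodup_cons, List.nodup_append, List.mem_append] at hn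
  · exact hn.2.1
  · exact fun h => hn.1 (.inl h)
  · exact fun h => hn.2.2.2 _ h _ (by simp) rfl

/-- The only cycles along a given cycle are the trivial ones. -/
theorem eq_zero_or_sg {f : List ℕ} (hf : f.Nodup) {z : EV} (hz : bd z = 0)
    (hs : ∀ e, z e ≠ 0 → e ∈ cyc f) (hf0 : sg f ≠ 0) : z = 0 ∨ z = sg f := by
  rcases f with _ | ⟨a, l⟩
  · exact absurd rfl hf0
  rw [cyc_cons] at hs
  obtain ⟨c, hc⟩ := const_on_path (z := z) (b := a) l ∅ a (fun x _ => by rw [hz]; rfl)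
    (fun e he => .inr (hs e he)) (fun x _ h => by simp [vs] at h) (List.nodup_cons.1 hf).2
    (List.nodup_cons.1 hf).1 (List.nodup_cons.1 hf).1
  obtain ⟨c', hc'⟩ := const_on_path (z := sg (a :: l)) (b := a) l ∅ a
    (fun x _ => by rw [bd_sg]; rfl)
    (fun e he => .inr (by rw [← cyc_cons]; exact mem_of_vec_ne he)) (fun x _ h => by simp [vs] at h)
    (List.nodup_cons.1 hf).2 (List.nodup_cons.1 hf).1 (List.nodup_cons.1 hf).1
  have hc'1 : c' = 1 := by
    refine ZMod2_eq_one fun h0 => hf0 ?_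
    ext e
    by_contra hne
    exact hne ((hc' e (by rw [← cyc_cons]; exact mem_of_vec_ne hne)).trans h0)
  rcases ZMod2_cases c with rfl | rfl
  · left
    ext e
    by_contra hne
    exact hne (hc e (hs e hne))
  · right
    ext e
    by_cases he : e ∈ pe (a :: l ++ [a])
    · rw [hc e he, hc' e he, hc'1]
    · rw [not_not.1 (fun h => he (hs e h)), sg, cyc_cons, vec_apply_of_not_mem he]

end Ears

/-! ### Chains of plane certificates along ear sequences -/

theorem ZMod2_add_cancel {M : Type*} [AddCommGroup M] [Module (ZMod 2) M] (x y : M) :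
    x + y + y = x := by rw [add_assoc, ZMod2_add_self, add_zero]

theorem ZMod2_eq_add {M : Type*} [AddCommGroup M] [Module (ZMod 2) M] {x y z : M}
    (h : x + y = z) : x = z + y := by rw [← h, ZMod2_add_cancel]

theorem sg_split (L0 L1 L2 : List ℕ) (a b : ℕ) : sg (L0 ++ a :: L1 ++ b :: L2) =
    vec (pe (a :: L1 ++ [b])) + vec (pe (b :: (L2 ++ L0) ++ [a])) := by
  rw [sg, vec_perm (cyc_split _ _ _ _ _), vec_append]

theorem sg_ear (p L1 : List ℕ) (a b : ℕ) : sg (p.reverse ++ a :: L1 ++ [b]) =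
    vec (pe (a :: p ++ [b])) + vec (pe (a :: L1 ++ [b])) := by
  have h1 : (pe (b :: p.reverse ++ [a])) = (pe (a :: p ++ [b])).reverse := by
    rw [← pe_reverse]; simp
  rw [add_comm, show p.reverse ++ a :: L1 ++ [b] = p.reverse ++ (a :: L1 ++ b :: []) by simp, sg,
    vec_perm (cyc_rotate _ _)]
  have h2 := cyc_split [] L1 p.reverse a b
  rw [show a :: L1 ++ [b] ++ p.reverse = [] ++ a :: L1 ++ b :: p.reverse by simp, vec_perm h2,
    vec_append, List.append_nil, h1, vec_perm (List.reverse_perm _)]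

section Unmerge

variable {E : Finset (Sym2 ℕ)} {b1 b2 : EV} {f : List ℕ}

theorem unmerge_aux {a b : ℕ} {p L0 L1 L2 : List ℕ} (hf : (L0 ++ a :: L1 ++ b :: L2).Nodup)
    (hsg : sg (L0 ++ a :: L1 ++ b :: L2) = b1 + b2) (hne : b1 + b2 ≠ 0)
    (hbd : bd (b1 + vec (pe (a :: p ++ [b]))) = Finsupp.single a 1 + Finsupp.single b 1)
    (hs : ∀ g, (b1 + vec (pe (a :: p ++ [b]))) g ≠ 0 → g ∈ cyc (L0 ++ a :: L1 ++ b :: L2)) :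
    (sg (p.reverse ++ a :: L1 ++ [b]) = b1 ∧ sg (L0 ++ a :: p ++ b :: L2) = b2) ∨
      (sg (p.reverse ++ a :: L1 ++ [b]) = b2 ∧ sg (L0 ++ a :: p ++ b :: L2) = b1) := by
  have h1 := sg_ear p L1 a b
  have h2 := sg_split L0 L1 L2 a b
  have h3 := sg_split L0 p L2 a b
  have hQ : bd (vec (pe (a :: L1 ++ [b]))) = Finsupp.single a 1 + Finsupp.single b 1 :=
    bd_vec_pe _ _ _
  have hQs : ∀ g, vec (pe (a :: L1 ++ [b])) g ≠ 0 → g ∈ cyc (L0 ++ a :: L1 ++ b :: L2) := by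
    intro g hg
    exact (cyc_split L0 L1 L2 a b).symm.subset (List.mem_append_left _ (mem_of_vec_ne hg))
  have := eq_zero_or_sg hf (z := b1 + vec (pe (a :: p ++ [b])) + vec (pe (a :: L1 ++ [b])))
    (by rw [map_add, hbd, hQ, ZMod2_add_self]) (fun g hg => by
      by_contra hn
      have e1 := not_not.1 fun h => hn (hs g h)
      have e2 := not_not.1 fun h => hn (hQs g h)
      rw [Finsupp.add_apply, e1, e2] at hg
      exact hg (add_zero _)) (hsg ▸ hne)
  rw [h1, h3]
  rw [h2] at hsg this
  generalize vec (pe (a :: p ++ [b])) = P at *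
  generalize vec (pe (a :: L1 ++ [b])) = Q at *
  generalize vec (pe (b :: (L2 ++ L0) ++ [a])) = R at *
  have dec : ∀ {x y : EV}, (∀ g, x g = y g) → x = y := fun h => Finsupp.ext h
  have d1 : ∀ p q r x y : ZMod 2, q + r = x + y → x + p + q = 0 → p + q = x ∧ p + r = y := by decide
  have d2 : ∀ p q r x y : ZMod 2, q + r = x + y → x + p + q = q + r → p + q = y ∧ p + r = x := by
    decide
  rcases this with h | h
  · left
    have key := fun g => d1 (P g) (Q g) (R g) (b1 g) (b2 g) (DFunLike.congr_fun hsg g)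
      (DFunLike.congr_fun h g)
    exact ⟨dec fun g => (key g).1, dec fun g => (key g).2⟩
  · right
    have key := fun g => d2 (P g) (Q g) (R g) (b1 g) (b2 g) (DFunLike.congr_fun hsg g)
      (DFunLike.congr_fun h g)
    exact ⟨dec fun g => (key g).1, dec fun g => (key g).2⟩

theorem IsEar.ne {e : Ear} (h : IsEar E e) : e.a ≠ e.b := by
  have := h.nodup
  intro hab
  simp [hab] at this

theorem IsEar.unmerge {e : Ear} (h : IsEar E e) (hb1 : b1 ∈ Zs (addEar E e))
    (h1 : ∀ d ∈ e.edges, b1 d = 1) (hdisj : ∀ g ∈ E, b1 g = 0 ∨ b2 g = 0) (hf : f.Nodup)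
    (hsg : sg f = b1 + b2) : ∃ f1 f2,
      (∀ F, EarStep e (E, f ::ₘ F) (addEar E e, f1 ::ₘ f2 ::ₘ F)) ∧
      ((sg f1 = b1 ∧ sg f2 = b2) ∨ (sg f1 = b2 ∧ sg f2 = b1)) := by
  rw [mem_Zs] at hb1
  have hab := h.ne
  have hnE := fun d (hd : d ∈ e.edges) => h.new' hd
  obtain ⟨a, p, b⟩ := e
  have hπ : (Ear.mk a p b).edges = pe (a :: p ++ [b]) := rfl
  have hA : ∀ g, (b1 + vec (pe (a :: p ++ [b]))) g ≠ 0 → g ∈ E ∧ b1 g ≠ 0 := by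
    intro g hg
    rw [Finsupp.add_apply] at hg
    by_cases hgp : g ∈ pe (a :: p ++ [b])
    · rw [h1 g hgp, vec_apply_of_mem (pe_nodup h.nodup) hgp] at hg
      exact absurd (by decide) hg
    · rw [vec_apply_of_not_mem hgp, add_zero] at hg
      have := hb1.2 g hg
      rw [addEar, hπ, Finset.mem_union, List.mem_toFinset] at this
      exact ⟨this.resolve_right hgp, hg⟩
  have hsgA : ∀ g, (b1 + vec (pe (a :: p ++ [b]))) g ≠ 0 → sg f g ≠ 0 := by
    intro g hg
    obtain ⟨hgE, hg1⟩ := hA g hg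
    rw [hsg, Finsupp.add_apply, (hdisj g hgE).resolve_left hg1, add_zero]
    exact hg1
  have hs : ∀ g, (b1 + vec (pe (a :: p ++ [b]))) g ≠ 0 → g ∈ cyc f :=
    fun g hg => mem_of_vec_ne (hsgA g hg)
  have hbd : bd (b1 + vec (pe (a :: p ++ [b]))) = Finsupp.single a 1 + Finsupp.single b 1 := by
    rw [map_add, hb1.1, zero_add, bd_vec_pe]
  have hmem : ∀ x, (x = a ∨ x = b) → ∃ g, (b1 + vec (pe (a :: p ++ [b]))) g ≠ 0 ∧ x ∈ g := by
    intro x hx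
    by_contra! hno
    have := bd_apply_eq_zero (z := b1 + vec (pe (a :: p ++ [b]))) (x := x) hno
    rw [hbd, Finsupp.add_apply, Finsupp.single_apply, Finsupp.single_apply] at this
    rcases hx with rfl | rfl
    · simp [hab.symm] at this
    · simp [hab] at this
  have hmemf : ∀ x, (x = a ∨ x = b) → x ∈ f := by
    intro x hx
    obtain ⟨g, hg, hxg⟩ := hmem x hx
    have := mem_of_mem_pe (hs g hg) hxg
    rcases List.mem_append.1 this with h | h
    · exact h
    · exact List.mem_of_mem_take h
  have hne : b1 + b2 ≠ 0 := by
    obtain ⟨g, hg, -⟩ := hmem a (.inl rfl)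
    intro h0
    exact hsgA g hg (by rw [hsg, h0]; rfl)
  obtain ⟨s, t, rfl⟩ := List.append_of_mem (hmemf a (.inl rfl))
  have hb := hmemf b (.inr rfl)
  simp only [List.mem_append, List.mem_cons, hab.symm, false_or] at hb
  rcases hb with hb | hb
  · obtain ⟨L0, L1, rfl⟩ := List.append_of_mem hb
    refine ⟨_, _, fun F => EarStep.bwd (L0 := L0) (L1 := L1) (L2 := t), ?_⟩
    have hrev : vec (pe (b :: p.reverse ++ [a])) = vec (pe (a :: p ++ [b])) := by
      refine vec_perm ?_
      rw [show b :: p.reverse ++ [a] = (a :: p ++ [b]).reverse by simp, pe_reverse]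
      exact List.reverse_perm _
    have := unmerge_aux (b1 := b1) (b2 := b2) (p := p.reverse) hf hsg hne
      (by rw [hrev, hbd, add_comm]) (by rw [hrev]; exact hs)
    simpa using this
  · obtain ⟨L1, L2, rfl⟩ := List.append_of_mem hb
    refine ⟨p.reverse ++ a :: L1 ++ [b], s ++ a :: p ++ b :: L2, fun F => ?_, ?_⟩
    · have := EarStep.fwd (e := ⟨a, p, b⟩) (E := E) (F := F) (L0 := s) (L1 := L1) (L2 := L2)
      simpa using this
    · exact unmerge_aux (b1 := b1) (b2 := b2) (p := p) (by simpa using hf) (by simpa using hsg) hne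
        hbd (by simpa using hs)

end Unmerge

/-- An ear decomposition with `N` ears that starts with the edge `uv`. -/
structure EarSeq (u v : ℕ) (e : ℕ → Ear) (Es : ℕ → Finset (Sym2 ℕ)) (N : ℕ) : Prop where
  ne : u ≠ v
  zero : Es 0 = {s(u, v)}
  ear : ∀ i < N, IsEar (Es i) (e i)
  succ : ∀ i < N, Es (i + 1) = addEar (Es i) (e i)

/-- Families of faces that grow along an ear decomposition. -/
structure EarChain (u v : ℕ) (e : ℕ → Ear) (Es : ℕ → Finset (Sym2 ℕ)) (N : ℕ)
    (Fs : ℕ → Multiset (List ℕ)) : Prop where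
  zero : Fs 0 = {[u, v]}
  step : ∀ i < N, EarStep (e i) (Es i, Fs i) (Es (i + 1), Fs (i + 1))

/-- `a` and `b` are joined by a path in `E`, up to cycles. -/
def Linked (E : Finset (Sym2 ℕ)) (a b : ℕ) : Prop :=
  ∃ z : EV, bd z = Finsupp.single a 1 + Finsupp.single b 1 ∧ ∀ e, z e ≠ 0 → e ∈ E

theorem Linked.symm {E : Finset (Sym2 ℕ)} {a b : ℕ} (h : Linked E a b) : Linked E b a := by
  obtain ⟨z, h1, h2⟩ := h
  exact ⟨z, by rw [h1, add_comm], h2⟩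

theorem Linked.trans {E : Finset (Sym2 ℕ)} {a b c : ℕ} (h : Linked E a b) (h' : Linked E b c) :
    Linked E a c := by
  obtain ⟨z, h1, h2⟩ := h
  obtain ⟨z', h1', h2'⟩ := h'
  refine ⟨z + z', ?_, fun e he => ?_⟩
  · rw [map_add, h1, h1', add_assoc, ← add_assoc (Finsupp.single b 1), ZMod2_add_self, zero_add]
  · by_contra hn
    rw [Finsupp.add_apply, not_not.1 fun h => hn (h2 e h), not_not.1 fun h => hn (h2' e h)] at he
    exact he (add_zero _)

theorem Linked.mono {E E' : Finset (Sym2 ℕ)} {a b : ℕ} (h : Linked E a b) (hE : E ⊆ E') :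
    Linked E' a b := by
  obtain ⟨z, h1, h2⟩ := h
  exact ⟨z, h1, fun e he => hE (h2 e he)⟩

theorem Linked.of_pe {E : Finset (Sym2 ℕ)} {a b : ℕ} (l : List ℕ)
    (h : ∀ e ∈ pe (a :: l ++ [b]), e ∈ E) : Linked E a b :=
  ⟨vec (pe (a :: l ++ [b])), bd_vec_pe _ _ _, fun e he => h e (mem_of_vec_ne he)⟩

section EarSeqSec

variable {u v N : ℕ} {e : ℕ → Ear} {Es : ℕ → Finset (Sym2 ℕ)} {Fs : ℕ → Multiset (List ℕ)}

theorem EarSeq.le (h : EarSeq u v e Es N) {M : ℕ} (hM : M ≤ N) : EarSeq u v e Es M :=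
  ⟨h.ne, h.zero, fun i hi => h.ear i (hi.trans_le hM), fun i hi => h.succ i (hi.trans_le hM)⟩

theorem EarSeq.linked (h : EarSeq u v e Es N) : ∀ i ≤ N, ∀ a ∈ vs (Es i), Linked (Es i) u a := by
  intro i
  induction i with
  | zero =>
    intro _ a ha
    rw [h.zero] at *
    simp only [vs, Finset.mem_singleton, exists_eq_left, Sym2.mem_iff, Set.mem_ofPred_eq] at ha
    rcases ha with rfl | rfl
    · exact ⟨0, by rw [ZMod2_add_self, map_zero], by simp⟩
    · exact .of_pe [] (by simp)
  | succ i ih =>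
    intro hi a ha
    have ih := ih (by omega)
    have he := h.ear i hi
    rw [h.succ i hi] at *
    rw [he.vs_add] at ha
    rcases ha with ha | ha
    · exact (ih a ha).mono (subset_addEar _)
    · refine ((ih _ he.left).mono (subset_addEar _)).trans ?_
      obtain ⟨l, m, hlm⟩ := List.append_of_mem ha
      refine .of_pe l fun d hd => Finset.mem_union_right _ ?_
      have := pe_append ((e i).a :: l) (m ++ [(e i).b]) a
      rw [List.mem_toFinset, Ear.edges, hlm,
        show (e i).a :: (l ++ a :: m) ++ [(e i).b] = (e i).a :: l ++ a :: (m ++ [(e i).b]) by simp,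
        this]
      exact List.mem_append_left _ hd

/-- Every edge of an ear decomposition lies on a cycle. -/
theorem EarSeq.cover (h : EarSeq u v e Es N) : ∀ i < N, ∀ g ∈ Es (i + 1),
    ∃ z ∈ Zs (Es (i + 1)), z g ≠ 0 := by
  intro i
  induction i with
  | zero =>
    intro hi g hg
    have he := h.ear 0 hi
    have hne := he.ne
    have hs := h.succ 0 hi
    have hzE : ∀ g ∈ pe ((e 0).a :: (e 0).p ++ [(e 0).b]), g ∈ Es (0 + 1) := by
      intro g hg
      rw [hs]; exact Finset.mem_union_right _ (List.mem_toFinset.2 hg)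
    have huv : s((e 0).a, (e 0).b) ∈ Es 0 := by
      have h1 := he.left
      have h2 := he.right
      rw [h.zero] at *
      simp only [vs, Finset.mem_singleton, exists_eq_left, Sym2.mem_iff, Set.mem_ofPred_eq] at h1 h2
      rcases h1 with h1 | h1 <;> rcases h2 with h2 | h2
      · exact absurd (h1.trans h2.symm) hne
      · rw [h1, h2]; simp
      · rw [h1, h2, Sym2.eq_swap]; simp
      · exact absurd (h1.trans h2.symm) hne
    have hnot : s((e 0).a, (e 0).b) ∉ pe ((e 0).a :: (e 0).p ++ [(e 0).b]) :=
      fun h => he.new' h huv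
    refine ⟨vec (pe ((e 0).a :: (e 0).p ++ [(e 0).b])) + Finsupp.single s((e 0).a, (e 0).b) 1,
      mem_Zs.2 ⟨?_, fun d hd => ?_⟩, ?_⟩
    · rw [map_add, bd_vec_pe, bd_single, bdE_mk, ZMod2_add_self]
    · by_cases hd' : d = s((e 0).a, (e 0).b)
      · rw [hd', hs]; exact subset_addEar _ huv
      · rw [Finsupp.add_apply, Finsupp.single_apply, if_neg (Ne.symm hd'), add_zero] at hd
        exact hzE d (mem_of_vec_ne hd)
    · have hg' : g ∈ Es 0 ∨ g ∈ pe ((e 0).a :: (e 0).p ++ [(e 0).b]) := by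
        rw [hs] at hg
        simpa [addEar, Ear.edges] using hg
      rcases hg' with hg' | hg'
      · have : g = s((e 0).a, (e 0).b) := by
          rw [h.zero, Finset.mem_singleton] at *
          rw [hg', huv]
        rw [this, Finsupp.add_apply, vec_apply_of_not_mem hnot, Finsupp.single_apply, if_pos rfl]
        decide
      · rw [Finsupp.add_apply, vec_apply_of_mem (pe_nodup he.nodup) hg', Finsupp.single_apply,
          if_neg (by rintro rfl; exact hnot hg')]
        decide
  | succ i ih =>
    intro hi g hg
    have he := h.ear _ hi
    have hs := h.succ _ hi
    have hg' : g ∈ Es (i + 1) ∨ g ∈ (e (i + 1)).edges := by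
      rw [hs] at hg
      simpa [addEar] using hg
    rcases hg' with hg' | hg'
    · obtain ⟨z, hz, hzg⟩ := ih (by omega) g hg'
      exact ⟨z, Zs_mono (by rw [hs]; exact subset_addEar _) hz, hzg⟩
    · obtain ⟨z, hz, hzE⟩ := ((h.linked (i + 1) hi.le _ he.left).symm.trans
        (h.linked (i + 1) hi.le _ he.right))
      refine ⟨vec (e (i + 1)).edges + z, mem_Zs.2 ⟨?_, fun d hd => ?_⟩, ?_⟩
      · rw [map_add, Ear.edges, bd_vec_pe, hz, ZMod2_add_self]
      · rw [hs]
        by_cases hzd : z d = 0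
        · rw [Finsupp.add_apply, hzd, add_zero] at hd
          exact Finset.mem_union_right _ (List.mem_toFinset.2 (mem_of_vec_ne hd))
        · exact subset_addEar _ (hzE d hzd)
      · have hzg : z g = 0 := not_not.1 fun h => he.new' hg' (hzE g h)
        rw [Finsupp.add_apply, hzg, vec_apply_of_mem (l := (e (i + 1)).edges)
            (pe_nodup he.nodup) hg']
        decide

theorem EarChain.goodFaces (hc : EarChain u v e Es N Fs) (h : EarSeq u v e Es N) :
    ∀ i ≤ N, GoodFaces (Es i, Fs i) := by
  intro i
  induction i with
  | zero =>
    intro _ f hf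
    rw [hc.zero, Multiset.mem_singleton] at hf
    subst hf
    rw [h.zero]
    simpa [vs] using h.ne
  | succ i ih =>
    intro hi
    exact (hc.step i hi).goodFaces (h.ear i hi) (ih (by omega))

theorem EarChain.planeCert (hc : EarChain u v e Es N Fs) (h : EarSeq u v e Es N) :
    ∀ i ≤ N, PlaneCert (Es i) (Fs i) := by
  intro i
  induction i with
  | zero =>
    intro _
    rw [hc.zero, h.zero]
    exact .edge h.ne
  | succ i ih =>
    intro hi
    exact ((hc.step i hi).moves_and (h.ear i hi)).2 (ih (by omega))

theorem EarSeq.exists_chain_one (h : EarSeq u v e Es 1) {B : Multiset EV}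
    (hB : TwoBasis (Es 1) B) (h0 : (0 : EV) ∉ B) :
    ∃ Fs, EarChain u v e Es 1 Fs ∧ (Fs 1).map sg = B := by
  have he := h.ear 0 one_pos
  have hne := he.ne
  have hs : Es 1 = addEar (Es 0) (e 0) := h.succ 0 one_pos
  have hl := he.left
  have hr := he.right
  rw [h.zero] at hl hr
  obtain ⟨d0, hd0⟩ := (e 0).edges_ne_nil
  have hconst : ∀ b ∈ B, ∀ d ∈ (e 0).edges, b d = 1 := by
    intro b hb
    obtain ⟨c, hc⟩ := he.const (hs ▸ hB.mem b hb)
    rcases ZMod2_cases c with rfl | rfl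
    · exfalso
      apply h0
      have : b = 0 := by
        have hbz := mem_Zs.1 (hB.mem b hb)
        have hsupp : ∀ d, b d ≠ 0 → d = s(u, v) := by
          intro d hd
          have := hbz.2 d hd
          rw [hs, addEar, Finset.mem_union, List.mem_toFinset] at this
          rcases this with h' | h'
          · simpa [h.zero] using h'
          · exact absurd (hc d h') hd
        have h1 : b = Finsupp.single s(u, v) (b s(u, v)) := by
          ext d
          by_cases hd : d = s(u, v)
          · simp [hd]
          · rw [Finsupp.single_apply, if_neg (Ne.symm hd)]
            exact not_not.1 fun h => hd (hsupp d h)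
        have h2 := DFunLike.congr_fun hbz.1 u
        rw [h1, bd_single', bdE_mk] at h2
        have h3 : b s(u, v) = 0 := by simpa [Finsupp.single_apply, h.ne.symm] using h2
        rw [h1, h3, Finsupp.single_zero]
      exact this ▸ hb
    · exact hc
  have hfil : (B.filter fun b => b d0 ≠ 0) = B := by
    rw [Multiset.filter_eq_self]
    intro b hb
    rw [hconst b hb d0 hd0]
    decide
  obtain ⟨b1, b2, hb⟩ : ∃ b1 b2, B = {b1, b2} := by
    rcases hB.apply_even d0 with h' | ⟨b1, b2, h'⟩
    · rw [hfil] at h'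
      obtain ⟨z, hz, hzd⟩ := h.cover 0 one_pos d0 (by
        rw [Nat.zero_add, hs]; exact Finset.mem_union_right _ (List.mem_toFinset.2 hd0))
      have := hB.span hz
      rw [h'] at this
      simp at this
      exact absurd (by rw [this]; rfl) hzd
    · exact ⟨b1, b2, hfil ▸ h'⟩
  have hsg : sg [u, v] = b1 + b2 := by
    have h1 : sg [u, v] = 0 := by
      rw [sg, cyc, show [u, v] ++ [u, v].take 1 = [u, v, u] from rfl]
      simp [Sym2.eq_swap (a := v), ZMod2_add_self]
    have h2 := hB.sum
    rw [hb] at h2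
    rw [h1, ← h2]
    simp
  have hb12 : b1 = b2 := by
    have h2 := hB.sum
    rw [hb] at h2
    have : b1 + b2 = 0 := by simpa using h2
    rw [ZMod2_eq_add this, zero_add]
  subst hb12
  -- all members equal the unique cycle
  have hz : ∀ L1 L2 : List ℕ, ∀ a b : ℕ, ∀ p : List ℕ, vec (pe (a :: p ++ [b])) = vec (e 0).edges →
      s(a, b) = s(u, v) → sg (p.reverse ++ a :: [] ++ [b]) = b1 ∧
        sg ([] ++ a :: p ++ b :: []) = b1 := by
    intro L1 L2 a b p hp hab
    have hb1 : b1 = vec (e 0).edges + Finsupp.single s(u, v) 1 := by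
      have hb1m : b1 ∈ B := by rw [hb]; simp
      have hbz := mem_Zs.1 (hB.mem b1 hb1m)
      have hsupp : ∀ d, (b1 + vec (e 0).edges) d ≠ 0 → d = s(u, v) := by
        intro d hd
        by_cases hde : d ∈ (e 0).edges
        · rw [Finsupp.add_apply, hconst b1 hb1m d hde,
            vec_apply_of_mem (l := (e 0).edges) (pe_nodup he.nodup) hde] at hd
          exact absurd (by decide) hd
        · rw [Finsupp.add_apply, vec_apply_of_not_mem hde, add_zero] at hd
          have := hbz.2 d hd
          rw [hs, addEar, Finset.mem_union, List.mem_toFinset] at this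
          simpa [h.zero] using this.resolve_right hde
      have hbd : bd (b1 + vec (e 0).edges) ≠ 0 := by
        rw [map_add, hbz.1, zero_add, Ear.edges, bd_vec_pe]
        intro h'
        have := DFunLike.congr_fun h' (e 0).a
        simp [hne.symm] at this
      have : b1 + vec (e 0).edges = Finsupp.single s(u, v) 1 := by
        ext d
        by_cases hd : d = s(u, v)
        · subst hd
          rw [Finsupp.single_apply, if_pos rfl]
          refine ZMod2_eq_one fun h' => hbd ?_
          have : b1 + vec (e 0).edges = 0 := by
            ext d
            by_contra hd
            rw [hsupp d hd] at hd
            exact hd h'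
          rw [this, map_zero]
        · rw [Finsupp.single_apply, if_neg (Ne.symm hd)]
          exact not_not.1 fun h => hd (hsupp d h)
      rw [ZMod2_eq_add this, add_comm]
    constructor
    · rw [sg_ear, hb1, hp, ← hab]; simp
    · rw [sg_split, hb1, hp, ← hab]; simp [Sym2.eq_swap (a := b)]
  simp only [vs, Finset.mem_singleton, exists_eq_left, Sym2.mem_iff, Set.mem_ofPred_eq] at hl hr
  have hmain : ∃ f1 f2, EarStep (e 0) (Es 0, {[u, v]}) (Es 1, {f1, f2}) ∧ sg f1 = b1 ∧
      sg f2 = b1 := by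
    rcases hl with hl | hl <;> rcases hr with hr | hr
    · exact absurd (hl.trans hr.symm) hne
    · have := hz [] [] (e 0).a (e 0).b (e 0).p rfl (by rw [hl, hr])
      refine ⟨_, _, ?_, this⟩
      have := EarStep.fwd (e := e 0) (E := Es 0) (F := 0) (L0 := []) (L1 := []) (L2 := [])
      rw [hs]
      rw [hl, hr] at *
      exact this
    · have := hz [] [] (e 0).b (e 0).a (e 0).p.reverse
        (by
          have := Ear.edges_reverse (e 0).a (e 0).b (e 0).p
          refine (congrArg vec this).trans ?_
          exact vec_perm (List.reverse_perm _)) (by rw [hl, hr])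
      rw [List.reverse_reverse] at this
      refine ⟨_, _, ?_, this⟩
      have := EarStep.bwd (e := e 0) (E := Es 0) (F := 0) (L0 := []) (L1 := []) (L2 := [])
      rw [hs]
      rw [hl, hr] at *
      exact this
    · exact absurd (hl.trans hr.symm) hne
  obtain ⟨f1, f2, hstep, h1, h2⟩ := hmain
  refine ⟨fun i => if i = 0 then {[u, v]} else {f1, f2}, ⟨rfl, fun i hi => ?_⟩, ?_⟩
  · have : i = 0 := by omega
    subst this
    exact hstep
  · simp [hb, h1, h2]

/-- A graph with a planar cycle basis and an ear decomposition is built inside its faces. -/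
theorem EarSeq.exists_chain (n : ℕ) : ∀ (_ : EarSeq u v e Es (n + 1)) {B : Multiset EV}
    (_ : TwoBasis (Es (n + 1)) B) (_ : (0 : EV) ∉ B),
    ∃ Fs, EarChain u v e Es (n + 1) Fs ∧ (Fs (n + 1)).map sg = B := by
  induction n with
  | zero => intro h B hB h0; exact h.exists_chain_one hB h0
  | succ n ih =>
    intro h B hB h0
    have hn : n + 1 < n + 1 + 1 := by omega
    have he := h.ear (n + 1) hn
    have hs := h.succ (n + 1) hn
    obtain ⟨d0, hd0⟩ := (e (n + 1)).edges_ne_nil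
    have hsub : Es (n + 1) ⊆ Es (n + 1 + 1) := by rw [hs]; exact subset_addEar _
    obtain ⟨b1, b2, hfil⟩ : ∃ b1 b2, (B.filter fun b => b d0 ≠ 0) = {b1, b2} := by
      rcases hB.apply_even d0 with h' | h'
      · rw [Multiset.filter_eq_nil] at h'
        push Not at h'
        obtain ⟨z, hz, hzd⟩ := h.cover (n + 1) hn d0 (by
          rw [hs]; exact Finset.mem_union_right _ (List.mem_toFinset.2 hd0))
        have : Submodule.span (ZMod 2) {b | b ∈ B} ≤
            LinearMap.ker (Finsupp.lapply (R := ZMod 2) (M := ZMod 2) d0) := by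
          rw [Submodule.span_le]
          intro b hb
          simpa using h' b hb
        exact absurd (by simpa using this (hB.span hz)) hzd
      · exact h'
    set R := B.filter fun b => ¬ b d0 ≠ 0 with hR
    have hBR : B = b1 ::ₘ b2 ::ₘ R := by
      conv_lhs => rw [← Multiset.filter_add_not (fun b : EV => b d0 ≠ 0) B, hfil]
      simp [hR]
    have hm : ∀ b ∈ ({b1, b2} : Multiset EV), b d0 ≠ 0 := by
      intro b hb
      rw [← hfil] at hb
      exact (Multiset.mem_filter.1 hb).2
    have hb1 := hm b1 (by simp)
    have hb2 := hm b2 (by simp)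
    have hR0 : ∀ r ∈ R, r d0 = 0 := fun r hr => by simpa using (Multiset.mem_filter.1 hr).2
    have hmem : ∀ b ∈ b1 ::ₘ b2 ::ₘ R, b ∈ Zs (Es (n + 1 + 1)) := fun b hb => hB.mem b (hBR ▸ hb)
    have hZ : ∀ z ∈ Zs (Es (n + 1 + 1)), z d0 = 0 → z ∈ Zs (Es (n + 1)) := by
      intro z hz hz0
      obtain ⟨c, hc⟩ := he.const (hs ▸ hz)
      have : c = 0 := by rw [← hc d0 hd0, hz0]
      subst this
      rw [mem_Zs] at *
      refine ⟨hz.1, fun d hd => ?_⟩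
      have := hz.2 d hd
      rw [hs, addEar, Finset.mem_union, List.mem_toFinset] at this
      exact this.resolve_right fun h' => hd (hc d h')
    have hmerge := (hBR ▸ hB).merge hsub (he.new' hd0) hZ hb1 hb2 hR0
    have hdisj : ∀ g ∈ Es (n + 1), b1 g = 0 ∨ b2 g = 0 := by
      intro g hg
      by_contra! hno
      obtain ⟨z, hz, hzg⟩ := h.cover n (by omega) g hg
      have hle : Submodule.span (ZMod 2) {b | b ∈ (b1 + b2) ::ₘ R} ≤
          LinearMap.ker (Finsupp.lapply (R := ZMod 2) (M := ZMod 2) g) := by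
        rw [Submodule.span_le]
        intro b hb
        have hb' : b ∈ (b1 + b2) ::ₘ R := hb
        rw [Multiset.mem_cons] at hb'
        simp only [SetLike.mem_coe, LinearMap.mem_ker, Finsupp.lapply_apply]
        rcases hb' with rfl | hb'
        · rw [Finsupp.add_apply, ZMod2_eq_one hno.1, ZMod2_eq_one hno.2]; decide
        · by_contra hbg
          have := hB.two g
          rw [hBR, Multiset.filter_cons_of_pos (p := fun b : EV => b g ≠ 0) _ hno.1,
            Multiset.filter_cons_of_pos (p := fun b : EV => b g ≠ 0) _ hno.2,
            Multiset.card_cons, Multiset.card_cons] at this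
          have hpos : 0 < (R.filter fun b => b g ≠ 0).card :=
            Multiset.card_pos_iff_exists_mem.2 ⟨b, Multiset.mem_filter.2 ⟨hb', hbg⟩⟩
          omega
      exact hzg (by simpa using hle (hmerge.span hz))
    have hb1z : b1 ∈ Zs (addEar (Es (n + 1)) (e (n + 1))) := hs ▸ hmem b1 (by simp)
    have hc1 : ∀ d ∈ (e (n + 1)).edges, b1 d = 1 := by
      obtain ⟨c, hc⟩ := he.const hb1z
      intro d hd
      rw [hc d hd, ← hc d0 hd0, ZMod2_eq_one hb1]
    have h0' : (0 : EV) ∉ (b1 + b2) ::ₘ R := by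
      rw [Multiset.mem_cons]
      rintro (h' | h')
      · have heq : b1 = b2 := by rw [ZMod2_eq_add h'.symm, zero_add]
        have : b1 + vec (e (n + 1)).edges = 0 := by
          ext g
          by_cases hg : g ∈ (e (n + 1)).edges
          · rw [Finsupp.add_apply, hc1 g hg,
              vec_apply_of_mem (l := (e (n + 1)).edges) (pe_nodup he.nodup) hg,
                  Finsupp.zero_apply]; decide
          · rw [Finsupp.add_apply, vec_apply_of_not_mem hg, add_zero]
            by_contra hne
            have := (mem_Zs.1 hb1z).2 g hne
            rw [addEar, Finset.mem_union, List.mem_toFinset] at this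
            have := hdisj g (this.resolve_right hg)
            rw [← heq] at this
            exact hne (this.elim id id)
        have h2 := congrArg bd this
        rw [map_add, (mem_Zs.1 hb1z).1, zero_add, Ear.edges, bd_vec_pe, map_zero] at h2
        have := DFunLike.congr_fun h2 (e (n + 1)).a
        simp [he.ne.symm] at this
      · exact h0 (hBR ▸ by simp [h'])
    obtain ⟨Fs, hFs, hmap⟩ := ih (h.le (by omega)) hmerge h0'
    obtain ⟨f, hf, hsg, hrest⟩ := Multiset.map_eq_cons _ _ _ _ |>.2 hmap
    have hfn := (hFs.goodFaces (h.le (by omega)) (n + 1) le_rfl f hf).1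
    obtain ⟨f1, f2, hstep, hff⟩ := he.unmerge (b2 := b2) hb1z hc1 hdisj hfn hsg
    have hst := hstep ((Fs (n + 1)).erase f)
    rw [Multiset.cons_erase hf, ← hs] at hst
    refine ⟨Function.update Fs (n + 1 + 1) (f1 ::ₘ f2 ::ₘ (Fs (n + 1)).erase f),
        ⟨?_, fun i hi => ?_⟩,
      ?_⟩
    · rw [Function.update_of_ne (by omega)]; exact hFs.zero
    · rw [Function.update_of_ne (by omega)]
      rcases Nat.lt_or_ge i (n + 1) with hi' | hi'
      · rw [Function.update_of_ne (by omega)]; exact hFs.step i hi'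
      · have : i = n + 1 := by omega
        subst this
        rw [Function.update_self]
        exact hst
    · rw [Function.update_self, Multiset.map_cons, Multiset.map_cons, hrest, hBR]
      rcases hff with ⟨h1, h2⟩ | ⟨h1, h2⟩
      · rw [h1, h2]
      · rw [h1, h2, Multiset.cons_swap]

theorem TwoBasis.filter_ne_zero {E : Finset (Sym2 ℕ)} {B : Multiset EV} (h : TwoBasis E B) :
    ∃ B', TwoBasis E B' ∧ (0 : EV) ∉ B' := by
  classical
  refine ⟨B.filter (· ≠ 0), ⟨fun b hb => h.mem b (Multiset.mem_filter.1 hb).1, ?_, fun e => ?_, ?_⟩,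
    by simp⟩
  · refine h.span.trans (Submodule.span_le.2 fun b hb => ?_)
    by_cases hb0 : b = 0
    · rw [hb0]; exact Submodule.zero_mem _
    · exact Submodule.subset_span (Multiset.mem_filter.2 ⟨hb, hb0⟩)
  · exact (Multiset.card_le_card (Multiset.filter_le_filter _ (Multiset.filter_le _ _))).trans
      (h.two e)
  · have : ∀ C : Multiset EV, (C.filter (· ≠ 0)).sum = C.sum := by
      intro C
      induction C using Multiset.induction_on with
      | empty => simp
      | cons b C ih =>
        by_cases hb : b = 0
        · simp [hb, ih]
        · simp only [ne_eq] at ih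
          simp [hb, ih]
    rw [this, h.sum]

end EarSeqSec

/-! ### Existence of ear decompositions -/

section EarExist

variable {G : SimpleGraph ℕ} {S T Q : Set ℕ} {E E' : Finset (Sym2 ℕ)} {u v a b c : ℕ}

/-- All elements of `E` are edges of `G` with both ends in `T`. -/
def Inside (G : SimpleGraph ℕ) (T : Set ℕ) (E : Finset (Sym2 ℕ)) : Prop :=
  ∀ a b, s(a, b) ∈ E → G.Adj a b ∧ a ∈ T ∧ b ∈ T

/-- `E'` arises from `E` by adding an ear. -/
def EarRel (E E' : Finset (Sym2 ℕ)) : Prop := ∃ e, IsEar E e ∧ E' = addEar E e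

theorem Inside.vs (h : Inside G T E) : vs E ⊆ T := by
  rintro x ⟨e, he, hx⟩
  induction e with
  | h a b =>
    rcases Sym2.mem_iff.1 hx with rfl | rfl
    · exact (h _ _ he).2.1
    · exact (h _ _ he).2.2

theorem exists_path (h : Joined G S b c) (hb : b ∈ S) (hc : c ∈ Q) :
    ∃ l d, (∃ m, l ++ [d] = b :: m) ∧ (l ++ [d]).Nodup ∧
        (∀ x y, s(x, y) ∈ pe (l ++ [d]) → G.Adj x y) ∧
      (∀ y ∈ l, y ∈ S ∧ y ∉ Q) ∧ d ∈ Q ∧ d ∈ S := by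
  induction h using ReflTransGen.head_induction_on with
  | refl => exact ⟨[], c, ⟨[], rfl⟩, by simp, by simp, by simp, hc, hb⟩
  | @head x y hxy _ ih =>
    by_cases hx : x ∈ Q
    · exact ⟨[], x, ⟨[], rfl⟩, by simp, by simp, by simp, hx, hb⟩
    obtain ⟨l, d, ⟨m, hm⟩, hnd, hadj, hl, hd, hdS⟩ := ih hxy.2.2
    by_cases hxl : x ∈ l
    · obtain ⟨l1, l2, rfl⟩ := List.append_of_mem hxl
      refine ⟨x :: l2, d, ⟨l2 ++ [d], rfl⟩, ?_, fun p q hpq => hadj p q ?_,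
        fun y hy => hl y (List.mem_append_right _ hy), hd, hdS⟩
      · rw [List.append_assoc] at hnd
        exact (List.nodup_append.1 hnd).2.1
      · rw [List.append_assoc, List.cons_append, pe_append]
        exact List.mem_append_right _ hpq
    · refine ⟨x :: l, d, ⟨l ++ [d], rfl⟩, ?_, fun p q hpq => ?_, ?_, hd, hdS⟩
      · rw [List.cons_append, List.nodup_cons]
        refine ⟨?_, hnd⟩
        rw [List.mem_append, List.mem_singleton]
        rintro (h | rfl)
        exacts [hxl h, hx hd]
      · rw [List.cons_append, hm] at hpq
        rcases List.mem_cons.1 (show s(p, q) ∈ s(x, y) :: pe (y :: m) from hpq) with h | h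
        · rw [← SimpleGraph.mem_edgeSet, h]; exact hxy.1
        · exact hadj p q (hm ▸ h)
      · rintro z hz
        rcases List.mem_cons.1 hz with rfl | hz
        exacts [⟨hb, hx⟩, hl z hz]

theorem exists_ear (hT : ∀ z, ConnOn G (T \ {z})) (hE : Inside G T E) (ha : a ∈ vs E)
    (hc : c ∈ vs E) (hca : c ≠ a) (hab : G.Adj a b) (hb : b ∈ T) (hn : s(a, b) ∉ E) :
    ∃ e, IsEar E e ∧ s(a, b) ∈ addEar E e ∧ Inside G T (addEar E e) := by
  obtain ⟨l, d, ⟨m, hm⟩, hnd, hadj, hl, hd, hdS⟩ := exists_path (Q := vs E)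
    (hT a b ⟨hb, hab.ne'⟩ c ⟨hE.vs hc, hca⟩) ⟨hb, hab.ne'⟩ hc
  have hmem : ∀ y ∈ l ++ [d], y ∈ T \ {a} := by
    intro y hy
    rcases List.mem_append.1 hy with h | h
    · exact (hl y h).1
    · rw [List.mem_singleton.1 h]; exact hdS
  have hedge : Ear.edges ⟨a, l, d⟩ = s(a, b) :: pe (l ++ [d]) := by
    rw [Ear.edges, List.cons_append, hm]; rfl
  refine ⟨⟨a, l, d⟩, ⟨ha, hd, ?_, fun x hx => (hl x hx).2, ?_⟩, ?_, ?_⟩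
  · rw [List.cons_append, List.nodup_cons]
    exact ⟨fun h => (hmem a h).2 rfl, hnd⟩
  · rintro (rfl : l = [])
    have : d = b := by simpa using congrArg List.head? hm
    simpa [this] using hn
  · simp [addEar, hedge]
  · intro x y hxy
    rw [addEar, Finset.mem_union, List.mem_toFinset, hedge, List.mem_cons] at hxy
    rcases hxy with h | h | h
    · exact hE x y h
    · have haT := hE.vs ha
      rcases Sym2.eq_iff.1 h with ⟨rfl, rfl⟩ | ⟨rfl, rfl⟩
      exacts [⟨hab, haT, hb⟩, ⟨hab.symm, hb, haT⟩]
    · exact ⟨hadj x y h, (hmem x (mem_of_mem_pe h (by simp))).1,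
        (hmem y (mem_of_mem_pe h (by simp))).1⟩

/-- `d` is an edge of `G[T]` outside of `E` that meets `E`. -/
def Addable (G : SimpleGraph ℕ) (T : Set ℕ) (E : Finset (Sym2 ℕ)) (d : Sym2 ℕ) : Prop :=
  d ∉ E ∧ ∃ a b, d = s(a, b) ∧ G.Adj a b ∧ a ∈ vs E ∧ b ∈ T

theorem exists_next (f : Sym2 ℕ → ℕ) (hT : ∀ z, ConnOn G (T \ {z})) (huv : u ≠ v)
    (hE : Inside G T E) (hu : s(u, v) ∈ E) :
    ∃ E', E ⊆ E' ∧ Inside G T E' ∧ ((E' = E ∧ ∀ d, ¬ Addable G T E d) ∨ EarRel E E') ∧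
      ∀ d, Addable G T E d → ∃ d', f d' ≤ f d ∧ d' ∉ E ∧ d' ∈ E' := by
  by_cases h : ∃ d, Addable G T E d
  · obtain ⟨d, hd, hmin⟩ : ∃ d, Addable G T E d ∧ ∀ d', Addable G T E d' → f d ≤ f d' := by
      obtain ⟨d, hd, hmin⟩ := WellFounded.has_min
          (InvImage.wf f wellFounded_lt) {d | Addable G T E d} h
      exact ⟨d, hd, fun d' hd' => not_lt.1 (hmin d' hd')⟩
    obtain ⟨hn, a, b, rfl, hab, ha, hb⟩ := hd
    obtain ⟨c, hc, hca⟩ : ∃ c ∈ vs E, c ≠ a := by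
      by_cases hua : u = a
      · exact ⟨v, mem_vs_right hu, hua ▸ huv.symm⟩
      · exact ⟨u, mem_vs_left hu, hua⟩
    obtain ⟨e, he, h1, h2⟩ := exists_ear hT hE ha hc hca hab hb hn
    exact ⟨_, subset_addEar e, h2, .inr ⟨e, he, rfl⟩, fun d' hd' => ⟨_, hmin d' hd', hn, h1⟩⟩
  · push Not at h
    exact ⟨E, subset_rfl, hE, .inl ⟨rfl, h⟩, fun d hd => absurd hd (h d)⟩

theorem Inside.singleton (huv : G.Adj u v) (hu : u ∈ T) (hv : v ∈ T) : Inside G T {s(u, v)} := by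
  intro a b hab
  rcases Sym2.eq_iff.1 (Finset.mem_singleton.1 hab) with ⟨rfl, rfl⟩ | ⟨rfl, rfl⟩
  exacts [⟨huv, hu, hv⟩, ⟨huv.symm, hv, hu⟩]

theorem exists_exhaustion (hT : ∀ z, ConnOn G (T \ {z})) {E0 : Finset (Sym2 ℕ)}
    (h0 : Inside G T E0) (huv : s(u, v) ∈ E0) :
    ∃ Es : ℕ → Finset (Sym2 ℕ), Es 0 = E0 ∧ Monotone Es ∧
      (∀ i, Inside G T (Es i)) ∧
      (∀ i, (Es (i + 1) = Es i ∧ ∀ d, ¬ Addable G T (Es i) d) ∨ EarRel (Es i) (Es (i + 1))) ∧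
      ∀ a ∈ T, ∀ b ∈ T, G.Adj a b → ∃ i, s(a, b) ∈ Es i := by
  obtain ⟨f, hf⟩ := Countable.exists_injective_nat (Sym2 ℕ)
  let X := {E : Finset (Sym2 ℕ) // Inside G T E ∧ s(u, v) ∈ E}
  have hnext : ∀ E : X, ∃ E' : X, E.1 ⊆ E'.1 ∧
      ((E'.1 = E.1 ∧ ∀ d, ¬ Addable G T E.1 d) ∨ EarRel E.1 E'.1) ∧
      ∀ d, Addable G T E.1 d → ∃ d', f d' ≤ f d ∧ d' ∉ E.1 ∧ d' ∈ E'.1 := by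
    intro E
    obtain ⟨E', h1, h2, h3, h4⟩ := exists_next f hT (h0 _ _ huv).1.ne E.2.1 E.2.2
    exact ⟨⟨E', h2, h1 E.2.2⟩, h1, h3, h4⟩
  choose next h1 h2 h3 using hnext
  let Xs : ℕ → X := fun n => next^[n] ⟨E0, h0, huv⟩
  have hXs : ∀ n, Xs (n + 1) = next (Xs n) := fun n => Function.iterate_succ_apply' _ _ _
  have hmono : Monotone fun n => (Xs n).1 := monotone_nat_of_le_succ fun n => by
    simp only [hXs]; exact h1 _
  have hadd : ∀ i d, Addable G T (Xs i).1 d → ∃ j, d ∈ (Xs j).1 := by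
    intro i d hd
    by_contra! hno
    have hadd' : ∀ j, Addable G T (Xs (i + j)).1 d := by
      obtain ⟨-, a, b, rfl, hab, ha, hb⟩ := hd
      exact fun j => ⟨hno _, a, b, rfl, hab, vs_mono (hmono (Nat.le_add_right i j)) ha, hb⟩
    choose g hg1 hg2 hg3 using fun j => h3 _ d (hadd' j)
    have hinj : Function.Injective fun j => (⟨f (g j), Nat.lt_succ_of_le (hg1 j)⟩ : Fin
        (f d + 1)) := by
      have key : ∀ j k, j < k → g j ≠ g k := by
        intro j k hjk h
        refine hg2 k (hmono (show i + j + 1 ≤ i + k by omega) ?_)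
        simp only [hXs]
        exact h ▸ hg3 j
      intro j k hjk
      have hjk : g j = g k := hf (Fin.mk.inj hjk)
      rcases lt_trichotomy j k with h | h | h
      exacts [absurd hjk (key j k h), h, absurd hjk.symm (key k j h)]
    exact not_injective_infinite_finite _ hinj
  have hcover : ∀ a b, G.Adj a b → a ∈ T → b ∈ T → (∃ i, a ∈ vs (Xs i).1) → ∃ i,
      s(a, b) ∈ (Xs i).1 := by
    rintro a b hab ha hb ⟨i, hi⟩
    by_cases h : s(a, b) ∈ (Xs i).1
    · exact ⟨i, h⟩
    · exact hadd i _ ⟨h, a, b, rfl, hab, hi, hb⟩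
  have hreach : ∀ a ∈ T, ∃ i, a ∈ vs (Xs i).1 := by
    intro a ha
    have hTu : ∃ z, z ∉ ({u, a} : Set ℕ) := (Set.toFinite {u, a}).exists_notMem
    obtain ⟨z, hz⟩ := hTu
    have hz : z ≠ u ∧ z ≠ a := by simpa using hz
    have hj := hT z u ⟨(h0 _ _ huv).2.1, fun h => hz.1 h.symm⟩ a ⟨ha, fun h => hz.2 h.symm⟩
    refine (hj.of_closed (P := {a | ∃ i, a ∈ vs (Xs i).1}) ⟨0, s(u, v), (Xs 0).2.2, by simp⟩ ?_).1
    intro x hx y hy hxy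
    obtain ⟨i, hi⟩ := hcover x y hxy hx.1.1 hy.1 hx.2
    exact ⟨i, mem_vs_right hi⟩
  exact ⟨fun n => (Xs n).1, rfl, hmono, fun i => (Xs i).2.1, fun i => by
    simp only [hXs]; exact h2 _, fun a ha b hb hab => hcover a b hab ha hb (hreach a ha)⟩

/-- All edges of `G[T]` for finite `T`. -/
theorem exists_full (hT : ∀ z, ConnOn G (T \ {z})) (hfin : T.Finite) {E0 : Finset (Sym2 ℕ)}
    (hE0 : Inside G T E0) (huv : s(u, v) ∈ E0) : ∃ E, ReflTransGen EarRel E0 E ∧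
      ∀ a b, s(a, b) ∈ E ↔ G.Adj a b ∧ a ∈ T ∧ b ∈ T := by
  obtain ⟨Es, h0, hmono, hin, hstep, hex⟩ := exists_exhaustion hT hE0 huv
  have hreach : ∀ i, ReflTransGen EarRel E0 (Es i) := by
    intro i
    induction i with
    | zero => rw [h0]
    | succ i ih =>
      rcases hstep i with h | h
      · rw [h.1]; exact ih
      · exact ih.tail h
  have hb : ∀ p ∈ T ×ˢ T, ∃ i, G.Adj p.1 p.2 → s(p.1, p.2) ∈ Es i := by
    rintro ⟨a, b⟩ ⟨ha, hb⟩
    by_cases h : G.Adj a b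
    · obtain ⟨i, hi⟩ := hex a ha b hb h
      exact ⟨i, fun _ => hi⟩
    · exact ⟨0, fun h' => absurd h' h⟩
  choose! i hi using hb
  obtain ⟨n, hn⟩ := ((hfin.prod hfin).image i).bddAbove
  refine ⟨Es n, hreach n, fun a b => ⟨hin n a b, fun h => ?_⟩⟩
  exact hmono (hn ⟨(a, b), ⟨h.2.1, h.2.2⟩, rfl⟩) (hi (a, b) ⟨h.2.1, h.2.2⟩ h.1)

theorem exists_infinite_earSeq (hT : ∀ z, ConnOn G (T \ {z})) (hinf : T.Infinite) (huv : G.Adj u v)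
    (hu : u ∈ T) (hv : v ∈ T) : ∃ e Es, (∀ N, EarSeq u v e Es N) ∧ Monotone Es ∧
      (∀ i, Inside G T (Es i)) ∧ ∀ a ∈ T, ∀ b ∈ T, G.Adj a b → ∃ i, s(a, b) ∈ Es i := by
  obtain ⟨Es, h0, hmono, hin, hstep, hex⟩ := exists_exhaustion hT (.singleton huv hu hv)
    (Finset.mem_singleton_self _)
  have hstep' : ∀ i, EarRel (Es i) (Es (i + 1)) := by
    intro i
    refine (hstep i).resolve_left fun h => ?_
    have hui : u ∈ vs (Es i) := ⟨s(u, v), hmono (Nat.zero_le i) (by simp [h0]), by simp⟩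
    obtain ⟨w, hw, hwn⟩ := hinf.exists_notMem_finite (vs_finite (Es i))
    obtain ⟨z, hz⟩ := (Set.toFinite {u, w}).exists_notMem
    have hz : z ≠ u ∧ z ≠ w := by simpa using hz
    obtain ⟨p, q, hpq, hp, hq, hp', hq', -⟩ := (hT z u ⟨hu, fun h => hz.1 h.symm⟩ w
      ⟨hw, fun h => hz.2 h.symm⟩).exists_exit hui hwn
    exact h.2 s(p, q) ⟨fun h => hq' (mem_vs_right h), p, q, rfl, hpq, hp', hq.1⟩
  choose e he using hstep'
  exact ⟨e, Es, fun N => ⟨huv.ne, h0, fun i _ => (he i).1, fun i _ => (he i).2⟩, hmono, hin, hex⟩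

/-! ### Growing faces along ear decompositions -/

/-- Adding an ear to a graph together with its faces. -/
def EarMove (A B : St) : Prop := ∃ e, IsEar A.1 e ∧ EarStep e A B

theorem EarSeq.snoc {e : ℕ → Ear} {Es : ℕ → Finset (Sym2 ℕ)} {N : ℕ} (h : EarSeq u v e Es N)
    (hE : EarRel (Es N) E') :
    ∃ e' Es', EarSeq u v e' Es' (N + 1) ∧ (∀ i ≤ N, Es' i = Es i) ∧ Es' (N + 1) = E' := by
  obtain ⟨e', he', rfl⟩ := hE
  refine ⟨Function.update e N e', Function.update Es (N + 1) (addEar (Es N) e'),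
    ⟨h.ne, ?_, ?_, ?_⟩, fun i hi => Function.update_of_ne (by omega) _ _, Function.update_self ..⟩
  · rw [Function.update_of_ne (by omega)]; exact h.zero
  · intro i hi
    rw [Function.update_of_ne (by omega)]
    rcases Nat.lt_succ_iff_lt_or_eq.1 hi with hi | rfl
    · rw [Function.update_of_ne hi.ne]; exact h.ear i hi
    · rw [Function.update_self]; exact he'
  · intro i hi
    rcases Nat.lt_succ_iff_lt_or_eq.1 hi with hi | rfl
    · rw [Function.update_of_ne (by omega), Function.update_of_ne (by omega),
        Function.update_of_ne hi.ne]
      exact h.succ i hi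
    · rw [Function.update_self, Function.update_self, Function.update_of_ne (by omega)]

theorem exists_seq_of_earRel (huv : u ≠ v) {E0 E1 : Finset (Sym2 ℕ)}
    (h0 : ReflTransGen EarRel {s(u, v)} E0) (h1 : ReflTransGen EarRel E0 E1) :
    ∃ e Es N M, EarSeq u v e Es N ∧ M ≤ N ∧ Es M = E0 ∧ Es N = E1 := by
  have hext : ∀ {E0 E}, (∃ e Es N M, EarSeq u v e Es N ∧ M ≤ N ∧ Es M = E0 ∧ Es N = E) →
      ∀ {E'}, EarRel E E' → ∃ e Es N M, EarSeq u v e Es N ∧ M ≤ N ∧ Es M = E0 ∧ Es N = E' := by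
    rintro E0 E ⟨e, Es, N, M, hs, hM, hM', rfl⟩ E' hE
    obtain ⟨e', Es', h1, h2, h3⟩ := hs.snoc hE
    exact ⟨e', Es', N + 1, M, h1, by omega, by rw [h2 M hM, hM'], h3⟩
  have hbase : ∃ e Es N M, EarSeq u v e Es N ∧ M ≤ N ∧ Es M = E0 ∧ Es N = E0 := by
    have : ∃ e Es N M, EarSeq u v e Es N ∧ M ≤ N ∧ Es M = {s(u, v)} ∧ Es N = E0 := by
      clear h1
      induction h0 with
      | refl => exact ⟨fun _ => ⟨0, [], 0⟩, fun _ => {s(u, v)}, 0, 0,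
          ⟨huv, rfl, by simp, by simp⟩, le_rfl, rfl, rfl⟩
      | tail _ hE ih => exact hext ih hE
    obtain ⟨e, Es, N, M, hs, hM, -, hN⟩ := this
    exact ⟨e, Es, N, N, hs, le_rfl, hN, hN⟩
  induction h1 with
  | refl => exact hbase
  | tail _ hE ih => exact hext ih hE

theorem exists_states (huv : u ≠ v) {E0 E1 : Finset (Sym2 ℕ)}
    (h0 : ReflTransGen EarRel {s(u, v)} E0) (h1 : ReflTransGen EarRel E0 E1) (hne : E1 ≠ {s(u, v)})
    {B : Multiset EV} (hB : TwoBasis E1 B) (hz : (0 : EV) ∉ B) :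
    ∃ F0 F1, ReflTransGen EarMove ({s(u, v)}, {[u, v]}) (E0, F0) ∧ PlaneCert E0 F0 ∧
      GoodFaces (E0, F0) ∧ ReflTransGen EarMove (E0, F0) (E1, F1) := by
  obtain ⟨e, Es, N, M, hs, hM, rfl, rfl⟩ := exists_seq_of_earRel huv h0 h1
  cases N with
  | zero => exact absurd hs.zero hne
  | succ N =>
    obtain ⟨Fs, hF, -⟩ := hs.exists_chain N hB hz
    have key : ∀ k, ∀ m, m + k ≤ N + 1 → ReflTransGen EarMove (Es m, Fs m)
        (Es (m + k), Fs (m + k)) := by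
      intro k
      induction k with
      | zero => intro m _; exact .refl
      | succ k ih =>
        intro m hm
        exact (ih m (by omega)).tail ⟨e (m + k), hs.ear _ (by omega), hF.step _ (by omega)⟩
    refine ⟨Fs M, Fs (N + 1), ?_, hF.planeCert hs M hM, hF.goodFaces hs M hM, ?_⟩
    · have := key M 0 (by omega)
      rwa [zero_add, hs.zero, hF.zero] at this
    · have := key (N + 1 - M) M (by omega)
      rwa [show M + (N + 1 - M) = N + 1 by omega] at this

theorem EarStep.finite (e : Ear) (A : St) : {B | EarStep e A B}.Finite := by
  classical
  obtain ⟨E, F⟩ := A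
  have h1 : {B | EarStep e (E, F) B} ⊆ ⋃ f ∈ (F.toFinset : Set (List ℕ)),
      (fun q : (ℕ × ℕ) × Bool => (addEar E e,
        if q.2 then (e.p.reverse ++ e.a :: (f.drop (q.1.1 + 1)).take q.1.2 ++ [e.b]) ::ₘ
          (f.take q.1.1 ++ e.a :: e.p ++ e.b :: f.drop (q.1.1 + 1 + q.1.2 + 1)) ::ₘ F.erase f
        else (e.p ++ e.b :: (f.drop (q.1.1 + 1)).take q.1.2 ++ [e.a]) ::ₘ
          (f.take q.1.1 ++ e.b :: e.p.reverse ++ e.a :: f.drop (q.1.1 + 1 + q.1.2 + 1)) ::ₘ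
            F.erase f)) '' ((Set.Iic f.length ×ˢ Set.Iic f.length) ×ˢ Set.univ) := by
    intro B hB
    have aux : ∀ L0 L1 L2 : List ℕ, ∀ a b : ℕ,
        (L0 ++ a :: L1 ++ b :: L2).take L0.length = L0 ∧
        ((L0 ++ a :: L1 ++ b :: L2).drop (L0.length + 1)).take L1.length = L1 ∧
        (L0 ++ a :: L1 ++ b :: L2).drop (L0.length + 1 + L1.length + 1) = L2 := by
      intro L0 L1 L2 a b
      have e1 : (L0 ++ a :: L1 ++ b :: L2).drop (L0.length + 1) = L1 ++ b :: L2 := by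
        simp [List.drop_append]
      refine ⟨by simp, by rw [e1]; simp, ?_⟩
      rw [add_assoc (L0.length + 1), ← List.drop_drop, e1]
      simp [List.drop_append]
    cases hB with
    | @fwd _ F L0 L1 L2 =>
      refine Set.mem_biUnion (x := L0 ++ e.a :: L1 ++ e.b :: L2) (by simp) ?_
      obtain ⟨h1, h2, h3⟩ := aux L0 L1 L2 e.a e.b
      exact ⟨((L0.length, L1.length), true), ⟨⟨by simp, by simp; omega⟩, trivial⟩, by
        simp only [h1, h2, h3, if_true, Multiset.erase_cons_head]⟩
    | @bwd _ F L0 L1 L2 =>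
      refine Set.mem_biUnion (x := L0 ++ e.b :: L1 ++ e.a :: L2) (by simp) ?_
      obtain ⟨h1, h2, h3⟩ := aux L0 L1 L2 e.b e.a
      exact ⟨((L0.length, L1.length), false), ⟨⟨by simp, by simp; omega⟩, trivial⟩, by
        simp only [h1, h2, h3, Bool.false_eq_true, if_false, Multiset.erase_cons_head]⟩
  refine (Set.Finite.biUnion (Finset.finite_toSet _) fun f _ => Set.Finite.image _ ?_).subset h1
  exact ((Set.finite_Iic _).prod (Set.finite_Iic _)).prod Set.finite_univ

/-- Faces can be grown along an infinite ear decomposition, by compactness. -/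
theorem exists_infinite_chain {e : ℕ → Ear} {Es : ℕ → Finset (Sym2 ℕ)}
    (h : ∀ N, EarSeq u v e Es N) (hB : ∀ N, ∃ B, TwoBasis (Es N) B) :
    ∃ Fs : ℕ → Multiset (List ℕ), Fs 0 = {[u, v]} ∧
      ∀ i, EarStep (e i) (Es i, Fs i) (Es (i + 1), Fs (i + 1)) := by
  let P : ℕ → Multiset (List ℕ) → Prop := fun n F =>
    ∀ m, ∃ N ≥ m, N ≥ n ∧ ∃ Fs, EarChain u v e Es N Fs ∧ Fs n = F
  have h0 : P 0 {[u, v]} := by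
    intro m
    obtain ⟨B, hB⟩ := hB (m + 1)
    obtain ⟨B', hB', hz⟩ := hB.filter_ne_zero
    obtain ⟨Fs, hF, -⟩ := (h (m + 1)).exists_chain m hB' hz
    exact ⟨m + 1, by omega, by omega, Fs, hF, hF.zero⟩
  have hs : ∀ n F, P n F → ∃ F', EarStep (e n) (Es n, F) (Es (n + 1), F') ∧ P (n + 1) F' := by
    intro n F hP
    have hfin : {F' | EarStep (e n) (Es n, F) (Es (n + 1), F')}.Finite :=
      ((EarStep.finite (e n) (Es n, F)).image Prod.snd).subset fun F' hF' => ⟨_, hF', rfl⟩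
    by_contra! hno
    have hno' : ∀ F' ∈ {F' | EarStep (e n) (Es n, F) (Es (n + 1), F')}, ∃ m, ∀ N ≥ m, N ≥ n + 1 →
        ∀ Fs, EarChain u v e Es N Fs → Fs (n + 1) ≠ F' := by
      intro F' hF'
      have := hno F' hF'
      simp only [P] at this
      push Not at this
      exact this
    choose! m hm using hno'
    obtain ⟨M, hM⟩ := (hfin.image m).bddAbove
    obtain ⟨N, hN, -, Fs, hF, rfl⟩ := hP (max M (n + 1))
    have hst := hF.step n (by omega)
    exact hm _ hst N ((hM ⟨_, hst, rfl⟩).trans (by omega)) (by omega) Fs hF rfl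
  choose f hf1 hf2 using hs
  let Xs : (n : ℕ) → {F // P n F} := fun n =>
    Nat.rec ⟨_, h0⟩ (fun n X => ⟨f n X.1 X.2, hf2 n X.1 X.2⟩) n
  exact ⟨fun n => (Xs n).1, rfl, fun i => hf1 i (Xs i).1 (Xs i).2⟩

end EarExist

/-! ### Contractions -/

/-- The graph obtained from `G[S]` by contracting the fibers of `r`. -/
def contr (G : SimpleGraph ℕ) (S : Set ℕ) (r : ℕ → ℕ) : SimpleGraph ℕ where
  Adj u v := u ≠ v ∧ ∃ u' ∈ S, ∃ v' ∈ S, r u' = u ∧ r v' = v ∧ G.Adj u' v'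
  symm := ⟨fun _ _ ⟨h, u', hu, v', hv, h1, h2, h3⟩ => ⟨h.symm, v', hv, u', hu, h2, h1, h3.symm⟩⟩
  loopless := ⟨fun _ h => h.1 rfl⟩

section Contr

variable {G : SimpleGraph ℕ} {S X Y : Set ℕ} {r : ℕ → ℕ} {a b : ℕ}

theorem Joined.contr (h : Joined G X a b) (hX : X ⊆ S) (hY : ∀ x ∈ X, r x ∈ Y) :
    Joined (contr G S r) Y (r a) (r b) := by
  induction h with
  | refl => exact .refl _
  | @tail x y _ hxy ih =>
    refine ih.trans ?_
    by_cases h : r x = r y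
    · rw [h]; exact .refl _
    · exact .edge ⟨h, x, hX hxy.2.1, y, hX hxy.2.2, rfl, rfl, hxy.1⟩ (hY x hxy.2.1) (hY y hxy.2.2)

theorem Free.contr (h : Free G S) (hr : ∀ v ∈ S, ∀ w ∈ S, r v = r w →
    Joined G {x | x ∈ S ∧ r x = r v} v w) (T : Set ℕ) : Free (contr G S r) T := by
  classical
  rintro ⟨c, hc, -⟩
  have hlift : ∀ B : Set ℕ, ConnOn (K33U.contr G S r) B → ConnOn G {v | v ∈ S ∧ r v ∈ B} := by
    rintro B hB v ⟨hvS, hvB⟩ w ⟨hwS, hwB⟩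
    have hfib : ∀ p ∈ S, ∀ q ∈ S, r p ∈ B → r p = r q → Joined G {v | v ∈ S ∧ r v ∈ B} p q :=
      fun p hp q hq hpB hpq => (hr p hp q hq hpq).mono le_rfl fun _ hx =>
          ⟨hx.1, by rw [hx.2]; exact hpB⟩
    have key : ∀ x, Joined (K33U.contr G S r) B (r v) x → ∀ w ∈ S, r w = x →
        Joined G {v | v ∈ S ∧ r v ∈ B} v w := by
      intro x hx
      induction hx with
      | refl => exact fun w hw hwv => hfib v hvS w hw hvB hwv.symm
      | tail _ hxy ih =>
        rintro w hw rfl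
        obtain ⟨⟨-, p, hp, q, hq, rfl, hqw, hpq⟩, hx, hy⟩ := hxy
        exact ((ih p hp rfl).trans (.edge hpq ⟨hp, hx⟩ ⟨hq, hqw ▸ hy⟩)).trans
          (hfib q hq w hw (hqw ▸ hy) hqw)
    exact key _ (hB _ hvB _ hwB) w hwS rfl
  have hiff : ∀ v a, (if v ∈ S then c (r v) else none) = some a ↔ v ∈ S ∧ c (r v) = some a := by
    intro v a; split_ifs with hv <;> simp [hv]
  have hadj : ∀ a b, K33.Adj a b → ∃ u v, G.Adj u v ∧ (u ∈ S ∧ c (r u) = some a) ∧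
      (v ∈ S ∧ c (r v) = some b) := by
    intro a b hab
    obtain ⟨u, v, ⟨-, u', hu, v', hv, rfl, rfl, huv⟩, h1, h2⟩ := hc.adj a b hab
    exact ⟨u', v', huv, ⟨hu, h1⟩, hv, h2⟩
  refine h ⟨fun v => if v ∈ S then c (r v) else none, ⟨fun a => ?_, fun a => ?_, fun a b hab => ?_⟩,
    fun v a hv => ((hiff v a).1 hv).1⟩
  · obtain ⟨b, hb⟩ : ∃ b, K33.Adj a b := by
      rcases a with i | i
      exacts [⟨.inr 0, by simp⟩, ⟨.inl 0, by simp⟩]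
    obtain ⟨u, v, -, hu, -⟩ := hadj a b hb
    exact ⟨u, (hiff u a).2 hu⟩
  · simp only [hiff]
    exact hlift _ (hc.conn a)
  · simp only [hiff]
    exact hadj a b hab

end Contr

/-! ### Models of `K_{3,3}` -/

section Models

variable {G : SimpleGraph ℕ} {S : Set ℕ} {x y a b c d : ℕ} {L1 L2 L3 L4 f f' : List ℕ}

/-- There is an edge between two lists of vertices. -/
def ListAdj (G : SimpleGraph ℕ) (l m : List ℕ) : Prop := ∃ u ∈ l, ∃ v ∈ m, G.Adj u v

theorem not_free_of_lists (l m : Fin 3 → List ℕ)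
    (hn : (l 0 ++ (l 1 ++ (l 2 ++ (m 0 ++ (m 1 ++ m 2))))).Nodup)
    (hl : ∀ i, ConnOn G {v | v ∈ l i}) (hm : ∀ i, ConnOn G {v | v ∈ m i})
    (hlS : ∀ i, ∀ v ∈ l i, v ∈ S) (hmS : ∀ i, ∀ v ∈ m i, v ∈ S)
    (hadj : ∀ i j, ListAdj G (l i) (m j)) : ¬ Free G S := by
  classical
  let g : Fin 3 ⊕ Fin 3 → List ℕ := Sum.elim l m
  have hdisj : ∀ v p q, v ∈ g p → v ∈ g q → p = q := by
    simp only [List.nodup_append] at hn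
    intro v p q hp hq
    rcases p with p | p <;> rcases q with q | q <;> fin_cases p <;> fin_cases q <;>
      simp only [g, Sum.elim_inl, Sum.elim_inr] at hp hq <;> first | rfl | (exfalso; grind)
  let col : ℕ → Option (Fin 3 ⊕ Fin 3) := fun v => if h : ∃ p, v ∈ g p then some h.choose else none
  have hcol : ∀ v p, col v = some p ↔ v ∈ g p := by
    intro v p
    simp only [col]
    split_ifs with h
    · rw [Option.some_inj]
      exact ⟨fun h' => h' ▸ h.choose_spec, fun h' => hdisj v _ _ h.choose_spec h'⟩
    · simp only [false_iff]; exact fun h' => h ⟨p, h'⟩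
  intro hF
  refine hF ⟨col, ⟨fun p => ?_, fun p => ?_, fun p q hpq => ?_⟩, fun v p hv => ?_⟩
  · simp only [hcol]
    rcases p with i | i
    · obtain ⟨u, hu, -⟩ := hadj i 0
      exact ⟨u, hu⟩
    · obtain ⟨-, -, u, hu, -⟩ := hadj 0 i
      exact ⟨u, hu⟩
  · simp only [hcol]
    rcases p with i | i
    exacts [hl i, hm i]
  · simp only [hcol]
    rcases p with i | i <;> rcases q with j | j
    · simp at hpq
    · obtain ⟨u, hu, v, hv, huv⟩ := hadj i j
      exact ⟨u, v, huv, hu, hv⟩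
    · obtain ⟨u, hu, v, hv, huv⟩ := hadj j i
      exact ⟨v, u, huv.symm, hv, hu⟩
    · simp at hpq
  · have := (hcol v p).1 hv
    rcases p with i | i
    exacts [hlS i v this, hmS i v this]

/-- `f` is a cycle of `G` (or degenerate). -/
def IsCyc (G : SimpleGraph ℕ) (f : List ℕ) : Prop :=
  f.Nodup ∧ ∀ p q, s(p, q) ∈ cyc f → G.Adj p q

theorem IsCyc.rotate (h : IsCyc G f) (hf : f ~r f') : IsCyc G f' := by
  obtain ⟨n, rfl⟩ := hf
  refine ⟨List.nodup_rotate.2 h.1, fun p q hpq => h.2 p q ?_⟩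
  rw [List.rotate_eq_drop_append_take_mod] at hpq
  have := cyc_rotate (f.take (n % f.length)) (f.drop (n % f.length))
  rw [List.take_append_drop] at this
  exact this.symm.subset hpq

theorem connOn_path (L : List ℕ) : ∀ a b, (∀ p q, s(p, q) ∈ pe (a :: L ++ [b]) → G.Adj p q) →
    ConnOn G {v | v ∈ a :: L} ∧ ListAdj G (a :: L) [b] := by
  induction L with
  | nil =>
    intro a b h
    refine ⟨?_, a, by simp, b, by simp, h a b (by simp)⟩
    simpa using ConnOn.singleton a
  | cons c L ih =>
    intro a b h
    obtain ⟨h1, u, hu, v, hv, huv⟩ := ih c b fun p q hpq => h p q (List.mem_cons_of_mem _ hpq)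
    refine ⟨?_, u, List.mem_cons_of_mem _ hu, v, hv, huv⟩
    have := (ConnOn.singleton (G := G) a).union h1 rfl (b := c) (by simp)
      (.inr (h a c (by simp)))
    refine (show ({v | v ∈ a :: c :: L} : Set ℕ) = {a} ∪ {v | v ∈ c :: L} from ?_) ▸ this
    ext z; simp

theorem cyc_four (a b c d : ℕ) (L1 L2 L3 L4 : List ℕ) :
    cyc (a :: L1 ++ b :: L2 ++ c :: L3 ++ d :: L4) =
      pe (a :: L1 ++ [b]) ++ (pe (b :: L2 ++ [c]) ++
          (pe (c :: L3 ++ [d]) ++ pe (d :: L4 ++ [a]))) := by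
  have : a :: L1 ++ b :: L2 ++ c :: L3 ++ d :: L4 =
      a :: (L1 ++ b :: L2 ++ c :: L3 ++ d :: L4) := by simp
  rw [this, cyc_cons]
  have e1 := pe_append (c :: L3) (L4 ++ [a]) d
  have e2 := pe_append (b :: L2) (L3 ++ d :: (L4 ++ [a])) c
  have e3 := pe_append (a :: L1) (L2 ++ c :: (L3 ++ d :: (L4 ++ [a]))) b
  simp only [List.cons_append, List.append_assoc] at *
  rw [e3, e2, e1]

theorem not_free_of_interlaced (hf : IsCyc G f) (hr : f ~r a :: L1 ++ b :: L2 ++ c :: L3 ++ d :: L4)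
    (hfS : ∀ z ∈ f, z ∈ S ∧ z ≠ x ∧ z ≠ y) (hx : x ∈ S) (hy : y ∈ S) (hxy : G.Adj x y)
    (hxa : G.Adj x a) (hyb : G.Adj y b) (hxc : G.Adj x c) (hyd : G.Adj y d) : ¬ Free G S := by
  have hf' := hf.rotate hr
  have hmem : ∀ z ∈ a :: L1 ++ b :: L2 ++ c :: L3 ++ d :: L4, z ∈ S ∧ z ≠ x ∧ z ≠ y :=
    fun z hz => hfS z (hr.mem_iff.2 hz)
  have hadj := hf'.2
  rw [cyc_four] at hadj
  obtain ⟨c1, u1, hu1, v1, hv1, e1⟩ := connOn_path L1 a b fun p q h =>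
    hadj p q (List.mem_append_left _ h)
  obtain ⟨c2, u2, hu2, v2, hv2, e2⟩ := connOn_path L2 b c fun p q h =>
    hadj p q (List.mem_append_right _ (List.mem_append_left _ h))
  obtain ⟨c3, u3, hu3, v3, hv3, e3⟩ := connOn_path L3 c d fun p q h =>
    hadj p q (List.mem_append_right _ (List.mem_append_right _ (List.mem_append_left _ h)))
  obtain ⟨c4, u4, hu4, v4, hv4, e4⟩ := connOn_path L4 d a fun p q h =>
    hadj p q (List.mem_append_right _ (List.mem_append_right _ (List.mem_append_right _ h)))
  rw [List.mem_singleton] at hv1 hv2 hv3 hv4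
  subst hv1 hv2 hv3 hv4
  have hnd := hf'.1
  refine not_free_of_lists ![[x], v1 :: L2, v3 :: L4] ![[y], v4 :: L1, v2 :: L3] ?_ ?_ ?_ ?_ ?_ ?_
  · have hne := hxy.ne
    have hp : ([x] ++ (v1 :: L2 ++ (v3 :: L4 ++ ([y] ++ (v4 :: L1 ++ v2 :: L3))))).Perm
        (x :: y :: (v4 :: L1 ++ v1 :: L2 ++ v2 :: L3 ++ v3 :: L4)) := by
      rw [List.perm_iff_count]
      intro z
      simp only [List.count_cons, List.count_append, List.count_nil]
      omega
    refine hp.nodup_iff.2 (List.nodup_cons.2 ⟨?_, List.nodup_cons.2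
        ⟨fun h => (hmem _ h).2.2 rfl, hnd⟩⟩)
    rw [List.mem_cons]
    rintro (h | h)
    exacts [hne h, (hmem _ h).2.1 rfl]
  · intro i; fin_cases i
    · simpa using ConnOn.singleton x
    · exact c2
    · exact c4
  · intro i; fin_cases i
    · simpa using ConnOn.singleton y
    · exact c1
    · exact c3
  · intro i v hv
    fin_cases i
    · rw [show v = x by simpa using hv]; exact hx
    · exact (hmem v (by rcases List.mem_cons.1 (show v ∈ v1 :: L2 from hv) with h | h <;>
        simp [h])).1
    · exact (hmem v (by rcases List.mem_cons.1 (show v ∈ v3 :: L4 from hv) with h | h <;>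
        simp [h])).1
  · intro i v hv
    fin_cases i
    · rw [show v = y by simpa using hv]; exact hy
    · exact (hmem v (by rcases List.mem_cons.1 (show v ∈ v4 :: L1 from hv) with h | h <;>
        simp [h])).1
    · exact (hmem v (by rcases List.mem_cons.1 (show v ∈ v2 :: L3 from hv) with h | h <;>
        simp [h])).1
  · intro i j
    fin_cases i <;> fin_cases j
    · exact ⟨x, by simp, y, by simp, hxy⟩
    · exact ⟨x, by simp, v4, by simp, hxa⟩
    · exact ⟨x, by simp, v2, by simp, hxc⟩
    · exact ⟨v1, by simp, y, by simp, hyb.symm⟩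
    · exact ⟨v1, by simp, u1, hu1, e1.symm⟩
    · exact ⟨u2, hu2, v2, by simp, e2⟩
    · exact ⟨v3, by simp, y, by simp, hyd.symm⟩
    · exact ⟨u4, hu4, v4, by simp, e4⟩
    · exact ⟨v3, by simp, u3, hu3, e3.symm⟩

end Models

/-! ### Two sets of vertices on a cycle -/

section Cyclic

variable {X Y : ℕ → Prop} {f : List ℕ}

/-- Two elements of `X` separate two elements of `Y` on the cycle `f`. -/
def Interlaced (X Y : ℕ → Prop) (f : List ℕ) : Prop :=
  ∃ a L1 b L2 c L3 d L4, f ~r a :: L1 ++ b :: L2 ++ c :: L3 ++ d :: L4 ∧ X a ∧ Y b ∧ X c ∧ Y d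

/-- All elements of `Y` on `f` lie in a closed segment between two consecutive elements of `X`. -/
def Segmented (X Y : ℕ → Prop) (f : List ℕ) : Prop :=
  ∃ a L1 b L2, f ~r a :: L1 ++ b :: L2 ∧ X a ∧ X b ∧ (∀ z ∈ L1, ¬ X z) ∧ ∀ z ∈ L2, ¬ Y z

/-- `X` and `Y` agree on `f` and have three elements there. -/
def ThreeCommon (X Y : ℕ → Prop) (f : List ℕ) : Prop :=
  ∃ a L1 b L2 c L3, f ~r a :: L1 ++ b :: L2 ++ c :: L3 ∧ (X a ∧ X b ∧ X c) ∧ (Y a ∧ Y b ∧ Y c) ∧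
    ∀ z ∈ f, X z ∨ Y z → z = a ∨ z = b ∨ z = c

theorem isRotated_append (l m : List ℕ) : l ++ m ~r m ++ l :=
  ⟨l.length, by simp [List.rotate_append_length_eq]⟩

theorem exists_rotated_cons {z : ℕ} (hz : z ∈ f) : ∃ M, f ~r z :: M := by
  obtain ⟨l, m, rfl⟩ := List.append_of_mem hz
  exact ⟨m ++ l, isRotated_append l (z :: m)⟩

theorem exists_first {P : ℕ → Prop} {l : List ℕ} (h : ∃ z ∈ l, P z) :
    ∃ l1 z l2, l = l1 ++ z :: l2 ∧ P z ∧ ∀ w ∈ l1, ¬ P w := by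
  induction l with
  | nil => simp at h
  | cons a l ih =>
    by_cases ha : P a
    · exact ⟨[], a, l, rfl, ha, by simp⟩
    · obtain ⟨z, hz, hP⟩ := h
      obtain ⟨l1, z, l2, rfl, h1, h2⟩ := ih ⟨z, (List.mem_cons.1 hz).resolve_left fun h =>
          ha (h ▸ hP), hP⟩
      refine ⟨a :: l1, z, l2, rfl, h1, fun w hw => ?_⟩
      rcases List.mem_cons.1 hw with rfl | hw
      exacts [ha, h2 w hw]

theorem exists_last {P : ℕ → Prop} {l : List ℕ} (h : ∃ z ∈ l, P z) :
    ∃ l1 z l2, l = l1 ++ z :: l2 ∧ P z ∧ ∀ w ∈ l2, ¬ P w := by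
  obtain ⟨z, hz, hP⟩ := h
  obtain ⟨l1, z, l2, h1, h2, h3⟩ := exists_first (l := l.reverse) ⟨z, List.mem_reverse.2 hz, hP⟩
  refine ⟨l2.reverse, z, l1.reverse, ?_, h2, by simpa using h3⟩
  rw [← List.reverse_reverse l, h1]; simp

theorem segmented_or_interlaced (hX : ∃ p ∈ f, ∃ q ∈ f, p ≠ q ∧ X p ∧ X q)
    (hy : ∃ y ∈ f, Y y ∧ ¬ X y) : Interlaced X Y f ∨ Segmented X Y f := by
  obtain ⟨y, hyf, hYy, hXy⟩ := hy
  obtain ⟨M, hM⟩ := exists_rotated_cons hyf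
  obtain ⟨p, hp, q, hq, hpq, hXp, hXq⟩ := hX
  have hmem : ∀ z ∈ f, X z → z ∈ M := fun z hz hXz =>
    (List.mem_cons.1 (hM.mem_iff.1 hz)).resolve_left fun h => hXy (h ▸ hXz)
  obtain ⟨P, b, R, rfl, hXb, hP⟩ := exists_first ⟨p, hmem p hp hXp, hXp⟩
  have hR : ∃ z ∈ R, X z := by
    have hor : ∀ z ∈ f, X z → z = b ∨ z ∈ R := fun z hz hXz => by
      rcases List.mem_append.1 (hmem z hz hXz) with h | h
      · exact absurd hXz (hP z h)
      · exact List.mem_cons.1 h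
    rcases hor p hp hXp with rfl | h
    · exact ⟨q, (hor q hq hXq).resolve_left hpq.symm, hXq⟩
    · exact ⟨p, h, hXp⟩
  obtain ⟨R1, a, R2, rfl, hXa, hR2⟩ := exists_last hR
  have hrot : f ~r a :: (R2 ++ y :: P) ++ b :: R1 := by
    refine hM.trans ?_
    have := isRotated_append (y :: P ++ b :: R1) (a :: R2)
    simpa using this
  by_cases hd : ∃ d ∈ R1, Y d
  · obtain ⟨d, hd, hYd⟩ := hd
    obtain ⟨Q1, Q2, rfl⟩ := List.append_of_mem hd
    exact .inl ⟨a, R2, y, P, b, Q1, d, Q2, by simpa using hrot, hXa, hYy, hXb, hYd⟩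
  · push Not at hd
    refine .inr ⟨a, R2 ++ y :: P, b, R1, hrot, hXa, hXb, fun z hz => ?_, hd⟩
    rcases List.mem_append.1 hz with h | h
    · exact hR2 z h
    · rcases List.mem_cons.1 h with rfl | h
      exacts [hXy, hP z h]

theorem cyclic_cases (hf : f.Nodup) (hX : ∃ p ∈ f, ∃ q ∈ f, p ≠ q ∧ X p ∧ X q)
    (hY : ∃ p ∈ f, ∃ q ∈ f, p ≠ q ∧ Y p ∧ Y q) :
    Interlaced X Y f ∨ Segmented X Y f ∨ ThreeCommon X Y f := by
  by_cases hyX : ∃ y ∈ f, Y y ∧ ¬ X y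
  · exact (segmented_or_interlaced hX hyX).imp_right .inl
  push Not at hyX
  obtain ⟨p, hp, q, hq, hpq, hYp, hYq⟩ := hY
  obtain ⟨M, hM⟩ := exists_rotated_cons hp
  have hqM : q ∈ M := (List.mem_cons.1 (hM.mem_iff.1 hq)).resolve_left hpq.symm
  by_cases h3 : ∃ w ∈ f, Y w ∧ w ≠ p ∧ w ≠ q
  · obtain ⟨w, hw, hYw, hwp, hwq⟩ := h3
    have hwM : w ∈ M := (List.mem_cons.1 (hM.mem_iff.1 hw)).resolve_left hwp
    have hsplit : ∃ L1 b L2 c L3, M = L1 ++ b :: L2 ++ c :: L3 ∧ Y b ∧ Y c := by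
      obtain ⟨L, L', rfl⟩ := List.append_of_mem hqM
      rcases List.mem_append.1 hwM with h | h
      · obtain ⟨L1, L2, rfl⟩ := List.append_of_mem h
        exact ⟨L1, w, L2, q, L', rfl, hYw, hYq⟩
      · obtain ⟨L2, L3, rfl⟩ := List.append_of_mem ((List.mem_cons.1 h).resolve_left hwq)
        exact ⟨L, q, L2, w, L3, by simp, hYq, hYw⟩
    obtain ⟨L1, b, L2, c, L3, rfl, hYb, hYc⟩ := hsplit
    have hXf : ∀ z ∈ p :: (L1 ++ b :: L2 ++ c :: L3), Y z → X z := fun z hz =>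
        hyX z (hM.mem_iff.2 hz)
    have hXp := hXf p (by simp) hYp
    have hXb := hXf b (by simp) hYb
    have hXc := hXf c (by simp) hYc
    by_cases hd : ∃ d ∈ f, (X d ∨ Y d) ∧ d ≠ p ∧ d ≠ b ∧ d ≠ c
    · obtain ⟨d, hdf, hd, hdp, hdb, hdc⟩ := hd
      have hXd : X d := hd.elim id (hyX d hdf)
      have hdM := hM.mem_iff.1 hdf
      simp only [List.mem_append, List.mem_cons, hdp, hdb, hdc, false_or] at hdM
      left
      rcases hdM with (h | h) | h
      · obtain ⟨N1, N2, rfl⟩ := List.append_of_mem h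
        refine ⟨d, N2, b, L2, c, L3, p, N1, hM.trans ?_, hXd, hYb, hXc, hYp⟩
        simpa using isRotated_append (p :: N1) (d :: N2 ++ b :: L2 ++ c :: L3)
      · obtain ⟨N1, N2, rfl⟩ := List.append_of_mem h
        refine ⟨d, N2, c, L3, p, L1, b, N1, hM.trans ?_, hXd, hYc, hXp, hYb⟩
        simpa using isRotated_append (p :: L1 ++ b :: N1) (d :: N2 ++ c :: L3)
      · obtain ⟨N1, N2, rfl⟩ := List.append_of_mem h
        refine ⟨d, N2, p, L1, b, L2, c, N1, hM.trans ?_, hXd, hYp, hXb, hYc⟩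
        simpa using isRotated_append (p :: L1 ++ b :: L2 ++ c :: N1) (d :: N2)
    · push Not at hd
      refine .inr (.inr ⟨p, L1, b, L2, c, L3, by simpa using hM, ⟨hXp, hXb, hXc⟩, ⟨hYp, hYb, hYc⟩,
        fun z hz h => ?_⟩)
      by_contra! hne
      exact hne.2.2 (hd z hz h hne.1 hne.2.1)
  · push Not at h3
    obtain ⟨M1, M2, rfl⟩ := List.append_of_mem hqM
    have hXp := hyX p hp hYp
    have hXq := hyX q hq hYq
    have hnd : (p :: (M1 ++ q :: M2)).Nodup := hM.nodup_iff.1 hf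
    simp only [List.nodup_cons, List.mem_append, List.mem_cons, List.nodup_append, not_or] at hnd
    have hY' : ∀ w, w ∈ M1 ∨ w ∈ M2 → ¬ Y w := fun w hw hYw => by
      have hwf : w ∈ f := hM.mem_iff.2 (by
        rcases hw with h | h <;> simp [h])
      have hwp : w ≠ p := by rintro rfl; exact hw.elim hnd.1.1 hnd.1.2.2
      obtain rfl := h3 w hwf hYw hwp
      exact hw.elim (fun h => hnd.2.2.2 _ h _ (.inl rfl) rfl) hnd.2.2.1.1
    have hrot : f ~r q :: M2 ++ p :: M1 := hM.trans (isRotated_append (p :: M1) (q :: M2))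
    by_cases h1 : ∃ x ∈ M1, X x
    · obtain ⟨x1, hx1, hXx1⟩ := h1
      by_cases h2 : ∃ x ∈ M2, X x
      · obtain ⟨x2, hx2, hXx2⟩ := h2
        obtain ⟨N1, N2, rfl⟩ := List.append_of_mem hx1
        obtain ⟨K1, K2, rfl⟩ := List.append_of_mem hx2
        refine .inl ⟨x1, N2, q, K1, x2, K2, p, N1, hM.trans ?_, hXx1, hYq, hXx2, hYp⟩
        simpa using isRotated_append (p :: N1) (x1 :: N2 ++ q :: K1 ++ x2 :: K2)
      · push Not at h2
        exact .inr (.inl ⟨q, M2, p, M1, hrot, hXq, hXp, h2, fun z hz => hY' z (.inl hz)⟩)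
    · push Not at h1
      exact .inr (.inl ⟨p, M1, q, M2, hM, hXp, hXq, h1, fun z hz => hY' z (.inr hz)⟩)

end Cyclic

/-! ### Splitting a vertex in the centre of a face -/

section Split

variable {E : Finset (Sym2 ℕ)} {F : Multiset (List ℕ)}

theorem cyc_perm_of_isRotated {f f' : List ℕ} (h : f ~r f') : (cyc f).Perm (cyc f') := by
  obtain ⟨n, rfl⟩ := h
  rw [List.rotate_eq_drop_append_take_mod]
  conv_lhs => rw [← List.take_append_drop (n % f.length) f]
  exact cyc_rotate _ _

theorem PlaneCert.rotate {f f' : List ℕ} (h : PlaneCert E (f ::ₘ F)) (hf : f ~r f') :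
    PlaneCert E (f' ::ₘ F) :=
  h.perm rfl (cyc_perm_of_isRotated hf.symm)

theorem PlaneCert.fan {x c : ℕ} (P : ℕ → Prop) (L : List ℕ) :
    ∀ {E : Finset (Sym2 ℕ)} {F : Multiset (List ℕ)} {R : List ℕ},
      PlaneCert E ((x :: c :: (L ++ R)) ::ₘ F) → (∀ z ∈ L, P z → s(x, z) ∉ E) → L.Nodup →
      ∃ (E' : Finset (Sym2 ℕ)) (F' : Multiset (List ℕ)), PlaneCert E' (F' + F) ∧
        ∀ e, e ∈ E' ↔ e ∈ E ∨ ∃ z ∈ L, P z ∧ e = s(x, z) := by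
  induction L using List.reverseRecOn with
  | nil => exact fun {E F R} h _ _ => ⟨E, {x :: c :: ([] ++ R)}, by simpa using h, by simp⟩
  | append_singleton L z ih =>
    intro E F R h hE hL
    rw [List.nodup_append] at hL
    by_cases hz : P z
    · have h1 : PlaneCert (insert s(x, z) E) ((x :: c :: (L ++ [z])) ::ₘ (x :: z :: R) ::ₘ F) := by
        have := PlaneCert.chord (L0 := []) (L1 := c :: L) (L2 := R) (a := x) (b := z) (F := F)
          (by simpa using h) (hE z (by simp) hz)
        simpa using this
      obtain ⟨E', F', h2, h3⟩ := ih h1 (fun w hw hP => by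
        rw [Finset.mem_insert, not_or]
        refine ⟨fun h4 => ?_, hE w (by simp [hw]) hP⟩
        have : w = z := by
          rcases Sym2.eq_iff.1 h4 with h | h
          exacts [h.2, h.2.trans h.1]
        exact hL.2.2 w hw z (by simp) this) hL.1
      refine ⟨E', (x :: z :: R) ::ₘ F', by simpa using h2, fun e => ?_⟩
      rw [h3, Finset.mem_insert]
      constructor
      · rintro ((rfl | h) | ⟨w, hw, hP, rfl⟩)
        exacts [.inr ⟨z, by simp, hz, rfl⟩, .inl h, .inr ⟨w, by simp [hw], hP, rfl⟩]
      · rintro (h | ⟨w, hw, hP, rfl⟩)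
        · exact .inl (.inr h)
        · rcases List.mem_append.1 hw with hw | hw
          · exact .inr ⟨w, hw, hP, rfl⟩
          · obtain rfl := List.mem_singleton.1 hw
            exact .inl (.inl rfl)
    · obtain ⟨E', F', h2, h3⟩ := ih (R := z :: R) (by simpa using h)
        (fun w hw => hE w (by simp [hw])) hL.1
      refine ⟨E', F', h2, fun e => ?_⟩
      rw [h3]
      refine or_congr_right ⟨fun ⟨w, hw, h⟩ => ⟨w, by simp [hw], h⟩, fun ⟨w, hw, h⟩ => ?_⟩
      rcases List.mem_append.1 hw with hw | hw
      · exact ⟨w, hw, h⟩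
      · exact absurd (List.mem_singleton.1 hw ▸ h.1) hz

theorem mem_addEar_single {a x b : ℕ} {e : Sym2 ℕ} :
    e ∈ addEar E ⟨a, [x], b⟩ ↔ e ∈ E ∨ e = s(x, a) ∨ e = s(x, b) := by
  simp [addEar, Ear.edges, pe, Sym2.eq_swap (a := a), or_left_comm, or_comm]

theorem not_mem_of_fresh {x z : ℕ} (hx : x ∉ vs E) : s(x, z) ∉ E := fun h => hx (mem_vs_left h)

theorem PlaneCert.split {X Y : ℕ → Prop} {f L1 L2 : List ℕ} {a b x y : ℕ}
    (h : PlaneCert E (f ::ₘ F))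
    (hf : f ~r a :: L1 ++ b :: L2) (hnd : f.Nodup) (hfE : ∀ z ∈ f, z ∈ vs E)
    (hx : x ∉ vs E) (hy : y ∉ vs E) (hxy : x ≠ y) (hXa : X a) (hXb : X b) (hL1 : ∀ z ∈ L1, ¬ X z)
    (hL2 : ∀ z ∈ L2, ¬ Y z) (hY : ∃ z ∈ f, Y z) :
    ∃ (E' : Finset (Sym2 ℕ)) (F' : Multiset (List ℕ)), PlaneCert E' F' ∧
      ∀ e, e ∈ E' ↔ e ∈ E ∨ e = s(x, y) ∨ (∃ z ∈ f, X z ∧ e = s(x, z)) ∨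
        ∃ z ∈ f, Y z ∧ e = s(y, z) := by
  have hmem : ∀ z, z ∈ f ↔ z = a ∨ z ∈ L1 ∨ z = b ∨ z ∈ L2 := fun z => by
    rw [hf.mem_iff]; simp
  have hnd1 := hf.nodup_iff.1 hnd
  have hvs : ∀ z ∈ f, z ≠ x ∧ z ≠ y := fun z hz =>
    ⟨fun h => hx (h ▸ hfE z hz), fun h => hy (h ▸ hfE z hz)⟩
  have ha := (hmem a).2 (.inl rfl)
  have hb := (hmem b).2 (.inr (.inr (.inl rfl)))
  have hab : a ≠ b := by
    rintro rfl; simp at hnd1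
  have he1 : IsEar E ⟨a, [x], b⟩ := ⟨hfE a ha, hfE b hb, by
    simp [(hvs a ha).1, (hvs b hb).1.symm, hab], by simpa using hx, by simp⟩
  have h1 := (EarStep.fwd (e := ⟨a, [x], b⟩) (E := E) (F := F) (L0 := []) (L1 := L1)
    (L2 := L2)).moves_and he1 |>.2 (h.rotate hf)
  simp only [List.nil_append] at h1
  rw [Multiset.cons_swap] at h1
  have h2 := h1.rotate (f' := x :: b :: (L2 ++ [a])) (by
    simpa using isRotated_append [a] (x :: b :: L2))
  have hL2nd : L2.Nodup := by
    have := (List.nodup_append.1 hnd1).2.1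
    exact (List.nodup_cons.1 this).2
  have haL2 : a ∉ L2 := by
    intro h
    exact (List.nodup_append.1 hnd1).2.2 a (by simp) a (by simp [h]) rfl
  have hbL2 : b ∉ L2 := (List.nodup_cons.1 (List.nodup_append.1 hnd1).2.1).1
  obtain ⟨E2, F2, h3, hE2⟩ := PlaneCert.fan X L2 h2 (fun z hz _ => by
    rw [mem_addEar_single, not_or, not_or]
    refine ⟨not_mem_of_fresh hx, fun h => ?_, fun h => ?_⟩
    · rw [Sym2.congr_right] at h; exact haL2 (h ▸ hz)
    · rw [Sym2.congr_right] at h; exact hbL2 (h ▸ hz)) hL2nd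
  have hE2' : ∀ e, e ∈ E2 ↔ e ∈ E ∨ ∃ z ∈ f, X z ∧ e = s(x, z) := by
    intro e
    rw [hE2, mem_addEar_single]
    constructor
    · rintro ((h | rfl | rfl) | ⟨z, hz, hX, rfl⟩)
      exacts [.inl h, .inr ⟨a, ha, hXa, rfl⟩, .inr ⟨b, hb, hXb, rfl⟩,
        .inr ⟨z, (hmem z).2 (by simp [hz]), hX, rfl⟩]
    · rintro (h | ⟨z, hz, hX, rfl⟩)
      · exact .inl (.inl h)
      · rcases (hmem z).1 hz with rfl | h | rfl | h
        exacts [.inl (.inr (.inl rfl)), absurd hX (hL1 z h), .inl (.inr (.inr rfl)),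
          .inr ⟨z, h, hX, rfl⟩]
  obtain ⟨w0, hw0, hYw0⟩ := hY
  obtain ⟨m1, w, m2, hm, hYw, hm1⟩ := exists_first (P := Y) (l := a :: L1 ++ [b]) ⟨w0, by
    rcases (hmem w0).1 hw0 with rfl | h | rfl | h
    · simp
    · simp [h]
    · simp
    · exact absurd hYw0 (hL2 _ h), hYw0⟩
  have hmemY : ∀ z, Y z → (z ∈ f ↔ z = w ∨ z ∈ m2) := fun z hz => by
    have h1 : z ∈ f ↔ z ∈ a :: L1 ++ [b] := by
      rw [hmem]
      have : z ∉ L2 := fun h => hL2 z h hz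
      simp [this]
    rw [h1, hm]
    have : z ∉ m1 := fun h => hm1 z h hz
    simp [this]
  have hw := (hmemY w hYw).2 (.inl rfl)
  have hmnd : (m1 ++ w :: m2).Nodup := by
    rw [← hm]
    refine hnd1.sublist ?_
    simp
  have hyE2 : y ∉ vs E2 := by
    rintro ⟨e, he, hye⟩
    rcases (hE2' e).1 he with h | ⟨z, hz, -, rfl⟩
    · exact hy ⟨e, h, hye⟩
    · rcases Sym2.mem_iff.1 hye with h | h
      exacts [hxy h.symm, (hvs z hz).2 h.symm]
  have he2 : IsEar E2 ⟨x, [y], w⟩ := by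
    refine ⟨mem_vs_left ((hE2' s(x, a)).2 (.inr ⟨a, ha, hXa, rfl⟩)), ?_, ?_, by simpa using hyE2,
      by simp⟩
    · obtain ⟨e, he, hwe⟩ := hfE w hw
      exact ⟨e, (hE2' e).2 (.inl he), hwe⟩
    · simp [hxy, (hvs w hw).1.symm, (hvs w hw).2.symm]
  have h4 : PlaneCert E2 ((x :: m1 ++ w :: m2) ::ₘ (F2 + F)) := by
    rw [List.cons_append, ← hm]
    simpa using h3
  have h5 := (EarStep.fwd (e := ⟨x, [y], w⟩) (E := E2) (F := F2 + F) (L0 := []) (L1 := m1)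
    (L2 := m2)).moves_and he2 |>.2 h4
  simp only [List.nil_append] at h5
  rw [Multiset.cons_swap] at h5
  have h6 := h5.rotate (f' := y :: w :: (m2 ++ [x])) (by
    simpa using isRotated_append [x] (y :: w :: m2))
  have hm2 := (List.nodup_append.1 hmnd).2.1
  obtain ⟨E3, F3, h7, hE3⟩ := PlaneCert.fan Y m2 h6 (fun z hz hYz => by
    rw [mem_addEar_single, not_or, not_or]
    refine ⟨not_mem_of_fresh hyE2, fun h => ?_, fun h => ?_⟩
    · rw [Sym2.congr_right] at h; exact (hvs z ((hmemY z hYz).2 (.inr hz))).1 h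
    · rw [Sym2.congr_right] at h
      exact (List.nodup_cons.1 hm2).1 (h ▸ hz)) (List.nodup_cons.1 hm2).2
  refine ⟨E3, _, h7, fun e => ?_⟩
  rw [hE3, mem_addEar_single, hE2', Sym2.eq_swap (a := y) (b := x)]
  constructor
  · rintro (((h | h) | h | rfl) | ⟨z, hz, hYz, rfl⟩)
    exacts [.inl h, .inr (.inr (.inl h)), .inr (.inl h), .inr (.inr (.inr ⟨w, hw, hYw, rfl⟩)),
      .inr (.inr (.inr ⟨z, (hmemY z hYz).2 (.inr hz), hYz, rfl⟩))]
  · rintro (h | h | h | ⟨z, hz, hYz, rfl⟩)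
    · exact .inl (.inl (.inl h))
    · exact .inl (.inr (.inl h))
    · exact .inl (.inl (.inr h))
    · rcases (hmemY z hYz).1 hz with rfl | h
      exacts [.inl (.inr (.inr rfl)), .inr ⟨z, h, hYz, rfl⟩]

end Split

/-! ### Contractible edges in 3-connected graphs -/

section Contractible

variable {V : Type*} {G : SimpleGraph V} {S : Set V}

/-- Deleting at most two vertices does not disconnect `G[S]`. -/
def C3 (G : SimpleGraph V) (S : Set V) : Prop := ∀ s t, ConnOn G (S \ {s, t})

theorem C3.two (h : C3 G S) (z : V) : ConnOn G (S \ {z}) := by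
  simpa using h z z

theorem C3.exists_adj (h : C3 G S) {v s t : V} (hv : v ∈ S) (hs : v ≠ s) (ht : v ≠ t)
    (ho : ∃ o ∈ S, o ≠ s ∧ o ≠ t ∧ o ≠ v) : ∃ w ∈ S, G.Adj v w ∧ w ≠ s ∧ w ≠ t := by
  obtain ⟨o, hoS, h1, h2, h3⟩ := ho
  obtain ⟨u, w, huw, hu, hw, huv, -, -⟩ :=
    (h s t v ⟨hv, by simp [hs, ht]⟩ o ⟨hoS, by simp [h1, h2]⟩).exists_exit (P := {v}) rfl h3
  obtain rfl : u = v := huv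
  have := hw.2
  simp only [Set.mem_insert_iff, Set.mem_singleton_iff, not_or] at this
  exact ⟨w, hw.1, huw, this⟩

theorem comp_exit {s a b : V} {T : Set V} (hT : T ⊆ S) (h : ConnOn G S)
    (ha : a ∈ T) (hb : b ∈ S) (hab : ¬ Joined G T a b)
    (hST : ∀ w ∈ S, w ∉ T → w = s) : ∃ u ∈ comp G T a, G.Adj u s ∧ s ∈ S := by
  obtain ⟨u, w, huw, -, hw, hu, hwn, -⟩ := (h a (hT ha) b hb).exists_exit
    (P := comp G T a) (mem_comp_self ha) fun h => hab h.2
  have : w ∉ T := fun hwT => hwn (comp_closed hu hwT huw)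
  obtain rfl := hST w hw this
  exact ⟨u, hu, huw, hw⟩

theorem C3.not_all_separate (h : C3 G S) (hfin : S.Finite)
    (hsep : ∀ x ∈ S, ∀ y ∈ S, G.Adj x y → ∃ z, ¬ ConnOn G (S \ {x, y, z})) (n : ℕ) :
    ∀ x ∈ S, ∀ y ∈ S, ∀ z p q, G.Adj x y → p ∈ S \ {x, y, z} → q ∈ S \ {x, y, z} →
      ¬ Joined G (S \ {x, y, z}) p q → (comp G (S \ {x, y, z}) p).ncard ≠ n := by
  induction n using Nat.strong_induction_on with
  | _ n ih =>
    intro x hx y hy z p q hxy hp hq hpq hn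
    have hsub : S \ {x, y, z} ⊆ S \ {x, y} := fun v hv => ⟨hv.1, fun h => hv.2 (by
      simp only [Set.mem_insert_iff, Set.mem_singleton_iff] at *; tauto)⟩
    obtain ⟨v, hv, hvz, hz⟩ := comp_exit (s := z) hsub (h x y) hp (hsub hq) hpq (by
      intro w hw hwn
      by_contra hwz
      exact hwn ⟨hw.1, fun h => hw.2 (by
        simp only [Set.mem_insert_iff, Set.mem_singleton_iff] at *; tauto)⟩)
    have hvS := (comp_subset hv).1
    have hvn := (comp_subset hv).2
    simp only [Set.mem_insert_iff, Set.mem_singleton_iff, not_or] at hvn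
    obtain ⟨w, hw⟩ := hsep z hz.1 v hvS hvz.symm
    simp only [ConnOn, not_forall] at hw
    obtain ⟨p1, hp1, p2, hp2, h12⟩ := hw
    obtain ⟨p', q', hp', hq', hpq', hxD, hyD⟩ : ∃ p' q', p' ∈ S \ {z, v, w} ∧ q' ∈ S \ {z, v, w} ∧
        ¬ Joined G (S \ {z, v, w}) p' q' ∧ x ∉ comp G (S \ {z, v, w}) p' ∧
        y ∉ comp G (S \ {z, v, w}) p' := by
      by_cases h1 : x ∈ comp G (S \ {z, v, w}) p1 ∨ y ∈ comp G (S \ {z, v, w}) p1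
      · have hno : ∀ a b, (a = b ∨ G.Adj a b) → a ∈ comp G (S \ {z, v, w}) p1 →
            b ∉ comp G (S \ {z, v, w}) p2 := fun a b hab ha hb => h12 <| by
          rcases hab with rfl | hab
          · exact ha.2.trans hb.2.symm
          · exact (comp_closed ha hb.1 hab).2.trans hb.2.symm
        refine ⟨p2, p1, hp2, hp1, fun h => h12 h.symm, fun hx2 => ?_, fun hy2 => ?_⟩
        · exact h1.elim (fun h => hno x x (.inl rfl) h hx2) fun h => hno y x (.inr hxy.symm) h hx2
        · exact h1.elim (fun h => hno x y (.inr hxy) h hy2) fun h => hno y y (.inl rfl) h hy2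
      · rw [not_or] at h1
        exact ⟨p1, p2, hp1, hp2, h12, h1⟩
    have hsub' : S \ {z, v, w} ⊆ S \ {z, w} := fun v hv => ⟨hv.1, fun h => hv.2 (by
      simp only [Set.mem_insert_iff, Set.mem_singleton_iff] at *; tauto)⟩
    obtain ⟨u, hu, huv, -⟩ := comp_exit (s := v) hsub' (h z w) hp' (hsub' hq') hpq' (by
      intro a ha hwn
      by_contra hwz
      exact hwn ⟨ha.1, fun h => ha.2 (by
        simp only [Set.mem_insert_iff, Set.mem_singleton_iff] at *; tauto)⟩)
    have hD : comp G (S \ {z, v, w}) p' ⊆ S \ {x, y, z} := fun a ha => by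
      refine ⟨(comp_subset ha).1, ?_⟩
      have h2 := (comp_subset ha).2
      simp only [Set.mem_insert_iff, Set.mem_singleton_iff, not_or] at *
      exact ⟨fun h => hxD (h ▸ ha), fun h => hyD (h ▸ ha), h2.1⟩
    have huC := comp_closed hv (hD hu) huv.symm
    have hDC : comp G (S \ {z, v, w}) p' ⊆ comp G (S \ {x, y, z}) p := fun a ha =>
      ⟨hD ha, huC.2.trans ((connOn_comp u hu a ha).mono le_rfl hD)⟩
    have hlt : (comp G (S \ {z, v, w}) p').ncard < n := by
      rw [← hn]
      refine Set.ncard_lt_ncard (Set.ssubset_iff_of_subset hDC |>.2 ⟨v, hv, fun hv' => ?_⟩)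
        (hfin.subset fun a ha => (comp_subset ha).1)
      exact (comp_subset hv').2 (by simp)
    exact ih _ hlt z hz.1 v hvS w p' q' hvz.symm hp' hq' hpq' rfl

theorem C3.exists_contractible (h : C3 G S) (hfin : S.Finite) {x y : V} (hx : x ∈ S) (hy : y ∈ S)
    (hxy : G.Adj x y) : ∃ x ∈ S, ∃ y ∈ S, G.Adj x y ∧ ∀ z, ConnOn G (S \ {x, y, z}) := by
  by_contra! hcon
  obtain ⟨z, hz⟩ := hcon x hx y hy hxy
  simp only [ConnOn, not_forall] at hz
  obtain ⟨p, hp, q, hq, hpq⟩ := hz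
  exact h.not_all_separate hfin hcon _ x hx y hy z p q hxy hp hq hpq rfl

end Contractible

/-! ### Ears that end at a new vertex stay in one face -/

section Center

variable {E0 E1 : Finset (Sym2 ℕ)} {F0 : Multiset (List ℕ)} {x : ℕ}

theorem EarStep.faces {e : Ear} {A B : St} (h : EarStep e A B) :
    ∃ g ∈ A.2, e.a ∈ g ∧ e.b ∈ g ∧ ∀ g' ∈ B.2, g' ∈ A.2 ∨ ∀ z ∈ g', z ∈ g ∨ z ∈ e.p := by
  cases h with
  | @fwd E F L0 L1 L2 =>
    refine ⟨_, Multiset.mem_cons_self _ _, by simp, by simp, fun g' hg' => ?_⟩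
    simp only [Multiset.mem_cons] at hg' ⊢
    rcases hg' with rfl | rfl | h
    · right; intro z hz
      simp only [List.mem_append, List.mem_cons, List.mem_reverse, List.not_mem_nil] at *; tauto
    · right; intro z hz
      simp only [List.mem_append, List.mem_cons] at *; tauto
    · exact .inl (.inr h)
  | @bwd E F L0 L1 L2 =>
    refine ⟨_, Multiset.mem_cons_self _ _, by simp, by simp, fun g' hg' => ?_⟩
    simp only [Multiset.mem_cons] at hg' ⊢
    rcases hg' with rfl | rfl | h
    · right; intro z hz
      simp only [List.mem_append, List.mem_cons, List.not_mem_nil] at *; tauto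
    · right; intro z hz
      simp only [List.mem_append, List.mem_cons, List.mem_reverse] at *; tauto
    · exact .inl (.inr h)

theorem exists_center_face (hx : x ∉ vs E0) (hG : GoodFaces (E0, F0))
    (hE1 : ∀ a b, s(a, b) ∈ E1 → a ≠ x → b ≠ x → s(a, b) ∈ E0) {A : St}
    (h : ReflTransGen EarMove (E0, F0) A) : A.1 ⊆ E1 → E0 ⊆ A.1 ∧ (A = (E0, F0) ∨ x ∈ vs A.1 ∧
      ∃ f ∈ F0, (∀ g ∈ A.2, x ∈ g → ∀ z ∈ g, z = x ∨ z ∈ f) ∧ ∀ z, s(x, z) ∈ A.1 → z ∈ f) := by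
  induction h with
  | refl => exact fun _ => ⟨subset_rfl, .inl rfl⟩
  | @tail A B _ hAB ih =>
    obtain ⟨⟨a, p, b⟩, he, hs⟩ := hAB
    intro hB
    rw [hs.fst] at hB
    obtain ⟨h0, ih⟩ := ih ((subset_addEar _).trans hB)
    have hBA := hs.fst
    have hnew : ∀ c d, s(c, d) ∈ (Ear.mk a p b).edges → c = x ∨ d = x := fun c d hcd => by
      by_contra! hne
      exact he.new' hcd (h0 (hE1 c d (hB (by simp [addEar, hcd])) hne.1 hne.2))
    obtain ⟨g, hg, hag, hbg, hfaces⟩ := hs.faces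
    have hnd := he.nodup
    simp only at hag hbg hfaces hnd
    refine ⟨hBA ▸ h0.trans (subset_addEar _), .inr ?_⟩
    rcases ih with rfl | ⟨hxA, f, hf, h1, h2⟩
    · have ha : a ≠ x := fun h => hx (h ▸ he.left)
      have hb : b ≠ x := fun h => hx (h ▸ he.right)
      have hp : p = [x] := by
        match p, hnew, hnd with
        | [], hnew, _ => exact absurd (hnew a b (by simp [Ear.edges, pe])) (by simp [ha, hb])
        | [c], hnew, _ =>
          rw [(hnew a c (by simp [Ear.edges, pe])).resolve_left ha]
        | c :: d :: [], hnew, hnd =>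
          have hc := (hnew a c (by simp [Ear.edges, pe])).resolve_left ha
          have hd := (hnew d b (by simp [Ear.edges, pe])).resolve_right hb
          simp [hc, hd] at hnd
        | c :: d :: d' :: p, hnew, hnd =>
          have hc := (hnew a c (by simp [Ear.edges, pe])).resolve_left ha
          have hd := hnew d d' (by simp [Ear.edges, pe])
          rcases hd with hd | hd <;> simp [hc, hd] at hnd
      subst hp
      have hmem := fun e => mem_addEar_single (E := E0) (a := a) (x := x) (b := b) (e := e)
      refine ⟨hBA ▸ mem_vs_left ((hmem s(x, a)).2 (.inr (.inl rfl))), g, hg, fun g' hg' hxg' => ?_,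
        fun z hz => ?_⟩
      · rcases hfaces g' hg' with h | h
        · exact absurd ((hG g' h).2 x hxg') hx
        · intro z hz
          have := h z hz
          simp only [List.mem_singleton] at this
          exact this.symm
      · rw [hBA, hmem] at hz
        rcases hz with h | h | h
        · exact absurd (mem_vs_left h) hx
        · rw [Sym2.congr_right] at h; exact h ▸ hag
        · rw [Sym2.congr_right] at h; exact h ▸ hbg
    · have hp : p = [] := by
        match p, hnew, hnd, he.fresh with
        | [], _, _, _ => rfl
        | [c], hnew, hnd, hfr =>
          have hc : c ≠ x := fun h => hfr c (by simp) (h ▸ hxA)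
          have ha := (hnew a c (by simp [Ear.edges, pe])).resolve_right hc
          have hb := (hnew c b (by simp [Ear.edges, pe])).resolve_left hc
          simp [ha, hb] at hnd
        | c :: d :: p, hnew, hnd, hfr =>
          have hc : c ≠ x := fun h => hfr c (by simp) (h ▸ hxA)
          have ha := (hnew a c (by simp [Ear.edges, pe])).resolve_right hc
          have hb := (hnew c d (by simp [Ear.edges, pe])).resolve_left hc
          simp [ha, hb] at hnd
      subst hp
      have hab := hnew a b (by simp [Ear.edges, pe])
      have hne : a ≠ b := by simpa using hnd
      have hxg : x ∈ g := by
        rcases hab with rfl | rfl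
        exacts [hag, hbg]
      refine ⟨?_, f, hf, fun g' hg' hxg' => ?_, fun z hz => ?_⟩
      · rw [hBA]; exact vs_mono (subset_addEar _) hxA
      · rcases hfaces g' hg' with h | h
        · exact h1 g' h hxg'
        · exact fun z hz => h1 g hg hxg z (by simpa using h z hz)
      · rw [hBA] at hz
        have : s(x, z) ∈ A.1 ∨ s(x, z) = s(a, b) := by
          simpa [addEar, Ear.edges, pe, or_comm] using hz
        rcases this with h | h
        · exact h2 z h
        · have hzg : z ∈ g ∧ z ≠ x := by
            rcases Sym2.eq_iff.1 h with ⟨rfl, rfl⟩ | ⟨rfl, rfl⟩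
            exacts [⟨hbg, hne.symm⟩, ⟨hag, hne⟩]
          exact (h1 g hg hxg z hzg.1).resolve_left hzg.2

end Center

/-! ### Contracting an edge -/

section ContrEdge

variable {G : SimpleGraph ℕ} {S : Set ℕ} {x y : ℕ}

/-- The graph `G[S]` with the edge `xy` contracted to `x`. -/
def ctr (G : SimpleGraph ℕ) (S : Set ℕ) (x y : ℕ) : SimpleGraph ℕ :=
  contr G S fun v => if v = y then x else v

theorem ctr_adj_of_ne {a b : ℕ} (ha : a ≠ x) (hb : b ≠ x) (h : (ctr G S x y).Adj a b) :
    G.Adj a b := by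
  obtain ⟨-, a', -, b', -, h1, h2, h⟩ := h
  simp only at h1 h2
  split_ifs at h1 h2
  · exact absurd h1.symm ha
  · exact absurd h1.symm ha
  · exact absurd h2.symm hb
  · exact h1 ▸ h2 ▸ h

theorem ctr_adj_of_adj {a b : ℕ} (haS : a ∈ S) (hbS : b ∈ S) (ha : a ≠ y) (hb : b ≠ y)
    (h : G.Adj a b) : (ctr G S x y).Adj a b :=
  ⟨h.ne, a, haS, b, hbS, by simp [ha], by simp [hb], h⟩

theorem ctr_adj_left {z : ℕ} (hy : y ∈ S) (hz : z ∈ S) (hzx : z ≠ x) (hzy : z ≠ y)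
    (h : G.Adj y z) : (ctr G S x y).Adj x z :=
  ⟨hzx.symm, y, hy, z, hz, by simp, by simp [hzy], h⟩

theorem adj_or_of_ctr_adj {z : ℕ} (h : (ctr G S x y).Adj x z) : G.Adj x z ∨ G.Adj y z := by
  obtain ⟨h0, a', -, b', -, h1, h2, h⟩ := h
  simp only at h1 h2
  split_ifs at h1 h2 with h3 h4 h4
  · exact absurd h2 h0
  · exact .inr (h3 ▸ h2 ▸ h)
  · exact absurd h2 h0
  · exact .inl (h1 ▸ h2 ▸ h)

theorem C3.ctr (h : C3 G S) (hx : x ∈ S) (hxy : x ≠ y) (hz : ∀ z, ConnOn G (S \ {x, y, z})) :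
    C3 (ctr G S x y) (S \ {y}) := by
  intro s t a ha b hb
  have hay : a ≠ y := ha.1.2
  have hby : b ≠ y := hb.1.2
  have hc : ∃ X, X ⊆ S ∧ Joined G X a b ∧ ∀ v ∈ X,
      (if v = y then x else v) ∈ (S \ {y}) \ {s, t} := by
    by_cases hst : x = s ∨ x = t
    · obtain ⟨z, hzst⟩ : ∃ z, ({s, t} : Set ℕ) = {x, z} := by
        rcases hst with rfl | rfl
        exacts [⟨t, rfl⟩, ⟨s, Set.pair_comm _ _⟩]
      rw [hzst] at ha hb ⊢
      have hsub : ∀ v, v ∈ (S \ {y}) \ {x, z} ↔ v ∈ S \ {x, y, z} := fun v => by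
        simp only [Set.mem_sdiff, Set.mem_insert_iff, Set.mem_singleton_iff]; tauto
      refine ⟨_, Set.sdiff_subset, hz z a ((hsub a).1 ha) b ((hsub b).1 hb), fun v hv => ?_⟩
      rw [if_neg (fun h => hv.2 (by simp [h]))]
      exact (hsub v).2 hv
    · refine ⟨_, Set.sdiff_subset, h s t a ⟨ha.1.1, ha.2⟩ b ⟨hb.1.1, hb.2⟩, fun v hv => ?_⟩
      split_ifs with h
      · exact ⟨⟨hx, hxy⟩, hst⟩
      · exact ⟨⟨hv.1, h⟩, hv.2⟩
  obtain ⟨X, hX, hj, hr⟩ := hc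
  have := hj.contr (r := fun v => if v = y then x else v) hX hr
  unfold K33U.ctr
  simpa only [if_neg hay, if_neg hby] using this

theorem Free.ctr (h : Free G S) (hx : x ∈ S) (hy : y ∈ S) (hxy : G.Adj x y) (T : Set ℕ) :
    Free (ctr G S x y) T := by
  refine h.contr (fun v hv w hw hvw => ?_) T
  by_cases hvw' : v = w
  · exact hvw' ▸ .refl _
  have : (v = x ∧ w = y) ∨ (v = y ∧ w = x) := by
    split_ifs at hvw with h1 h2 h2
    · exact absurd (h1.trans h2.symm) hvw'
    · exact .inr ⟨h1, hvw.symm⟩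
    · exact .inl ⟨hvw, h2⟩
    · exact absurd hvw hvw'
  rcases this with ⟨rfl, rfl⟩ | ⟨rfl, rfl⟩
  · exact .edge hxy ⟨hv, rfl⟩ ⟨hw, by simp [hxy.ne]⟩
  · exact .edge hxy.symm ⟨hv, rfl⟩ ⟨hw, by simp⟩

end ContrEdge

/-! ### Finite 3-connected graphs without a `K₃,₃` minor -/

section FiniteThreeConnected

variable {G : SimpleGraph ℕ} {S : Set ℕ} {x y : ℕ}

/-- `G[S]` is a complete graph on five vertices. -/
def K5on (G : SimpleGraph ℕ) (S : Set ℕ) : Prop :=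
  S.ncard = 5 ∧ ∀ a ∈ S, ∀ b ∈ S, a ≠ b → G.Adj a b

/-- `G[S]` is finite and has a plane embedding. -/
def PlaneOn (G : SimpleGraph ℕ) (S : Set ℕ) : Prop :=
  ∃ (E : Finset (Sym2 ℕ)) (F : Multiset (List ℕ)), PlaneCert E F ∧
    ∀ a b, s(a, b) ∈ E ↔ G.Adj a b ∧ a ∈ S ∧ b ∈ S

theorem exists_mem_notMem_of_card_lt {T : Finset ℕ} (h : T.card < S.ncard) : ∃ o ∈ S, o ∉ T := by
  have := Set.exists_mem_notMem_of_ncard_lt_ncard (s := (T : Set ℕ)) (t := S) (by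
    simpa [Set.ncard_coe_finset] using h)
  simpa using this

theorem exists_two {P : ℕ → Prop} (h : ∀ s, ∃ w ∈ S, P w ∧ w ≠ s) :
    ∃ p ∈ S, ∃ q ∈ S, p ≠ q ∧ P p ∧ P q := by
  obtain ⟨p, hp, h1, -⟩ := h 0
  obtain ⟨q, hq, h2, h3⟩ := h p
  exact ⟨p, hp, q, hq, h3.symm, h1, h2⟩

theorem C3.exists_adj_of_card (h : C3 G S) (hS : 4 ≤ S.ncard) {v w s : ℕ} (hv : v ∈ S)
    (hvw : v ≠ w) : ∃ z ∈ S, G.Adj v z ∧ z ≠ w ∧ z ≠ s := by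
  by_cases hs : v = s
  · obtain ⟨o, ho, h1⟩ := exists_mem_notMem_of_card_lt (S := S) (T := {v, w})
      (Finset.card_le_two.trans_lt (by omega))
    simp only [Finset.mem_insert, Finset.mem_singleton, not_or] at h1
    obtain ⟨z, hz, h2, h3, -⟩ := h.exists_adj hv hvw hvw ⟨o, ho, h1.2, h1.2, h1.1⟩
    exact ⟨z, hz, h2, h3, hs ▸ h2.ne'⟩
  · obtain ⟨o, ho, h1⟩ := exists_mem_notMem_of_card_lt (S := S) (T := {v, w, s})
      (Finset.card_le_three.trans_lt (by omega))
    simp only [Finset.mem_insert, Finset.mem_singleton, not_or] at h1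
    exact h.exists_adj hv hvw hs ⟨o, ho, h1.2.1, h1.2.2, h1.1⟩

theorem planeOn_of_ncard_eq_three (h : C3 G S) (hS : S.ncard = 3) : PlaneOn G S := by
  obtain ⟨a, b, c, hab, hac, hbc, rfl⟩ := Set.ncard_eq_three.1 hS
  have key : ∀ p q r, p ∈ ({a, b, c} : Set ℕ) → q ∈ ({a, b, c} : Set ℕ) → p ≠ q → p ≠ r → q ≠ r →
      (∀ z ∈ ({a, b, c} : Set ℕ), z = p ∨ z = q ∨ z = r) → G.Adj p q := by
    intro p q r hp hq hpq hpr hqr hall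
    obtain ⟨w, hw, hpw, hwr, -⟩ := h.exists_adj hp hpr hpr ⟨q, hq, hqr, hqr, hpq.symm⟩
    rcases hall w hw with rfl | rfl | rfl
    exacts [absurd rfl hpw.ne, hpw, absurd rfl hwr]
  have gab := key a b c (by simp) (by simp) hab hac hbc (by simp)
  have gca := key c a b (by simp) (by simp) hac.symm hbc.symm hab (by simp)
  have gcb := key c b a (by simp) (by simp) hbc.symm hac.symm hab.symm (by simp)
  have he : IsEar {s(a, b)} ⟨a, [c], b⟩ := by
    refine ⟨mem_vs_left (b := b) (by simp), mem_vs_right (a := a) (by simp),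
      by simp [hab, hac, hbc.symm], ?_, by simp⟩
    rintro z hz ⟨e, he, hze⟩
    obtain rfl := List.mem_singleton.1 hz
    rw [Finset.mem_singleton] at he
    subst he
    rcases Sym2.mem_iff.1 hze with h | h
    exacts [hac h.symm, hbc h.symm]
  have h1 := (EarStep.fwd (e := ⟨a, [c], b⟩) (E := {s(a, b)}) (F := 0) (L0 := []) (L1 := [])
    (L2 := [])).moves_and he |>.2 (PlaneCert.edge hab)
  refine ⟨_, _, h1, fun p q => ?_⟩
  rw [mem_addEar_single, Finset.mem_singleton]
  constructor
  · rintro (h | h | h) <;> rcases Sym2.eq_iff.1 h with ⟨rfl, rfl⟩ | ⟨rfl, rfl⟩ <;>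
      simp [*, gab.symm, gca.symm, gcb.symm]
  · rintro ⟨hpq, hp, hq⟩
    have := hpq.ne
    simp only [Set.mem_insert_iff, Set.mem_singleton_iff] at hp hq
    rcases hp with rfl | rfl | rfl <;> rcases hq with rfl | rfl | rfl <;>
      simp_all [Sym2.eq_swap]

theorem not_free_of_K4 (hx : x ∈ S) (hy : y ∈ S) (hxy : G.Adj x y) (hT : (S \ {x, y}).ncard = 4)
    (hc : ∀ a ∈ S \ {x, y}, ∀ b ∈ S \ {x, y}, a ≠ b → G.Adj a b)
    (hor : ∀ z ∈ S \ {x, y}, G.Adj x z ∨ G.Adj y z)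
    (hX : ∃ p ∈ S \ {x, y}, ∃ q ∈ S \ {x, y}, p ≠ q ∧ G.Adj x p ∧ G.Adj x q)
    (hY : ∃ p ∈ S \ {x, y}, ∃ q ∈ S \ {x, y}, p ≠ q ∧ G.Adj y p ∧ G.Adj y q) : ¬ Free G S := by
  have key : ∀ p q r s, [p, q, r, s].Nodup → (∀ z ∈ [p, q, r, s], z ∈ S \ {x, y}) →
      G.Adj x p → G.Adj y q → G.Adj x r → G.Adj y s → ¬ Free G S := by
    intro p q r s hnd hmem h1 h2 h3 h4
    refine not_free_of_interlaced (f := [p, q, r, s]) (L1 := []) (L2 := []) (L3 := []) (L4 := [])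
      ⟨hnd, ?_⟩ (.refl _) (fun z hz => ?_) hx hy hxy h1 h2 h3 h4
    · intro u v huv
      have : ∀ c ∈ [p, q, r, s], ∀ d ∈ [p, q, r, s], c ≠ d → s(u, v) = s(c, d) → G.Adj u v := by
        intro c hc' d hd hcd h
        rcases Sym2.eq_iff.1 h with ⟨rfl, rfl⟩ | ⟨rfl, rfl⟩
        exacts [hc _ (hmem _ hc') _ (hmem _ hd) hcd, hc _ (hmem _ hd) _ (hmem _ hc') hcd.symm]
      simp only [List.nodup_cons, List.mem_cons, List.not_mem_nil, or_false, not_or] at hnd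
      simp only [cyc, pe, List.take, List.cons_append, List.nil_append, List.mem_cons,
        List.not_mem_nil, or_false] at huv
      rcases huv with h | h | h | h
      · exact this p (by simp) q (by simp) hnd.1.1 h
      · exact this q (by simp) r (by simp) hnd.2.1.1 h
      · exact this r (by simp) s (by simp) hnd.2.2.1 h
      · exact this s (by simp) p (by simp) (Ne.symm hnd.1.2.2) h
    · have := hmem z hz
      exact ⟨this.1, fun h => this.2 (by simp [h]), fun h => this.2 (by simp [h])⟩
  obtain ⟨l, hl, hlT, hlen⟩ : ∃ l : List ℕ, l.Nodup ∧ (∀ z, z ∈ l ↔ z ∈ S \ {x, y}) ∧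
      l.length = 4 := by
    have hfin : (S \ {x, y}).Finite := Set.finite_of_ncard_pos (by omega)
    refine ⟨hfin.toFinset.toList, Finset.nodup_toList _, by simp, ?_⟩
    rw [Finset.length_toList, ← Set.ncard_eq_toFinset_card _ hfin, hT]
  match l, hl, hlT, hlen with
  | [a, b, c, d], hl, hlT, _ =>
    have hX' : ∀ {P : ℕ → Prop}, (∃ p ∈ S \ {x, y}, ∃ q ∈ S \ {x, y}, p ≠ q ∧ P p ∧ P q) →
        P a ∧ P b ∨ P a ∧ P c ∨ P a ∧ P d ∨ P b ∧ P c ∨ P b ∧ P d ∨ P c ∧ P d := by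
      rintro P ⟨p, hp, q, hq, hpq, h1, h2⟩
      rw [← hlT] at hp hq
      simp only [List.mem_cons, List.not_mem_nil, or_false] at hp hq
      rcases hp with rfl | rfl | rfl | rfl <;> rcases hq with rfl | rfl | rfl | rfl <;>
        first | exact absurd rfl hpq | (clear key hc hor hX hY hlT; tauto)
    have h1 := hX' hX
    have h2 := hX' hY
    have ha := hor a ((hlT a).1 (by simp))
    have hb := hor b ((hlT b).1 (by simp))
    have hc' := hor c ((hlT c).1 (by simp))
    have hd := hor d ((hlT d).1 (by simp))
    have hl' := hl
    simp only [List.nodup_cons, List.mem_cons, List.not_mem_nil, or_false, not_or] at hl'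
    have key' : ∀ p q r s, [p, q, r, s].Nodup → (∀ z ∈ [p, q, r, s], z ∈ [a, b, c, d]) →
        ¬ Free G S ∨ ¬ (G.Adj x p ∧ G.Adj y q ∧ G.Adj x r ∧ G.Adj y s) := by
      intro p q r s hn hp
      by_cases h : G.Adj x p ∧ G.Adj y q ∧ G.Adj x r ∧ G.Adj y s
      · exact .inl (key p q r s hn (fun z hz => (hlT z).1 (hp z hz)) h.1 h.2.1 h.2.2.1 h.2.2.2)
      · exact .inr h
    have k1 := key' a c b d (by simp [hl', Ne.symm hl'.2.1.1]) (by simp)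
    have k2 := key' a b c d hl (by simp)
    have k3 := key' a b d c (by simp [hl', Ne.symm hl'.2.2.1]) (by simp)
    have k4 := key' b a c d (by simp [hl', Ne.symm hl'.1.1]) (by simp)
    have k5 := key' b a d c (by simp [hl', Ne.symm hl'.1.1, Ne.symm hl'.2.2.1]) (by simp)
    have k6 := key' c a d b (by
      simp [hl', Ne.symm hl'.1.2.1, Ne.symm hl'.2.1.1, Ne.symm hl'.2.1.2]) (by simp)
    clear hl hl'
    clear key key' hX' hX hY hor hc hlT
    grind

end FiniteThreeConnected

section FiniteThreeConnectedStep

variable {G : SimpleGraph ℕ} {S : Set ℕ} {x y : ℕ} {f : List ℕ}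

theorem IsCyc.adj_three {a b c : ℕ} (hf : IsCyc G f) (hr : f ~r [a, b, c]) :
    G.Adj a b ∧ G.Adj b c ∧ G.Adj c a := by
  have h := (hf.rotate hr).2
  exact ⟨h a b (by simp [cyc, pe]), h b c (by simp [cyc, pe]), h c a (by simp [cyc, pe])⟩

theorem C3.k5on_of_three_common (h : C3 G S) (hfin : S.Finite) (hfree : Free G S)
    (hx : x ∈ S) (hy : y ∈ S) (hxy : G.Adj x y) (hf : IsCyc G f)
    (hfS : ∀ z ∈ f, z ∈ S ∧ z ≠ x ∧ z ≠ y)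
    (hN : ∀ z ∈ S, z ≠ x → z ≠ y → G.Adj x z ∨ G.Adj y z → z ∈ f)
    (h3 : ThreeCommon (G.Adj x) (G.Adj y) f) : K5on G S := by
  obtain ⟨a, L1, b, L2, c, L3, hr, ⟨hxa, hxb, hxc⟩, ⟨hya, hyb, hyc⟩, hall⟩ := h3
  have hmem : ∀ z, z = a ∨ z = b ∨ z = c → z ∈ f := fun z hz => hr.mem_iff.2 (by
    rcases hz with rfl | rfl | rfl <;> simp)
  have ha := hfS a (hmem a (by simp))
  have hb := hfS b (hmem b (by simp))
  have hc := hfS c (hmem c (by simp))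
  have hnd := hr.nodup_iff.1 hf.1
  have habc : a ≠ b ∧ a ≠ c ∧ b ≠ c := by
    refine ⟨?_, ?_, ?_⟩ <;> rintro rfl <;> simp [List.nodup_append] at hnd
  have hN' : ∀ z ∈ S, z ≠ x → z ≠ y → G.Adj x z ∨ G.Adj y z → z = a ∨ z = b ∨ z = c :=
    fun z h1 h2 h3 h4 => hall z (hN z h1 h2 h3 h4) h4
  by_cases hw : ∃ w ∈ S, w ∉ ({x, y, a, b, c} : Set ℕ)
  · obtain ⟨w, hwS, hwn⟩ := hw
    exfalso
    set D := comp G (S \ {x, y, a, b, c}) w with hD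
    have hwD : w ∈ D := mem_comp_self ⟨hwS, hwn⟩
    have hDn : ∀ z ∈ D, z ≠ x ∧ z ≠ y ∧ z ≠ a ∧ z ≠ b ∧ z ≠ c := fun z hz => by
      have := (comp_subset hz).2
      simpa only [Set.mem_insert_iff, Set.mem_singleton_iff, not_or] using this
    have att : ∀ r s t, (∀ v, v = a ∨ v = b ∨ v = c → v = r ∨ v = s ∨ v = t) → x ≠ s → x ≠ t →
        w ≠ s → w ≠ t → ∃ u ∈ D, G.Adj u r := by
      intro r s t hrst hxs hxt hws hwt
      obtain ⟨u, v, huv, -, hv, hu, hvn, -⟩ := (h s t w ⟨hwS, by simp [hws, hwt]⟩ x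
        ⟨hx, by simp [hxs, hxt]⟩).exists_exit (P := D) hwD fun h => (hDn x h).1 rfl
      have hvx : v ∈ ({x, y, a, b, c} : Set ℕ) := by
        by_contra hv'
        exact hvn (comp_closed hu ⟨hv.1, hv'⟩ huv)
      have hun := hDn u hu
      have huS := (comp_subset hu).1
      have hno : ¬ (G.Adj x u ∨ G.Adj y u) := fun h => by
        rcases hN' u huS hun.1 hun.2.1 h with h | h | h
        exacts [hun.2.2.1 h, hun.2.2.2.1 h, hun.2.2.2.2 h]
      have hv' := hv.2
      simp only [Set.mem_insert_iff, Set.mem_singleton_iff, not_or] at hvx hv'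
      rcases hvx with rfl | rfl | hvx
      · exact absurd (.inl huv.symm) hno
      · exact absurd (.inr huv.symm) hno
      · obtain rfl := (hrst v hvx).resolve_right (by simp [hv'])
        exact ⟨u, hu, huv⟩
    have hwn' := hDn w hwD
    obtain ⟨ua, hua, hua'⟩ := att a b c (by simp) hb.2.1.symm hc.2.1.symm hwn'.2.2.2.1 hwn'.2.2.2.2
    obtain ⟨ub, hub, hub'⟩ := att b a c (by simp) ha.2.1.symm hc.2.1.symm hwn'.2.2.1 hwn'.2.2.2.2
    obtain ⟨uc, huc, huc'⟩ := att c a b (by simp) ha.2.1.symm hb.2.1.symm hwn'.2.2.1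
      hwn'.2.2.2.1
    have hDfin : D.Finite := hfin.subset fun z hz => (comp_subset hz).1
    have hDl : ∀ z, z ∈ hDfin.toFinset.toList ↔ z ∈ D := by simp
    refine not_free_of_lists ![[x], [y], hDfin.toFinset.toList] ![[a], [b], [c]] ?_ ?_ ?_ ?_ ?_ ?_
      hfree
    · have hD1 : ∀ z, z ∉ D → ∀ v ∈ D, v ≠ z := fun z hz v hv h => hz (h ▸ hv)
      have hx' : x ∉ D := fun h => (hDn x h).1 rfl
      have hy' : y ∉ D := fun h => (hDn y h).2.1 rfl
      have ha' : a ∉ D := fun h => (hDn a h).2.2.1 rfl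
      have hb' : b ∉ D := fun h => (hDn b h).2.2.2.1 rfl
      have hc' : c ∉ D := fun h => (hDn c h).2.2.2.2 rfl
      simp only [Matrix.cons_val_zero, Matrix.cons_val_one, Matrix.cons_val, List.nodup_append,
        List.nodup_cons, List.mem_append, hDl, List.mem_singleton, Finset.nodup_toList]
      simp only [List.not_mem_nil, not_false_eq_true, List.nodup_nil, true_and, forall_eq_or_imp,
        forall_eq, habc, hxy.ne, ne_eq, and_self]
      refine ⟨⟨fun v hv => ⟨(hDn v hv).2.2.1, (hDn v hv).2.2.2⟩, ?_⟩, ?_⟩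
      · rintro v (hv | rfl | rfl | rfl)
        exacts [fun h => (hDn v hv).2.1 h.symm, ha.2.2.symm, hb.2.2.symm, hc.2.2.symm]
      · rintro v (hv | rfl | rfl | rfl)
        exacts [fun h => (hDn v hv).1 h.symm, ha.2.1.symm, hb.2.1.symm, hc.2.1.symm]
    · intro i
      fin_cases i
      · simpa using ConnOn.singleton x
      · simpa using ConnOn.singleton y
      · simpa using connOn_comp
    · intro i
      fin_cases i
      · simpa using ConnOn.singleton a
      · simpa using ConnOn.singleton b
      · simpa using ConnOn.singleton c
    · intro i
      fin_cases i
      · simpa using hx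
      · simpa using hy
      · simpa using fun v hv => (comp_subset hv).1
    · intro i
      fin_cases i
      · simpa using ha.1
      · simpa using hb.1
      · simpa using hc.1
    · intro i j
      fin_cases i <;> fin_cases j <;> simp only [ListAdj, Fin.zero_eta, Fin.mk_one, Fin.reduceFinMk,
        Matrix.cons_val_zero, Matrix.cons_val_one, Matrix.cons_val, List.mem_singleton,
        exists_eq_left, hDl, hxa, hxb, hxc, hya, hyb, hyc]
      exacts [⟨ua, hua, hua'⟩, ⟨ub, hub, hub'⟩, ⟨uc, huc, huc'⟩]
  · push Not at hw
    have hfS' : ∀ z ∈ f, z = a ∨ z = b ∨ z = c := fun z hz => by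
      have h1 := hfS z hz
      have := hw z h1.1
      simpa only [Set.mem_insert_iff, Set.mem_singleton_iff, h1.2.1, h1.2.2, false_or] using this
    have hno : ∀ z, z ∈ L1 ∨ z ∈ L2 ∨ z ∈ L3 → False := fun z hz => by
      have h1 := hfS' z (hr.mem_iff.2 (by
        simp only [List.mem_append, List.mem_cons]; tauto))
      rcases h1 with rfl | rfl | rfl <;> rcases hz with hz | hz | hz <;>
        obtain ⟨s, t, rfl⟩ := List.append_of_mem hz <;> simp [List.nodup_append] at hnd
    have e1 : L1 = [] := List.eq_nil_iff_forall_not_mem.2 fun z hz => hno z (.inl hz)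
    have e2 : L2 = [] := List.eq_nil_iff_forall_not_mem.2 fun z hz => hno z (.inr (.inl hz))
    have e3 : L3 = [] := List.eq_nil_iff_forall_not_mem.2 fun z hz => hno z (.inr (.inr hz))
    subst e1 e2 e3
    obtain ⟨gab, gbc, gca⟩ := hf.adj_three hr
    have hS : S = (({x, y, a, b, c} : Finset ℕ) : Set ℕ) := by
      refine Set.Subset.antisymm (fun z hz => by simpa using hw z hz) ?_
      intro z hz
      simp only [Finset.coe_insert, Finset.coe_singleton, Set.mem_insert_iff,
        Set.mem_singleton_iff] at hz
      rcases hz with rfl | rfl | rfl | rfl | rfl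
      exacts [hx, hy, ha.1, hb.1, hc.1]
    refine ⟨?_, ?_⟩
    · rw [hS, Set.ncard_coe_finset]
      have h1 : x ∉ ({y, a, b, c} : Finset ℕ) := by
        simp [hxy.ne, ha.2.1.symm, hb.2.1.symm, hc.2.1.symm]
      have h2 : y ∉ ({a, b, c} : Finset ℕ) := by simp [ha.2.2.symm, hb.2.2.symm, hc.2.2.symm]
      rw [Finset.card_insert_of_notMem h1, Finset.card_insert_of_notMem h2,
        Finset.card_eq_three.2 ⟨a, b, c, habc.1, habc.2.1, habc.2.2, rfl⟩]
    · intro p hp q hq hpq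
      have hp' := hw p hp
      have hq' := hw q hq
      simp only [Set.mem_insert_iff, Set.mem_singleton_iff] at hp' hq'
      rcases hp' with rfl | rfl | rfl | rfl | rfl <;>
          rcases hq' with rfl | rfl | rfl | rfl | rfl <;>
        first | exact absurd rfl hpq | assumption | (apply SimpleGraph.Adj.symm; assumption)

end FiniteThreeConnectedStep

section FiniteThreeConnected

variable {G : SimpleGraph ℕ} {S : Set ℕ} {x y : ℕ}

theorem GoodFaces.isCyc {E : Finset (Sym2 ℕ)} {F : Multiset (List ℕ)} {T : Set ℕ} {f : List ℕ}
    (hG : GoodFaces (E, F)) (hP : PlaneCert E F) (hE : Inside G T E) (hf : f ∈ F) : IsCyc G f :=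
  ⟨(hG f hf).1, fun p q h => (hE p q (hP.mem_of_cyc hf h)).1⟩

theorem C3.planeOn_of_ctr (h : C3 G S) (hfin : S.Finite) (hcard : 4 ≤ S.ncard)
    (hfree : Free G S) (hx : x ∈ S) (hy : y ∈ S) (hxy : G.Adj x y)
    (hz : ∀ z, ConnOn G (S \ {x, y, z})) (hP : PlaneOn (K33U.ctr G S x y) (S \ {y})) :
    K5on G S ∨ PlaneOn G S := by
  obtain ⟨E', F', hP', hE'⟩ := hP
  obtain ⟨B, hB, hB0⟩ := hP'.twoBasis.filter_ne_zero
  have hxT : ∃ p ∈ S, ∃ q ∈ S, p ≠ q ∧ (G.Adj x p ∧ p ≠ y) ∧ (G.Adj x q ∧ q ≠ y) :=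
    exists_two fun s => by
      obtain ⟨w, h1, h2, h3, h4⟩ := h.exists_adj_of_card hcard (s := s) hx hxy.ne
      exact ⟨w, h1, ⟨h2, h3⟩, h4⟩
  have hyT : ∃ p ∈ S, ∃ q ∈ S, p ≠ q ∧ (G.Adj y p ∧ p ≠ x) ∧ (G.Adj y q ∧ q ≠ x) :=
    exists_two fun s => by
      obtain ⟨w, h1, h2, h3, h4⟩ := h.exists_adj_of_card hcard (s := s) hy hxy.ne'
      exact ⟨w, h1, ⟨h2, h3⟩, h4⟩
  have hTc : ∀ z, ConnOn G ((S \ {x, y}) \ {z}) := fun z => by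
    have e : (S \ {x, y}) \ {z} = S \ {x, y, z} := by
      ext v; simp only [Set.mem_sdiff, Set.mem_insert_iff, Set.mem_singleton_iff]; tauto
    exact e ▸ hz z
  obtain ⟨p, hp, q, hq, hpq, ⟨hxp, hpy⟩, hxq, hqy⟩ := hxT
  have hpT : p ∈ S \ {x, y} := ⟨hp, by simp [hxp.ne', hpy]⟩
  have hqT : q ∈ S \ {x, y} := ⟨hq, by simp [hxq.ne', hqy]⟩
  obtain ⟨v, hv, hpv⟩ : ∃ v ∈ S \ {x, y}, G.Adj p v := by
    obtain ⟨v, hv, hpv, hvx, hvy⟩ := h.exists_adj hp hxp.ne' hpy ⟨q, hq, hxq.ne', hqy, hpq.symm⟩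
    exact ⟨v, ⟨hv, by simp [hvx, hvy]⟩, hpv⟩
  have hTS : ∀ z ∈ S \ {x, y}, z ∈ S ∧ z ≠ x ∧ z ≠ y := fun z hz => by
    simpa using hz
  obtain ⟨E0, hpre, hE0⟩ := exists_full hTc (hfin.subset Set.sdiff_subset)
    (Inside.singleton hpv hpT hv) (u := p) (v := v) (by simp)
  have hpvE : s(p, v) ∈ E0 := (hE0 p v).2 ⟨hpv, hpT, hv⟩
  have hin : Inside (K33U.ctr G S x y) (S \ {y}) E0 := fun a b hab => by
    obtain ⟨h1, h2, h3⟩ := (hE0 a b).1 hab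
    have h2' := hTS a h2
    have h3' := hTS b h3
    exact ⟨ctr_adj_of_adj h2'.1 h3'.1 h2'.2.2 h3'.2.2 h1, ⟨h2'.1, h2'.2.2⟩, h3'.1, h3'.2.2⟩
  obtain ⟨E1, hE01, hE1⟩ := exists_full (h.ctr hx hxy.ne hz).two (hfin.subset Set.sdiff_subset)
    hin hpvE
  have hEE : E1 = E' := by
    ext d
    induction d with
    | _ a b => rw [hE1, hE']
  subst hEE
  have hxpE : s(x, p) ∈ E1 := (hE1 x p).2 ⟨ctr_adj_of_adj hx hp hxy.ne hpy hxp, ⟨hx, hxy.ne⟩, hp,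
      hpy⟩
  have hv' := hTS v hv
  have hne : E1 ≠ {s(p, v)} := fun e => by
    rw [e] at hxpE
    simp [hxp.ne, hv'.2.1.symm] at hxpE
  obtain ⟨F0, F1, -, hP0, hG0, hmv⟩ := exists_states hpv.ne hpre hE01 hne hB hB0
  have hxE0 : x ∉ vs E0 := fun ⟨d, hd, hxd⟩ => by
    obtain ⟨b, rfl⟩ := hxd
    exact ((hTS x ((hE0 x b).1 hd).2.1).2.1 rfl)
  have hyE0 : y ∉ vs E0 := fun ⟨d, hd, hxd⟩ => by
    obtain ⟨b, rfl⟩ := hxd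
    exact ((hTS y ((hE0 y b).1 hd).2.1).2.2 rfl)
  obtain ⟨-, hA | ⟨-, f, hf, -, hnb⟩⟩ := exists_center_face hxE0 hG0 (fun a b hab ha hb => by
    obtain ⟨h1, h2, h3⟩ := (hE1 a b).1 hab
    exact (hE0 a b).2 ⟨ctr_adj_of_ne ha hb h1, ⟨h2.1, by simpa [ha] using h2.2⟩, h3.1,
        by simpa [hb] using h3.2⟩) hmv
    subset_rfl
  · rw [(Prod.mk.inj hA).1] at hxpE
    exact absurd (mem_vs_left hxpE) hxE0
  have hcyc : IsCyc G f := hG0.isCyc hP0 (fun a b hab => (hE0 a b).1 hab) hf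
  have hfE : ∀ z ∈ f, z ∈ vs E0 := (hG0 f hf).2
  have hfS : ∀ z ∈ f, z ∈ S ∧ z ≠ x ∧ z ≠ y := fun z hz =>
    hTS z (Inside.vs (fun a b hab => (hE0 a b).1 hab) (hfE z hz))
  have hN : ∀ z ∈ S, z ≠ x → z ≠ y → G.Adj x z ∨ G.Adj y z → z ∈ f := fun z hz hzx hzy hadj => by
    refine hnb z ((hE1 x z).2 ⟨?_, ⟨hx, hxy.ne⟩, hz, hzy⟩)
    rcases hadj with h1 | h1
    · exact ctr_adj_of_adj hx hz hxy.ne hzy h1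
    · exact ctr_adj_left hy hz hzx hzy h1
  have hX : ∃ p ∈ f, ∃ q ∈ f, p ≠ q ∧ G.Adj x p ∧ G.Adj x q :=
    ⟨p, hN p hp hxp.ne' hpy (.inl hxp), q, hN q hq hxq.ne' hqy (.inl hxq), hpq, hxp, hxq⟩
  obtain ⟨a, ha, b, hb, hab, ⟨hya, hax⟩, hyb, hbx⟩ := hyT
  have haf := hN a ha hax hya.ne' (.inr hya)
  have hY : ∃ p ∈ f, ∃ q ∈ f, p ≠ q ∧ G.Adj y p ∧ G.Adj y q :=
    ⟨a, haf, b, hN b hb hbx hyb.ne' (.inr hyb), hab, hya, hyb⟩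
  rcases cyclic_cases hcyc.1 hX hY with hI | hS | h3
  · obtain ⟨a, L1, b, L2, c, L3, d, L4, hr, hxa, hyb, hxc, hyd⟩ := hI
    exact absurd hfree (not_free_of_interlaced hcyc hr hfS hx hy hxy hxa hyb hxc hyd)
  · obtain ⟨c, L1, d, L2, hr, hXc, hXd, hL1, hL2⟩ := hS
    obtain ⟨F0', rfl⟩ := Multiset.exists_cons_of_mem hf
    obtain ⟨E2, F2, hP2, hE2⟩ := hP0.split hr hcyc.1 hfE hxE0 hyE0 hxy.ne hXc hXd hL1 hL2
        ⟨a, haf, hya⟩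
    refine .inr ⟨E2, F2, hP2, fun r t => ?_⟩
    rw [hE2, hE0]
    constructor
    · rintro (⟨h1, h2, h3⟩ | h1 | ⟨z, hzf, hxz, h1⟩ | ⟨z, hzf, hxz, h1⟩)
      · exact ⟨h1, h2.1, h3.1⟩
      · rcases Sym2.eq_iff.1 h1 with ⟨rfl, rfl⟩ | ⟨rfl, rfl⟩
        exacts [⟨hxy, hx, hy⟩, ⟨hxy.symm, hy, hx⟩]
      · rcases Sym2.eq_iff.1 h1 with ⟨rfl, rfl⟩ | ⟨rfl, rfl⟩
        exacts [⟨hxz, hx, (hfS _ hzf).1⟩, ⟨hxz.symm, (hfS _ hzf).1, hx⟩]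
      · rcases Sym2.eq_iff.1 h1 with ⟨rfl, rfl⟩ | ⟨rfl, rfl⟩
        exacts [⟨hxz, hy, (hfS _ hzf).1⟩, ⟨hxz.symm, (hfS _ hzf).1, hy⟩]
    · rintro ⟨hrt, hr, ht⟩
      have key : ∀ z ∈ S, z ≠ x → z ≠ y → (G.Adj x z → z ∈ f) ∧ (G.Adj y z → z ∈ f) :=
        fun z hz h1 h2 => ⟨fun h => hN z hz h1 h2 (.inl h), fun h => hN z hz h1 h2 (.inr h)⟩
      by_cases hrx : r = x
      · subst hrx
        by_cases hty : t = y
        · exact .inr (.inl (by rw [hty]))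
        · exact .inr (.inr (.inl ⟨t, (key t ht hrt.ne' hty).1 hrt, hrt, rfl⟩))
      by_cases hry : r = y
      · subst hry
        by_cases htx : t = x
        · exact .inr (.inl (by rw [htx, Sym2.eq_swap]))
        · exact .inr (.inr (.inr ⟨t, (key t ht htx hrt.ne').2 hrt, hrt, rfl⟩))
      by_cases htx : t = x
      · subst htx
        exact .inr (.inr (.inl ⟨r, (key r hr hrx hry).1 hrt.symm, hrt.symm, Sym2.eq_swap⟩))
      by_cases hty : t = y
      · subst hty
        exact .inr (.inr (.inr ⟨r, (key r hr hrx hry).2 hrt.symm, hrt.symm, Sym2.eq_swap⟩))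
      exact .inl ⟨hrt, ⟨hr, by simp [hrx, hry]⟩, ht, by simp [htx, hty]⟩
  · exact .inl (h.k5on_of_three_common hfin hfree hx hy hxy hcyc hfS hN h3)

theorem C3.k5on_or_planeOn (n : ℕ) : ∀ {G : SimpleGraph ℕ} {S : Set ℕ}, S.ncard = n + 3 → C3 G S →
    Free G S → K5on G S ∨ PlaneOn G S := by
  induction n with
  | zero => exact fun hS h _ => .inr (planeOn_of_ncard_eq_three h hS)
  | succ n ih =>
    intro G S hS h hfree
    have hfin : S.Finite := Set.finite_of_ncard_pos (by omega)
    have hcard : 4 ≤ S.ncard := by omega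
    obtain ⟨a, ha⟩ : S.Nonempty := Set.nonempty_of_ncard_ne_zero (by omega)
    obtain ⟨b, hb, hab, -⟩ := h.exists_adj_of_card hcard (w := a + 1) (s := a) ha (by omega)
    obtain ⟨x, hx, y, hy, hxy, hz⟩ := h.exists_contractible hfin ha hb hab
    have hcard' : (S \ {y}).ncard = n + 3 := by
      rw [Set.ncard_sdiff_singleton_of_mem hy]; omega
    rcases ih hcard' (h.ctr hx hxy.ne hz) (hfree.ctr hx hy hxy _) with h5 | hP
    · exfalso
      obtain ⟨h5, hc⟩ := h5
      have hTS : ∀ z ∈ S \ {x, y}, z ∈ S \ {y} ∧ z ≠ x := fun z hz => by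
        simp only [Set.mem_sdiff, Set.mem_insert_iff, Set.mem_singleton_iff, not_or] at hz ⊢
        tauto
      have e : S \ {x, y} = (S \ {y}) \ {x} := by
        ext v; simp only [Set.mem_sdiff, Set.mem_insert_iff, Set.mem_singleton_iff]; tauto
      refine not_free_of_K4 hx hy hxy ?_ ?_ ?_ ?_ ?_ hfree
      · have hxS : x ∈ S \ {y} := ⟨hx, hxy.ne⟩
        rw [e, Set.ncard_sdiff_singleton_of_mem hxS, h5]
      · intro a ha b hb hab
        exact ctr_adj_of_ne (hTS a ha).2 (hTS b hb).2 (hc a (hTS a ha).1 b (hTS b hb).1 hab)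
      · intro z hz
        exact adj_or_of_ctr_adj (hc x ⟨hx, hxy.ne⟩ z (hTS z hz).1 (hTS z hz).2.symm)
      · refine exists_two fun s => ?_
        obtain ⟨w, h1, h2, h3, h4⟩ := h.exists_adj_of_card hcard (s := s) hx hxy.ne
        exact ⟨w, ⟨h1, by simp [h3, h2.ne']⟩, h2, h4⟩
      · refine exists_two fun s => ?_
        obtain ⟨w, h1, h2, h3, h4⟩ := h.exists_adj_of_card hcard (s := s) hy hxy.ne'
        exact ⟨w, ⟨h1, by simp [h3, h2.ne']⟩, h2, h4⟩
    · exact h.planeOn_of_ctr hfin hcard hfree hx hy hxy hz hP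

end FiniteThreeConnected

section InfiniteThreeConnected

variable {G : SimpleGraph ℕ} {S T : Set ℕ} {u v : ℕ} {e : ℕ → Ear} {Es : ℕ →
    Finset (Sym2 ℕ)} {N : ℕ}

theorem connOn_list (L : List ℕ) : ∀ a, (∀ p q, s(p, q) ∈ pe (a :: L) → G.Adj p q) →
    ConnOn G {v | v ∈ a :: L} := by
  induction L with
  | nil => exact fun a _ => by simpa using ConnOn.singleton a
  | cons b L ih =>
    intro a h
    have h1 := ih b fun p q hpq => h p q (by simp [pe, hpq])
    have h2 : ({v | v ∈ a :: b :: L} : Set ℕ) = {a} ∪ {v | v ∈ b :: L} := by ext; simp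
    rw [h2]
    exact (ConnOn.singleton a).union h1 (Set.mem_singleton a) (b := b) (by simp)
      (.inr (h a b (by simp [pe])))

theorem ne_of_mem_pe {l : List ℕ} (h : l.Nodup) {p q : ℕ} (hpq : s(p, q) ∈ pe l) : p ≠ q := by
  induction l with
  | nil => simp at hpq
  | cons a l ih =>
    cases l with
    | nil => simp at hpq
    | cons b l =>
      rw [pe_cons_cons, List.mem_cons] at hpq
      rcases hpq with hpq | hpq
      · have hab : a ≠ b := by rintro rfl; simp at h
        rcases Sym2.eq_iff.1 hpq with ⟨rfl, rfl⟩ | ⟨rfl, rfl⟩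
        exacts [hab, hab.symm]
      · exact ih h.of_cons hpq

theorem IsEar.connOn {E : Finset (Sym2 ℕ)} {e : Ear} (h : IsEar E e) {t : ℕ}
    (hE : ConnOn (gr E) (vs E \ {t})) : ConnOn (gr (addEar E e)) (vs (addEar E e) \ {t}) := by
  have hvs := h.vs_add
  have hadj : ∀ p q, s(p, q) ∈ e.edges → (gr (addEar E e)).Adj p q := fun p q hpq =>
    gr_adj.2 ⟨by simp [addEar, hpq], ne_of_mem_pe h.nodup hpq⟩
  have key : ∀ x ∈ vs (addEar E e) \ {t}, ∃ y ∈ vs E \ {t},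
      Joined (gr (addEar E e)) (vs (addEar E e) \ {t}) y x := by
    rintro x ⟨hx, hxt⟩
    by_cases hxE : x ∈ vs E
    · exact ⟨x, ⟨hxE, hxt⟩, .refl x⟩
    have hxp : x ∈ e.p := by
      rw [hvs] at hx
      exact hx.resolve_left hxE
    have hsub : ∀ z, z ∈ e.a :: e.p ++ [e.b] → z ∈ vs (addEar E e) := fun z hz => by
      rw [hvs]
      simp only [List.cons_append, List.mem_cons, List.mem_append, List.not_mem_nil, or_false] at hz
      rcases hz with rfl | hz | rfl
      exacts [.inl h.left, .inr hz, .inl h.right]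
    have hnd := h.nodup
    have ha := h.left
    have hb := h.right
    unfold Ear.edges at hadj
    obtain ⟨p1, p2, hp⟩ := List.append_of_mem hxp
    have hl : e.a :: e.p ++ [e.b] = (e.a :: p1) ++ x :: (p2 ++ [e.b]) := by simp [hp]
    rw [hl] at hadj hsub hnd
    rw [pe_append] at hadj
    have c1 := connOn_list (G := gr (addEar E e)) (p1 ++ [x]) e.a fun p q hpq =>
      hadj p q (by simpa using .inl hpq)
    have c2 := connOn_list (G := gr (addEar E e)) (p2 ++ [e.b]) x fun p q hpq =>
      hadj p q (by simpa using .inr hpq)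
    have hxt' : t ≠ x := fun h => hxt h.symm
    by_cases ht : t ∈ e.a :: (p1 ++ [x])
    · have ht2 : t ∉ x :: (p2 ++ [e.b]) := fun h2 => by
        rw [List.nodup_append] at hnd
        refine hnd.2.2 t ?_ t h2 rfl
        simpa [hxt'] using ht
      refine ⟨e.b, ⟨hb, fun h' => ht2 (by rw [← Set.mem_singleton_iff.1 h']; simp)⟩,
          (c2 e.b (by simp) x (by simp)).mono le_rfl ?_⟩
      intro z hz
      exact ⟨hsub z (List.mem_append_right _ hz), fun h' => ht2 (h' ▸ hz)⟩
    · refine ⟨e.a, ⟨ha, fun h' => ht (by rw [← Set.mem_singleton_iff.1 h']; simp)⟩,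
        (c1 e.a (by simp) x (by simp)).mono le_rfl ?_⟩
      intro z hz
      refine ⟨hsub z ?_, fun h' => ht (h' ▸ hz)⟩
      have hz' : z ∈ e.a :: (p1 ++ [x]) := hz
      simp only [List.mem_cons, List.mem_append, List.not_mem_nil, or_false] at hz' ⊢
      tauto
  intro x hx y hy
  obtain ⟨x', hx', jx⟩ := key x hx
  obtain ⟨y', hy', jy⟩ := key y hy
  refine jx.symm.trans (((hE x' hx' y' hy').mono (gr_mono (subset_addEar e)) ?_).trans jy)
  exact Set.sdiff_subset_sdiff_left (vs_mono (subset_addEar e))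

theorem EarSeq.connOn (h : EarSeq u v e Es N) (t : ℕ) :
    ∀ i ≤ N, ConnOn (gr (Es i)) (vs (Es i) \ {t}) := by
  intro i
  induction i with
  | zero =>
    intro _
    have hvs : ∀ x, x ∈ vs (Es 0) ↔ x = u ∨ x = v := fun x => by
      rw [h.zero]; simp [vs]
    intro x ⟨hx, hxt⟩ y ⟨hy, hyt⟩
    have hadj : (gr (Es 0)).Adj u v := gr_adj.2 ⟨by simp [h.zero], h.ne⟩
    rcases (hvs x).1 hx with rfl | rfl <;> rcases (hvs y).1 hy with rfl | rfl
    · exact .refl _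
    · exact .edge hadj ⟨hx, hxt⟩ ⟨hy, hyt⟩
    · exact .edge hadj.symm ⟨hx, hxt⟩ ⟨hy, hyt⟩
    · exact .refl _
  | succ i ih =>
    intro hi
    rw [h.succ i hi]
    exact (h.ear i hi).connOn (ih (by omega))

theorem Joined.exists_finset {a b : ℕ} (h : Joined G S a b) :
    ∃ Q : Finset ℕ, (Q : Set ℕ) ⊆ S ∧ Joined G Q a b := by
  induction h with
  | refl => exact ⟨∅, by simp, .refl a⟩
  | @tail x y _ hxy ih =>
    obtain ⟨Q, hQ, hj⟩ := ih
    refine ⟨insert x (insert y Q), ?_, (hj.mono le_rfl ?_).trans (.edge hxy.1 (by simp) (by simp))⟩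
    · simp [Set.insert_subset_iff, hxy.2.1, hxy.2.2, hQ]
    · intro z hz
      simp [Finset.mem_coe.1 hz]

theorem comp_eq_of_mem {a x : ℕ} (h : x ∈ comp G S a) : comp G S x = comp G S a :=
  Set.ext fun _ => and_congr_right fun _ => ⟨fun h' => h.2.trans h', fun h' => h.2.symm.trans h'⟩

open Classical in
/-- Sends every vertex outside `F` to the least vertex of its component of `T \ F`. -/
noncomputable def compRep (G : SimpleGraph ℕ) (T F : Set ℕ) (v : ℕ) : ℕ :=
  if v ∈ F then v else sInf (comp G (T \ F) v)

theorem compRep_of_mem {F : Set ℕ} (h : v ∈ F) : compRep G T F v = v := if_pos h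

theorem compRep_mem {F : Set ℕ} (h : v ∉ F) (hT : v ∈ T) :
    compRep G T F v ∈ comp G (T \ F) v := by
  rw [compRep, if_neg h]
  exact Nat.sInf_mem ⟨v, mem_comp_self ⟨hT, h⟩⟩

theorem compRep_eq {F : Set ℕ} {w : ℕ} (hw : w ∈ comp G (T \ F) v) (hv : v ∉ F) :
    compRep G T F w = compRep G T F v := by
  rw [compRep, if_neg (comp_subset hw).2, compRep, if_neg hv, comp_eq_of_mem hw]

theorem C3.exists_twoBasis (h : C3 G T) (hfree : Free G T) {F : Finset ℕ} (hF : (F : Set ℕ) ⊆ T)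
    (hcard : 6 ≤ F.card) (hconn : ∀ t, ConnOn G ((F : Set ℕ) \ {t})) :
    ∃ E B, TwoBasis E B ∧ ∀ a ∈ F, ∀ b ∈ F, G.Adj a b → s(a, b) ∈ E := by
  classical
  have hQ : ∀ s t p q : ℕ, ∃ Q : Finset ℕ, (Q : Set ℕ) ⊆ T \ {s, t} ∧
      (p ∈ T \ {s, t} → q ∈ T \ {s, t} → Joined G Q p q) := fun s t p q => by
    by_cases hp : p ∈ T \ {s, t} ∧ q ∈ T \ {s, t}
    · obtain ⟨Q, h1, h2⟩ := (h s t p hp.1 q hp.2).exists_finset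
      exact ⟨Q, h1, fun _ _ => h2⟩
    · exact ⟨∅, by simp, fun h1 h2 => absurd ⟨h1, h2⟩ hp⟩
  choose Q hQT hQj using hQ
  set P : Finset ℕ := F.biUnion fun s => F.biUnion fun t => F.biUnion fun p => F.biUnion fun q =>
    Q s t p q with hP
  have hQP : ∀ s ∈ F, ∀ t ∈ F, ∀ p ∈ F, ∀ q ∈ F, Q s t p q ⊆ P := fun s hs t ht p hp q hq z hz => by
    simp only [hP, Finset.mem_biUnion]
    exact ⟨s, hs, t, ht, p, hp, q, hq, hz⟩
  have hPT : (P : Set ℕ) ⊆ T := fun z hz => by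
    simp only [hP, Finset.mem_coe, Finset.mem_biUnion] at hz
    obtain ⟨s, -, t, -, p, -, q, -, hz⟩ := hz
    exact (hQT s t p q hz).1
  set r := compRep G T F with hr
  have hrF : ∀ z ∈ F, r z = z := fun z hz => compRep_of_mem (Finset.mem_coe.2 hz)
  have hrN : ∀ z ∈ T, z ∉ F → r z ∈ comp G (T \ F) z := fun z hz hzF =>
    compRep_mem (mt Finset.mem_coe.1 hzF) hz
  have hrNF : ∀ z ∈ T, z ∉ F → r z ∉ F := fun z hz hzF h' =>
    (comp_subset (hrN z hz hzF)).2 (Finset.mem_coe.2 h')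
  set Y : Finset ℕ := F ∪ P.image r with hY
  set S : Set ℕ := {x | x ∈ T ∧ r x ∈ Y} with hS
  have hFS : ∀ z ∈ F, z ∈ S := fun z hz => ⟨hF hz, by rw [hrF z hz]; simp [hY, hz]⟩
  have hPS : ∀ z ∈ P, z ∈ S := fun z hz =>
    ⟨hPT hz, Finset.mem_union_right _ (Finset.mem_image_of_mem _ hz)⟩
  have hcomp : ∀ z ∈ S, z ∉ F → ∀ w ∈ comp G (T \ F) z, w ∈ S ∧ r w = r z := fun z hz hzF w hw => by
    have e1 : r w = r z := compRep_eq hw hzF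
    exact ⟨⟨(comp_subset hw).1, by rw [e1]; exact hz.2⟩, e1⟩
  have hH : Free (contr G S r) (Y : Set ℕ) := by
    refine (hfree.anti (T := S) (fun _ _ _ _ h => h) fun z hz => hz.1).contr ?_ _
    intro z hz w hw hzw
    by_cases hzF : z ∈ F <;> by_cases hwF : w ∈ F
    · rw [hrF z hzF, hrF w hwF] at hzw
      rw [hzw]; exact .refl w
    · rw [hrF z hzF] at hzw
      exact absurd (hzw ▸ hzF) (hrNF w hw.1 hwF)
    · rw [hrF w hwF] at hzw
      exact absurd (hzw ▸ hwF) (hrNF z hz.1 hzF)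
    · have h1 : w ∈ comp G (T \ F) z := by
        have h2 := hrN z hz.1 hzF
        have h3 := hrN w hw.1 hwF
        rw [← hzw] at h3
        exact ⟨⟨hw.1, hwF⟩, h2.2.trans h3.2.symm⟩
      have h0 : z ∈ T \ (F : Set ℕ) := ⟨hz.1, hzF⟩
      refine (connOn_comp z (mem_comp_self h0) w h1).mono le_rfl fun x hx => ?_
      exact hcomp z hz hzF x hx
  have hc3 : C3 (contr G S r) (Y : Set ℕ) := by
    intro s t
    have hFF : ∀ p ∈ F, p ≠ s → p ≠ t → ∀ q ∈ F, q ≠ s → q ≠ t →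
        Joined (contr G S r) ((Y : Set ℕ) \ {s, t}) p q := by
      intro p hp hps hpt q hq hqs hqt
      have fin : ∀ (X : Set ℕ), X ⊆ S → Joined G X p q → (∀ x ∈ X, r x ≠ s ∧ r x ≠ t) →
          Joined (contr G S r) ((Y : Set ℕ) \ {s, t}) p q := fun X hX hj hXs => by
        have := hj.contr (r := r) (Y := (Y : Set ℕ) \ {s, t}) hX fun x hx =>
          ⟨(hX hx).2, by simpa using hXs x hx⟩
        rwa [hrF p hp, hrF q hq] at this
      by_cases hs : s ∈ F
      · by_cases ht : t ∈ F
        · refine fin (Q s t p q) (fun z hz => hPS z (hQP s hs t ht p hp q hq hz))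
            (hQj s t p q ⟨hF hp, by simp [hps, hpt]⟩ ⟨hF hq, by simp [hqs, hqt]⟩) fun z hz => ?_
          have hz' := hQT s t p q hz
          simp only [Set.mem_sdiff, Set.mem_insert_iff, Set.mem_singleton_iff, not_or] at hz'
          by_cases hzF : z ∈ F
          · rw [hrF z hzF]; exact hz'.2
          · have := hrNF z hz'.1 hzF
            exact ⟨fun h' => this (h' ▸ hs), fun h' => this (h' ▸ ht)⟩
        · refine fin ((F : Set ℕ) \ {s}) (fun z hz => hFS z hz.1) (hconn s p ⟨hp, hps⟩ q ⟨hq, hqs⟩)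
            fun z hz => ?_
          rw [hrF z hz.1]
          exact ⟨hz.2, fun h' => ht (h' ▸ hz.1)⟩
      · refine fin ((F : Set ℕ) \ {t}) (fun z hz => hFS z hz.1) (hconn t p ⟨hp, hpt⟩ q ⟨hq, hqt⟩)
          fun z hz => ?_
        rw [hrF z hz.1]
        exact ⟨fun h' => hs (h' ▸ hz.1), hz.2⟩
    have key : ∀ a ∈ (Y : Set ℕ) \ {s, t}, ∃ p ∈ F, p ≠ s ∧ p ≠ t ∧
        Joined (contr G S r) ((Y : Set ℕ) \ {s, t}) p a := by
      intro a ha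
      have ha' := ha
      simp only [Set.mem_sdiff, Set.mem_insert_iff, Set.mem_singleton_iff, not_or] at ha'
      obtain ⟨haY, has, hat⟩ := ha'
      by_cases haF : a ∈ F
      · exact ⟨a, haF, has, hat, .refl a⟩
      obtain ⟨w, hw, rfl⟩ : ∃ w ∈ P, r w = a := by simpa [hY, haF] using haY
      have hwF : w ∉ F := fun h' => haF (by rw [hrF w h']; exact h')
      obtain ⟨o, ho, hos⟩ := Finset.exists_mem_notMem_of_card_lt_card
        (s := {s, t}) (t := F) ((Finset.card_le_two).trans_lt (by omega))
      simp only [Finset.mem_insert, Finset.mem_singleton, not_or] at hos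
      have hrw := hrN w (hPT hw) hwF
      obtain ⟨x, y, hxy, -, hy, hx, hyc, -⟩ := (h s t (r w)
          (show r w ∈ T \ {s, t} from ⟨(comp_subset hrw).1, ha.2⟩) o
        (show o ∈ T \ {s, t} from ⟨hF ho, by simpa using hos⟩)).exists_exit
            (P := comp G (T \ F) w) hrw
        fun h' => (comp_subset h').2 ho
      have hyF : y ∈ F := by
        by_contra hyF
        exact hyc (comp_closed hx ⟨hy.1, hyF⟩ hxy)
      have hx' := hcomp w (hPS w hw) hwF x hx
      refine ⟨y, hyF, fun h' => hy.2 (.inl h'), fun h' => hy.2 (.inr h'), .edge ?_ ?_ ha⟩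
      · exact ⟨fun h' => haF (h' ▸ hyF), y, hFS y hyF, x, hx'.1, hrF y hyF, hx'.2, hxy.symm⟩
      · exact ⟨by simp [hY, hyF], hy.2⟩
    intro a ha b hb
    obtain ⟨p, hp, hps, hpt, jp⟩ := key a ha
    obtain ⟨q, hq, hqs, hqt, jq⟩ := key b hb
    exact jp.symm.trans ((hFF p hp hps hpt q hq hqs hqt).trans jq)
  have hYc : 6 ≤ (Y : Set ℕ).ncard := by
    rw [Set.ncard_coe_finset]
    exact hcard.trans (Finset.card_le_card Finset.subset_union_left)
  rcases hc3.k5on_or_planeOn ((Y : Set ℕ).ncard - 3) (by omega) hH with h5 | ⟨E, F', hPl, hE⟩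
  · exact absurd h5.1 (by omega)
  · refine ⟨E, _, hPl.twoBasis, fun a ha b hb hab => (hE a b).2 ⟨⟨hab.ne, a, hFS a ha, b, hFS b hb,
      hrF a ha, hrF b hb, hab⟩, by simp [hY, ha], by simp [hY, hb]⟩⟩

end InfiniteThreeConnected

section Blocks

variable {G : SimpleGraph ℕ} {T : Set ℕ} {u v : ℕ}

/-- A sequence of states, starting at the edge `uv` and connected by moves, that exhausts the
edges of `G` inside `T`. -/
structure Exhausts (G : SimpleGraph ℕ) (T : Set ℕ) (u v : ℕ) (B : ℕ → St) : Prop where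
  zero : (B 0).1 = {s(u, v)}
  faces : (B 0).2 ≤ {[u, v]}
  moves : ∀ i, ReflTransGen Move (B i) (B (i + 1))
  inside : ∀ i, Inside G T (B i).1
  edge : ∀ a ∈ T, ∀ b ∈ T, G.Adj a b → ∃ i, s(a, b) ∈ (B i).1

theorem moves_of_earMoves {A B : St} (h : ReflTransGen EarMove A B) : ReflTransGen Move A B := by
  induction h with
  | refl => exact .refl
  | tail _ h ih =>
    obtain ⟨e, he, hs⟩ := h
    exact ih.trans (hs.moves_and he).1

theorem C3.exists_finset_of_infinite (h : C3 G T) (hinf : T.Infinite) {Es : ℕ → Finset (Sym2 ℕ)}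
    (hmono : Monotone Es) (hE : ∀ a ∈ T, ∀ b ∈ T, G.Adj a b → ∃ i, s(a, b) ∈ Es i) (N : ℕ)
    (W : Finset ℕ) : (W : Set ℕ) ⊆ T → ∃ M, N ≤ M ∧ ∀ w ∈ W, w ∈ vs (Es M) := by
  induction W using Finset.induction with
  | empty => exact fun _ => ⟨N, le_rfl, by simp⟩
  | insert w W _ ih =>
    intro hW
    rw [Finset.coe_insert, Set.insert_subset_iff] at hW
    obtain ⟨M, hM, hMW⟩ := ih hW.2
    obtain ⟨o, ho, how⟩ := hinf.exists_notMem_finset {w, w + 1}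
    simp only [Finset.mem_insert, Finset.mem_singleton, not_or] at how
    obtain ⟨z, hz, hwz, -⟩ := h.exists_adj hW.1 (s := w + 1) (t := w + 1) (by omega) (by omega)
      ⟨o, ho, how.2, how.2, how.1⟩
    obtain ⟨i, hi⟩ := hE w hW.1 z hz hwz
    refine ⟨max M i, hM.trans (le_max_left _ _), fun x hx => ?_⟩
    rcases Finset.mem_insert.1 hx with rfl | hx
    · exact mem_vs_left (hmono (le_max_right _ _) hi)
    · exact vs_mono (hmono (le_max_left _ _)) (hMW x hx)

theorem C3.exists_exhausts_of_infinite (h : C3 G T) (hfree : Free G T) (hinf : T.Infinite)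
    (huv : G.Adj u v) (hu : u ∈ T) (hv : v ∈ T) : ∃ B, Exhausts G T u v B := by
  obtain ⟨e, Es, hseq, hmono, hin, hE⟩ := exists_infinite_earSeq h.two hinf huv hu hv
  obtain ⟨Fs, hF0, hF⟩ := exists_infinite_chain hseq fun N => by
    obtain ⟨W, hWT, hW6⟩ := hinf.exists_subset_card_eq 6
    obtain ⟨M, hNM, hWM⟩ := h.exists_finset_of_infinite hinf hmono hE N W hWT
    set F := (vs_finite (Es M)).toFinset with hF
    have hFm : ∀ z, z ∈ F ↔ z ∈ vs (Es M) := by simp [hF]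
    obtain ⟨E, B, hB, hEB⟩ := h.exists_twoBasis hfree (F := F)
      (fun z hz => (hin M).vs ((hFm z).1 hz))
      (hW6 ▸ Finset.card_le_card fun z hz => (hFm z).2 (hWM z hz)) fun t => by
        have h1 := (hseq M).connOn t M le_rfl
        rw [show (F : Set ℕ) = vs (Es M) by simp [hF]]
        exact h1.mono fun a b hab => (hin M a b (gr_adj.1 hab).1).1
    refine hB.anti (E' := Es N) fun d hd => ?_
    have hd' := hmono hNM hd
    induction d with
    | _ a b =>
      exact hEB a ((hFm a).2 (mem_vs_left hd')) b ((hFm b).2 (mem_vs_right hd')) (hin M a b hd').1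
  refine ⟨fun i => (Es i, Fs i), (hseq 0).zero, hF0.le, fun i => ?_, hin, hE⟩
  exact ((hF i).moves_and ((hseq (i + 1)).ear i (by omega))).1

theorem PlaneOn.exists_exhausts (hP : PlaneOn G T) (h : C3 G T) (hfin : T.Finite)
    (huv : G.Adj u v) (hu : u ∈ T) (hv : v ∈ T) (ho : ∃ o ∈ T, o ≠ u ∧ o ≠ v) :
    ∃ B, Exhausts G T u v B := by
  obtain ⟨E', F', hP, hE'⟩ := hP
  obtain ⟨B, hB, hB0⟩ := hP.twoBasis.filter_ne_zero
  obtain ⟨E1, hE, hE1⟩ := exists_full h.two hfin (Inside.singleton huv hu hv) (u := u) (v := v)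
    (by simp)
  have hEE : E' = E1 := by
    ext d
    induction d with
    | _ a b => rw [hE1, hE']
  subst hEE
  obtain ⟨o, ho, hou, hov⟩ := ho
  obtain ⟨w, hw, huw, hwv, -⟩ := h.exists_adj hu (s := v) (t := v) huv.ne huv.ne
    ⟨o, ho, hov, hov, hou⟩
  have hne : E' ≠ {s(u, v)} := fun h' => by
    have := (hE1 u w).2 ⟨huw, hu, hw⟩
    rw [h'] at this
    simp [hwv, huw.ne'] at this
  obtain ⟨F0, F1, h01, -, -, h12⟩ := exists_states huv.ne .refl hE hne hB hB0
  refine ⟨fun i => if i = 0 then ({s(u, v)}, {[u, v]}) else (E', F1), rfl, le_rfl, fun i => ?_,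
    fun i => ?_, fun a ha b hb hab => ⟨1, (hE1 a b).2 ⟨hab, ha, hb⟩⟩⟩
  · rcases Nat.eq_zero_or_pos i with rfl | hi
    · exact moves_of_earMoves (h01.trans h12)
    · simp only [hi.ne', if_false, Nat.succ_ne_zero]
      exact .refl
  · by_cases hi : i = 0
    · simpa only [hi, if_true] using Inside.singleton huv hu hv
    · simpa only [hi, if_false, Inside] using fun a b hab => (hE1 a b).1 hab

theorem K5on.exists_exhausts (h : K5on G T) (hu : u ∈ T) (hv : v ∈ T) (huv : G.Adj u v) :
    ∃ B, Exhausts G T u v B := by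
  classical
  have hfin : T.Finite := Set.finite_of_ncard_pos (by rw [h.1]; omega)
  set D : Finset (Sym2 ℕ) := (hfin.toFinset ×ˢ hfin.toFinset).image (fun p => s(p.1, p.2)) |>.filter
    (· ∈ G.edgeSet) with hD
  have hDm : ∀ a b, s(a, b) ∈ D ↔ G.Adj a b ∧ a ∈ T ∧ b ∈ T := fun a b => by
    simp only [hD, Finset.mem_filter, Finset.mem_image, Finset.mem_product, Set.Finite.mem_toFinset,
      SimpleGraph.mem_edgeSet, Prod.exists, Sym2.eq_iff]
    constructor
    · rintro ⟨⟨p, q, hpq, ⟨rfl, rfl⟩ | ⟨rfl, rfl⟩⟩, hab⟩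
      exacts [⟨hab, hpq⟩, ⟨hab, hpq.symm⟩]
    · exact fun ⟨h1, h2⟩ => ⟨⟨a, b, h2, .inl ⟨rfl, rfl⟩⟩, h1⟩
  have hsub : {s(u, v)} ∪ D = D := Finset.union_eq_right.2
      (by simpa using (hDm u v).2 ⟨huv, hu, hv⟩)
  have hin : Inside G T D := fun a b hab => (hDm a b).1 hab
  have hmv : Move ({s(u, v)}, 0) ({s(u, v)} ∪ D, 0) := by
    refine .small D hfin.toFinset (by simp) huv.ne ((hDm u v).2 ⟨huv, hu, hv⟩) ?_ ?_ ?_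
    · rw [← Set.ncard_eq_toFinset_card T hfin, h.1]
    · exact fun z hz => by simpa using hin.vs hz
    · rintro z ⟨-, hz⟩
      simpa [vs] using hz
  rw [hsub] at hmv
  refine ⟨fun i => if i = 0 then ({s(u, v)}, 0) else (D, 0), rfl, by simp, fun i => ?_,
    fun i => ?_, fun a ha b hb hab => ⟨1, (hDm a b).2 ⟨hab, ha, hb⟩⟩⟩
  · rcases Nat.eq_zero_or_pos i with rfl | hi
    · exact .single hmv
    · simp only [hi.ne', if_false, Nat.succ_ne_zero]
      exact .refl
  · by_cases hi : i = 0
    · simpa only [hi, if_true] using Inside.singleton huv hu hv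
    · simpa only [hi, if_false] using hin

theorem C3.exists_exhausts (h : C3 G T) (hfree : Free G T) (huv : G.Adj u v) (hu : u ∈ T)
    (hv : v ∈ T) (ho : ∃ o ∈ T, o ≠ u ∧ o ≠ v) : ∃ B, Exhausts G T u v B := by
  by_cases hfin : T.Finite
  · have hc : 3 ≤ T.ncard := by
      obtain ⟨o, ho, hou, hov⟩ := ho
      have h3 : ({u, v, o} : Set ℕ).ncard = 3 :=
        Set.ncard_eq_three.2 ⟨u, v, o, huv.ne, hou.symm, hov.symm, rfl⟩
      rw [← h3]
      exact Set.ncard_le_ncard (by simp [Set.insert_subset_iff, hu, hv, ho]) hfin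
    rcases h.k5on_or_planeOn (T.ncard - 3) (by omega) hfree with h5 | hP
    · exact h5.exists_exhausts hu hv huv
    · exact hP.exists_exhausts h hfin huv hu hv ho
  · exact h.exists_exhausts_of_infinite hfree hfin huv hu hv

end Blocks

section Lift

variable {A B : St}

theorem Move.subset (h : Move A B) : A.1 ⊆ B.1 := by
  cases h with
  | pendant => exact Finset.subset_insert _ _
  | chord => exact Finset.subset_insert _ _
  | page => exact subset_rfl
  | small => exact Finset.subset_union_left

theorem subset_of_moves (h : ReflTransGen Move A B) : A.1 ⊆ B.1 := by
  induction h with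
  | refl => exact subset_rfl
  | tail _ h ih => exact ih.trans h.subset

theorem Move.lift_union {X : Finset (Sym2 ℕ)} (Y : Multiset (List ℕ)) (h : Move A B)
    (hX : vs X ∩ vs B.1 ⊆ vs A.1) : Move (A.1 ∪ X, A.2 + Y) (B.1 ∪ X, B.2 + Y) := by
  cases h with
  | pendant hx =>
    simp only [Multiset.cons_add, Finset.insert_union]
    refine .pendant ?_
    rw [vs_union]
    rintro (h' | h')
    · exact hx h'
    · exact hx (hX ⟨h', mem_vs_right (Finset.mem_insert_self _ _)⟩)
  | chord hab =>
    simp only [Multiset.cons_add, Finset.insert_union]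
    exact .chord hab
  | page h1 h2 =>
    simp only [Multiset.cons_add]
    exact .page (Finset.mem_union_left _ h1) h2
  | small D l h1 h2 h3 h4 h5 h6 =>
    dsimp only at *
    rw [Finset.union_right_comm]
    refine .small D l (Finset.mem_union_left _ h1) h2 h3 h4 h5 ?_
    rintro z ⟨hz, hz'⟩
    rw [vs_union] at hz'
    rcases hz' with hz' | hz'
    · exact h6 ⟨hz, hz'⟩
    · exact h6 ⟨hz, hX ⟨hz', by rw [vs_union]; exact .inr hz⟩⟩

theorem moves_lift {X : Finset (Sym2 ℕ)} (Y : Multiset (List ℕ)) (h : ReflTransGen Move A B) :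
    vs X ∩ vs B.1 ⊆ vs A.1 → ReflTransGen Move (A.1 ∪ X, A.2 + Y) (B.1 ∪ X, B.2 + Y) := by
  induction h with
  | refl => exact fun _ => .refl
  | tail h1 h2 ih =>
    intro hX
    refine (ih fun z hz => hX ⟨hz.1, vs_mono h2.subset hz.2⟩).tail (h2.lift_union Y fun z hz => ?_)
    exact vs_mono (subset_of_moves h1) (hX hz)

end Lift

section Reach

variable {V : Type*} {G : SimpleGraph V} {S C : Set V} {a b : V}

/-- There is a walk of length `n` from `a` to `b` whose vertices after `a` lie in `S`. -/
def Reach (G : SimpleGraph V) (S : Set V) : ℕ → V → V → Prop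
  | 0, a, b => a = b
  | n + 1, a, b => ∃ c ∈ S, G.Adj a c ∧ Reach G S n c b

theorem Joined.exists_reach (h : Joined G S a b) : ∃ n, Reach G S n a b := by
  induction h using ReflTransGen.head_induction_on with
  | refl => exact ⟨0, rfl⟩
  | @head x y hxy _ ih =>
    obtain ⟨n, hn⟩ := ih
    exact ⟨n + 1, y, hxy.2.2, hxy.1, hn⟩

theorem Reach.exists_last_exit {n : ℕ} : ∀ {a}, Reach G S n a b → a ∈ C → b ∉ C →
    ∃ m < n, ∃ x ∈ C, ∃ y ∉ C, y ∈ S ∧ G.Adj x y ∧ Reach G S m y b := by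
  induction n with
  | zero => exact fun h ha hb => absurd (h ▸ ha) hb
  | succ n ih =>
    rintro a ⟨c, hc, hac, h⟩ ha hb
    by_cases hcC : c ∈ C
    · obtain ⟨m, hm, h'⟩ := ih h hcC hb
      exact ⟨m, by omega, h'⟩
    · exact ⟨n, by omega, a, ha, c, hcC, hc, hac, h⟩

theorem Reach.exists_first_exit {n : ℕ} : ∀ {a}, Reach G S n a b → a ∈ C → b ∉ C →
    ∃ m ≤ n, ∃ x ∈ C, ∃ y ∉ C, y ∈ S ∧ G.Adj x y ∧ Reach G (C ∪ {y}) m a y ∧ (m = n → y = b) := by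
  induction n with
  | zero => exact fun h ha hb => absurd (h ▸ ha) hb
  | succ n ih =>
    rintro a ⟨c, hc, hac, h⟩ ha hb
    by_cases hcC : c ∈ C
    · obtain ⟨m, hm, x, hx, y, hy, hyS, hxy, hr, hmn⟩ := ih h hcC hb
      exact ⟨m + 1, by omega, x, hx, y, hy, hyS, hxy, ⟨c, .inl hcC, hac, hr⟩,
        fun h => hmn (by omega)⟩
    · refine ⟨1, by omega, a, ha, c, hcC, hc, hac, ⟨c, .inr rfl, hac, rfl⟩, fun hn => ?_⟩
      obtain rfl : n = 0 := by omega
      exact h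

end Reach

section Pieces

variable {G : SimpleGraph ℕ} {D T : Set ℕ} {u v w a b s t z : ℕ}

/-- A connected set whose neighbours outside it are among the two ends of an edge. -/
structure Piece (G : SimpleGraph ℕ) (D : Set ℕ) (u v : ℕ) : Prop where
  adj : G.Adj u v
  left : u ∉ D
  right : v ∉ D
  nonempty : D.Nonempty
  conn : ConnOn G D
  out : ∀ x ∈ D, ∀ y, G.Adj x y → y ∈ D ∨ y = u ∨ y = v

theorem Piece.symm (h : Piece G D u v) : Piece G D v u :=
  ⟨h.adj.symm, h.right, h.left, h.nonempty, h.conn, fun x hx y hxy => (h.out x hx y hxy).imp_right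
    Or.symm⟩

/-- The vertices of `D ∪ {u, v}` that no two vertices separate from `{u, v}`. -/
def torso (G : SimpleGraph ℕ) (D : Set ℕ) (u v : ℕ) : Set ℕ :=
  {w | w = u ∨ w = v ∨ w ∈ D ∧ ∀ s t, w ≠ s → w ≠ t → (∃ r, (r = u ∨ r = v) ∧ r ≠ s ∧ r ≠ t) →
    ∃ r, (r = u ∨ r = v) ∧ Joined G {s, t}ᶜ w r}

theorem left_mem_torso : u ∈ torso G D u v := .inl rfl

theorem right_mem_torso : v ∈ torso G D u v := .inr (.inl rfl)

theorem torso_subset (h : w ∈ torso G D u v) : w ∈ D ∨ w = u ∨ w = v := by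
  rcases h with h | h | h
  exacts [.inr (.inl h), .inr (.inr h), .inl h.1]

theorem exists_separator (hw : w ∈ D \ torso G D u v) : ∃ s t, w ≠ s ∧ w ≠ t ∧
    (∃ r, (r = u ∨ r = v) ∧ r ≠ s ∧ r ≠ t) ∧ u ∉ comp G {s, t}ᶜ w ∧ v ∉ comp G {s, t}ᶜ w := by
  obtain ⟨hwD, hwT⟩ := hw
  simp only [torso, Set.mem_ofPred_eq, not_or, not_and, not_forall] at hwT
  obtain ⟨s, t, hs, ht, hr, hno⟩ := hwT.2.2 hwD
  exact ⟨s, t, hs, ht, hr, fun h => hno ⟨u, .inl rfl, h.2⟩, fun h => hno ⟨v, .inr rfl, h.2⟩⟩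

theorem torso_notMem_comp (ha : a ∈ torso G D u v) (hr : ∃ r, (r = u ∨ r = v) ∧ r ≠ s ∧ r ≠ t)
    (hu : u ∉ comp G {s, t}ᶜ w) (hv : v ∉ comp G {s, t}ᶜ w) : a ∉ comp G {s, t}ᶜ w := by
  intro h
  rcases ha with rfl | rfl | ha
  · exact hu h
  · exact hv h
  have has := (comp_subset h)
  simp only [Set.mem_compl_iff, Set.mem_insert_iff, Set.mem_singleton_iff, not_or] at has
  obtain ⟨r, hr, hj⟩ := ha.2 s t has.1 has.2 hr
  have hrm : r ∈ comp G {s, t}ᶜ w := ⟨hj.mem (comp_subset h), h.2.trans hj⟩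
  rcases hr with rfl | rfl
  exacts [hu hrm, hv hrm]

theorem adj_of_comp (hG : EdgeMax G) (hs : w ≠ s) (ht : w ≠ t)
    (hr : ∃ r, (r = u ∨ r = v) ∧ r ≠ s ∧ r ≠ t)
    (hu : u ∉ comp G {s, t}ᶜ w) (hv : v ∉ comp G {s, t}ᶜ w) : G.Adj s t := by
  refine hG.adj_of_sep (D := comp G {s, t}ᶜ w) ⟨w, mem_comp_self (by simp [hs, ht])⟩
    (fun h => comp_subset h (by simp)) (fun h => comp_subset h (by simp)) ?_ ?_
  · exact fun x hx y hy hys hyt hxy => hy (comp_closed hx (by simp [hys, hyt]) hxy)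
  · obtain ⟨r, rfl | rfl, h1, h2⟩ := hr
    exacts [⟨r, hu, h1, h2⟩, ⟨r, hv, h1, h2⟩]

theorem mem_of_exit {x y : ℕ} (hx : x ∈ comp G {s, t}ᶜ w) (hy : y ∉ comp G {s, t}ᶜ w)
    (hxy : G.Adj x y) : y = s ∨ y = t := by
  by_contra h
  push Not at h
  exact hy (comp_closed hx (by simp [h]) hxy)

theorem Piece.exists_adj (h : Piece G D u v) (hG : EdgeMax G) : ∃ x ∈ D, G.Adj x v := by
  obtain ⟨x, hx, y, hy, hyu, hxy⟩ := hG.exists_adj_of_ne h.nonempty h.left ⟨v, h.right, h.adj.ne'⟩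
  obtain rfl := ((h.out x hx y hxy).resolve_left hy).resolve_left hyu
  exact ⟨x, hx, hxy⟩

/-- Among the neighbours of `a` in a connected set there is one closest to `b`. -/
theorem ConnOn.exists_closest {C : Set ℕ} (hC : ConnOn G C) (ha : ∃ x ∈ C, G.Adj x a)
    (hb : ∃ x ∈ C, G.Adj x b) : ∃ z ∈ C, G.Adj z a ∧ ∃ n, Reach G (C ∪ {b}) n z b ∧
      ∀ y ∈ C, G.Adj y a → ∀ m < n, ¬ Reach G (C ∪ {b}) m y b := by
  classical
  obtain ⟨x, hx, hxa⟩ := ha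
  obtain ⟨y, hy, hyb⟩ := hb
  have hex : ∃ n, ∃ z ∈ C, G.Adj z a ∧ Reach G (C ∪ {b}) n z b := by
    obtain ⟨n, hn⟩ := (((hC x hx y hy).mono le_rfl Set.subset_union_left).trans
      (Joined.edge (S := C ∪ {b}) hyb (.inl hy) (.inr rfl))).exists_reach
    exact ⟨n, x, hx, hxa, hn⟩
  obtain ⟨z, hz, hza, hr⟩ := Nat.find_spec hex
  exact ⟨z, hz, hza, _, hr, fun y hy hya m hm hr' => Nat.find_min hex hm ⟨y, hy, hya, hr'⟩⟩

/-- A vertex separated by two vertices from `u, v` is separated by `a, b`, if it is a neighbour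
of `a` in `C` closest to `b`. -/
theorem separator_of_closest (hG : EdgeMax G) {C : Set ℕ} {n : ℕ} (hab : a ≠ b) (haC : a ∉ C)
    (hza : G.Adj z a)
    (hr : Reach G (C ∪ {b}) n z b)
    (hmin : ∀ y ∈ C, G.Adj y a → ∀ m < n, ¬ Reach G (C ∪ {b}) m y b) (hs : z ≠ s) (ht : z ≠ t)
    (hrr : ∃ r, (r = u ∨ r = v) ∧ r ≠ s ∧ r ≠ t)
    (hu : u ∉ comp G {s, t}ᶜ z) (hv : v ∉ comp G {s, t}ᶜ z)
    (ha : a ∉ comp G {s, t}ᶜ z) (hb : b ∉ comp G {s, t}ᶜ z) :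
    s = a ∧ t = b ∨ s = b ∧ t = a := by
  have hzK : z ∈ comp G {s, t}ᶜ z := mem_comp_self (by simp [hs, ht])
  have hst := adj_of_comp hG hs ht hrr hu hv
  have has := mem_of_exit hzK ha hza
  obtain ⟨m, hm, x, hx, y, hy, hyC, hxy, hry⟩ := hr.exists_last_exit hzK hb
  have hys := mem_of_exit hx hy hxy
  have hya : y ≠ a := by
    rintro rfl
    rcases hyC with h | h
    exacts [haC h, hab h]
  have hadj : G.Adj y a := by
    rcases has with rfl | rfl <;> rcases hys with rfl | rfl
    exacts [absurd rfl hya, hst.symm, hst, absurd rfl hya]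
  have hyb : y = b := hyC.resolve_left fun h => hmin y h hadj m hm hry
  subst hyb
  rcases has with rfl | rfl <;> rcases hys with rfl | rfl
  exacts [absurd rfl hya, .inl ⟨rfl, rfl⟩, .inr ⟨rfl, rfl⟩, absurd rfl hya]

theorem Piece.exists_mem_torso (h : Piece G D u v) (hG : EdgeMax G) :
    ∃ z ∈ D, z ∈ torso G D u v := by
  obtain ⟨z, hz, hza, n, hr, hmin⟩ := h.conn.exists_closest (h.symm.exists_adj hG)
    (h.exists_adj hG)
  refine ⟨z, hz, by_contra fun hzT => ?_⟩
  obtain ⟨s, t, hs, ht, hrr, hu, hv⟩ := exists_separator ⟨hz, hzT⟩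
  obtain ⟨r, hr', h1, h2⟩ := id hrr
  rcases separator_of_closest hG h.adj.ne h.left hza hr hmin hs ht hrr hu hv hu hv with
    ⟨rfl, rfl⟩ | ⟨rfl, rfl⟩ <;> tauto

theorem Piece.comp_adj (_ : Piece G D u v) (hG : EdgeMax G)
    (ha : ∃ x ∈ comp G (D \ torso G D u v) w, G.Adj x a)
    (hb : ∃ x ∈ comp G (D \ torso G D u v) w, G.Adj x b) (haT : a ∈ torso G D u v)
    (hbT : b ∈ torso G D u v) (hab : a ≠ b) : G.Adj a b ∧
      ∀ x ∈ comp G (D \ torso G D u v) w, ∀ y ∈ torso G D u v, G.Adj x y → y = a ∨ y = b := by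
  obtain ⟨z, hz, hza, n, hr, hmin⟩ := connOn_comp.exists_closest ha hb
  obtain ⟨s, t, hs, ht, hrr, hu, hv⟩ := exists_separator (comp_subset hz)
  have hT : ∀ c ∈ torso G D u v, c ∉ comp G {s, t}ᶜ z := fun c hc =>
    torso_notMem_comp hc hrr hu hv
  have hst := adj_of_comp hG hs ht hrr hu hv
  have hsep := separator_of_closest hG hab (fun h' => (comp_subset h').2 haT) hza hr hmin hs ht
    hrr hu hv (hT a haT) (hT b hbT)
  have hadj : G.Adj a b := by
    rcases hsep with ⟨rfl, rfl⟩ | ⟨rfl, rfl⟩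
    exacts [hst, hst.symm]
  refine ⟨hadj, fun x hx y hy hxy => ?_⟩
  have hsub : comp G (D \ torso G D u v) w ⊆ {s, t}ᶜ := by
    rintro c hc (rfl | rfl)
    · refine (comp_subset hc).2 ?_
      rcases hsep with ⟨rfl, -⟩ | ⟨rfl, -⟩ <;> assumption
    · refine (comp_subset hc).2 ?_
      rcases hsep with ⟨-, rfl⟩ | ⟨-, rfl⟩ <;> assumption
  have hxK : x ∈ comp G {s, t}ᶜ z := ⟨hsub hx, (connOn_comp z hz x hx).mono le_rfl hsub⟩
  have := mem_of_exit hxK (hT y hy) hxy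
  rcases hsep with ⟨rfl, rfl⟩ | ⟨rfl, rfl⟩
  exacts [this, this.symm]

theorem Piece.mem_torso_of_exit (h : Piece G D u v) {x y : ℕ}
    (hx : x ∈ comp G (D \ torso G D u v) w) (hy : y ∉ comp G (D \ torso G D u v) w)
    (hxy : G.Adj x y) : y ∈ torso G D u v := by
  by_contra hyT
  rcases h.out x (comp_subset hx).1 y hxy with hyD | rfl | rfl
  · exact hy (comp_closed hx ⟨hyD, hyT⟩ hxy)
  · exact hyT left_mem_torso
  · exact hyT right_mem_torso

theorem Piece.exists_child (h : Piece G D u v) (hG : EdgeMax G) (hw : w ∈ D)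
    (hwT : w ∉ torso G D u v) : ∃ a ∈ torso G D u v, ∃ b ∈ torso G D u v,
      Piece G (comp G (D \ torso G D u v) w) a b := by
  set C := comp G (D \ torso G D u v) w with hC
  have hwC : w ∈ C := mem_comp_self ⟨hw, hwT⟩
  have huC : u ∉ C := fun h' => h.left (comp_subset h').1
  have hvC : v ∉ C := fun h' => h.right (comp_subset h').1
  obtain ⟨x, hx, a, ha, hxa⟩ := hG.exists_adj ⟨w, hwC⟩ ⟨u, huC⟩
  have haT := h.mem_torso_of_exit hx ha hxa
  obtain ⟨y, hy, b, hb, hba, hyb⟩ := hG.exists_adj_of_ne ⟨w, hwC⟩ ha (by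
    by_cases hua : u = a
    · exact ⟨v, hvC, fun hva => h.adj.ne (hua.trans hva.symm)⟩
    · exact ⟨u, huC, hua⟩)
  have hbT := h.mem_torso_of_exit hy hb hyb
  obtain ⟨hadj, hout⟩ := h.comp_adj hG ⟨x, hx, hxa⟩ ⟨y, hy, hyb⟩ haT hbT hba.symm
  refine ⟨a, haT, b, hbT, hadj, ha, hb, ⟨w, hwC⟩, connOn_comp, fun p hp q hpq => ?_⟩
  by_cases hq : q ∈ C
  · exact .inl hq
  · exact .inr (hout p hp q (h.mem_torso_of_exit hp hq hpq) hpq)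

theorem Piece.connOn_torso_aux (h : Piece G D u v) (hG : EdgeMax G) {c d : ℕ}
    (hc : c ∈ torso G D u v) (hd : d ∈ torso G D u v) (hcs : c ∉ ({s, t} : Set ℕ))
    (hj : Joined G {s, t}ᶜ c d) : Joined G (torso G D u v \ {s, t}) c d := by
  set T := torso G D u v with hT
  let R : ℕ → ℕ → Prop := fun x r => x = r ∨ (x ∈ D \ T ∧ ∃ y ∈ comp G (D \ T) x, G.Adj y r) ∨
    (x ∉ D ∧ x ∉ T ∧ (r = u ∨ r = v))
  have key : ∀ x, Joined G {s, t}ᶜ c x → ∃ r ∈ T \ {s, t}, Joined G (T \ {s, t}) c r ∧ R x r := by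
    intro x hx
    induction hx with
    | refl => exact ⟨c, ⟨hc, hcs⟩, .refl c, .inl rfl⟩
    | @tail x y _ hxy ih =>
      obtain ⟨r, hr, hcr, hR⟩ := ih
      obtain ⟨hxy, hxs, hys⟩ := hxy
      have step : y ∈ T → (y = r ∨ G.Adj r y) → ∃ r ∈ T \ {s, t}, Joined G (T \ {s, t}) c r ∧
          R y r := by
        intro hyT hyr
        refine ⟨y, ⟨hyT, hys⟩, ?_, .inl rfl⟩
        rcases hyr with rfl | hyr
        · exact hcr
        · exact hcr.trans (.edge hyr hr ⟨hyT, hys⟩)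
      rcases hR with rfl | ⟨hxD, p, hp, hpr⟩ | ⟨hxD, hxT, hruv⟩
      · by_cases hyT : y ∈ T
        · exact step hyT (.inr hxy)
        refine ⟨x, hr, hcr, .inr ?_⟩
        by_cases hyD : y ∈ D
        · exact .inl ⟨⟨hyD, hyT⟩, y, mem_comp_self ⟨hyD, hyT⟩, hxy.symm⟩
        · refine .inr ⟨hyD, hyT, (torso_subset hr.1).resolve_left fun hxD => ?_⟩
          rcases h.out x hxD y hxy with h' | rfl | rfl
          exacts [hyD h', hyT left_mem_torso, hyT right_mem_torso]
      · have hxC := mem_comp_self (G := G) hxD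
        by_cases hyC : y ∈ comp G (D \ T) x
        · refine ⟨r, hr, hcr, .inr (.inl ⟨comp_subset hyC, p, ?_, hpr⟩)⟩
          rw [comp_eq_of_mem hyC]; exact hp
        · have hyT := h.mem_torso_of_exit hxC hyC hxy
          by_cases hyr : y = r
          · exact step hyT (.inl hyr)
          · exact step hyT (.inr (h.comp_adj hG ⟨p, hp, hpr⟩ ⟨x, hxC, hxy⟩ hr.1 hyT
              (Ne.symm hyr)).1)
      · have hyD : y ∉ D := fun hyD => by
          rcases h.out y hyD x hxy.symm with h' | rfl | rfl
          exacts [hxD h', hxT left_mem_torso, hxT right_mem_torso]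
        by_cases hyT : y ∈ T
        · refine step hyT ?_
          rcases (torso_subset hyT).resolve_left hyD with rfl | rfl <;> rcases hruv with rfl | rfl
          exacts [.inl rfl, .inr h.adj.symm, .inr h.adj, .inl rfl]
        · exact ⟨r, hr, hcr, .inr (.inr ⟨hyD, hyT, hruv⟩)⟩
  obtain ⟨r, -, hcr, hR⟩ := key d hj
  rcases hR with rfl | hR | hR
  exacts [hcr, absurd hd hR.1.2, absurd hd hR.2.1]

theorem Piece.c3 (h : Piece G D u v) (hG : EdgeMax G) : C3 G (torso G D u v) := by
  rintro s t a ⟨ha, has⟩ b ⟨hb, hbs⟩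
  refine h.connOn_torso_aux hG ha hb has ?_
  by_cases hr : ∃ r, (r = u ∨ r = v) ∧ r ≠ s ∧ r ≠ t
  · have key : ∀ c ∈ torso G D u v, c ∉ ({s, t} : Set ℕ) →
        ∃ r, (r = u ∨ r = v) ∧ Joined G {s, t}ᶜ c r := by
      rintro c (rfl | rfl | hc) hcs
      · exact ⟨c, .inl rfl, .refl c⟩
      · exact ⟨c, .inr rfl, .refl c⟩
      · simp only [Set.mem_insert_iff, Set.mem_singleton_iff, not_or] at hcs
        exact hc.2 s t hcs.1 hcs.2 hr
    obtain ⟨p, hp, jp⟩ := key a ha has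
    obtain ⟨q, hq, jq⟩ := key b hb hbs
    have hpS := jp.mem has
    have hqS := jq.mem hbs
    refine jp.trans (Joined.trans ?_ jq.symm)
    rcases hp with rfl | rfl <;> rcases hq with rfl | rfl
    exacts [.refl _, .edge h.adj hpS hqS, .edge h.adj.symm hpS hqS, .refl _]
  · push Not at hr
    have huv : ∀ c, c ∈ torso G D u v → c ∉ ({s, t} : Set ℕ) → c ∈ D := fun c hc hcs =>
      (torso_subset hc).resolve_right fun h' => hcs (by
        have := hr c h'
        by_cases hcs' : c = s
        · exact .inl hcs'
        · exact .inr (this hcs'))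
    refine (h.conn a (huv a ha has) b (huv b hb hbs)).mono le_rfl fun z hz => ?_
    rintro (rfl | rfl)
    all_goals
      have h1 := hr u (.inl rfl)
      have h2 := hr v (.inr rfl)
      have h3 : z ≠ u := fun h' => h.left (h' ▸ hz)
      have h4 : z ≠ v := fun h' => h.right (h' ▸ hz)
      have h5 := h.adj.ne
      grind

end Pieces

section Dovetail

variable {G : SimpleGraph ℕ} {D : Set ℕ} {u v w z : ℕ}

/-- A vertex set together with a sequence of states exhausting its edges. -/
structure Block (G : SimpleGraph ℕ) where
  verts : Set ℕ
  left : ℕ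
  right : ℕ
  seq : ℕ → St
  exhausts : Exhausts G verts left right seq

/-- A finite collection of blocks, each with the index of its current state. -/
abbrev Config (G : SimpleGraph ℕ) := Multiset (Block G × ℕ)

variable {O O' R : Config G} {p : Block G × ℕ}

/-- The edges present in a configuration. -/
def Config.edges (O : Config G) : Finset (Sym2 ℕ) := (O.map fun p => (p.1.seq p.2).1).sup

/-- The faces present in a configuration. -/
def Config.faces (O : Config G) : Multiset (List ℕ) := (O.map fun p => (p.1.seq p.2).2).sum

/-- The union of the vertex sets of the blocks. -/
def Config.verts (O : Config G) : Set ℕ := {x | ∃ p ∈ O, x ∈ p.1.verts}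

theorem Config.edges_cons : Config.edges (p ::ₘ O) = (p.1.seq p.2).1 ∪ O.edges := by
  simp [Config.edges]

theorem Config.faces_cons : Config.faces (p ::ₘ O) = (p.1.seq p.2).2 + O.faces := by
  simp [Config.faces]

theorem Config.mem_verts_cons {x : ℕ} :
    x ∈ Config.verts (p ::ₘ O) ↔ x ∈ p.1.verts ∨ x ∈ O.verts := by
  simp [Config.verts]

theorem Block.vs_subset (b : Block G) (i : ℕ) : vs (b.seq i).1 ⊆ b.verts :=
  (b.exhausts.inside i).vs

theorem Block.seq_mono (b : Block G) : Monotone fun i => (b.seq i).1 :=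
  monotone_nat_of_le_succ fun i => subset_of_moves (b.exhausts.moves i)

theorem Config.vs_edges_subset : vs O.edges ⊆ O.verts := by
  induction O using Multiset.induction with
  | empty => rintro x ⟨d, hd, -⟩; simp [Config.edges] at hd
  | cons p O ih =>
    intro x hx
    rw [Config.edges_cons, vs_union] at hx
    exact Config.mem_verts_cons.2 (hx.imp (fun h => p.1.vs_subset _ h) fun h => ih h)

/-- Blocks overlap only in vertices already present in their states, every edge between vertices
of the configuration lies in a block, and every other vertex lies in a piece attached to a
block. -/
structure Good (G : SimpleGraph ℕ) (O : Config G) : Prop where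
  overlap : ∀ p (R : Config G), O = p ::ₘ R → ∀ x ∈ p.1.verts, x ∈ R.verts → x ∈ vs (p.1.seq p.2).1
  piece : ∀ z ∉ O.verts, ∃ D a b, z ∈ D ∧ Piece G D a b ∧ Disjoint D O.verts ∧
    ∃ p ∈ O, a ∈ p.1.verts ∧ b ∈ p.1.verts
  adj : ∀ z ∈ O.verts, ∀ w ∈ O.verts, G.Adj z w → ∃ p ∈ O, z ∈ p.1.verts ∧ w ∈ p.1.verts

/-- The configuration `O'` is good and can be reached from `O` by moves. -/
structure Extends (O O' : Config G) : Prop where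
  good : Good G O'
  moves : ReflTransGen Move (O.edges, O.faces) (O'.edges, O'.faces)
  subset : O.verts ⊆ O'.verts

theorem Good.extends_self (h : Good G O) : Extends O O := ⟨h, .refl, subset_rfl⟩

theorem Extends.trans {O'' : Config G} (h : Extends O O') (h' : Extends O' O'') : Extends O O'' :=
  ⟨h'.good, h.moves.trans h'.moves, h.subset.trans h'.subset⟩

theorem Good.advance_one (h : Good G (p ::ₘ R)) : Extends (p ::ₘ R) ((p.1, p.2 + 1) ::ₘ R) := by
  obtain ⟨b, i⟩ := p
  have hmem : ∀ q : Block G × ℕ, q ∈ (b, i) ::ₘ R → ∃ q' ∈ (b, i + 1) ::ₘ R, q'.1 = q.1 := by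
    intro q hq
    rcases Multiset.mem_cons.1 hq with rfl | hq
    exacts [⟨_, Multiset.mem_cons_self _ _, rfl⟩, ⟨q, Multiset.mem_cons_of_mem hq, rfl⟩]
  have hU : Config.verts ((b, i + 1) ::ₘ R) = Config.verts ((b, i) ::ₘ R) := by
    ext x; simp [Config.mem_verts_cons]
  refine ⟨⟨fun q S hS x hx hxS => ?_, fun z hz => ?_, fun z hz w hw hzw => ?_⟩, ?_, hU.ge⟩
  · rcases Multiset.cons_eq_cons.1 hS with ⟨rfl, rfl⟩ | ⟨-, S', rfl, rfl⟩
    · exact vs_mono (b.seq_mono i.le_succ) (h.overlap _ _ rfl x hx hxS)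
    · refine h.overlap q ((b, i) ::ₘ S') (Multiset.cons_swap _ _ _) x hx ?_
      simpa [Config.mem_verts_cons] using hxS
  · rw [hU] at hz ⊢
    obtain ⟨D, a, c, hzD, hD, hdisj, q, hq, ha, hc⟩ := h.piece z hz
    obtain ⟨q', hq', e⟩ := hmem q hq
    exact ⟨D, a, c, hzD, hD, hdisj, q', hq', e ▸ ha, e ▸ hc⟩
  · rw [hU] at hz hw
    obtain ⟨q, hq, ha, hc⟩ := h.adj z hz w hw hzw
    obtain ⟨q', hq', e⟩ := hmem q hq
    exact ⟨q', hq', e ▸ ha, e ▸ hc⟩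
  · rw [Config.edges_cons, Config.edges_cons, Config.faces_cons, Config.faces_cons]
    refine moves_lift _ (b.exhausts.moves i) fun x hx => ?_
    exact h.overlap _ _ rfl x (b.vs_subset _ hx.2) (Config.vs_edges_subset hx.1)

theorem Good.advance (k : ℕ) : Good G (p ::ₘ R) →
    Extends (p ::ₘ R) ((p.1, p.2 + k) ::ₘ R) := by
  induction k with
  | zero => exact Good.extends_self
  | succ k ih => exact fun h => (ih h).trans (ih h).good.advance_one

theorem Good.exists_edge (h : Good G O) (hp : p ∈ O) (hu : u ∈ p.1.verts) (hv : v ∈ p.1.verts)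
    (huv : G.Adj u v) : ∃ O', Extends O O' ∧ O'.verts = O.verts ∧ s(u, v) ∈ O'.edges := by
  obtain ⟨R, rfl⟩ := Multiset.exists_cons_of_mem hp
  obtain ⟨i, hi⟩ := p.1.exhausts.edge u hu v hv huv
  refine ⟨_, h.advance i, ?_, ?_⟩
  · ext x; simp [Config.mem_verts_cons]
  · rw [Config.edges_cons]
    exact Finset.mem_union_left _ (p.1.seq_mono (Nat.le_add_left i p.2) hi)

theorem Good.add (h : Good G O) (hG : EdgeMax G) (hD : Piece G D u v)
    (hdisj : Disjoint D O.verts) (hE : s(u, v) ∈ O.edges) :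
    ∃ p : Block G × ℕ, Extends O (p ::ₘ O) ∧ p.1.verts = torso G D u v := by
  obtain ⟨o, hoD, ho⟩ := hD.exists_mem_torso hG
  obtain ⟨B, hB⟩ := (hD.c3 hG).exists_exhausts (hG.free.anti (fun _ _ _ _ h => h)
      (Set.subset_univ _)) hD.adj
    left_mem_torso right_mem_torso
    ⟨o, ho, fun e => hD.left (e ▸ hoD), fun e => hD.right (e ▸ hoD)⟩
  have huU : u ∈ O.verts := Config.vs_edges_subset (mem_vs_left hE)
  have hvU : v ∈ O.verts := Config.vs_edges_subset (mem_vs_right hE)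
  have hUD : ∀ x ∈ O.verts, x ∉ D := fun x hx hxD => Set.disjoint_left.1 hdisj hxD hx
  have hTU : ∀ x ∈ torso G D u v, x ∈ O.verts → x = u ∨ x = v := fun x hx hxU =>
    (torso_subset hx).resolve_left (hUD x hxU)
  refine ⟨(⟨_, u, v, B, hB⟩, 0), ⟨⟨fun q S hS x hx hxS => ?_, fun z hz => ?_,
    fun z hz w hw hzw => ?_⟩, ?_, fun x hx => Config.mem_verts_cons.2 (.inr hx)⟩, rfl⟩
  · rcases Multiset.cons_eq_cons.1 hS with ⟨rfl, rfl⟩ | ⟨-, S', rfl, rfl⟩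
    · have : s(u, v) ∈ (B 0).1 := by simp [hB.zero]
      rcases hTU x hx hxS with rfl | rfl
      exacts [mem_vs_left this, mem_vs_right this]
    · rcases Config.mem_verts_cons.1 hxS with hxT | hxS
      · have hxU := hTU x hxT (Config.mem_verts_cons.2 (.inl hx))
        have hxE : ∀ E : Finset (Sym2 ℕ), s(u, v) ∈ E → x ∈ vs E := fun E hE => by
          rcases hxU with rfl | rfl
          exacts [mem_vs_left hE, mem_vs_right hE]
        rw [Config.edges_cons] at hE
        rcases Finset.mem_union.1 hE with hE | hE
        · exact hxE _ hE
        · exact h.overlap q S' rfl x hx (Config.vs_edges_subset (hxE _ hE))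
      · exact h.overlap q S' rfl x hx hxS
  · rw [Config.mem_verts_cons, not_or] at hz
    by_cases hzD : z ∈ D
    · obtain ⟨a, ha, b, hb, hC⟩ := hD.exists_child hG hzD hz.1
      refine ⟨comp G (D \ torso G D u v) z, a, b, mem_comp_self ⟨hzD, hz.1⟩, hC, ?_, _,
        Multiset.mem_cons_self _ _, ha, hb⟩
      refine Set.disjoint_left.2 fun x hx hx' => ?_
      have := comp_subset hx
      rcases Config.mem_verts_cons.1 hx' with h1 | h1
      exacts [this.2 h1, hUD x h1 this.1]
    · obtain ⟨D', a, b, hzD', hD', hdisj', p, hp, ha, hb⟩ := h.piece z hz.2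
      refine ⟨D', a, b, hzD', hD', ?_, p, Multiset.mem_cons_of_mem hp, ha, hb⟩
      have hUD' : ∀ x ∈ O.verts, x ∉ D' := fun x hx hxD => Set.disjoint_left.1 hdisj' hxD hx
      refine Set.disjoint_left.2 fun x hx hx' => ?_
      rcases Config.mem_verts_cons.1 hx' with h1 | h1
      · rcases torso_subset h1 with h2 | rfl | rfl
        · refine hzD ((hD'.conn x hx z hzD').of_closed (P := D) h2 fun a ha b hb hab => ?_).1
          rcases hD.out a ha.2 b hab with h3 | rfl | rfl
          exacts [h3, absurd hb (hUD' _ huU), absurd hb (hUD' _ hvU)]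
        exacts [hUD' _ huU hx, hUD' _ hvU hx]
      · exact hUD' x h1 hx
  · have hcross : ∀ z ∈ torso G D u v, ∀ w ∈ O.verts, G.Adj z w →
        ∃ p ∈ ((⟨torso G D u v, u, v, B, hB⟩, 0) ::ₘ O : Config G), z ∈ p.1.verts ∧
            w ∈ p.1.verts := by
      intro z hz w hw hzw
      by_cases hzU : z ∈ O.verts
      · obtain ⟨p, hp, h'⟩ := h.adj z hzU w hw hzw
        exact ⟨p, Multiset.mem_cons_of_mem hp, h'⟩
      · have hzD : z ∈ D := by
          rcases torso_subset hz with h' | rfl | rfl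
          exacts [h', absurd huU hzU, absurd hvU hzU]
        refine ⟨_, Multiset.mem_cons_self _ _, hz, ?_⟩
        rcases hD.out z hzD w hzw with h' | rfl | rfl
        exacts [absurd h' (hUD w hw), left_mem_torso, right_mem_torso]
    rcases Config.mem_verts_cons.1 hz with hz | hz <;>
      rcases Config.mem_verts_cons.1 hw with hw | hw
    · exact ⟨_, Multiset.mem_cons_self _ _, hz, hw⟩
    · exact hcross z hz w hw hzw
    · obtain ⟨p, hp, h1, h2⟩ := hcross w hw z hz hzw.symm
      exact ⟨p, hp, h2, h1⟩
    · obtain ⟨p, hp, h'⟩ := h.adj z hz w hw hzw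
      exact ⟨p, Multiset.mem_cons_of_mem hp, h'⟩
  · rw [Config.edges_cons, Config.faces_cons]
    have e1 : (B 0).1 ∪ O.edges = O.edges := by
      rw [hB.zero, Finset.union_eq_right, Finset.singleton_subset_iff]; exact hE
    show ReflTransGen Move _ ((B 0).1 ∪ O.edges, (B 0).2 + O.faces)
    rw [e1]
    rcases Multiset.le_singleton.1 hB.faces with e2 | e2
    · rw [e2, zero_add]
    · rw [e2]
      exact .single (.page hE hD.adj.ne)

theorem Good.exists_open (h : Good G O) (hG : EdgeMax G) (hD : Piece G D u v)
    (hdisj : Disjoint D O.verts) (hp : p ∈ O) (hu : u ∈ p.1.verts) (hv : v ∈ p.1.verts) :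
    ∃ O', Extends O O' ∧ (∀ x, x ∈ O'.verts ↔ x ∈ torso G D u v ∨ x ∈ O.verts) ∧
      ∃ q ∈ O', q.1.verts = torso G D u v := by
  obtain ⟨O₁, h₁, hU, hE⟩ := h.exists_edge hp hu hv hD.adj
  obtain ⟨q, h₂, hq⟩ := h₁.good.add hG hD (hU ▸ hdisj) hE
  refine ⟨_, h₁.trans h₂, fun x => ?_, q, Multiset.mem_cons_self _ _, hq⟩
  rw [Config.mem_verts_cons, hq, hU]

theorem Good.exists_mem_of_reach (hG : EdgeMax G) (n : ℕ) : ∀ {O : Config G} {D : Set ℕ} {v}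
    {p : Block G × ℕ}, Good G O → Piece G D z v → Disjoint D O.verts → p ∈ O → z ∈ p.1.verts →
    v ∈ p.1.verts → w ∈ D → G.Adj w z → Reach G (D ∪ {v}) n w v →
    ∃ O', Extends O O' ∧ w ∈ O'.verts := by
  induction n using Nat.strong_induction_on with
  | _ n ih =>
  intro O D v p h hD hdisj hp hz hv hw hwz hr
  obtain ⟨O', h', hU, q, hq, hqT⟩ := h.exists_open hG hD hdisj hp hz hv
  by_cases hwT : w ∈ torso G D z v
  · exact ⟨O', h', (hU w).2 (.inl hwT)⟩
  obtain ⟨b, hb, hC, hbz⟩ : ∃ b ∈ torso G D z v, Piece G (comp G (D \ torso G D z v) w) z b ∧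
      z ≠ b := by
    obtain ⟨a, ha, b, hb, hC⟩ := hD.exists_child hG hw hwT
    rcases hC.out w (mem_comp_self ⟨hw, hwT⟩) z hwz with h1 | rfl | rfl
    · exact absurd left_mem_torso (comp_subset h1).2
    · exact ⟨b, hb, hC, hC.adj.ne⟩
    · exact ⟨a, ha, hC.symm, hC.adj.ne'⟩
  have hwC : w ∈ comp G (D \ torso G D z v) w := mem_comp_self ⟨hw, hwT⟩
  set C := comp G (D \ torso G D z v) w with hCdef
  have hbv : b ≠ v := by
    rintro rfl
    obtain ⟨o, hoD, ho⟩ := hD.exists_mem_torso hG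
    refine (comp_subset ((hD.conn w hw o hoD).of_closed (P := C) hwC fun x hx y hy hxy => ?_).1).2
      ho
    rcases hC.out x hx.2 y hxy with h1 | rfl | rfl
    exacts [h1, absurd hy hD.left, absurd hy hD.right]
  obtain ⟨m, hm, x, hx, y, hy, hyS, hxy, hr', hmn⟩ := hr.exists_first_exit (C := C) hwC
    fun h1 => hD.right (comp_subset h1).1
  have hyb : y = b := by
    rcases hC.out x hx y hxy with h1 | rfl | h1
    · exact absurd h1 hy
    · rcases hyS with h1 | h1
      exacts [absurd h1 hD.left, absurd h1 hD.adj.ne]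
    · exact h1
  subst hyb
  have hmn' : m < n := lt_of_le_of_ne hm fun e => hbv (hmn e)
  obtain ⟨O'', h'', hw''⟩ := ih m hmn' h'.good hC (Set.disjoint_left.2 fun x hx hx' => by
    have hxD := comp_subset hx
    rcases (hU x).1 hx' with h1 | h1
    exacts [hxD.2 h1, Set.disjoint_left.1 hdisj hxD.1 h1]) hq (hqT ▸ left_mem_torso) (hqT ▸ hb)
    hwC hwz hr'
  exact ⟨O'', h'.trans h'', hw''⟩

theorem Good.exists_mem_of_adj (h : Good G O) (hG : EdgeMax G) (hz : z ∈ O.verts)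
    (hzw : G.Adj z w) : ∃ O', Extends O O' ∧ w ∈ O'.verts := by
  by_cases hw : w ∈ O.verts
  · exact ⟨O, h.extends_self, hw⟩
  obtain ⟨D, b, hwD, hD, hdisj, p, hp, ha, hb⟩ : ∃ D b, w ∈ D ∧ Piece G D z b ∧
      Disjoint D O.verts ∧ ∃ p ∈ O, z ∈ p.1.verts ∧ b ∈ p.1.verts := by
    obtain ⟨D, a, b, hwD, hD, hdisj, p, hp, ha, hb⟩ := h.piece w hw
    rcases hD.out w hwD z hzw.symm with h1 | rfl | rfl
    exacts [absurd hz (Set.disjoint_left.1 hdisj h1), ⟨D, b, hwD, hD, hdisj, p, hp, ha, hb⟩,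
      ⟨D, a, hwD, hD.symm, hdisj, p, hp, hb, ha⟩]
  obtain ⟨x, hx, hxb⟩ := hD.exists_adj hG
  obtain ⟨n, hn⟩ := (((hD.conn w hwD x hx).mono le_rfl Set.subset_union_left).trans
    (Joined.edge (S := D ∪ {b}) hxb (.inl hx) (.inr rfl))).exists_reach
  exact h.exists_mem_of_reach hG n hD hdisj hp ha hb hwD hzw.symm hn

theorem Good.exists_mem (h : Good G O) (hG : EdgeMax G) (hz : z ∈ O.verts) (w : ℕ) :
    ∃ O', Extends O O' ∧ w ∈ O'.verts := by
  induction hG.connOn z (Set.mem_univ z) w (Set.mem_univ w) with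
  | refl => exact ⟨O, h.extends_self, hz⟩
  | @tail x y _ hxy ih =>
    obtain ⟨O₁, h₁, hx⟩ := ih
    obtain ⟨O₂, h₂, hy⟩ := h₁.good.exists_mem_of_adj hG hx hxy.1
    exact ⟨O₂, h₁.trans h₂, hy⟩

theorem Good.exists_edge_of_adj (h : Good G O) (hG : EdgeMax G) (hne : O.verts.Nonempty)
    (huv : G.Adj u v) : ∃ O', Extends O O' ∧ s(u, v) ∈ O'.edges := by
  obtain ⟨z, hz⟩ := hne
  obtain ⟨O₁, h₁, hu⟩ := h.exists_mem hG hz u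
  obtain ⟨O₂, h₂, hv⟩ := h₁.good.exists_mem_of_adj hG hu huv
  obtain ⟨p, hp, hpu, hpv⟩ := h₂.good.adj u (h₂.subset hu) v hv huv
  obtain ⟨O₃, h₃, -, hE⟩ := h₂.good.exists_edge hp hpu hpv huv
  exact ⟨O₃, (h₁.trans h₂).trans h₃, hE⟩

theorem EdgeMax.exists_good (hG : EdgeMax G) : ∃ u v, u ≠ v ∧ ∃ O : Config G, Good G O ∧
    O.verts.Nonempty ∧ O.edges = {s(u, v)} ∧ O.faces = {[u, v]} := by
  obtain ⟨u, -, v, -, huv⟩ := hG.exists_adj (A := {0}) ⟨0, rfl⟩ ⟨1, by simp⟩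
  have hB : Exhausts G {u, v} u v fun _ => ({s(u, v)}, {[u, v]}) := by
    refine ⟨rfl, le_rfl, fun _ => .refl, fun _ => .singleton huv (by simp) (by simp),
      fun a ha b hb hab => ⟨0, ?_⟩⟩
    have := hab.ne
    rcases ha with rfl | rfl <;> rcases hb with rfl | rfl <;> simp [Sym2.eq_swap] at this ⊢
  have hU : ∀ x, x ∈ Config.verts ({((⟨_, u, v, _, hB⟩ : Block G), 0)} : Config G) ↔
      x ∈ ({u, v} : Set ℕ) := fun x => by
    simp [Config.verts]
  refine ⟨u, v, huv.ne, {(⟨_, u, v, _, hB⟩, 0)}, ⟨fun p R hR x hx hxR => ?_, fun z hz => ?_,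
    fun z hz w hw _ => ⟨_, Multiset.mem_singleton_self _, (hU z).1 hz, (hU w).1 hw⟩⟩,
    ⟨u, (hU u).2 (by simp)⟩, ?_, ?_⟩
  · have hR' : R = 0 := by
      have := congrArg Multiset.card hR
      simpa using this
    subst hR'
    obtain ⟨q, hq, -⟩ := hxR
    simp at hq
  · have hz' : z ∈ ({u, v} : Set ℕ)ᶜ := fun h => hz ((hU z).2 h)
    refine ⟨comp G {u, v}ᶜ z, u, v, mem_comp_self hz', ⟨huv, fun h => comp_subset h (by simp),
      fun h => comp_subset h (by simp), ⟨z, mem_comp_self hz'⟩, connOn_comp, fun x hx y hxy => ?_⟩,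
      Set.disjoint_left.2 fun x hx hx' => comp_subset hx ((hU x).1 hx'), _,
      Multiset.mem_singleton_self _, by simp, by simp⟩
    by_cases hy : y ∈ ({u, v} : Set ℕ)
    exacts [.inr hy, .inl (comp_closed hx hy hxy)]
  · simp [Config.edges]
  · simp [Config.faces]

theorem EdgeMax.isMinor_univGraph (hG : EdgeMax G) : IsMinor G univGraph := by
  obtain ⟨u, v, huv, O₀, h₀, hne, hE₀, hF₀⟩ := hG.exists_good
  have step : ∀ (n : ℕ) (O : {O : Config G // Good G O ∧ O.verts.Nonempty}),
      ∃ O' : {O : Config G // Good G O ∧ O.verts.Nonempty}, Extends O.1 O'.1 ∧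
        (G.Adj n.unpair.1 n.unpair.2 → s(n.unpair.1, n.unpair.2) ∈ O'.1.edges) := by
    rintro n ⟨O, h, hO⟩
    by_cases hn : G.Adj n.unpair.1 n.unpair.2
    · obtain ⟨O', h', hE⟩ := h.exists_edge_of_adj hG hO hn
      exact ⟨⟨O', h'.good, hO.mono h'.subset⟩, h', fun _ => hE⟩
    · exact ⟨⟨O, h, hO⟩, h.extends_self, fun h => absurd h hn⟩
  choose f hf hfE using step
  let A : ℕ → {O : Config G // Good G O ∧ O.verts.Nonempty} := fun n =>
    Nat.rec ⟨O₀, h₀, hne⟩ f n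
  have hadj : ∀ a b, G.Adj a b → ∃ i, s(a, b) ∈ (A i).1.edges := fun a b hab =>
    ⟨Nat.pair a b + 1, by simpa [hab] using hfE (Nat.pair a b) (A (Nat.pair a b))⟩
  refine isMinor_univGraph_of_moves (A := fun n => ((A n).1.edges, (A n).1.faces)) huv ?_
    (fun n => (hf n (A n)).moves) (fun a => ?_) hadj
  · show (O₀.edges, O₀.faces) = _
    rw [hE₀, hF₀]
  · obtain ⟨x, rfl, y, -, hxy⟩ := hG.exists_adj (A := {a}) ⟨a, rfl⟩ ⟨a + 1, by simp⟩
    obtain ⟨i, hi⟩ := hadj x y hxy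
    exact ⟨i, mem_vs_left hi⟩

end Dovetail

/-- Every countable graph without a `K_{3,3}` minor is a minor of the universal graph. -/
theorem isMinor_univGraph {W : Type*} [Countable W] {G : SimpleGraph W}
    (h : Free G Set.univ) : IsMinor G univGraph := by
  obtain ⟨f, hf⟩ := exists_injective_nat W
  obtain ⟨G', hle, hG'⟩ := exists_edgeMax (free_map ⟨f, hf⟩ h)
  refine isMinor_trans hG'.isMinor_univGraph (isMinor_iff.2 (IsModel.of_injective hf fun a b hab =>
    hle ?_))
  exact SimpleGraph.map_adj_apply.2 hab

end K33U

/-- The class of countable graphs with no `K_{3,3}` minor has a minor-universal element. -/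
theorem exists_universal_K33_minor_free :
    ∃ (V : Type) (_ : Countable V) (U : SimpleGraph V),
      ¬ IsMinor (completeBipartiteGraph (Fin 3) (Fin 3)) U ∧
      ∀ (W : Type) (_ : Countable W) (G : SimpleGraph W),
        ¬ IsMinor (completeBipartiteGraph (Fin 3) (Fin 3)) G → IsMinor G U := by
  refine ⟨ℕ, inferInstance, K33U.univGraph, K33U.free_univ_iff.1 K33U.free_univGraph, ?_⟩
  exact fun W _ G h => K33U.isMinor_univGraph (K33U.free_univ_iff.2 h)
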